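/- For all real x ≥ 149, |θ(x) − x| ≤ x·√(8/(17π))·X^{1/2}·e^{−X}, where X = √((log x)/6.315). -/

import Mathlib

/-- The Chebyshev function `θ(x) = Σ_{p ≤ x} log p`, the sum over primes. -/
noncomputable def chebyshevTheta (x : ℝ) : ℝ :=
  ∑ p ∈ Finset.filter Nat.Prime (Finset.range (⌊x⌋₊ + 1)), Real.log p

namespace ThetaBound

section

open Complex Filter Topology MeasureTheory Set HurwitzZeta

/-- The kernel whose Mellin transform is the completed zeta function. -/
noncomputable def thetaModif (x : ℝ) : ℝ :=
  (Ioi 1).indicator (fun x ↦ evenKernel 0 x - 1) x +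
  (Ioo 0 1).indicator (fun x ↦ evenKernel 0 x - x ^ (-(1 / 2) : ℝ)) x

lemma one_le_evenKernel_zero {t : ℝ} (ht : 0 < t) : 1 ≤ evenKernel 0 t := by
  have h := hasSum_int_evenKernel₀ 0 ht
  have h2 := h.nonneg (fun n ↦ by split_ifs <;> positivity)
  simp only [QuotientAddGroup.mk_zero, if_true] at h2
  linarith

lemma thetaModif_nonneg (x : ℝ) : 0 ≤ thetaModif x := by
  unfold thetaModif
  refine add_nonneg (indicator_nonneg (fun x hx ↦ ?_) x) (indicator_nonneg (fun x hx ↦ ?_) x)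
  · have : (0:ℝ) < x := lt_trans one_pos hx
    linarith [one_le_evenKernel_zero this]
  · have hx0 : (0:ℝ) < x := hx.1
    have h := evenKernel_functional_equation 0 x
    rw [← evenKernel_eq_cosKernel_of_zero] at h
    have h1 := one_le_evenKernel_zero (one_div_pos.mpr hx0)
    have h2 : (1 / x ^ (1 / 2 : ℝ)) = x ^ (-(1 / 2) : ℝ) := by
      rw [Real.rpow_neg hx0.le, one_div]
    rw [h, h2]
    have := Real.rpow_nonneg hx0.le (-(1 / 2) : ℝ)
    nlinarith

lemma f_modif_eq (x : ℝ) : (hurwitzEvenFEPair 0).f_modif x = (thetaModif x : ℂ) := by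
  unfold WeakFEPair.f_modif thetaModif hurwitzEvenFEPair
  simp only [Pi.add_apply, Set.indicator_apply, ofReal_add]
  congr 1
  · split_ifs <;> simp
  · split_ifs <;> simp

lemma mellinConvergent_thetaModif (s : ℂ) :
    MellinConvergent (fun x ↦ (thetaModif x : ℂ)) s := by
  have h := ((hurwitzEvenFEPair 0).isStrongFEPair_toStrongFEPair.hasMellin s).1
  have : (hurwitzEvenFEPair 0).toStrongFEPair.f = fun x ↦ (thetaModif x : ℂ) :=
    funext f_modif_eq
  rwa [this] at h

lemma completedRiemannZeta₀_eq_mellin (s : ℂ) :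
    completedRiemannZeta₀ s = mellin (fun x ↦ (thetaModif x : ℂ)) (s / 2) / 2 := by
  have : (hurwitzEvenFEPair 0).f_modif = fun x ↦ (thetaModif x : ℂ) := funext f_modif_eq
  rw [← this]; rfl

/-- The real Mellin transform of `thetaModif`, normalised to agree with `completedRiemannZeta₀`. -/
noncomputable def lam (σ : ℝ) : ℝ := (∫ x in Ioi (0:ℝ), x ^ (σ / 2 - 1) * thetaModif x) / 2

lemma integrableOn_lam (σ : ℝ) :
    IntegrableOn (fun x : ℝ ↦ x ^ (σ / 2 - 1) * thetaModif x) (Ioi 0) := by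
  have h := (mellinConvergent_thetaModif (σ / 2)).norm
  refine IntegrableOn.congr_fun h (fun x hx ↦ ?_) measurableSet_Ioi
  simp only [smul_eq_mul, norm_mul, norm_real, Real.norm_of_nonneg (thetaModif_nonneg x)]
  rw [norm_cpow_eq_rpow_re_of_pos hx]
  simp

lemma lam_eq (σ : ℝ) : completedRiemannZeta₀ σ = lam σ := by
  rw [completedRiemannZeta₀_eq_mellin, mellin, lam, ofReal_div, ← integral_complex_ofReal]
  congr 1
  refine setIntegral_congr_fun measurableSet_Ioi (fun x hx ↦ ?_)
  simp only [smul_eq_mul, ofReal_mul]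
  rw [ofReal_cpow (le_of_lt hx)]
  simp

lemma norm_completedRiemannZeta₀_le (s : ℂ) : ‖completedRiemannZeta₀ s‖ ≤ lam s.re := by
  rw [completedRiemannZeta₀_eq_mellin, mellin, lam, norm_div, Complex.norm_two]
  gcongr
  refine (norm_integral_le_integral_norm _).trans_eq
    (setIntegral_congr_fun measurableSet_Ioi (fun x hx ↦ ?_))
  simp only [smul_eq_mul, norm_mul, norm_real, Real.norm_of_nonneg (thetaModif_nonneg x)]
  rw [norm_cpow_eq_rpow_re_of_pos hx]
  simp

/-- Convexity of `lam` between two points. -/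
lemma lam_le {a b σ : ℝ} {p q : ℝ} (hp : 0 ≤ p) (hq : 0 ≤ q) (hpq : p + q = 1)
    (hσ : σ = p * a + q * b) : lam σ ≤ p * lam a + q * lam b := by
  unfold lam
  rw [← mul_div_assoc, ← mul_div_assoc, ← add_div, ← integral_const_mul, ← integral_const_mul,
    ← integral_add ((integrableOn_lam a).const_mul p) ((integrableOn_lam b).const_mul q)]
  refine div_le_div_of_nonneg_right ?_ two_pos.le
  refine setIntegral_mono_on (integrableOn_lam σ) (Integrable.add
    ((integrableOn_lam a).const_mul p) ((integrableOn_lam b).const_mul q))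
    measurableSet_Ioi (fun x hx ↦ ?_)
  change _ ≤ p * (x ^ (a / 2 - 1) * thetaModif x) + q * (x ^ (b / 2 - 1) * thetaModif x)
  have hx : (0:ℝ) < x := hx
  have h := Real.geom_mean_le_arith_mean2_weighted hp hq
    (Real.rpow_nonneg hx.le (a / 2 - 1)) (Real.rpow_nonneg hx.le (b / 2 - 1)) hpq
  rw [← Real.rpow_mul hx.le, ← Real.rpow_mul hx.le, ← Real.rpow_add hx] at h
  have e : (a / 2 - 1) * p + (b / 2 - 1) * q = σ / 2 - 1 := by
    rw [hσ]; linear_combination (-1) * hpq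
  rw [e] at h
  nlinarith [thetaModif_nonneg x]

lemma lam_one_sub (σ : ℝ) : lam (1 - σ) = lam σ := by
  have := completedRiemannZeta₀_one_sub σ
  rw [lam_eq, show (1 - σ : ℂ) = ((1 - σ : ℝ) : ℂ) by push_cast; rfl, lam_eq] at this
  exact_mod_cast this

lemma lam_nonneg (σ : ℝ) : 0 ≤ lam σ := (norm_nonneg _).trans (norm_completedRiemannZeta₀_le σ)

lemma lam_le_of_mem {σ b : ℝ} (h1 : 1 - b ≤ σ) (h2 : σ ≤ b) : lam σ ≤ lam b := by
  rcases eq_or_ne b (1 / 2) with rfl | hb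
  · rw [show σ = 1 / 2 by linarith]
  have hb' : 0 < 2 * b - 1 := by
    rcases lt_or_gt_of_ne hb with h | h <;> linarith
  have hb'' := hb'.ne'
  have := lam_le (a := 1 - b) (b := b) (σ := σ) (p := (b - σ) / (2 * b - 1))
    (q := (σ - (1 - b)) / (2 * b - 1)) (div_nonneg (by linarith) hb'.le)
    (div_nonneg (by linarith) hb'.le) (by rw [← add_div, div_eq_one_iff_eq hb'']; ring)
    (by rw [div_mul_eq_mul_div, div_mul_eq_mul_div, ← add_div, eq_div_iff hb'']; ring)
  rw [lam_one_sub, ← add_mul] at this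
  rwa [show (b - σ) / (2 * b - 1) + (σ - (1 - b)) / (2 * b - 1) = 1 by
    rw [← add_div, div_eq_one_iff_eq hb'']; ring,
    one_mul] at this

lemma lam_one : lam 1 = (Real.eulerMascheroniConstant - Real.log (4 * Real.pi)) / 2 + 1 := by
  have h := completedRiemannZeta₀_one
  have h2 := lam_eq 1
  rw [ofReal_one, h] at h2
  rw [show (4 * (Real.pi:ℂ)) = ((4 * Real.pi : ℝ) : ℂ) by push_cast; rfl,
    ← ofReal_log (by positivity)] at h2
  exact_mod_cast h2.symm

/-- The entire Riemann `ξ` function, normalised by `ξ(0) = ξ(1) = 1`. -/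
noncomputable def xi (s : ℂ) : ℂ := s * (s - 1) * completedRiemannZeta₀ s + 1

lemma differentiable_xi : Differentiable ℂ xi := by
  unfold xi
  have := differentiable_completedZeta₀
  fun_prop

lemma xi_one_sub (s : ℂ) : xi (1 - s) = xi s := by
  unfold xi; rw [completedRiemannZeta₀_one_sub]; ring

lemma xi_zero : xi 0 = 1 := by simp [xi]
lemma xi_one : xi 1 = 1 := by simp [xi]

lemma xi_eq {s : ℂ} (h0 : s ≠ 0) (h1 : s ≠ 1) (hG : Gammaℝ s ≠ 0) :
    xi s = s * (s - 1) * (Gammaℝ s * riemannZeta s) := by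
  have hg : Gammaℝ s * riemannZeta s = completedRiemannZeta s := by
    rw [riemannZeta_def_of_ne_zero h0]
    field_simp
  rw [hg, completedRiemannZeta_eq, xi]
  have : 1 - s ≠ 0 := sub_ne_zero.mpr h1.symm
  field_simp
  ring

end

section

open Complex Filter Topology MeasureTheory Set

lemma analyticOrderAt_ne_top_of_entire {g : ℂ → ℂ} (hg : Differentiable ℂ g) {x : ℂ}
    (hx : g x ≠ 0) (a : ℂ) : analyticOrderAt g a ≠ ⊤ := by
  have hA : AnalyticOnNhd ℂ g univ := fun z _ ↦ hg.analyticAt z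
  refine hA.analyticOrderAt_ne_top_of_isPreconnected isPreconnected_univ (mem_univ x)
    (mem_univ a) ?_
  rw [(hg.analyticAt x).analyticOrderAt_eq_zero.mpr hx]
  simp

lemma exists_factor_pow {g : ℂ → ℂ} (hg : Differentiable ℂ g) {x : ℂ} (hx : g x ≠ 0) (a : ℂ) :
    ∃ k : ℂ → ℂ, Differentiable ℂ k ∧ k a ≠ 0 ∧
      ∀ z, g z = (z - a) ^ analyticOrderNatAt g a * k z := by
  obtain ⟨k₀, hk₀, hk0, hke⟩ := ((hg.analyticAt a).analyticOrderAt_ne_top).mp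
    (analyticOrderAt_ne_top_of_entire hg hx a)
  set m := analyticOrderNatAt g a
  let k : ℂ → ℂ := Function.update (fun z ↦ g z / (z - a) ^ m) a (k₀ a)
  have hka : k a = k₀ a := by simp [k]
  have hkz : ∀ z, z ≠ a → k z = g z / (z - a) ^ m := fun z hz ↦ by simp [k, hz]
  have hkk : k =ᶠ[𝓝 a] k₀ := by
    filter_upwards [hke] with z hz
    by_cases h : z = a
    · rw [h, hka]
    · rw [hkz z h, hz, smul_eq_mul, mul_div_cancel_left₀ _ (pow_ne_zero _ (sub_ne_zero.mpr h))]
  refine ⟨k, fun z ↦ ?_, by rwa [hka], fun z ↦ ?_⟩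
  · by_cases h : z = a
    · subst h
      exact hk₀.differentiableAt.congr_of_eventuallyEq hkk
    · have : k =ᶠ[𝓝 z] fun z ↦ g z / (z - a) ^ m := by
        filter_upwards [isOpen_ne.mem_nhds h] with w hw using hkz w hw
      refine DifferentiableAt.congr_of_eventuallyEq ?_ this
      exact (hg z).div (by fun_prop) (pow_ne_zero _ (sub_ne_zero.mpr h))
  · by_cases h : z = a
    · subst h
      rw [hka]; simpa using hke.self_of_nhds
    · rw [hkz z h, mul_div_cancel₀ _ (pow_ne_zero _ (sub_ne_zero.mpr h))]

lemma exists_factor_finset {g : ℂ → ℂ} (hg : Differentiable ℂ g) {x : ℂ} (hx : g x ≠ 0)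
    (S : Finset ℂ) :
    ∃ k : ℂ → ℂ, Differentiable ℂ k ∧ (∀ a ∈ S, k a ≠ 0) ∧
      ∀ z, g z = (∏ a ∈ S, (z - a) ^ analyticOrderNatAt g a) * k z := by
  classical
  induction S using Finset.induction_on with
  | empty => exact ⟨g, hg, by simp, by simp⟩
  | insert a S ha ih =>
    obtain ⟨k, hk, hk0, hgk⟩ := ih
    have hkx : k x ≠ 0 := fun h ↦ hx (by rw [hgk, h, mul_zero])
    obtain ⟨k', hk', hk'a, hkk'⟩ := exists_factor_pow hk hkx a
    have hord : analyticOrderNatAt k a = analyticOrderNatAt g a := by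
      have hP : Differentiable ℂ (fun z ↦ ∏ b ∈ S, (z - b) ^ analyticOrderNatAt g b) := by
        fun_prop
      have : g = (fun z ↦ ∏ b ∈ S, (z - b) ^ analyticOrderNatAt g b) * k := funext hgk
      have h2 : analyticOrderAt g a = analyticOrderAt k a := by
        conv_lhs => rw [this]
        rw [analyticOrderAt_mul (hP.analyticAt a) (hk.analyticAt a),
          (hP.analyticAt a).analyticOrderAt_eq_zero.mpr, zero_add]
        refine Finset.prod_ne_zero_iff.mpr fun b hb ↦ pow_ne_zero _ (sub_ne_zero.mpr ?_)
        rintro rfl; exact ha hb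
      unfold analyticOrderNatAt; rw [h2]
    refine ⟨k', hk', fun b hb ↦ ?_, fun z ↦ ?_⟩
    · rcases Finset.mem_insert.mp hb with rfl | hb
      · exact hk'a
      · intro h0
        exact hk0 b hb (by rw [hkk', h0, mul_zero])
    · rw [hgk, hkk', hord, Finset.prod_insert ha]; ring

lemma finite_zeros {g : ℂ → ℂ} (hg : Differentiable ℂ g) {x : ℂ} (hx : g x ≠ 0) (R : ℝ) :
    {z | g z = 0 ∧ ‖z‖ ≤ R}.Finite := by
  by_contra hinf
  have hinf : {z | g z = 0 ∧ ‖z‖ ≤ R}.Infinite := hinf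
  obtain ⟨z, -, hz⟩ := hinf.exists_accPt_of_subset_isCompact
    (isCompact_closedBall (0:ℂ) R) (fun z hz ↦ by simpa using hz.2)
  have hA : AnalyticOnNhd ℂ g univ := fun z _ ↦ hg.analyticAt z
  have := hA.eqOn_zero_of_preconnected_of_frequently_eq_zero isPreconnected_univ (mem_univ z)
    ((accPt_iff_frequently_nhdsNE.mp hz).mono fun w hw ↦ hw.1)
  exact hx (this (mem_univ x))

/-- A zero-free function on a disc with `log`-derivative vanishing at the centre. -/
lemma norm_logDeriv_le {H : ℂ → ℂ} {R M : ℝ} (hR : 0 < R) (hM : 0 < M) (hH : Differentiable ℂ H)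
    (h0 : H 0 = 1) (hd : deriv H 0 = 0) (hne : ∀ z, ‖z‖ < R → H z ≠ 0)
    (hb : ∀ z, ‖z‖ < R → ‖H z‖ ≤ Real.exp M) {z : ℂ} (hz : ‖z‖ < R / 4) :
    ‖deriv H z / H z‖ ≤ 32 * M / R ^ 2 * ‖z‖ := by
  have hdH : Differentiable ℂ (deriv H) := fun w ↦ (hH.analyticAt w).deriv.differentiableAt
  obtain ⟨F₁, hF₁⟩ := DifferentiableOn.isExactOn_ball (c := 0) (r := R)
    (f := fun z ↦ deriv H z / H z) (fun w hw ↦ ((hdH w).div (hH w)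
      (hne w (by simpa using hw))).differentiableWithinAt)
  let F : ℂ → ℂ := fun z ↦ F₁ z - F₁ 0
  have hF : ∀ w ∈ Metric.ball (0:ℂ) R, HasDerivAt F (deriv H w / H w) w :=
    fun w hw ↦ (hF₁ w hw).sub_const _
  have hF0 : F 0 = 0 := by simp [F]
  have hexp : ∀ w ∈ Metric.ball (0:ℂ) R, H w = exp (F w) := by
    intro w hw
    have hder : ∀ u ∈ Metric.ball (0:ℂ) R, HasDerivAt (fun u ↦ H u * exp (-F u)) 0 u := by
      intro u hu
      have h1 := (hH u).hasDerivAt.mul ((hF u hu).neg.cexp)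
      refine h1.congr_deriv ?_
      have := hne u (by simpa using hu)
      field_simp; ring
    have := IsOpen.is_const_of_deriv_eq_zero Metric.isOpen_ball
      (convex_ball (0:ℂ) R).isPreconnected
      (fun u hu ↦ (hder u hu).differentiableAt.differentiableWithinAt)
      (fun u hu ↦ (hder u hu).deriv) hw (Metric.mem_ball_self hR)
    simp only [hF0, h0, neg_zero, exp_zero, mul_one] at this
    rw [exp_neg] at this
    field_simp at this
    exact this
  have hFd : DifferentiableOn ℂ F (Metric.ball 0 R) :=
    fun w hw ↦ (hF w hw).differentiableAt.differentiableWithinAt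
  have hmaps : Set.MapsTo F (Metric.ball 0 R) {z | z.re ≤ M} := by
    intro w hw
    have := hb w (by simpa using hw)
    rw [hexp w hw, norm_exp, Real.exp_le_exp] at this
    exact this
  have hFb : ∀ w, ‖w‖ ≤ R / 2 → ‖F w‖ ≤ 2 * M := by
    intro w hw
    have := borelCaratheodory_zero hM hFd hmaps hR (z := w) (by simp; linarith) hF0
    refine this.trans ?_
    rw [div_le_iff₀ (by linarith)]
    nlinarith
  have hder : ∀ w, ‖w‖ < R / 4 → ‖deriv H w / H w‖ ≤ 8 * M / R := by
    intro w hw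
    have hs : Metric.closedBall w (R / 4) ⊆ Metric.ball 0 R := by
      intro u hu
      have : ‖u - w‖ ≤ R / 4 := by simpa [dist_eq_norm] using hu
      have h2 : ‖u‖ ≤ ‖u - w‖ + ‖w‖ := by simpa using norm_add_le (u - w) w
      simp; linarith
    have := norm_deriv_le_of_forall_mem_sphere_norm_le (c := w) (R := R / 4) (C := 2 * M) (f := F)
      (by linarith) ?_ ?_
    · rw [(hF w (by simp; linarith)).deriv] at this
      refine this.trans_eq (by field_simp; ring)
    · exact (hFd.mono hs).diffContOnCl_ball Subset.rfl
    · intro u hu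
      apply hFb
      have : ‖u - w‖ = R / 4 := by simpa [dist_eq_norm] using hu
      have h2 : ‖u‖ ≤ ‖u - w‖ + ‖w‖ := by simpa using norm_add_le (u - w) w
      linarith
  have := dist_le_div_mul_dist_of_mapsTo_ball (c := 0) (R₁ := R / 4) (R₂ := 8 * M / R)
    (f := fun z ↦ deriv H z / H z) (z := z) ?_ ?_ (by simpa using hz)
  · simp only [hd, zero_div, dist_zero_right] at this
    refine this.trans_eq (by field_simp; ring)
  · intro w hw
    have : ‖w‖ < R / 4 := by simpa using hw
    exact ((hdH w).div (hH w) (hne w (by linarith))).differentiableWithinAt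
  · intro w hw
    simpa [hd] using hder w (by simpa using hw)

lemma analyticOrderNatAt_neg {g : ℂ → ℂ} (hg : Differentiable ℂ g) {x : ℂ} (hx : g x ≠ 0)
    (hev : ∀ z, g (-z) = g z) (a : ℂ) :
    analyticOrderNatAt g (-a) = analyticOrderNatAt g a := by
  obtain ⟨k, hk, hka, hgk⟩ := exists_factor_pow hg hx a
  refine ((hg.analyticAt (-a)).analyticOrderNatAt_eq_iff
    (analyticOrderAt_ne_top_of_entire hg hx (-a))).mpr
    ⟨fun z ↦ (-1) ^ analyticOrderNatAt g a * k (-z), ?_, ?_, ?_⟩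
  · exact Differentiable.analyticAt (by fun_prop) _
  · simpa using hka
  · refine Eventually.of_forall fun z ↦ ?_
    rw [← hev, hgk, smul_eq_mul, ← mul_assoc, ← mul_pow]
    congr 2; ring

lemma deriv_zero_of_even {g : ℂ → ℂ} (hev : ∀ z, g (-z) = g z) :
    deriv g 0 = 0 := by
  have h := deriv_comp_neg g 0
  rw [funext hev, neg_zero] at h
  linear_combination h / 2

/-- The finite set of zeros of an entire function in the closed disc of radius `R`. -/
noncomputable def zerosIn {g : ℂ → ℂ} (hg : Differentiable ℂ g) {x : ℂ} (hx : g x ≠ 0) (R : ℝ) :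
    Finset ℂ := (finite_zeros hg hx R).toFinset

lemma mem_zerosIn {g : ℂ → ℂ} (hg : Differentiable ℂ g) {x : ℂ} (hx : g x ≠ 0) (R : ℝ) (z : ℂ) :
    z ∈ zerosIn hg hx R ↔ g z = 0 ∧ ‖z‖ ≤ R := by simp [zerosIn]

lemma norm_logDeriv_sub_sum_le {g : ℂ → ℂ} (hg : Differentiable ℂ g) (hev : ∀ z, g (-z) = g z)
    (hg0 : g 0 ≠ 0) {R B : ℝ} (hR : 0 < R) (hB : ∀ z, ‖z‖ ≤ 2 * R → ‖g z‖ ≤ Real.exp B)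
    {z : ℂ} (hz : g z ≠ 0) (hzR : ‖z‖ < R / 4) :
    ‖deriv g z / g z - ∑ a ∈ zerosIn hg hg0 R, analyticOrderNatAt g a / (z - a)‖ ≤
      32 * (|B| + |Real.log ‖g 0‖| + 1) / R ^ 2 * ‖z‖ := by
  set S := zerosIn hg hg0 R with hS
  set m := analyticOrderNatAt g
  obtain ⟨k, hk, hkS, hgk⟩ := exists_factor_finset hg hg0 S
  have hSa : ∀ a ∈ S, a ≠ 0 := by
    rintro a ha rfl
    exact hg0 ((mem_zerosIn hg hg0 R 0).mp ha).1
  have hk0 : k 0 ≠ 0 := fun h ↦ hg0 (by rw [hgk, h, mul_zero])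
  let H : ℂ → ℂ := fun w ↦ k w / k 0
  have hH : Differentiable ℂ H := hk.div_const _
  have hlog : ∀ w, g w ≠ 0 → deriv g w / g w = ∑ a ∈ S, m a / (w - a) + deriv H w / H w := by
    intro w hw
    have hkw : k w ≠ 0 := fun h ↦ hw (by rw [hgk, h, mul_zero])
    have hwa : ∀ a ∈ S, w - a ≠ 0 := by
      intro a ha h
      have := ((mem_zerosIn hg hg0 R a).mp ha).1
      rw [← sub_eq_zero.mp h] at this
      exact hw this
    have h1 : deriv H w / H w = deriv k w / k w := by
      simp only [H, deriv_div_const]; field_simp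
    rw [h1, ← logDeriv_apply g, funext hgk, logDeriv_mul w
      (Finset.prod_ne_zero_iff.mpr fun a ha ↦ pow_ne_zero _ (hwa a ha)) hkw (by fun_prop) (hk w),
      logDeriv_prod (x := w)
        (f := fun a z ↦ (z - a) ^ analyticOrderNatAt g a) (fun a ha ↦ pow_ne_zero _ (hwa a ha)) (fun a _ ↦ by fun_prop), logDeriv_apply]
    congr 1
    refine Finset.sum_congr rfl fun a ha ↦ ?_
    have hwa := hwa a ha
    have h2 := logDeriv_fun_pow (f := fun w : ℂ ↦ w - a) (x := w) (by fun_prop) (m a)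
    rw [h2, logDeriv_apply]
    simp; ring
  have hne : ∀ w, ‖w‖ < R → H w ≠ 0 := by
    intro w hw h
    have hkw : k w = 0 := by simpa [H, hk0] using h
    have hgw : g w = 0 := by rw [hgk, hkw, mul_zero]
    exact hkS w ((mem_zerosIn hg hg0 R w).mpr ⟨hgw, hw.le⟩) hkw
  have hb : ∀ w, ‖w‖ < R → ‖H w‖ ≤ Real.exp (|B| + |Real.log ‖g 0‖| + 1) := by
    intro w hw
    refine norm_le_of_forall_mem_frontier_norm_le (U := Metric.ball 0 (2 * R))
      Metric.isBounded_ball hH.diffContOnCl (fun u hu ↦ ?_)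
      (subset_closure (by simp; linarith))
    rw [frontier_ball _ (by positivity)] at hu
    have hu : ‖u‖ = 2 * R := by simpa using hu
    have hle : (∏ a ∈ S, ‖(0:ℂ) - a‖ ^ m a) ≤ ∏ a ∈ S, ‖u - a‖ ^ m a := by
      refine Finset.prod_le_prod (fun a _ ↦ by positivity) (fun a ha ↦ ?_)
      refine pow_le_pow_left₀ (norm_nonneg _) ?_ _
      have h1 := ((mem_zerosIn hg hg0 R a).mp ha).2
      have h2 := norm_sub_norm_le u a
      rw [zero_sub, norm_neg]; linarith
    have hpos : 0 < ∏ a ∈ S, ‖(0:ℂ) - a‖ ^ m a :=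
      Finset.prod_pos fun a ha ↦ pow_pos (by simpa using hSa a ha) _
    have e1 : ‖g u‖ = (∏ a ∈ S, ‖u - a‖ ^ m a) * ‖k u‖ := by
      rw [hgk]; simp [norm_prod, m]
    have e0 : ‖g 0‖ = (∏ a ∈ S, ‖(0:ℂ) - a‖ ^ m a) * ‖k 0‖ := by
      rw [hgk]; simp [norm_prod, m]
    have hk0' : 0 < ‖k 0‖ := norm_pos_iff.mpr hk0
    have hg0' : 0 < ‖g 0‖ := norm_pos_iff.mpr hg0
    have h3 : ‖H u‖ ≤ ‖g u‖ / ‖g 0‖ := by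
      simp only [H, norm_div]
      rw [div_le_div_iff₀ hk0' hg0', e1, e0]
      have := mul_le_mul_of_nonneg_right hle (mul_nonneg (norm_nonneg (k u)) hk0'.le)
      linarith
    have h4 := hB u hu.le
    calc ‖H u‖ ≤ ‖g u‖ / ‖g 0‖ := h3
      _ ≤ Real.exp B / Real.exp (Real.log ‖g 0‖) := by rw [Real.exp_log hg0']; gcongr
      _ = Real.exp (B - Real.log ‖g 0‖) := by rw [Real.exp_sub]
      _ ≤ _ := by
        apply Real.exp_le_exp.mpr
        have := le_abs_self B
        have := neg_abs_le (Real.log ‖g 0‖)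
        linarith
  have hsum0 : ∑ a ∈ S, (m a : ℂ) / (0 - a) = 0 := by
    have : ∑ a ∈ S, (m a : ℂ) / (0 - a) = ∑ a ∈ S, -((m a : ℂ) / (0 - a)) := by
      have hmem : ∀ a ∈ S, -a ∈ S := by
        intro a ha
        rw [hS, mem_zerosIn] at ha ⊢
        rwa [hev, norm_neg]
      refine Finset.sum_bij' (fun a _ ↦ -a) (fun a _ ↦ -a) hmem hmem (by simp) (by simp) ?_
      intro a ha
      have : m (-a) = m a := analyticOrderNatAt_neg hg hg0 hev a
      rw [this, zero_sub, zero_sub, neg_neg, div_neg]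
    rw [Finset.sum_neg_distrib] at this
    linear_combination this / 2
  have hH0 : H 0 = 1 := by simp [H, hk0]
  have hd0 : deriv H 0 = 0 := by
    have := hlog 0 hg0
    rw [hsum0, deriv_zero_of_even hev, hH0] at this
    simpa using this.symm
  have := norm_logDeriv_le hR (by positivity) hH hH0 hd0 hne hb hzR
  rw [hlog z hz, add_sub_cancel_left]
  exact this

theorem tendsto_sum_zeros {g : ℂ → ℂ} (hg : Differentiable ℂ g) (hev : ∀ z, g (-z) = g z)
    (hg0 : g 0 ≠ 0) {B : ℕ → ℝ} (hB : ∀ n : ℕ, ∀ z, ‖z‖ ≤ 2 * n → ‖g z‖ ≤ Real.exp (B n))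
    (hlim : Tendsto (fun n : ℕ ↦ B n / n ^ 2) atTop (𝓝 0)) {z : ℂ} (hz : g z ≠ 0) :
    Tendsto (fun n : ℕ ↦ ∑ a ∈ zerosIn hg hg0 n, analyticOrderNatAt g a / (z - a)) atTop
      (𝓝 (deriv g z / g z)) := by
  rw [tendsto_iff_norm_sub_tendsto_zero]
  have hl : Tendsto (fun n : ℕ ↦ 32 * (|B n / n ^ 2| + (|Real.log ‖g 0‖| + 1) / (n:ℝ) ^ 2) * ‖z‖)
      atTop (𝓝 0) := by
    have h1 := hlim.abs
    have h2 : Tendsto (fun n : ℕ ↦ (|Real.log ‖g 0‖| + 1) / (n:ℝ) ^ 2) atTop (𝓝 0) :=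
      tendsto_const_nhds.div_atTop
        ((tendsto_pow_atTop two_ne_zero).comp tendsto_natCast_atTop_atTop)
    simpa using ((h1.add h2).const_mul 32).mul_const ‖z‖
  refine squeeze_zero' (Eventually.of_forall fun _ ↦ norm_nonneg _) ?_ hl
  obtain ⟨N, hN⟩ := exists_nat_gt (4 * ‖z‖)
  filter_upwards [eventually_ge_atTop (N + 1)] with n hn
  have hn' : (N:ℝ) + 1 ≤ n := by exact_mod_cast hn
  have hn0 : (0:ℝ) < n := by have := norm_nonneg z; linarith
  rw [norm_sub_rev]
  refine (norm_logDeriv_sub_sum_le hg hev hg0 hn0 (hB n) hz (by linarith)).trans_eq ?_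
  rw [abs_div, abs_of_pos (pow_pos hn0 2)]
  field_simp
  ring

end

section

open Complex Filter Topology MeasureTheory Set
open scoped ComplexConjugate

lemma completedRiemannZeta₀_conj (s : ℂ) :
    completedRiemannZeta₀ (conj s) = conj (completedRiemannZeta₀ s) := by
  rw [completedRiemannZeta₀_eq_mellin, completedRiemannZeta₀_eq_mellin, map_div₀, mellin, mellin,
    ← integral_conj]
  congr 1
  · refine setIntegral_congr_fun measurableSet_Ioi (fun x hx ↦ ?_)
    have hx : (0:ℝ) < x := hx
    simp only [smul_eq_mul, map_mul, conj_ofReal]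
    rw [show conj s / 2 - 1 = conj (s / 2 - 1) by
      rw [map_sub, map_div₀, map_one, map_ofNat],
      cpow_conj _ _ (by rw [arg_ofReal_of_nonneg hx.le]; exact Real.pi_pos.ne), conj_ofReal]
  · exact (conj_ofReal 2).symm

lemma xi_conj (s : ℂ) : xi (conj s) = conj (xi s) := by
  unfold xi; rw [completedRiemannZeta₀_conj]; simp

lemma lam_two_mul_le {n : ℕ} (hn : 1 ≤ n) : lam (2 * n) ≤ 4 * n.factorial := by
  have hn' : (1:ℝ) ≤ n := by exact_mod_cast hn
  have e := lam_eq (2 * n)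
  push_cast at e
  have h1 : completedRiemannZeta₀ (2 * n) =
      Gammaℝ (2 * n) * riemannZeta (2 * n) + 1 / (2 * n) + 1 / (1 - 2 * n) := by
    have := completedRiemannZeta_eq (2 * n)
    rw [riemannZeta_def_of_ne_zero (by simp; omega), mul_div_cancel₀ _
      (Gammaℝ_ne_zero_of_re_pos (by simp; linarith))]
    rw [this]; ring
  have h2 : ‖Gammaℝ (2 * n)‖ ≤ n.factorial := by
    rw [Gammaℝ_def, norm_mul]
    obtain ⟨k, rfl⟩ : ∃ k, n = k + 1 := ⟨n - 1, by omega⟩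
    have e1 : (2 * ((k + 1 : ℕ):ℂ)) / 2 = k + 1 := by push_cast; ring
    rw [e1, Gamma_nat_eq_factorial, Complex.norm_natCast, norm_cpow_eq_rpow_re_of_pos Real.pi_pos]
    have : Real.pi ^ ((-(2 * ((k + 1 : ℕ):ℂ)) / 2).re) ≤ 1 := by
      apply Real.rpow_le_one_of_one_le_of_nonpos (by linarith [Real.pi_gt_three])
      rw [neg_div, e1]; simp; linarith [(Nat.cast_nonneg k : (0:ℝ) ≤ k)]
    have h3 : (k.factorial : ℝ) ≤ (k + 1).factorial := by
      exact_mod_cast Nat.factorial_le (Nat.le_succ k)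
    calc _ ≤ 1 * (k.factorial : ℝ) := by gcongr
      _ ≤ _ := by linarith
  have h3 : ‖riemannZeta (2 * n)‖ ≤ 2 := by
    have := zeta_nat_eq_tsum_of_gt_one (k := 2 * n) (by omega)
    push_cast at this
    rw [this]
    have hz := hasSum_zeta_two
    refine (tsum_of_norm_bounded hz (fun i ↦ ?_)).trans ?_
    · rcases Nat.eq_zero_or_pos i with rfl | hi
      · simp [show n ≠ 0 by omega]
      · have : (1:ℝ) ≤ i := by exact_mod_cast hi
        simp only [norm_div, norm_one, norm_pow, Complex.norm_natCast]
        exact one_div_le_one_div_of_le (by positivity) (pow_le_pow_right₀ this (by omega))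
    · nlinarith [Real.pi_lt_d2, Real.pi_gt_three]
  have hf : (1:ℝ) ≤ n.factorial := by exact_mod_cast Nat.succ_le_of_lt (Nat.factorial_pos n)
  have h4 : ‖(1:ℂ) / (2 * n)‖ ≤ 1 := by
    rw [norm_div, norm_one, norm_mul, Complex.norm_natCast, div_le_one (by simp; linarith)]
    simp; linarith
  have h5 : ‖(1:ℂ) / (1 - 2 * n)‖ ≤ 1 := by
    have : ((1:ℂ) - 2 * n) = ((1 - 2 * n : ℝ) : ℂ) := by push_cast; ring
    rw [norm_div, norm_one, this, norm_real, Real.norm_eq_abs, abs_of_nonpos (by linarith),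
      div_le_one (by linarith)]
    linarith
  have h6 : lam (2 * n) = ‖completedRiemannZeta₀ (2 * n)‖ := by
    rw [e, norm_real, Real.norm_of_nonneg (lam_nonneg _)]
  rw [h6, h1]
  calc _ ≤ ‖Gammaℝ (2 * n)‖ * ‖riemannZeta (2 * n)‖ + 1 + 1 := by
        refine (norm_add₃_le).trans ?_
        rw [norm_mul]; linarith
    _ ≤ n.factorial * 2 + 1 + 1 := by gcongr
    _ ≤ _ := by linarith

lemma norm_xi_le {n : ℕ} (hn : 1 ≤ n) {s : ℂ} (hs : ‖s‖ ≤ 2 * n - 1) :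
    ‖xi s‖ ≤ 17 * n ^ 2 * n.factorial := by
  have hn' : (1:ℝ) ≤ n := by exact_mod_cast hn
  have hf : (1:ℝ) ≤ n.factorial := by exact_mod_cast Nat.succ_le_of_lt (Nat.factorial_pos n)
  have hre := abs_le.mp ((abs_re_le_norm s).trans hs)
  have h1 : ‖completedRiemannZeta₀ s‖ ≤ 4 * n.factorial :=
    (norm_completedRiemannZeta₀_le s).trans
      ((lam_le_of_mem (by linarith) (by linarith)).trans (lam_two_mul_le hn))
  have h2 : ‖s - 1‖ ≤ 2 * n := by
    have := norm_sub_le s 1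
    rw [norm_one] at this; linarith
  unfold xi
  calc _ ≤ ‖s‖ * ‖s - 1‖ * ‖completedRiemannZeta₀ s‖ + 1 := by
        refine (norm_add_le _ _).trans_eq ?_
        rw [norm_mul, norm_mul, norm_one]
    _ ≤ (2 * n) * (2 * n) * (4 * n.factorial) + 1 := by gcongr; linarith
    _ ≤ _ := by
      have : 1 ≤ (n:ℝ) ^ 2 * n.factorial := by nlinarith
      nlinarith

/-- The function `ξ` recentred at the critical point. -/
noncomputable def xiC (z : ℂ) : ℂ := xi (1 / 2 + z)

lemma differentiable_xiC : Differentiable ℂ xiC := by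
  unfold xiC; have := differentiable_xi; fun_prop

lemma xiC_neg (z : ℂ) : xiC (-z) = xiC z := by
  unfold xiC; rw [← xi_one_sub]; congr 1; ring

lemma norm_xiC_le (n : ℕ) (z : ℂ) (hz : ‖z‖ ≤ 2 * n) :
    ‖xiC z‖ ≤ Real.exp (Real.log 17 + (n + 3) * Real.log (n + 1)) := by
  have h := norm_xi_le (n := n + 1) (by omega) (s := 1 / 2 + z) (by
    refine (norm_add_le _ _).trans ?_
    have : ‖(1 / 2 : ℂ)‖ = 1 / 2 := by norm_num
    rw [this]; push_cast; linarith)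
  refine h.trans ?_
  have h2 : ((n + 1).factorial : ℝ) ≤ (n + 1) ^ (n + 1) := by
    exact_mod_cast Nat.factorial_le_pow (n + 1)
  have e : Real.exp (Real.log 17 + (n + 3) * Real.log (n + 1)) = 17 * (n + 1) ^ (n + 3) := by
    rw [Real.exp_add, Real.exp_log (by norm_num), mul_comm _ (Real.log _), Real.exp_mul,
      Real.exp_log (by positivity)]
    norm_cast
  rw [e]; push_cast
  calc 17 * ((n:ℝ) + 1) ^ 2 * (n + 1).factorial ≤ 17 * (n + 1) ^ 2 * (n + 1) ^ (n + 1) := by gcongr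
    _ = _ := by ring

lemma tendsto_xi_growth :
    Tendsto (fun n : ℕ ↦ (Real.log 17 + (n + 3) * Real.log (n + 1)) / (n : ℝ) ^ 2) atTop (𝓝 0) := by
  have h0 : Tendsto (fun n : ℕ ↦ (n:ℝ) + 1) atTop atTop :=
    tendsto_atTop_add_const_right _ _ tendsto_natCast_atTop_atTop
  have h1 : Tendsto (fun n : ℕ ↦ Real.log ((n:ℝ) + 1) / (n + 1)) atTop (𝓝 0) :=
    (Real.isLittleO_log_id_atTop.tendsto_div_nhds_zero).comp h0
  have h2 : Tendsto (fun n : ℕ ↦ (n:ℝ)⁻¹) atTop (𝓝 0) := tendsto_inv_atTop_nhds_zero_nat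
  have h3 : Tendsto (fun n : ℕ ↦ Real.log 17 * ((n:ℝ)⁻¹) ^ 2 +
      (1 + 3 * (n:ℝ)⁻¹) * ((1 + (n:ℝ)⁻¹) * (Real.log ((n:ℝ) + 1) / (n + 1)))) atTop (𝓝 0) := by
    have := ((h2.pow 2).const_mul (Real.log 17)).add
      (((h2.const_mul 3).const_add 1).mul ((h2.const_add 1).mul h1))
    simpa using this
  refine h3.congr' ?_
  filter_upwards [eventually_ge_atTop 1] with n hn
  have : (n:ℝ) ≠ 0 := by positivity
  field_simp

lemma lam_one_lt : lam 1 < 0.07 := by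
  rw [lam_one]
  have h1 := Real.eulerMascheroniConstant_lt_two_thirds
  have h2 : (2.53:ℝ) < Real.log (4 * Real.pi) := by
    rw [Real.lt_log_iff_exp_lt (by positivity)]
    have : Real.exp 2.53 = Real.exp 1 ^ 2 * Real.exp 0.53 := by
      rw [← Real.exp_nat_mul, ← Real.exp_add]; norm_num
    rw [this]
    have h3 := Real.exp_one_lt_d9
    have h4 : Real.exp 0.53 < 1.7 := by
      have := Real.exp_bound' (x := 0.53) (by norm_num) (by norm_num) (n := 5) (by norm_num)
      refine this.trans_lt ?_
      norm_num [Finset.sum_range_succ, Nat.factorial]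
    have := Real.pi_gt_d4
    have h5 : Real.exp 1 ^ 2 < 2.7182818286 ^ 2 := by gcongr
    have h6 := Real.exp_pos 0.53
    nlinarith
  linarith

lemma norm_completedRiemannZeta₀_lt {s : ℂ} (h0 : 0 ≤ s.re) (h1 : s.re ≤ 1) :
    ‖completedRiemannZeta₀ s‖ < 0.07 :=
  ((norm_completedRiemannZeta₀_le s).trans (lam_le_of_mem (by linarith) h1)).trans_lt lam_one_lt

lemma xi_ne_zero_of_norm_lt {s : ℂ} (h0 : 0 ≤ s.re) (h1 : s.re ≤ 1)
    (h : ‖s * (s - 1)‖ ≤ 14) : xi s ≠ 0 := by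
  intro hx
  have := norm_completedRiemannZeta₀_lt h0 h1
  unfold xi at hx
  have e : s * (s - 1) * completedRiemannZeta₀ s = -1 := by linear_combination hx
  have := congrArg norm e
  rw [norm_mul, norm_neg, norm_one] at this
  nlinarith [norm_nonneg (s * (s - 1)), norm_nonneg (completedRiemannZeta₀ s)]

lemma xiC_zero_ne : xiC 0 ≠ 0 := by
  unfold xiC
  apply xi_ne_zero_of_norm_lt <;> norm_num

lemma xi_zero_re {ρ : ℂ} (h : xi ρ = 0) : 0 < ρ.re ∧ ρ.re < 1 := by
  have key : ∀ s : ℂ, 1 ≤ s.re → xi s ≠ 0 := by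
    intro s hs
    rcases eq_or_ne s 1 with rfl | h1
    · simp [xi_one]
    have h0 : s ≠ 0 := by rintro rfl; norm_num at hs
    have hG := Gammaℝ_ne_zero_of_re_pos (s := s) (by linarith)
    rw [xi_eq h0 h1 hG]
    exact mul_ne_zero (mul_ne_zero h0 (sub_ne_zero.mpr h1))
      (mul_ne_zero hG (riemannZeta_ne_zero_of_one_le_re hs))
  constructor
  · by_contra! hn
    refine key (1 - ρ) (by simp; linarith) (by rw [xi_one_sub, h])
  · by_contra! hn
    exact key ρ hn h

lemma xi_zero_im {ρ : ℂ} (h : xi ρ = 0) : 3.5 < |ρ.im| := by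
  by_contra! hn
  obtain ⟨h0, h1⟩ := xi_zero_re h
  refine xi_ne_zero_of_norm_lt h0.le h1.le ?_ h
  rw [norm_mul]
  have hi : ρ.im ^ 2 ≤ 3.5 ^ 2 := by rw [← sq_abs]; gcongr
  have a1 : ‖ρ‖ ≤ 3.7 := by
    rw [← sq_le_sq₀ (norm_nonneg _) (by norm_num), ← normSq_eq_norm_sq, normSq_apply]
    nlinarith
  have a2 : ‖ρ - 1‖ ≤ 3.7 := by
    rw [← sq_le_sq₀ (norm_nonneg _) (by norm_num), ← normSq_eq_norm_sq, normSq_apply]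
    simp only [sub_re, one_re, sub_im, one_im, sub_zero]
    nlinarith
  nlinarith [norm_nonneg ρ, norm_nonneg (ρ - 1)]

/-- Multiplicity of a point as a zero of `ξ`. -/
noncomputable def mz (ρ : ℂ) : ℝ := analyticOrderNatAt xi ρ

lemma mz_nonneg (ρ : ℂ) : 0 ≤ mz ρ := by unfold mz; positivity

lemma mz_eq_zero {ρ : ℂ} (h : xi ρ ≠ 0) : mz ρ = 0 := by
  unfold mz analyticOrderNatAt
  rw [(differentiable_xi.analyticAt ρ).analyticOrderAt_eq_zero.mpr h]; simp

lemma one_le_mz {ρ : ℂ} (h : xi ρ = 0) : 1 ≤ mz ρ := by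
  have h1 : analyticOrderAt xi ρ ≠ ⊤ := analyticOrderAt_ne_top_of_entire differentiable_xi
    (x := 0) (by simp [xi_zero]) ρ
  have h2 : analyticOrderAt xi ρ ≠ 0 := by
    rw [Ne, (differentiable_xi.analyticAt ρ).analyticOrderAt_eq_zero]; simpa using h
  have : analyticOrderNatAt xi ρ ≠ 0 := by
    intro h0
    rw [← Nat.cast_analyticOrderNatAt h1, h0] at h2
    simp at h2
  unfold mz
  exact_mod_cast Nat.one_le_iff_ne_zero.mpr this

lemma xi_zero_of_mz_ne {ρ : ℂ} (h : mz ρ ≠ 0) : xi ρ = 0 := by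
  by_contra hn; exact h (mz_eq_zero hn)

lemma mz_one_sub (ρ : ℂ) : mz (1 - ρ) = mz ρ := by
  obtain ⟨k, hk, hka, hgk⟩ := exists_factor_pow differentiable_xi (x := 0) (by simp [xi_zero]) ρ
  unfold mz
  rw [((differentiable_xi.analyticAt (1 - ρ)).analyticOrderNatAt_eq_iff
    (analyticOrderAt_ne_top_of_entire differentiable_xi (x := 0) (by simp [xi_zero]) _)).mpr
    ⟨fun z ↦ (-1) ^ analyticOrderNatAt xi ρ * k (1 - z), ?_, ?_, ?_⟩]
  · exact Differentiable.analyticAt (by fun_prop) _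
  · simpa using hka
  · refine Eventually.of_forall fun z ↦ ?_
    rw [← xi_one_sub, hgk, smul_eq_mul, ← mul_assoc, ← mul_pow]
    congr 2; ring

lemma mz_conj (ρ : ℂ) : mz (conj ρ) = mz ρ := by
  obtain ⟨k, hk, hka, hgk⟩ := exists_factor_pow differentiable_xi (x := 0) (by simp [xi_zero]) ρ
  unfold mz
  rw [((differentiable_xi.analyticAt (conj ρ)).analyticOrderNatAt_eq_iff
    (analyticOrderAt_ne_top_of_entire differentiable_xi (x := 0) (by simp [xi_zero]) _)).mpr
    ⟨conj ∘ k ∘ conj, ?_, ?_, ?_⟩]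
  · refine Differentiable.analyticAt (fun z ↦ ?_) _
    have := (hk (conj z)).conj_conj
    simpa using this
  · simpa using hka
  · refine Eventually.of_forall fun z ↦ ?_
    have := xi_conj (conj z)
    rw [conj_conj] at this
    rw [this, hgk (conj z), smul_eq_mul]
    simp

lemma mz_xiC (a : ℂ) : (analyticOrderNatAt xiC a : ℝ) = mz (1 / 2 + a) := by
  obtain ⟨k, hk, hka, hgk⟩ := exists_factor_pow differentiable_xi (x := 0) (by simp [xi_zero])
    (1 / 2 + a)
  unfold mz
  rw [((differentiable_xiC.analyticAt a).analyticOrderNatAt_eq_iff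
    (analyticOrderAt_ne_top_of_entire differentiable_xiC xiC_zero_ne _)).mpr
    ⟨fun z ↦ k (1 / 2 + z), ?_, ?_, ?_⟩]
  · exact Differentiable.analyticAt (by fun_prop) _
  · simpa using hka
  · refine Eventually.of_forall fun z ↦ ?_
    unfold xiC
    rw [hgk, smul_eq_mul]
    congr 2; ring

/-- The finite set of zeros of `ξ` at distance at most `n` from `1/2`. -/
noncomputable def xiZeros (n : ℕ) : Finset ℂ :=
  (zerosIn differentiable_xiC xiC_zero_ne n).image (fun a ↦ 1 / 2 + a)

lemma mem_xiZeros {n : ℕ} {ρ : ℂ} : ρ ∈ xiZeros n ↔ xi ρ = 0 ∧ ‖ρ - 1 / 2‖ ≤ n := by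
  unfold xiZeros
  simp only [Finset.mem_image, mem_zerosIn, xiC]
  constructor
  · rintro ⟨a, ⟨h1, h2⟩, rfl⟩
    exact ⟨h1, by simpa using h2⟩
  · rintro ⟨h1, h2⟩
    exact ⟨ρ - 1 / 2, ⟨by rwa [add_sub_cancel], h2⟩, by ring⟩

lemma xiZeros_mono : Monotone xiZeros := by
  intro m n h ρ hρ
  rw [mem_xiZeros] at hρ ⊢
  exact ⟨hρ.1, hρ.2.trans (by exact_mod_cast h)⟩

lemma exists_mem_xiZeros {ρ : ℂ} (h : xi ρ = 0) : ∃ n, ρ ∈ xiZeros n := by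
  obtain ⟨n, hn⟩ := exists_nat_ge ‖ρ - 1 / 2‖
  exact ⟨n, mem_xiZeros.mpr ⟨h, hn⟩⟩

lemma tendsto_xi_logDeriv {s : ℂ} (hs : xi s ≠ 0) :
    Tendsto (fun n ↦ ∑ ρ ∈ xiZeros n, (mz ρ : ℂ) * (s - ρ)⁻¹) atTop (𝓝 (logDeriv xi s)) := by
  have h := tendsto_sum_zeros differentiable_xiC xiC_neg xiC_zero_ne norm_xiC_le
    tendsto_xi_growth (z := s - 1 / 2) (by unfold xiC; rwa [add_sub_cancel])
  have e : deriv xiC (s - 1 / 2) / xiC (s - 1 / 2) = logDeriv xi s := by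
    have h1 : deriv xiC (s - 1 / 2) = deriv xi s := by
      have : xiC = fun z ↦ xi (1 / 2 + z) := rfl
      rw [this, deriv_comp_const_add, add_sub_cancel]
    rw [h1, logDeriv_apply]; unfold xiC; rw [add_sub_cancel]
  rw [e] at h
  refine h.congr fun n ↦ ?_
  unfold xiZeros
  rw [Finset.sum_image (by intro a _ b _ hab; simpa using hab)]
  refine Finset.sum_congr rfl fun a _ ↦ ?_
  rw [← mz_xiC, ofReal_natCast, div_eq_mul_inv]
  congr 2; ring

lemma hasSum_of_tendsto_xiZeros {f : ℂ → ℝ} {L : ℝ} (hf : ∀ ρ, 0 ≤ f ρ)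
    (hf0 : ∀ ρ, xi ρ ≠ 0 → f ρ = 0)
    (h : Tendsto (fun n ↦ ∑ ρ ∈ xiZeros n, f ρ) atTop (𝓝 L)) : HasSum f L := by
  have hmono : Monotone fun n ↦ ∑ ρ ∈ xiZeros n, f ρ := fun m n hmn ↦
    Finset.sum_le_sum_of_subset_of_nonneg (xiZeros_mono hmn) fun ρ _ _ ↦ hf ρ
  have hle : ∀ n, ∑ ρ ∈ xiZeros n, f ρ ≤ L := fun n ↦ hmono.ge_of_tendsto h n
  have hdom : ∀ T : Finset ℂ, ∃ n, ∑ ρ ∈ T, f ρ ≤ ∑ ρ ∈ xiZeros n, f ρ := by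
    classical
    intro T
    have : ∃ n, ∀ ρ ∈ T, xi ρ = 0 → ρ ∈ xiZeros n := by
      induction T using Finset.induction_on with
      | empty => exact ⟨0, by simp⟩
      | insert a T _ ih =>
        obtain ⟨n, hn⟩ := ih
        by_cases ha : xi a = 0
        · obtain ⟨m, hm⟩ := exists_mem_xiZeros ha
          refine ⟨max m n, fun ρ hρ h0 ↦ ?_⟩
          rcases Finset.mem_insert.mp hρ with rfl | hρ
          · exact xiZeros_mono (le_max_left m n) hm
          · exact xiZeros_mono (le_max_right m n) (hn ρ hρ h0)
        · refine ⟨n, fun ρ hρ h0 ↦ ?_⟩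
          rcases Finset.mem_insert.mp hρ with rfl | hρ
          · exact absurd h0 ha
          · exact hn ρ hρ h0
    obtain ⟨n, hn⟩ := this
    refine ⟨n, ?_⟩
    rw [← Finset.sum_filter_add_sum_filter_not T (fun ρ ↦ xi ρ = 0)]
    rw [Finset.sum_eq_zero (s := T.filter fun ρ ↦ ¬ xi ρ = 0)
      (fun ρ hρ ↦ hf0 ρ (Finset.mem_filter.mp hρ).2), add_zero]
    refine Finset.sum_le_sum_of_subset_of_nonneg (fun ρ hρ ↦ ?_) fun ρ _ _ ↦ hf ρ
    obtain ⟨h1, h2⟩ := Finset.mem_filter.mp hρ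
    exact hn ρ h1 h2
  refine hasSum_of_isLUB_of_nonneg L hf ⟨?_, ?_⟩
  · rintro _ ⟨T, rfl⟩
    obtain ⟨n, hn⟩ := hdom T
    exact hn.trans (hle n)
  · intro b hb
    exact le_of_tendsto' h fun n ↦ hb ⟨xiZeros n, rfl⟩

lemma tendsto_of_hasSum_xiZeros {f : ℂ → ℂ} {L : ℂ} (hf0 : ∀ ρ, xi ρ ≠ 0 → f ρ = 0)
    (h : HasSum f L) : Tendsto (fun n ↦ ∑ ρ ∈ xiZeros n, f ρ) atTop (𝓝 L) := by
  classical
  have hsub : HasSum (f ∘ ((↑) : {ρ : ℂ | xi ρ = 0} → ℂ)) L := by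
    rw [hasSum_subtype_iff_of_support_subset]
    · exact h
    · intro ρ hρ
      by_contra hn
      exact hρ (hf0 ρ hn)
  let S : ℕ → Finset {ρ : ℂ | xi ρ = 0} := fun n ↦ (xiZeros n).subtype (fun ρ ↦ xi ρ = 0)
  have hS : Tendsto S atTop atTop := by
    refine tendsto_atTop_finset_of_monotone (fun m n hmn ρ hρ ↦ ?_) fun ρ ↦ ?_
    · rw [Finset.mem_subtype] at hρ ⊢
      exact xiZeros_mono hmn hρ
    · obtain ⟨n, hn⟩ := exists_mem_xiZeros ρ.2
      exact ⟨n, Finset.mem_subtype.mpr hn⟩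
  refine (hsub.comp hS).congr fun n ↦ ?_
  exact Finset.sum_subtype_of_mem f (fun ρ hρ ↦ (mem_xiZeros.mp hρ).1)

lemma re_inv_sub (s ρ : ℂ) : ((s - ρ)⁻¹).re = (s.re - ρ.re) / ((s.re - ρ.re) ^ 2 + (s.im - ρ.im) ^ 2) := by
  rw [inv_re, normSq_apply]; simp [sq]

lemma hasSum_re_logDeriv_xi {s : ℂ} (hs : 1 ≤ s.re) :
    HasSum (fun ρ ↦ mz ρ * ((s - ρ)⁻¹).re) (logDeriv xi s).re := by
  have hx : xi s ≠ 0 := fun h ↦ absurd (xi_zero_re h).2 (by linarith)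
  refine hasSum_of_tendsto_xiZeros (fun ρ ↦ ?_) (fun ρ hρ ↦ by rw [mz_eq_zero hρ, zero_mul]) ?_
  · by_cases h : xi ρ = 0
    · refine mul_nonneg (mz_nonneg ρ) ?_
      rw [re_inv_sub]
      have := (xi_zero_re h).2
      exact div_nonneg (by linarith) (by positivity)
    · rw [mz_eq_zero h, zero_mul]
  · have := (continuous_re.tendsto _).comp (tendsto_xi_logDeriv hx)
    refine this.congr fun n ↦ ?_
    simp [re_sum]

lemma norm_gt_of_xi_zero {ρ : ℂ} (h : xi ρ = 0) : 3.5 < ‖ρ‖ :=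
  (xi_zero_im h).trans_le (abs_im_le_norm ρ)

lemma summable_mz_div_sq : Summable fun ρ ↦ mz ρ / ‖ρ‖ ^ 2 := by
  have h := (hasSum_re_logDeriv_xi (s := 2) (by norm_num)).summable.mul_left 4
  refine Summable.of_nonneg_of_le (fun ρ ↦ div_nonneg (mz_nonneg ρ) (by positivity))
    (fun ρ ↦ ?_) h
  by_cases hρ : xi ρ = 0
  · have h1 := (xi_zero_re hρ).2
    have h2 := norm_gt_of_xi_zero hρ
    have h3 : ‖2 - ρ‖ ≤ 2 * ‖ρ‖ := by
      have := norm_sub_le (2:ℂ) ρ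
      rw [Complex.norm_two] at this; linarith
    have h4 : 1 ≤ ‖2 - ρ‖ := by
      refine le_trans ?_ (abs_re_le_norm _)
      rw [sub_re, re_ofNat]
      exact le_trans (by linarith) (le_abs_self _)
    have h5 : ((2 - ρ)⁻¹).re = (2 - ρ.re) / ‖2 - ρ‖ ^ 2 := by
      rw [inv_re, normSq_eq_norm_sq]; simp
    rw [h5, mul_comm 4, mul_assoc, div_eq_mul_inv]
    refine mul_le_mul_of_nonneg_left ?_ (mz_nonneg ρ)
    rw [inv_eq_one_div, div_mul_eq_mul_div, div_le_div_iff₀ (by positivity) (by positivity)]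
    nlinarith
  · simp [mz_eq_zero hρ]

lemma summable_mz_inv {s : ℂ} (hs : 2 ≤ s.re) :
    Summable fun ρ ↦ (mz ρ : ℂ) * ((s - ρ)⁻¹ + ρ⁻¹) := by
  refine Summable.of_norm_bounded (g := fun ρ ↦ ‖s‖ * (‖s‖ + 1) * (mz ρ / ‖ρ‖ ^ 2))
    (summable_mz_div_sq.mul_left _) fun ρ ↦ ?_
  by_cases hρ : xi ρ = 0
  · have h1 := (xi_zero_re hρ).2
    have h2 := norm_gt_of_xi_zero hρ
    have h4 : 1 ≤ ‖s - ρ‖ := by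
      refine le_trans ?_ (abs_re_le_norm _)
      rw [sub_re]
      exact le_trans (by linarith) (le_abs_self _)
    have h3 : ‖ρ‖ ≤ (‖s‖ + 1) * ‖s - ρ‖ := by
      have := norm_sub_le s (s - ρ)
      rw [sub_sub_cancel] at this
      nlinarith [norm_nonneg s]
    have hn1 : s - ρ ≠ 0 := norm_pos_iff.mp (by linarith)
    have hn2 : ρ ≠ 0 := norm_pos_iff.mp (by linarith)
    have e : (s - ρ)⁻¹ + ρ⁻¹ = s / ((s - ρ) * ρ) := by field_simp; ring
    rw [e, norm_mul, norm_real, Real.norm_of_nonneg (mz_nonneg ρ), norm_div, norm_mul]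
    rw [mul_comm (‖s‖ * _), div_mul_eq_mul_div, mul_div_assoc]
    refine mul_le_mul_of_nonneg_left ?_ (mz_nonneg ρ)
    rw [div_le_div_iff₀ (by positivity) (by positivity)]
    have : 0 ≤ ‖s‖ * ‖ρ‖ := by positivity
    nlinarith
  · simp [mz_eq_zero hρ]

lemma hasSum_logDeriv_xi {s : ℂ} (hs : 2 ≤ s.re) :
    HasSum (fun ρ ↦ (mz ρ : ℂ) * ((s - ρ)⁻¹ + ρ⁻¹)) (logDeriv xi s - logDeriv xi 0) := by
  have hx : xi s ≠ 0 := fun h ↦ absurd (xi_zero_re h).2 (by linarith)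
  have h1 := tendsto_of_hasSum_xiZeros (fun ρ hρ ↦ by simp [mz_eq_zero hρ])
    (summable_mz_inv hs).hasSum
  have h2 := (tendsto_xi_logDeriv hx).sub (tendsto_xi_logDeriv (s := 0) (by simp [xi_zero]))
  have h3 := tendsto_nhds_unique h1 (h2.congr fun n ↦ by
    rw [← Finset.sum_sub_distrib]
    refine Finset.sum_congr rfl fun ρ _ ↦ ?_
    rw [zero_sub, inv_neg]; ring)
  rw [← h3]
  exact (summable_mz_inv hs).hasSum

/-- Logarithmic derivative of the real Gamma function. -/
noncomputable def psi (x : ℝ) : ℝ := deriv (fun y ↦ Real.log (Real.Gamma y)) x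

lemma hasDerivAt_logGamma {x : ℝ} (hx : 0 < x) :
    HasDerivAt (fun y ↦ Real.log (Real.Gamma y)) (psi x) x := by
  have h1 : DifferentiableAt ℝ Real.Gamma x :=
    Real.differentiableAt_Gamma (fun m ↦ by have : (0:ℝ) ≤ m := by positivity
                                            linarith)
  exact (h1.log (Real.Gamma_pos_of_pos hx).ne').hasDerivAt

lemma logGamma_add_one {x : ℝ} (hx : 0 < x) :
    Real.log (Real.Gamma (x + 1)) = Real.log (Real.Gamma x) + Real.log x := by
  rw [Real.Gamma_add_one hx.ne', Real.log_mul hx.ne' (Real.Gamma_pos_of_pos hx).ne', add_comm]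

lemma psi_le_log {x : ℝ} (hx : 0 < x) : psi x ≤ Real.log x := by
  have h := Real.convexOn_log_Gamma.le_slope_of_hasDerivAt (x := x) (y := x + 1)
    (mem_Ioi.mpr hx) (mem_Ioi.mpr (by linarith)) (by linarith) (hasDerivAt_logGamma hx)
  rw [slope_def_field] at h
  simp only [Function.comp] at h
  rw [logGamma_add_one hx] at h
  simpa using h

lemma log_le_psi_add_one {x : ℝ} (hx : 0 < x) : Real.log x ≤ psi (x + 1) := by
  have h := Real.convexOn_log_Gamma.slope_le_of_hasDerivAt (x := x) (y := x + 1)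
    (mem_Ioi.mpr hx) (mem_Ioi.mpr (by linarith)) (by linarith) (hasDerivAt_logGamma (by linarith))
  rw [slope_def_field] at h
  simp only [Function.comp] at h
  rw [logGamma_add_one hx] at h
  simpa using h

lemma psi_add_one {x : ℝ} (hx : 0 < x) : psi (x + 1) = psi x + x⁻¹ := by
  have h1 : HasDerivAt (fun y ↦ Real.log (Real.Gamma (y + 1))) (psi (x + 1)) x := by
    have := (hasDerivAt_logGamma (x := x + 1) (by linarith)).comp_add_const x 1
    exact this
  have h2 : HasDerivAt (fun y ↦ Real.log (Real.Gamma y) + Real.log y) (psi x + x⁻¹) x :=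
    (hasDerivAt_logGamma hx).add (Real.hasDerivAt_log hx.ne')
  refine h1.unique (h2.congr_of_eventuallyEq ?_)
  filter_upwards [lt_mem_nhds hx] with y hy using logGamma_add_one hy

lemma psi_add_nat {x : ℝ} (hx : 0 < x) (n : ℕ) :
    psi (x + n) = psi x + ∑ k ∈ Finset.range n, (x + k)⁻¹ := by
  induction n with
  | zero => simp
  | succ n ih =>
    rw [Finset.sum_range_succ, ← add_assoc, ← ih, ← psi_add_one (by positivity)]
    push_cast; ring_nf

lemma digamma_ofReal {x : ℝ} (hx : 0 < x) : digamma (x : ℂ) = psi x := by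
  have h0 : ∀ m : ℕ, x ≠ -m := fun m ↦ by
    have : (0:ℝ) ≤ m := by positivity
    linarith
  have h1 : HasDerivAt Real.Gamma (deriv Real.Gamma x) x :=
    (Real.differentiableAt_Gamma h0).hasDerivAt
  have h2 : DifferentiableAt ℂ Complex.Gamma x :=
    differentiableAt_Gamma _ fun m ↦ by exact_mod_cast h0 m
  have h3 : HasDerivAt (fun y : ℝ ↦ Complex.Gamma y) (deriv Complex.Gamma x) x :=
    h2.hasDerivAt.comp_ofReal
  have h4 : HasDerivAt (fun y : ℝ ↦ Complex.Gamma y) ((deriv Real.Gamma x : ℝ) : ℂ) x := by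
    simp_rw [Gamma_ofReal]
    exact h1.ofReal_comp
  have h5 := h3.unique h4
  rw [digamma_def, logDeriv_apply, h5, Gamma_ofReal, psi,
    deriv.log h1.differentiableAt (Real.Gamma_pos_of_pos hx).ne']
  push_cast; rfl

lemma tendsto_psi {x : ℝ} (hx : 0 < x) :
    Tendsto (fun n : ℕ ↦ Real.log n - ∑ k ∈ Finset.range n, (x + k)⁻¹) atTop (𝓝 (psi x)) := by
  have h1 : Tendsto (fun n : ℕ ↦ Real.log (x + n) - Real.log n) atTop (𝓝 0) := by
    have : Tendsto (fun n : ℕ ↦ Real.log (1 + x / n)) atTop (𝓝 (Real.log (1 + 0))) :=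
      ((tendsto_const_div_atTop_nhds_zero_nat x).const_add 1).log (by norm_num)
    rw [add_zero, Real.log_one] at this
    refine this.congr' ?_
    filter_upwards [eventually_gt_atTop 0] with n hn
    have : (0:ℝ) < n := by exact_mod_cast hn
    rw [← Real.log_div (by positivity) (by positivity)]
    congr 1; field_simp; ring
  have h2 : Tendsto (fun n : ℕ ↦ psi (x + n) - Real.log n) atTop (𝓝 0) := by
    have h3 : Tendsto (fun n : ℕ ↦ Real.log (x + n) - Real.log n - 1 / (x + n)) atTop (𝓝 0) := by
      have : Tendsto (fun n : ℕ ↦ 1 / (x + (n : ℝ))) atTop (𝓝 0) :=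
        tendsto_const_nhds.div_atTop (tendsto_atTop_add_const_left _ _ tendsto_natCast_atTop_atTop)
      simpa using h1.sub this
    refine tendsto_of_tendsto_of_tendsto_of_le_of_le h3 h1 (fun n ↦ ?_) (fun n ↦ ?_)
    · have := log_le_psi_add_one (x := x + n) (by positivity)
      rw [psi_add_one (by positivity)] at this
      simp only [one_div]; linarith
    · simp only [sub_le_sub_iff_right]; exact psi_le_log (by positivity)
  have h4 : Tendsto (fun n : ℕ ↦ psi x - (psi (x + n) - Real.log n)) atTop (𝓝 (psi x)) := by
    simpa using h2.const_sub (psi x)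
  refine h4.congr fun n ↦ ?_
  rw [psi_add_nat hx]; ring

lemma norm_digamma_term_le {z : ℂ} {δ r : ℝ} (hδ : 0 < δ) (hδ1 : δ ≤ 1) (hz : δ < z.re)
    (hr : ‖z‖ ≤ r) (k : ℕ) :
    ‖((k : ℂ) + 1)⁻¹ - (z + k)⁻¹‖ ≤ (r + 1) / δ * (1 / ((k : ℝ) + 1) ^ 2) := by
  have h1 : δ * (k + 1) ≤ ‖z + k‖ := by
    refine le_trans ?_ (Complex.re_le_norm _)
    simp only [add_re, natCast_re]
    have : (0:ℝ) ≤ k := by positivity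
    nlinarith
  have h2 : (0:ℝ) < δ * (k + 1) := by positivity
  have h3 : z + k ≠ 0 := norm_pos_iff.mp (h2.trans_le h1)
  have h4 : (k : ℂ) + 1 ≠ 0 := by exact_mod_cast Nat.succ_ne_zero k
  rw [inv_sub_inv h4 h3, norm_div, norm_mul]
  have h5 : ‖(k : ℂ) + 1‖ = k + 1 := by
    have : (k : ℂ) + 1 = ((k + 1 : ℝ) : ℂ) := by push_cast; ring
    rw [this, Complex.norm_real, Real.norm_of_nonneg (by positivity)]
  have h6 : ‖z + k - (k + 1)‖ ≤ r + 1 := by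
    rw [show z + k - (k + 1) = z - 1 by ring]
    exact (norm_sub_le _ _).trans (by simpa using hr)
  rw [h5]
  calc _ ≤ (r + 1) / ((k + 1) * (δ * (k + 1))) := by gcongr; linarith [norm_nonneg z]
    _ = _ := by field_simp

lemma summable_one_div_succ_sq : Summable fun k : ℕ ↦ 1 / ((k : ℝ) + 1) ^ 2 := by
  have := (summable_nat_add_iff 1).mpr (Real.summable_one_div_nat_pow (p := 2).mpr (by norm_num))
  simpa using this

lemma summable_digamma {z : ℂ} (hz : 0 < z.re) :
    Summable fun k : ℕ ↦ ((k : ℂ) + 1)⁻¹ - (z + k)⁻¹ := by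
  have h : min (z.re / 2) 1 < z.re := (min_le_left _ _).trans_lt (by linarith)
  exact Summable.of_norm_bounded (summable_one_div_succ_sq.mul_left _)
    (norm_digamma_term_le (by positivity) (min_le_right _ _) h le_rfl)

lemma differentiableOn_digamma_series :
    DifferentiableOn ℂ (fun z : ℂ ↦ ∑' k : ℕ, (((k : ℂ) + 1)⁻¹ - (z + k)⁻¹)) {z | 0 < z.re} := by
  intro z hz
  have hz : 0 < z.re := hz
  set δ := min (z.re / 2) 1
  have h : δ < z.re := (min_le_left _ _).trans_lt (by linarith)
  have hδ : 0 < δ := by positivity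
  have hopen : IsOpen {w : ℂ | δ < w.re ∧ ‖w‖ < ‖z‖ + 1} :=
    (isOpen_lt continuous_const Complex.continuous_re).inter
      (isOpen_lt continuous_norm continuous_const)
  have hd : DifferentiableOn ℂ (fun z : ℂ ↦ ∑' k : ℕ, (((k : ℂ) + 1)⁻¹ - (z + k)⁻¹))
      {w : ℂ | δ < w.re ∧ ‖w‖ < ‖z‖ + 1} := by
    refine differentiableOn_tsum_of_summable_norm
      (u := fun k : ℕ ↦ (‖z‖ + 1 + 1) / δ * (1 / ((k : ℝ) + 1) ^ 2))
      (summable_one_div_succ_sq.mul_left _) (fun k w hw ↦ ?_) hopen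
      (fun k w hw ↦ norm_digamma_term_le hδ (min_le_right _ _) hw.1 hw.2.le k)
    have : w + k ≠ 0 := fun h0 ↦ by
      have := congrArg Complex.re h0
      simp only [add_re, natCast_re, zero_re] at this
      have h3 : (0:ℝ) ≤ k := by positivity
      linarith [hw.1]
    fun_prop (disch := assumption)
  exact (hd.differentiableAt (hopen.mem_nhds ⟨h, by linarith⟩)).differentiableWithinAt

lemma digamma_eq {z : ℂ} (hz : 0 < z.re) :
    digamma z = -Real.eulerMascheroniConstant + ∑' k : ℕ, (((k : ℂ) + 1)⁻¹ - (z + k)⁻¹) := by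
  have hU : IsOpen {z : ℂ | 0 < z.re} := isOpen_lt continuous_const Complex.continuous_re
  have h1 : AnalyticOnNhd ℂ digamma {z : ℂ | 0 < z.re} := by
    have hG : DifferentiableOn ℂ Complex.Gamma {z : ℂ | 0 < z.re} := fun w hw ↦
      (differentiableAt_Gamma _ fun m h0 ↦ by
        have hw : 0 < w.re := hw
        rw [h0] at hw
        simp at hw
        have h3 : (0:ℝ) ≤ m := by positivity
        linarith).differentiableWithinAt
    refine DifferentiableOn.analyticOnNhd ?_ hU
    exact (hG.deriv hU).div hG fun w hw ↦ Gamma_ne_zero_of_re_pos hw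
  have h2 : AnalyticOnNhd ℂ (fun z : ℂ ↦ -(Real.eulerMascheroniConstant : ℂ) +
      ∑' k : ℕ, (((k : ℂ) + 1)⁻¹ - (z + k)⁻¹)) {z : ℂ | 0 < z.re} :=
    (differentiableOn_digamma_series.const_add _).analyticOnNhd hU
  have hreal : ∀ x : ℝ, 0 < x → digamma (x : ℂ) = -(Real.eulerMascheroniConstant : ℂ) +
      ∑' k : ℕ, (((k : ℂ) + 1)⁻¹ - ((x : ℂ) + k)⁻¹) := by
    intro x hx
    have hs := (summable_digamma (z := x) (by simpa using hx)).hasSum.tendsto_sum_nat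
    have ht : Tendsto (fun n : ℕ ↦ ((harmonic n : ℝ) - Real.log n) +
        (Real.log n - ∑ k ∈ Finset.range n, (x + k)⁻¹)) atTop
        (𝓝 (Real.eulerMascheroniConstant + psi x)) :=
      Real.tendsto_harmonic_sub_log.add (tendsto_psi hx)
    have ht' := (Complex.continuous_ofReal.tendsto _).comp ht
    have := tendsto_nhds_unique hs (ht'.congr fun n ↦ ?_)
    · rw [this, digamma_ofReal hx]; push_cast; ring
    · simp only [Function.comp, harmonic, Finset.sum_sub_distrib]
      push_cast; ring
  refine h1.eqOn_of_preconnected_of_frequently_eq h2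
    ((convex_halfSpace_re_gt 0).isPreconnected) (z₀ := 1) (by simp) ?_ hz
  have hseq : Tendsto (fun n : ℕ ↦ ((1 + 1 / ((n : ℝ) + 1) : ℝ) : ℂ)) atTop (𝓝[≠] 1) := by
    rw [tendsto_nhdsWithin_iff]
    constructor
    · have : Tendsto (fun n : ℕ ↦ 1 + 1 / ((n : ℝ) + 1)) atTop (𝓝 (1 + 0)) :=
        tendsto_one_div_add_atTop_nhds_zero_nat.const_add 1
      have := (Complex.continuous_ofReal.tendsto _).comp this
      simpa [Function.comp_def] using this
    · refine Eventually.of_forall fun n ↦ ?_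
      have : (0:ℝ) < 1 / ((n : ℝ) + 1) := by positivity
      simp only [mem_compl_iff, mem_singleton_iff]
      norm_cast
      intro h; push_cast at h; linarith
  exact hseq.frequently (Eventually.of_forall fun n ↦ hreal _ (by positivity)).frequently

lemma log_le_half_sub_inv {t : ℝ} (ht : 1 ≤ t) : Real.log t ≤ (t - t⁻¹) / 2 := by
  have h0 : 0 < t := by linarith
  have h := Real.self_le_sinh_iff.mpr (Real.log_nonneg ht)
  rwa [Real.sinh_eq, Real.exp_neg, Real.exp_log h0] at h

lemma abs_half_log_sub_le {u b : ℝ} (hu : 0 < u) :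
    |Real.log (((u + 1) ^ 2 + b ^ 2) / (u ^ 2 + b ^ 2)) / 2 -
      (u / (u ^ 2 + b ^ 2) + (u + 1) / ((u + 1) ^ 2 + b ^ 2)) / 2| ≤
    (1 / (u ^ 2 + b ^ 2) - 1 / ((u + 1) ^ 2 + b ^ 2)) / 4 := by
  set q := u ^ 2 + b ^ 2 with hq
  set q' := (u + 1) ^ 2 + b ^ 2 with hq'
  have hq0 : 0 < q := by positivity
  have hq0' : 0 < q' := by positivity
  have hD : q' - q = 2 * u + 1 := by rw [hq, hq']; ring
  have h1 : 1 ≤ q' / q := by rw [one_le_div hq0]; linarith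
  have hup := log_le_half_sub_inv h1
  have hlo := Real.le_log_one_add_of_nonneg (x := q' / q - 1) (by linarith)
  rw [show 1 + (q' / q - 1) = q' / q by ring] at hlo
  have e1 : u = (q' - q - 1) / 2 := by linarith
  have e2 : u + 1 = (q' - q + 1) / 2 := by linarith
  have e3 : u / q + (u + 1) / q' = ((q' - q) * (q' + q) - (q' - q)) / (2 * (q * q')) := by
    rw [e2, e1]; field_simp; ring
  have e4 : 1 / q - 1 / q' = (q' - q) / (q * q') := by field_simp
  have e5 : (q' / q - (q' / q)⁻¹) / 2 = (q' - q) * (q' + q) / (2 * (q * q')) := by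
    field_simp; ring
  have e6 : 2 * (q' / q - 1) / (q' / q - 1 + 2) = 2 * (q' - q) / (q' + q) := by
    rw [div_sub_one hq0.ne', div_add' _ _ _ hq0.ne', ← mul_div_assoc,
      div_div_div_cancel_right₀ hq0.ne']
    congr 1; ring
  rw [e5] at hup
  rw [e6] at hlo
  have hlo2 : (q' - q) * (q' + q) / (2 * (q * q')) - (q' - q) / (q * q') ≤
      2 * (q' - q) / (q' + q) := by
    rw [← sub_nonneg]
    have : 2 * (q' - q) / (q' + q) - ((q' - q) * (q' + q) / (2 * (q * q')) -
        (q' - q) / (q * q')) = (q' - q) * (2 * (q' + q) - (q' - q) ^ 2) /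
          (2 * (q * q') * (q' + q)) := by
      field_simp; ring
    rw [this]
    have : 0 ≤ 2 * (q' + q) - (q' - q) ^ 2 := by rw [hD, hq, hq']; nlinarith [sq_nonneg b]
    have : 0 ≤ q' - q := by linarith
    positivity
  rw [e3, e4, sub_div ((q' - q) * (q' + q)), abs_le]
  have e7 : (q' - q) / (2 * (q * q')) = (q' - q) / (q * q') / 2 := by field_simp
  rw [e7]
  constructor <;> linarith

lemma tendsto_re_digamma {z : ℂ} (hz : 0 < z.re) :
    Tendsto (fun n : ℕ ↦ Real.log n - ∑ k ∈ Finset.range n, ((z + k)⁻¹).re) atTop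
      (𝓝 (digamma z).re) := by
  have hs := ((summable_digamma hz).hasSum.mapL reCLM).tendsto_sum_nat
  have := hs.sub Real.tendsto_harmonic_sub_log
  refine (this.congr fun n ↦ ?_).trans_eq ?_
  · simp only [reCLM_apply, sub_re, harmonic, Finset.sum_sub_distrib]
    have : ∀ k : ℕ, (((k : ℂ) + 1)⁻¹).re = ((k : ℝ) + 1)⁻¹ := fun k ↦ by
      rw [show (((k : ℂ) + 1)⁻¹) = (((k : ℝ) + 1)⁻¹ : ℝ) by push_cast; rfl, ofReal_re]
    simp only [this]
    push_cast; ring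
  · rw [digamma_eq hz]; simp [sub_eq_neg_add]

lemma inv_add_nat_re (z : ℂ) (k : ℕ) :
    ((z + k)⁻¹).re = (z.re + k) / ((z.re + k) ^ 2 + z.im ^ 2) := by
  rw [Complex.inv_re, normSq_apply]; simp [sq]

/-- Stirling's approximation for the real part of the digamma function. -/
lemma abs_re_digamma_sub_le {z : ℂ} (hz : 0 < z.re) :
    |(digamma z).re - (Real.log (z.re ^ 2 + z.im ^ 2) / 2 -
      z.re / (z.re ^ 2 + z.im ^ 2) / 2)| ≤ 1 / (z.re ^ 2 + z.im ^ 2) / 4 := by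
  set a : ℕ → ℝ := fun k ↦ (z.re + k) / ((z.re + k) ^ 2 + z.im ^ 2) with ha
  set q : ℕ → ℝ := fun k ↦ (z.re + k) ^ 2 + z.im ^ 2 with hq
  have hq0 : ∀ k, 0 < q k := fun k ↦ by simp only [hq]; positivity
  have hstep : ∀ n : ℕ, |Real.log (q n) / 2 - Real.log (q 0) / 2 -
      (∑ k ∈ Finset.range n, a k - a 0 / 2 + a n / 2)| ≤ (1 / q 0 - 1 / q n) / 4 := by
    intro n
    induction n with
    | zero => simp
    | succ n ih =>
      have h := abs_half_log_sub_le (u := z.re + n) (b := z.im) (by positivity)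
      have e : z.re + n + 1 = z.re + (n + 1 : ℕ) := by push_cast; ring
      rw [e] at h
      change |Real.log (q (n + 1) / q n) / 2 - (a n + a (n + 1)) / 2| ≤
        (1 / q n - 1 / q (n + 1)) / 4 at h
      rw [Real.log_div (hq0 _).ne' (hq0 _).ne'] at h
      rw [Finset.sum_range_succ]
      have := (abs_add_le _ _).trans (add_le_add ih h)
      refine le_trans (le_of_eq ?_) (this.trans (by linarith))
      congr 1; ring
  have hlim : Tendsto (fun n : ℕ ↦ Real.log (q n) / 2 - Real.log n) atTop (𝓝 0) := by
    have h1 : Tendsto (fun n : ℕ ↦ Real.log ((1 + z.re / n) ^ 2 + (z.im / n) ^ 2) / 2) atTop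
        (𝓝 (Real.log ((1 + 0) ^ 2 + 0 ^ 2) / 2)) :=
      ((((tendsto_const_div_atTop_nhds_zero_nat _).const_add 1).pow 2).add
        ((tendsto_const_div_atTop_nhds_zero_nat _).pow 2)).log (by norm_num) |>.div_const 2
    simp only [add_zero, one_pow, ne_eq, OfNat.ofNat_ne_zero, not_false_eq_true, zero_pow,
      Real.log_one, zero_div] at h1
    refine h1.congr' ?_
    filter_upwards [eventually_gt_atTop 0] with n hn
    have hn' : (0:ℝ) < n := by exact_mod_cast hn
    have : (1 + z.re / n) ^ 2 + (z.im / n) ^ 2 = q n / (n:ℝ) ^ 2 := by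
      simp only [hq]; field_simp; ring
    rw [this, Real.log_div (hq0 n).ne' (by positivity), Real.log_pow]
    push_cast; ring
  have han : Tendsto a atTop (𝓝 0) := by
    have h1 : Tendsto (fun n : ℕ ↦ 1 / (z.re + (n:ℝ))) atTop (𝓝 0) :=
      tendsto_const_nhds.div_atTop (tendsto_atTop_add_const_left _ _ tendsto_natCast_atTop_atTop)
    refine squeeze_zero (fun n ↦ by simp only [ha]; positivity) (fun n ↦ ?_) h1
    simp only [ha]
    rw [div_le_div_iff₀ (hq0 n) (by positivity)]
    nlinarith [sq_nonneg z.im]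
  have ht : Tendsto (fun n : ℕ ↦ Real.log (q n) / 2 - Real.log (q 0) / 2 -
      (∑ k ∈ Finset.range n, a k - a 0 / 2 + a n / 2)) atTop
      (𝓝 ((digamma z).re - (Real.log (q 0) / 2 - a 0 / 2))) := by
    have h := ((tendsto_re_digamma hz).add hlim).sub (han.div_const 2)
    simp_rw [inv_add_nat_re] at h
    have h' := h.sub_const (Real.log (q 0) / 2 - a 0 / 2)
    simp only [add_zero, zero_div, sub_zero] at h'
    refine h'.congr fun n ↦ ?_
    simp only [ha]; ring
  have hfin := le_of_tendsto ht.abs (b := 1 / q 0 / 4) (Eventually.of_forall fun n ↦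
    (hstep n).trans (by have := hq0 n; have : 0 < 1 / q n := by positivity
                        linarith))
  simpa [ha, hq] using hfin

lemma logDeriv_xi_eq {s : ℂ} (hs : 1 < s.re) :
    logDeriv xi s = (s - 1)⁻¹ + digamma (s / 2 + 1) / 2 - Real.log Real.pi / 2 +
      deriv riemannZeta s / riemannZeta s := by
  have h0 : s ≠ 0 := fun h ↦ by rw [h] at hs; simp at hs; linarith
  have h1 : s ≠ 1 := fun h ↦ by rw [h] at hs; simp at hs
  have h1' : s - 1 ≠ 0 := sub_ne_zero.mpr h1
  have hre2 : 0 < (s / 2).re := by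
    rw [show s / 2 = ((1/2 : ℝ) : ℂ) * s by push_cast; ring, re_ofReal_mul]; linarith
  have hU : IsOpen {z : ℂ | 1 < z.re} := isOpen_lt continuous_const Complex.continuous_re
  have hz : riemannZeta s ≠ 0 := riemannZeta_ne_zero_of_one_lt_re hs
  have hG2 : Complex.Gamma (s / 2) ≠ 0 := Gamma_ne_zero_of_re_pos hre2
  have hnn : ∀ m : ℕ, s / 2 ≠ -m := fun m h ↦ by
    rw [h] at hre2; simp at hre2
    have : (0:ℝ) ≤ m := by positivity
    linarith
  have hpi : (Real.pi : ℂ) ≠ 0 := by exact_mod_cast Real.pi_ne_zero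
  have hev : xi =ᶠ[𝓝 s] fun z ↦ (z * (z - 1)) *
      (((Real.pi : ℂ) ^ (-z / 2) * Complex.Gamma (z / 2)) * riemannZeta z) := by
    filter_upwards [hU.mem_nhds hs] with z hz
    have hz : 1 < z.re := hz
    rw [xi_eq (fun h ↦ by rw [h] at hz; simp at hz; linarith)
      (fun h ↦ by rw [h] at hz; simp at hz) (Gammaℝ_ne_zero_of_re_pos (by linarith)), Gammaℝ_def]
  have hdG : HasDerivAt (fun z : ℂ ↦ Complex.Gamma (z / 2)) (deriv Complex.Gamma (s / 2) * (1 / 2))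
      s := by
    have := (differentiableAt_Gamma _ hnn).hasDerivAt.comp s ((hasDerivAt_id s).div_const 2)
    exact this
  have hdp : HasDerivAt (fun z : ℂ ↦ (Real.pi : ℂ) ^ (-z / 2))
      ((Real.pi : ℂ) ^ (-s / 2) * Complex.log Real.pi * (-1 / 2)) s := by
    have := ((hasDerivAt_id s).neg.div_const 2).const_cpow (c := (Real.pi : ℂ)) (Or.inl hpi)
    exact this
  have hdz : HasDerivAt riemannZeta (deriv riemannZeta s) s :=
    (differentiableAt_riemannZeta h1).hasDerivAt
  have hdq : HasDerivAt (fun z : ℂ ↦ z * (z - 1)) (1 * (s - 1) + s * 1) s :=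
    (hasDerivAt_id s).mul ((hasDerivAt_id s).sub_const 1)
  have hd := hdq.mul ((hdp.mul hdG).mul hdz)
  have hxi := hd.congr_of_eventuallyEq hev
  have hpw : (Real.pi : ℂ) ^ (-s / 2) ≠ 0 := by
    rw [Ne, cpow_eq_zero_iff]; tauto
  rw [logDeriv_apply, hxi.deriv, hev.eq_of_nhds, digamma_apply_add_one _ hnn, digamma_def,
    logDeriv_apply, ← Complex.ofReal_log Real.pi_pos.le]
  field_simp
  simp only [Pi.mul_apply]
  ring

lemma half_digamma_eq {s : ℂ} (hs : 0 < s.re) :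
    HasSum (fun k : ℕ ↦ (2 * ((k : ℂ) + 1))⁻¹ - (s + 2 * (k + 1))⁻¹)
      (digamma (s / 2 + 1) / 2 + Real.eulerMascheroniConstant / 2) := by
  have hre2 : 0 < (s / 2 + 1).re := by
    rw [show s / 2 = ((1/2 : ℝ) : ℂ) * s by push_cast; ring, add_re, re_ofReal_mul]; simp
    linarith
  have h := (summable_digamma hre2).hasSum.div_const 2
  rw [digamma_eq hre2]
  have e : (fun k : ℕ ↦ (2 * ((k : ℂ) + 1))⁻¹ - (s + 2 * (k + 1))⁻¹) =
      fun k : ℕ ↦ (((k : ℂ) + 1)⁻¹ - (s / 2 + 1 + k)⁻¹) / 2 := by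
    funext k
    rw [show s + 2 * ((k : ℂ) + 1) = 2 * (s / 2 + 1 + k) by ring, mul_inv, mul_inv]
    ring
  rw [e, ← add_div, neg_add_eq_sub, sub_add_cancel]
  exact h

lemma logDeriv_xi_zero :
    logDeriv xi 0 = Real.log (4 * Real.pi) / 2 - Real.eulerMascheroniConstant / 2 - 1 := by
  have h : HasDerivAt xi (((1 * (0 - 1) + 0 * 1) * completedRiemannZeta₀ 0 +
      0 * (0 - 1) * deriv completedRiemannZeta₀ 0)) 0 :=
    ((((hasDerivAt_id (0:ℂ)).mul ((hasDerivAt_id (0:ℂ)).sub_const 1)).mul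
      (differentiable_completedZeta₀ 0).hasDerivAt)).add_const 1
  rw [logDeriv_apply, h.deriv, xi_zero, ← completedRiemannZeta₀_one_sub]
  have := lam_eq 1
  have h1 := lam_one
  simp only [sub_zero, ofReal_one] at this ⊢
  rw [this, h1]
  push_cast; ring

lemma hasSum_log_deriv_zeta {s : ℂ} (hs : 2 ≤ s.re) :
    HasSum (fun ρ ↦ (mz ρ : ℂ) * ((s - ρ)⁻¹ + ρ⁻¹))
      ((s - 1)⁻¹ + digamma (s / 2 + 1) / 2 + Real.eulerMascheroniConstant / 2 + 1 -
        Real.log (2 * Real.pi) + deriv riemannZeta s / riemannZeta s) := by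
  have h := hasSum_logDeriv_xi hs
  rw [logDeriv_xi_zero, logDeriv_xi_eq (by linarith)] at h
  convert h using 1
  have hp := Real.pi_pos
  have h1 : Real.log (4 * Real.pi) = 2 * Real.log 2 + Real.log Real.pi := by
    rw [Real.log_mul (by norm_num) hp.ne', show (4:ℝ) = 2 ^ 2 by norm_num, Real.log_pow]
    push_cast; ring
  have h2 : Real.log (2 * Real.pi) = Real.log 2 + Real.log Real.pi :=
    Real.log_mul (by norm_num) hp.ne'
  rw [h1, h2]; push_cast; ring

lemma integrable_exp_neg_half_abs : Integrable fun u : ℝ ↦ Real.exp (-|u| / 2) := by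
  have h1 : IntegrableOn (fun u : ℝ ↦ Real.exp (-|u| / 2)) (Ioi 0) := by
    refine (integrableOn_exp_mul_Ioi (a := -(1/2)) (by norm_num) 0).congr_fun
      (fun u hu ↦ ?_) measurableSet_Ioi
    simp only [abs_of_pos hu.out]; ring_nf
  have h2 : IntegrableOn (fun u : ℝ ↦ Real.exp (-|u| / 2)) (Iic 0) := by
    refine (integrableOn_exp_mul_Iic (a := 1/2) (by norm_num) 0).congr_fun
      (fun u hu ↦ ?_) measurableSet_Iic
    simp only [abs_of_nonpos hu.out]; ring_nf
  rw [← integrableOn_univ, ← Iic_union_Ioi (a := (0:ℝ))]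
  exact h2.union h1

/-- `G` is the Fourier transform of the continuous function `g`, which decays like
`B * exp (-|u| / 2)`. -/
structure HasTransform (g : ℝ → ℂ) (G : ℝ → ℂ) (B : ℝ) : Prop where
  cont : Continuous g
  bound : ∀ u, ‖g u‖ ≤ B * Real.exp (-|u| / 2)
  eq : ∀ t : ℝ, ∫ u : ℝ, cexp (-(t * u) * I) * g u = G t

namespace HasTransform

variable {g g' G G' : ℝ → ℂ} {B B' : ℝ}

lemma nonneg (h : HasTransform g G B) : 0 ≤ B := by
  have := (norm_nonneg _).trans (h.bound 0); simpa using this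

lemma congr (h : HasTransform g G B) (hg : ∀ u, g' u = g u) (hG : ∀ t, G' t = G t) :
    HasTransform g' G' B := by
  rwa [show g' = g from funext hg, show G' = G from funext hG]

lemma integrable (h : HasTransform g G B) : Integrable g :=
  (integrable_exp_neg_half_abs.const_mul B).mono' h.cont.aestronglyMeasurable
    (Eventually.of_forall h.bound)

lemma norm_exp (t u : ℝ) : ‖cexp (-(t * u) * I)‖ = 1 := by
  rw [show -((t : ℂ) * u) * I = ((-(t * u) : ℝ) : ℂ) * I by push_cast; ring,
    norm_exp_ofReal_mul_I]

lemma integrable_mul (h : HasTransform g G B) (t : ℝ) :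
    Integrable fun u : ℝ ↦ cexp (-(t * u) * I) * g u :=
  (integrable_exp_neg_half_abs.const_mul B).mono'
    (((by fun_prop : Continuous fun u : ℝ ↦ cexp (-(t * u) * I)).mul
      h.cont).aestronglyMeasurable)
    (Eventually.of_forall fun u ↦ by rw [norm_mul, norm_exp, one_mul]; exact h.bound u)

lemma add (h : HasTransform g G B) (h' : HasTransform g' G' B') :
    HasTransform (fun u ↦ g u + g' u) (fun t ↦ G t + G' t) (B + B') where
  cont := h.cont.add h'.cont
  bound u := (norm_add_le _ _).trans (by rw [add_mul]; exact add_le_add (h.bound u) (h'.bound u))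
  eq t := by
    simp_rw [mul_add]
    rw [integral_add (h.integrable_mul t) (h'.integrable_mul t), h.eq, h'.eq]

lemma const_mul (h : HasTransform g G B) (c : ℂ) :
    HasTransform (fun u ↦ c * g u) (fun t ↦ c * G t) (‖c‖ * B) where
  cont := h.cont.const_mul c
  bound u := by rw [norm_mul, mul_assoc]; exact mul_le_mul_of_nonneg_left (h.bound u) (norm_nonneg _)
  eq t := by
    simp_rw [mul_left_comm _ c]
    rw [integral_const_mul, h.eq]

lemma tsum {ι : Type*} [Countable ι] {g G : ι → ℝ → ℂ} {B : ι → ℝ}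
    (h : ∀ i, HasTransform (g i) (G i) (B i)) (hB : Summable B) :
    HasTransform (fun u ↦ ∑' i, g i u) (fun t ↦ ∑' i, G i t) (∑' i, B i) where
  cont := continuous_tsum (fun i ↦ (h i).cont) hB fun i u ↦ ((h i).bound u).trans
    (mul_le_of_le_one_right (h i).nonneg (Real.exp_le_one_iff.mpr (by linarith [abs_nonneg u])))
  bound u := by
    rw [← tsum_mul_right]
    exact tsum_of_norm_bounded (hB.mul_right _).hasSum fun i ↦ (h i).bound u
  eq t := by
    simp_rw [← fun i ↦ (h i).eq t, ← tsum_mul_left]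
    refine ((hasSum_integral_of_summable_integral_norm (fun i ↦ (h i).integrable_mul t)
      ?_).tsum_eq).symm
    refine Summable.of_nonneg_of_le (fun i ↦ integral_nonneg fun u ↦ norm_nonneg _) (fun i ↦ ?_)
      (hB.mul_right (∫ u : ℝ, Real.exp (-|u| / 2)))
    rw [← integral_const_mul]
    refine integral_mono ((h i).integrable_mul t).norm (integrable_exp_neg_half_abs.const_mul _)
      fun u ↦ ?_
    simp only [norm_mul, norm_exp, one_mul]
    exact (h i).bound u

lemma eq_zero (h : HasTransform g G B) (hG : ∀ t, G t = 0) : g = 0 := by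
  have hF : FourierTransform.fourier g = 0 := by
    funext ξ
    rw [Real.fourier_real_eq_integral_exp_smul]
    have := h.eq (2 * Real.pi * ξ)
    rw [hG] at this
    simp only [Pi.zero_apply]
    rw [← this]
    congr 1; funext u; rw [smul_eq_mul]; congr 2; push_cast; ring
  have h1 := h.cont.fourierInv_fourier_eq h.integrable (by rw [hF]; exact integrable_zero _ _ _)
  rw [← h1, hF]
  funext v
  simp [Real.fourierInv_eq]

end HasTransform

lemma tendsto_pow_mul_cexp {s : ℂ} (hs : 1 ≤ s.re) (n : ℕ) :
    Tendsto (fun u : ℝ ↦ (u : ℂ) ^ n * cexp (-(s * u))) atTop (𝓝 0) := by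
  rw [tendsto_zero_iff_norm_tendsto_zero]
  refine squeeze_zero' (Eventually.of_forall fun _ ↦ norm_nonneg _) ?_
    (Real.tendsto_pow_mul_exp_neg_atTop_nhds_zero n)
  filter_upwards [eventually_ge_atTop 0] with u hu
  rw [norm_mul, norm_pow, Complex.norm_real, Real.norm_of_nonneg hu, Complex.norm_exp]
  gcongr
  simp only [neg_re, mul_re, ofReal_re, ofReal_im]
  nlinarith

lemma hasTransform_sq {a : ℝ} (ha : 0 ≤ a) :
    HasTransform (fun u ↦ cexp (-2 * u) * ((max (u - a) 0 ^ 2 / 2 : ℝ) : ℂ))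
      (fun t ↦ cexp (-(a * (2 + t * I))) / (2 + t * I) ^ 3) (Real.exp (-(3 / 2 * a))) := by
  have hc : Continuous fun u : ℝ ↦ cexp (-2 * u) * ((max (u - a) 0 ^ 2 / 2 : ℝ) : ℂ) := by fun_prop
  have hb : ∀ u : ℝ, ‖cexp (-2 * u) * ((max (u - a) 0 ^ 2 / 2 : ℝ) : ℂ)‖ ≤
      Real.exp (-(3 / 2 * a)) * Real.exp (-|u| / 2) := by
    intro u
    rw [norm_mul, Complex.norm_exp, Complex.norm_real, Real.norm_of_nonneg (by positivity)]
    rcases le_total u a with h | h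
    · rw [max_eq_right (by linarith)]; simp; positivity
    · rw [max_eq_left (by linarith), abs_of_nonneg (by linarith), ← Real.exp_add]
      have h1 := Real.quadratic_le_exp_of_nonneg (x := u - a) (by linarith)
      have h2 : (u - a) ^ 2 / 2 ≤ Real.exp (u - a) := by linarith
      calc _ ≤ Real.exp ((-2 * (u:ℂ)).re) * Real.exp (u - a) := by gcongr
        _ ≤ _ := by
          rw [← Real.exp_add]; apply Real.exp_le_exp.mpr
          simp; linarith
  refine ⟨hc, hb, fun t ↦ ?_⟩
  set s : ℂ := 2 + t * I with hs
  have hs2 : s.re = 2 := by simp [hs]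
  have hs0 : s ≠ 0 := fun h ↦ by rw [h] at hs2; simp at hs2
  have e1 : ∀ u : ℝ, cexp (-(t * u) * I) * (cexp (-2 * u) * ((max (u - a) 0 ^ 2 / 2 : ℝ) : ℂ)) =
      cexp (-(a * s)) * (cexp (-(s * (u - a : ℝ))) * ((max (u - a) 0 ^ 2 / 2 : ℝ) : ℂ)) := by
    intro u
    rw [← mul_assoc, ← mul_assoc, ← Complex.exp_add, ← Complex.exp_add]
    congr 2; rw [hs]; push_cast; ring
  have h_int : Integrable fun u : ℝ ↦ cexp (-(s * u)) * ((max u 0 ^ 2 / 2 : ℝ) : ℂ) := by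
    have h1 := ((integrable_exp_neg_half_abs.const_mul (Real.exp (-(3/2 * a)))).mono'
      hc.aestronglyMeasurable (Eventually.of_forall hb)).comp_add_right a
    refine (h1.norm.const_mul (Real.exp (2 * a))).mono' (by
      refine Continuous.aestronglyMeasurable ?_; fun_prop) (Eventually.of_forall fun u ↦ ?_)
    simp only [add_sub_cancel_right, norm_mul, Complex.norm_exp]
    rw [← mul_assoc, ← Real.exp_add]
    gcongr
    simp [hs]; linarith
  simp_rw [e1]
  rw [integral_const_mul, div_eq_mul_inv]
  congr 1
  rw [integral_sub_right_eq_self (fun u : ℝ ↦ cexp (-(s * u)) * ((max u 0 ^ 2 / 2 : ℝ) : ℂ)) a,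
    ← setIntegral_eq_integral_of_forall_compl_eq_zero (s := Ioi 0) (fun u hu ↦ by
      rw [max_eq_right (not_lt.mp hu)]; simp)]
  have hder : ∀ u ∈ Ici (0:ℝ), HasDerivAt (fun u : ℝ ↦ -(((u:ℂ) ^ 2 * cexp (-(s * u))) / (2 * s) +
      ((u:ℂ) ^ 1 * cexp (-(s * u))) / s ^ 2 + ((u:ℂ) ^ 0 * cexp (-(s * u))) / s ^ 3))
      (cexp (-(s * u)) * ((max u 0 ^ 2 / 2 : ℝ) : ℂ)) u := by
    intro u hu
    have hu : 0 ≤ u := hu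
    have hid : HasDerivAt (fun u : ℝ ↦ (u : ℂ)) 1 u := ofRealCLM.hasDerivAt
    have he : HasDerivAt (fun u : ℝ ↦ cexp (-(s * u))) (cexp (-(s * u)) * (-(s * 1))) u :=
      (hid.const_mul s).neg.cexp
    have := (((((hid.pow 2).mul he).div_const (2 * s)).add
      (((hid.pow 1).mul he).div_const (s ^ 2))).add (((hid.pow 0).mul he).div_const (s ^ 3))).neg
    convert! this using 1
    rw [max_eq_left hu]
    simp only [Pi.pow_apply]
    push_cast
    field_simp
    ring
  have ht : Tendsto (fun u : ℝ ↦ -(((u:ℂ) ^ 2 * cexp (-(s * u))) / (2 * s) +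
      ((u:ℂ) ^ 1 * cexp (-(s * u))) / s ^ 2 + ((u:ℂ) ^ 0 * cexp (-(s * u))) / s ^ 3)) atTop
      (𝓝 0) := by
    have h1 : 1 ≤ s.re := by rw [hs2]; norm_num
    simpa using ((((tendsto_pow_mul_cexp h1 2).div_const (2 * s)).add
      ((tendsto_pow_mul_cexp h1 1).div_const (s ^ 2))).add
      ((tendsto_pow_mul_cexp h1 0).div_const (s ^ 3))).neg
  rw [integral_Ioi_of_hasDerivAt_of_tendsto' hder h_int.integrableOn ht]
  simp

/-- The inverse Laplace transform of `((s - w)⁻¹ + w⁻¹) / s ^ 3`. -/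
noncomputable def phi (w : ℂ) (u : ℝ) : ℂ := (cexp (w * u) - 1 - w * u) / w ^ 3

lemma hasTransform_phi {w : ℂ} (hw : w.re ≤ 1) (hw1 : 1 ≤ ‖w‖) :
    HasTransform (fun u ↦ cexp (-2 * u) * phi w (max u 0))
      (fun t ↦ ((2 + t * I - w)⁻¹ + w⁻¹) / (2 + t * I) ^ 3) (3 / ‖w‖ ^ 2) := by
  have hw0 : w ≠ 0 := norm_pos_iff.mp (by linarith)
  have hc : Continuous fun u : ℝ ↦ cexp (-2 * u) * phi w (max u 0) := by unfold phi; fun_prop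
  have hb : ∀ u : ℝ, ‖cexp (-2 * u) * phi w (max u 0)‖ ≤
      3 / ‖w‖ ^ 2 * Real.exp (-|u| / 2) := by
    intro u
    rcases le_total u 0 with h | h
    · rw [max_eq_right h]; simp [phi]; positivity
    · rw [max_eq_left h, abs_of_nonneg h, norm_mul, Complex.norm_exp, phi, norm_div, norm_pow]
      have h1 : ‖cexp (w * u) - 1 - w * u‖ ≤ Real.exp u + 1 + ‖w‖ * u := by
        refine (norm_sub_le _ _).trans (add_le_add ((norm_sub_le _ _).trans (add_le_add ?_ ?_)) ?_)
        · rw [Complex.norm_exp]; apply Real.exp_le_exp.mpr; simp; nlinarith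
        · simp
        · simp [abs_of_nonneg h]
      have h3 : Real.exp u + 1 + ‖w‖ * u ≤ 3 * ‖w‖ * Real.exp u := by
        have := Real.add_one_le_exp u
        nlinarith [Real.exp_pos u]
      have h4 : (-2 * (u:ℂ)).re = -2 * u := by simp
      rw [h4]
      calc _ ≤ Real.exp (-2 * u) * (3 * ‖w‖ * Real.exp u / ‖w‖ ^ 3) := by gcongr; linarith
        _ = 3 / ‖w‖ ^ 2 * Real.exp (-2 * u + u) := by
          rw [Real.exp_add]; field_simp
        _ ≤ _ := by gcongr; linarith
  refine ⟨hc, hb, fun t ↦ ?_⟩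
  set s : ℂ := 2 + t * I with hs
  have hs2 : s.re = 2 := by simp [hs]
  have hs0 : s ≠ 0 := fun h ↦ by rw [h] at hs2; simp at hs2
  have hsw : s - w ≠ 0 := fun h ↦ by
    have := congrArg Complex.re h; rw [sub_re, hs2, zero_re] at this; linarith
  have h_int : Integrable fun u : ℝ ↦ cexp (-(t * u) * I) * (cexp (-2 * u) * phi w (max u 0)) :=
    (integrable_exp_neg_half_abs.const_mul (3 / ‖w‖ ^ 2)).mono'
      (by refine Continuous.aestronglyMeasurable ?_; fun_prop)
      (Eventually.of_forall fun u ↦ by rw [norm_mul, HasTransform.norm_exp, one_mul]; exact hb u)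
  rw [← setIntegral_eq_integral_of_forall_compl_eq_zero (s := Ioi 0) (fun u hu ↦ by
      rw [max_eq_right (not_lt.mp hu)]; simp [phi])]
  have hder : ∀ u ∈ Ici (0:ℝ), HasDerivAt (fun u : ℝ ↦ (-((u:ℂ) ^ 0 * cexp (-((s - w) * u))) /
      (s - w) + ((u:ℂ) ^ 0 * cexp (-(s * u))) / s + w * (((u:ℂ) ^ 1 * cexp (-(s * u))) / s +
      ((u:ℂ) ^ 0 * cexp (-(s * u))) / s ^ 2)) / w ^ 3)
      (cexp (-(t * u) * I) * (cexp (-2 * u) * phi w (max u 0))) u := by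
    intro u hu
    have hu : 0 ≤ u := hu
    have hid : HasDerivAt (fun u : ℝ ↦ (u : ℂ)) 1 u := ofRealCLM.hasDerivAt
    have he : ∀ z : ℂ, HasDerivAt (fun u : ℝ ↦ cexp (-(z * u))) (cexp (-(z * u)) * (-(z * 1))) u :=
      fun z ↦ (hid.const_mul z).neg.cexp
    have := ((((((hid.pow 0).mul (he (s - w))).neg.div_const (s - w)).add
      (((hid.pow 0).mul (he s)).div_const s)).add (((((hid.pow 1).mul (he s)).div_const s).add
      (((hid.pow 0).mul (he s)).div_const (s ^ 2))).const_mul w)).div_const (w ^ 3))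
    convert! this using 1
    rw [max_eq_left hu, phi, ← mul_assoc, ← Complex.exp_add,
      show -((t:ℂ) * u) * I + -2 * u = -(s * u) by rw [hs]; ring,
      show -((s - w) * (u:ℂ)) = -(s * u) + w * u by ring, Complex.exp_add]
    simp only [Pi.pow_apply]
    field_simp
    ring
  have ht : Tendsto (fun u : ℝ ↦ (-((u:ℂ) ^ 0 * cexp (-((s - w) * u))) /
      (s - w) + ((u:ℂ) ^ 0 * cexp (-(s * u))) / s + w * (((u:ℂ) ^ 1 * cexp (-(s * u))) / s +
      ((u:ℂ) ^ 0 * cexp (-(s * u))) / s ^ 2)) / w ^ 3) atTop (𝓝 0) := by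
    have h1 : 1 ≤ s.re := by rw [hs2]; norm_num
    have h2 : 1 ≤ (s - w).re := by rw [sub_re, hs2]; linarith
    simpa using ((((tendsto_pow_mul_cexp h2 0).neg.div_const (s - w)).add
      ((tendsto_pow_mul_cexp h1 0).div_const s)).add
      ((((tendsto_pow_mul_cexp h1 1).div_const s).add
      ((tendsto_pow_mul_cexp h1 0).div_const (s ^ 2))).const_mul w)).div_const (w ^ 3)
  rw [integral_Ioi_of_hasDerivAt_of_tendsto' hder h_int.integrableOn ht]
  simp only [ofReal_zero, mul_zero, neg_zero, Complex.exp_zero, pow_zero, pow_one]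
  field_simp
  ring

open ArithmeticFunction in
/-- Twice smoothed version of `ψ (exp u)`. -/
noncomputable def psiSm (u : ℝ) : ℝ := ∑' n : ℕ, Λ n * (max (u - Real.log n) 0 ^ 2 / 2)

open ArithmeticFunction in
lemma hasTransform_vonMangoldt :
    ∃ B, HasTransform (fun u ↦ cexp (-2 * u) * psiSm u)
      (fun t ↦ -(deriv riemannZeta (2 + t * I) / riemannZeta (2 + t * I)) / (2 + t * I) ^ 3) B := by
  have h : ∀ n : ℕ, HasTransform
      (fun u ↦ (Λ n : ℂ) * (cexp (-2 * u) * ((max (u - Real.log n) 0 ^ 2 / 2 : ℝ) : ℂ)))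
      (fun t ↦ (Λ n : ℂ) * (cexp (-(Real.log n * (2 + t * I))) / (2 + t * I) ^ 3))
      (‖(Λ n : ℂ)‖ * Real.exp (-(3 / 2 * Real.log n))) := fun n ↦
    (hasTransform_sq (Real.log_natCast_nonneg n)).const_mul _
  have hsum : Summable fun n : ℕ ↦ ‖(Λ n : ℂ)‖ * Real.exp (-(3 / 2 * Real.log n)) := by
    have h1 := LSeriesSummable_vonMangoldt (s := (3 / 2 : ℝ)) (by
      rw [ofReal_re]; norm_num)
    refine h1.norm.congr fun n ↦ ?_
    rcases eq_or_ne n 0 with rfl | hn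
    · simp
    · have hn' : (0:ℝ) < n := by positivity
      rw [LSeries.norm_term_eq, if_neg hn, ofReal_re, Real.rpow_def_of_pos hn', Real.exp_neg,
        mul_comm (Real.log n)]
      rfl
  refine ⟨_, (HasTransform.tsum h hsum).congr (fun u ↦ ?_) (fun t ↦ ?_)⟩
  · rw [psiSm, ofReal_tsum, ← tsum_mul_left]
    congr 1; funext n; push_cast; ring
  · have hs : 1 < ((2 : ℂ) + t * I).re := by simp
    rw [← neg_div, ← LSeries_vonMangoldt_eq_deriv_riemannZeta_div hs, LSeries, ← tsum_div_const]
    congr 1; funext n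
    rcases eq_or_ne n 0 with rfl | hn
    · simp
    · have hn' : (n : ℂ) ≠ 0 := by exact_mod_cast hn
      rw [LSeries.term_of_ne_zero hn, cpow_def_of_ne_zero hn', Complex.exp_neg, natCast_log]
      field_simp

/-- The zeros of `ξ`. -/
def zeroSet : Set ℂ := {ρ | xi ρ = 0}

lemma support_mz (f : ℂ → ℂ) : Function.support (fun ρ ↦ (mz ρ : ℂ) * f ρ) ⊆ zeroSet := by
  intro ρ hρ
  refine xi_zero_of_mz_ne fun h ↦ hρ ?_
  simp [h]

instance : Countable zeroSet := by
  have h := summable_mz_div_sq.countable_support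
  refine (h.mono fun ρ hρ ↦ ?_).to_subtype
  have h1 := one_le_mz hρ
  have h2 := norm_gt_of_xi_zero hρ
  have : 0 < mz ρ / ‖ρ‖ ^ 2 := by positivity
  exact this.ne'

lemma hasTransform_zeros :
    ∃ B, HasTransform (fun u ↦ cexp (-2 * u) * ∑' ρ, (mz ρ : ℂ) * phi ρ (max u 0))
      (fun t ↦ (∑' ρ, (mz ρ : ℂ) * ((2 + t * I - ρ)⁻¹ + ρ⁻¹)) / (2 + t * I) ^ 3) B := by
  have h : ∀ ρ : zeroSet, HasTransform
      (fun u ↦ (mz ρ : ℂ) * (cexp (-2 * u) * phi ρ (max u 0)))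
      (fun t ↦ (mz ρ : ℂ) * (((2 + t * I - ρ)⁻¹ + (ρ : ℂ)⁻¹) / (2 + t * I) ^ 3))
      (‖(mz ρ : ℂ)‖ * (3 / ‖(ρ : ℂ)‖ ^ 2)) := fun ρ ↦
    (hasTransform_phi (xi_zero_re ρ.2).2.le (by linarith [norm_gt_of_xi_zero ρ.2])).const_mul _
  have hsum : Summable fun ρ : zeroSet ↦ ‖(mz ρ : ℂ)‖ * (3 / ‖(ρ : ℂ)‖ ^ 2) := by
    refine ((summable_mz_div_sq.mul_left 3).subtype zeroSet).congr fun ρ ↦ ?_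
    simp only [Function.comp, Complex.norm_real, Real.norm_of_nonneg (mz_nonneg _)]
    ring
  refine ⟨_, (HasTransform.tsum h hsum).congr (fun u ↦ ?_) (fun t ↦ ?_)⟩
  · rw [← tsum_subtype_eq_of_support_subset (support_mz _), ← tsum_mul_left]
    congr 1; funext ρ; ring
  · rw [← tsum_subtype_eq_of_support_subset (support_mz _), ← tsum_div_const]
    congr 1; funext ρ; ring

lemma hasTransform_trivial (k : ℕ) : HasTransform
      (fun u ↦ cexp (-2 * u) * phi (-(2 * (k + 1))) (max u 0))
      (fun t ↦ ((2 + t * I - -(2 * ((k : ℂ) + 1)))⁻¹ + (-(2 * ((k : ℂ) + 1)))⁻¹) / (2 + t * I) ^ 3)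
      (3 / 4 * (1 / ((k : ℝ) + 1) ^ 2)) := by
  have hk : ‖-(2 * ((k : ℂ) + 1))‖ = 2 * (k + 1) := by
    rw [norm_neg, show 2 * ((k : ℂ) + 1) = ((2 * (k + 1) : ℝ) : ℂ) by push_cast; ring,
      Complex.norm_real, Real.norm_of_nonneg (by positivity)]
  have hk0 : (0:ℝ) ≤ k := by positivity
  have := hasTransform_phi (w := -(2 * (k + 1))) (by simp; linarith) (by rw [hk]; linarith)
  rw [hk] at this
  convert! this using 1
  field_simp
  norm_num

lemma hasTransform_trivials :
    ∃ B, HasTransform (fun u ↦ cexp (-2 * u) * ∑' k : ℕ, phi (-(2 * (k + 1))) (max u 0))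
      (fun t ↦ -(digamma ((2 + t * I) / 2 + 1) / 2 + Real.eulerMascheroniConstant / 2) /
        (2 + t * I) ^ 3) B := by
  refine ⟨_, (HasTransform.tsum hasTransform_trivial (summable_one_div_succ_sq.mul_left (3/4))).congr (fun u ↦ ?_) (fun t ↦ ?_)⟩
  · rw [← tsum_mul_left]
  · have hs : 0 < ((2 : ℂ) + t * I).re := by simp
    rw [tsum_div_const, ← (half_digamma_eq hs).tsum_eq, ← tsum_neg]
    congr 1; congr 1; funext k
    rw [sub_neg_eq_add, inv_neg]; ring

/-- The smoothed explicit formula. -/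
lemma psiSm_eq {u : ℝ} (hu : 0 ≤ u) :
    (psiSm u : ℂ) = phi 1 u - ∑' ρ, (mz ρ : ℂ) * phi ρ u - ∑' k : ℕ, phi (-(2 * (k + 1))) u -
      Real.log (2 * Real.pi) * (u ^ 2 / 2) := by
  obtain ⟨B1, h1⟩ := hasTransform_vonMangoldt
  obtain ⟨B2, h2⟩ := hasTransform_zeros
  obtain ⟨B3, h3⟩ := hasTransform_trivials
  have h4 := hasTransform_phi (w := 1) (by simp) (by simp)
  have h5 := hasTransform_sq (a := 0) le_rfl
  have h := (((h1.add h2).add h3).add (h4.const_mul (-1))).add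
    (h5.const_mul (Real.log (2 * Real.pi)))
  have h0 := h.eq_zero (fun t ↦ ?_)
  · have := congrFun h0 u
    simp only [sub_zero, max_eq_left hu, Pi.zero_apply] at this
    have he : cexp (-2 * u) ≠ 0 := Complex.exp_ne_zero _
    have h6 : cexp (-2 * u) * ((psiSm u : ℂ) - (phi 1 u - ∑' ρ, (mz ρ : ℂ) * phi ρ u -
        ∑' k : ℕ, phi (-(2 * (k + 1))) u - Real.log (2 * Real.pi) * (u ^ 2 / 2))) = 0 := by
      rw [← this]; push_cast; ring
    exact sub_eq_zero.mp ((mul_eq_zero.mp h6).resolve_left he)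
  · have hs : 2 ≤ ((2 : ℂ) + t * I).re := by simp
    rw [(hasSum_log_deriv_zeta hs).tsum_eq]
    simp
    ring

lemma summable_mz_phi {u : ℝ} (hu : 0 ≤ u) : Summable fun ρ ↦ (mz ρ : ℂ) * phi ρ u := by
  refine Summable.of_norm_bounded (g := fun ρ ↦ 3 * Real.exp (2 * u) * (mz ρ / ‖ρ‖ ^ 2))
    (summable_mz_div_sq.mul_left _) fun ρ ↦ ?_
  rcases eq_or_ne (xi ρ) 0 with h | h
  · have hb := (hasTransform_phi (xi_zero_re h).2.le (by linarith [norm_gt_of_xi_zero h])).bound u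
    have h1 : Real.exp (-2 * u) * ‖phi ρ u‖ ≤ 3 / ‖ρ‖ ^ 2 := by
      rw [max_eq_left hu, norm_mul, Complex.norm_exp] at hb
      have e : (-2 * (u : ℂ)).re = -2 * u := by simp
      rw [e] at hb
      exact hb.trans (mul_le_of_le_one_right (by positivity)
        (Real.exp_le_one_iff.mpr (by linarith [abs_nonneg u])))
    rw [norm_mul, Complex.norm_real, Real.norm_of_nonneg (mz_nonneg _)]
    have h2 : ‖phi ρ u‖ ≤ Real.exp (2 * u) * (3 / ‖ρ‖ ^ 2) := by
      calc ‖phi ρ u‖ = Real.exp (2 * u) * (Real.exp (-2 * u) * ‖phi ρ u‖) := by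
            rw [← mul_assoc, ← Real.exp_add]; simp
        _ ≤ _ := by gcongr
    calc _ ≤ mz ρ * (Real.exp (2 * u) * (3 / ‖ρ‖ ^ 2)) :=
          mul_le_mul_of_nonneg_left h2 (mz_nonneg _)
      _ = _ := by ring
  · simp [mz_eq_zero h]

lemma summable_phi_trivial {u : ℝ} (hu : 0 ≤ u) :
    Summable fun k : ℕ ↦ phi (-(2 * (k + 1))) u := by
  have h : Summable fun k : ℕ ↦ cexp (-2 * u) * phi (-(2 * (k + 1))) (max u 0) := by
    refine Summable.of_norm_bounded (summable_one_div_succ_sq.mul_left (3/4)) fun k ↦ ?_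
    refine ((hasTransform_trivial k).bound u).trans (mul_le_of_le_one_right (by positivity)
        (Real.exp_le_one_iff.mpr (by linarith [abs_nonneg u])))
  rw [max_eq_left hu] at h
  exact (summable_mul_left_iff (Complex.exp_ne_zero _)).mp h

lemma norm_one_sub_exp_neg_le {w : ℂ} (hw : 0 ≤ w.re) : ‖1 - cexp (-w)‖ ≤ ‖w‖ := by
  have h := (convex_halfSpace_re_ge 0).norm_image_sub_le_of_norm_hasDerivWithin_le
    (f := fun z ↦ -cexp (-z)) (f' := fun z ↦ cexp (-z)) (C := 1) (x := 0) (y := w)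
    (fun z _ ↦ by
      have := ((hasDerivAt_neg z).cexp).neg
      rw [mul_neg_one, neg_neg] at this
      exact this.hasDerivWithinAt)
    (fun z hz ↦ by
      rw [Complex.norm_exp]; exact Real.exp_le_one_iff.mpr (by simpa using hz)) (by simp) hw
  simp only [neg_zero, Complex.exp_zero, sub_zero, one_mul] at h
  rwa [show -cexp (-w) - -1 = 1 - cexp (-w) by ring] at h

/-- The weight with which a zero of absolute value `r` enters the smoothed explicit formula. -/
noncomputable def wt (T r : ℝ) : ℝ := min 1 ((T / r) ^ 2) / r

lemma wt_nonneg {T r : ℝ} (hr : 0 ≤ r) : 0 ≤ wt T r := by unfold wt; positivity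

lemma wt_le_one_div {T r : ℝ} (hr : 0 ≤ r) : wt T r ≤ 1 / r := by
  unfold wt; gcongr; exact min_le_left _ _

lemma wt_le_sq {T r : ℝ} (hr : 0 ≤ r) : wt T r ≤ T ^ 2 / r ^ 3 := by
  unfold wt
  calc _ ≤ (T / r) ^ 2 / r := by gcongr; exact min_le_right _ _
    _ = _ := by rcases hr.eq_or_lt with rfl | h <;> field_simp

/-- The contribution of the zeros to the smoothed explicit formula. -/
noncomputable def zeroSum (T y : ℝ) : ℝ := ∑' ρ, mz ρ * (Real.exp (ρ.re * y) * wt T ‖ρ‖)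

lemma summable_zeroSum (T : ℝ) {y : ℝ} (hy : 0 ≤ y) :
    Summable fun ρ ↦ mz ρ * (Real.exp (ρ.re * y) * wt T ‖ρ‖) := by
  refine Summable.of_nonneg_of_le (fun ρ ↦ by
    have := mz_nonneg ρ
    have := wt_nonneg (T := T) (norm_nonneg ρ)
    positivity) (fun ρ ↦ ?_) (summable_mz_div_sq.mul_left (Real.exp y * T ^ 2))
  rcases eq_or_ne (xi ρ) 0 with h | h
  · have h1 := norm_gt_of_xi_zero h
    have h2 : wt T ‖ρ‖ ≤ T ^ 2 / ‖ρ‖ ^ 2 := (wt_le_sq (norm_nonneg ρ)).trans (by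
      gcongr
      · linarith
      · norm_num)
    have h3 : Real.exp (ρ.re * y) ≤ Real.exp y := Real.exp_le_exp.mpr (by
      nlinarith [(xi_zero_re h).2])
    calc _ ≤ mz ρ * (Real.exp y * (T ^ 2 / ‖ρ‖ ^ 2)) :=
          mul_le_mul_of_nonneg_left (mul_le_mul h3 h2 (wt_nonneg (norm_nonneg _))
            (Real.exp_pos _).le) (mz_nonneg ρ)
      _ = _ := by ring
  · simp [mz_eq_zero h]

lemma phi_second_difference (w : ℂ) (v h : ℝ) :
    phi w (v + 2 * h) - 2 * phi w (v + h) + phi w v =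
      cexp (w * (v + 2 * h : ℝ)) * (1 - cexp (-(w * h))) ^ 2 / w ^ 3 := by
  have e1 : cexp (w * (v + h : ℝ)) = cexp (w * (v + 2 * h : ℝ)) * cexp (-(w * h)) := by
    rw [← Complex.exp_add]; congr 1; push_cast; ring
  have e2 : cexp (w * v) = cexp (w * (v + 2 * h : ℝ)) * cexp (-(w * h)) ^ 2 := by
    rw [← Complex.exp_nat_mul, ← Complex.exp_add]; congr 1; push_cast; ring
  unfold phi
  rw [e1, e2]
  push_cast
  ring

lemma norm_zero_term_le {ρ : ℂ} (hρ : xi ρ = 0) {h : ℝ} (hh : 0 < h) (y : ℝ) :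
    ‖cexp (ρ * y) * (1 - cexp (-(ρ * h))) ^ 2 / ρ ^ 3‖ ≤
      h ^ 2 * (Real.exp (ρ.re * y) * wt (2 / h) ‖ρ‖) := by
  have h1 := norm_gt_of_xi_zero hρ
  have hre : 0 ≤ (ρ * h).re := by
    rw [re_mul_ofReal]; exact mul_nonneg (xi_zero_re hρ).1.le hh.le
  have h2 : ‖1 - cexp (-(ρ * h))‖ ≤ ‖ρ‖ * h := by
    refine (norm_one_sub_exp_neg_le hre).trans ?_
    rw [norm_mul, Complex.norm_real, Real.norm_of_nonneg hh.le]
  have h3 : ‖1 - cexp (-(ρ * h))‖ ≤ 2 := by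
    refine (norm_sub_le _ _).trans ?_
    rw [norm_one, Complex.norm_exp]
    have : Real.exp (-(ρ * h)).re ≤ 1 := Real.exp_le_one_iff.mpr (by rw [neg_re]; linarith)
    linarith
  have hp : 0 < ‖ρ‖ := by linarith
  have h4 : ‖1 - cexp (-(ρ * h))‖ ^ 2 / ‖ρ‖ ^ 3 ≤ h ^ 2 * wt (2 / h) ‖ρ‖ := by
    unfold wt
    rw [show ‖1 - cexp (-(ρ * h))‖ ^ 2 / ‖ρ‖ ^ 3 =
      h ^ 2 * ((‖1 - cexp (-(ρ * h))‖ / (‖ρ‖ * h)) ^ 2 / ‖ρ‖) by field_simp]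
    gcongr
    apply le_min
    · have : ‖1 - cexp (-(ρ * h))‖ / (‖ρ‖ * h) ≤ 1 := by rw [div_le_one (by positivity)]; exact h2
      exact pow_le_one₀ (by positivity) this
    · rw [div_div, mul_comm h]; gcongr
  rw [norm_div, norm_mul, norm_pow, norm_pow, Complex.norm_exp, re_mul_ofReal]
  calc _ = Real.exp (ρ.re * y) * (‖1 - cexp (-(ρ * h))‖ ^ 2 / ‖ρ‖ ^ 3) := by ring
    _ ≤ Real.exp (ρ.re * y) * (h ^ 2 * wt (2 / h) ‖ρ‖) := by gcongr
    _ = _ := by ring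

/-- The contribution of the trivial zeros to the smoothed explicit formula. -/
noncomputable def trivSum (y h : ℝ) : ℝ :=
  ∑' k : ℕ, Real.exp (-(2 * (k + 1)) * y) * (1 - Real.exp (2 * (k + 1) * h)) ^ 2 /
    (2 * (k + 1)) ^ 3

lemma trivSum_nonneg (y h : ℝ) : 0 ≤ trivSum y h := tsum_nonneg fun k ↦ by positivity

lemma trivSum_le {v h : ℝ} (hv : 1 ≤ v) (hh : 0 < h) : trivSum (v + 2 * h) h ≤ h ^ 2 := by
  have hb : ∀ k : ℕ, Real.exp (-(2 * (k + 1)) * (v + 2 * h)) *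
      (1 - Real.exp (2 * (k + 1) * h)) ^ 2 / (2 * (k + 1)) ^ 3 ≤ h ^ 2 * (1 / 2) * (1 / 2) ^ k := by
    intro k
    have hk : (0:ℝ) ≤ k := by positivity
    set x : ℝ := 2 * (k + 1) * h with hx
    have hx0 : 0 < x := by positivity
    have e1 : Real.exp (-(2 * (k + 1)) * (v + 2 * h)) * (1 - Real.exp x) ^ 2 =
        Real.exp (-(2 * (k + 1)) * v) * (1 - Real.exp (-x)) ^ 2 := by
      rw [show -(2 * ((k:ℝ) + 1)) * (v + 2 * h) = -(2 * (k + 1)) * v + (-x) + (-x) by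
        rw [hx]; ring, Real.exp_add, Real.exp_add]
      have : Real.exp (-x) * Real.exp x = 1 := by rw [← Real.exp_add]; simp
      linear_combination Real.exp (-(2 * ((k:ℝ) + 1)) * v) *
        (Real.exp (-x) * Real.exp x - 2 * Real.exp (-x) + 1) * this
    have h1 : (1 - Real.exp (-x)) ^ 2 ≤ x ^ 2 := by
      have := Real.add_one_le_exp (-x)
      have := Real.exp_le_one_iff.mpr (show -x ≤ 0 by linarith)
      apply pow_le_pow_left₀ <;> linarith
    have h2 : Real.exp (-(2 * (k + 1)) * v) ≤ (1 / 2) ^ (k + 1) := by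
      have : Real.exp (-(2 * (k + 1)) * v) ≤ Real.exp ((k + 1 : ℕ) * (-1)) := by
        apply Real.exp_le_exp.mpr; push_cast; nlinarith
      refine this.trans ?_
      rw [Real.exp_nat_mul]
      gcongr
      have := Real.exp_neg_one_lt_half
      linarith
    rw [e1]
    calc _ ≤ (1 / 2) ^ (k + 1) * x ^ 2 / (2 * (k + 1)) ^ 3 := by gcongr
      _ = (1/2) ^ (k + 1) * (h ^ 2 * (1 / (2 * (k + 1)))) := by rw [hx]; field_simp
      _ ≤ (1/2) ^ (k + 1) * (h ^ 2 * 1) := by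
        gcongr; rw [div_le_one (by positivity)]; linarith
      _ = _ := by ring
  have hs := (hasSum_geometric_two.mul_left (h ^ 2 * (1 / 2)))
  refine (Summable.tsum_le_tsum hb (Summable.of_nonneg_of_le (fun k ↦ by positivity) hb hs.summable)
    hs.summable).trans (le_of_eq ?_)
  rw [hs.tsum_eq]; ring

lemma psiSm_second_difference {v h : ℝ} (hv : 0 ≤ v) (hh : 0 < h) :
    |psiSm (v + 2 * h) - 2 * psiSm (v + h) + psiSm v -
      (Real.exp (v + 2 * h) * (1 - Real.exp (-h)) ^ 2 + trivSum (v + 2 * h) h -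
        Real.log (2 * Real.pi) * h ^ 2)| ≤ h ^ 2 * zeroSum (2 / h) (v + 2 * h) := by
  have e0 := psiSm_eq hv
  have e1 := psiSm_eq (u := v + h) (by linarith)
  have e2 := psiSm_eq (u := v + 2 * h) (by linarith)
  have s0 := summable_mz_phi hv
  have s1 := summable_mz_phi (u := v + h) (by linarith)
  have s2 := summable_mz_phi (u := v + 2 * h) (by linarith)
  have t0 := summable_phi_trivial hv
  have t1 := summable_phi_trivial (u := v + h) (by linarith)
  have t2 := summable_phi_trivial (u := v + 2 * h) (by linarith)
  have hz := ((s2.hasSum.sub (s1.hasSum.mul_left 2)).add s0.hasSum)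
  have htr := ((t2.hasSum.sub (t1.hasSum.mul_left 2)).add t0.hasSum)
  have hz' : (fun ρ ↦ (mz ρ : ℂ) * phi ρ (v + 2 * h) - 2 * ((mz ρ : ℂ) * phi ρ (v + h)) +
      (mz ρ : ℂ) * phi ρ v) = fun ρ ↦ (mz ρ : ℂ) *
        (cexp (ρ * (v + 2 * h : ℝ)) * (1 - cexp (-(ρ * h))) ^ 2 / ρ ^ 3) := by
    funext ρ; rw [← phi_second_difference]; ring
  have htr' : (fun k : ℕ ↦ phi (-(2 * (k + 1))) (v + 2 * h) -
      2 * phi (-(2 * (k + 1))) (v + h) + phi (-(2 * (k + 1))) v) = fun k : ℕ ↦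
        -((Real.exp (-(2 * (k + 1)) * (v + 2 * h)) * (1 - Real.exp (2 * (k + 1) * h)) ^ 2 /
    (2 * (k + 1)) ^ 3 : ℝ) : ℂ) := by
    funext k; rw [phi_second_difference]
    push_cast
    rw [neg_pow (2 * ((k : ℂ) + 1)), show -(-(2 * ((k : ℂ) + 1)) * (h:ℂ)) = 2 * (k + 1) * h by ring]
    have : (2 * ((k : ℂ) + 1)) ≠ 0 := by
      have := Nat.cast_add_one_ne_zero (R := ℂ) k
      simpa using this
    field_simp
  rw [hz'] at hz
  rw [htr'] at htr
  have htr2 := htr.tsum_eq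
  rw [tsum_neg, ← ofReal_tsum] at htr2
  change -(trivSum (v + 2 * h) h : ℂ) = _ at htr2
  have hb : ∀ ρ, ‖(mz ρ : ℂ) *
        (cexp (ρ * (v + 2 * h : ℝ)) * (1 - cexp (-(ρ * h))) ^ 2 / ρ ^ 3)‖ ≤
        h ^ 2 * (mz ρ * (Real.exp (ρ.re * (v + 2 * h)) * wt (2 / h) ‖ρ‖)) := by
    intro ρ
    rcases eq_or_ne (xi ρ) 0 with h0 | h0
    · rw [norm_mul, Complex.norm_real, Real.norm_of_nonneg (mz_nonneg _)]
      calc _ ≤ mz ρ * (h ^ 2 * (Real.exp (ρ.re * (v + 2 * h)) * wt (2 / h) ‖ρ‖)) :=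
            mul_le_mul_of_nonneg_left (norm_zero_term_le h0 hh _) (mz_nonneg _)
        _ = _ := by ring
    · simp [mz_eq_zero h0]
  have hnorm := tsum_of_norm_bounded
    ((summable_zeroSum (2 / h) (y := v + 2 * h) (by linarith)).hasSum.mul_left (h ^ 2)) hb
  rw [hz.tsum_eq] at hnorm
  rw [← Real.norm_eq_abs, ← Complex.norm_real]
  refine le_of_eq_of_le ?_ hnorm
  rw [← norm_neg]
  congr 1
  have hphi := phi_second_difference 1 v h
  push_cast at e0 e1 e2 hphi ⊢
  rw [e0, e1, e2]
  simp only [one_mul, one_pow, div_one] at hphi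
  linear_combination (-1 : ℂ) * hphi - htr2

/-- The second difference with step `h` of `u ↦ max (u - a) 0 ^ 2 / 2`. -/
noncomputable def bump (a v h : ℝ) : ℝ :=
  max (v + 2 * h - a) 0 ^ 2 / 2 - 2 * (max (v + h - a) 0 ^ 2 / 2) + max (v - a) 0 ^ 2 / 2

lemma bump_nonneg {a v h : ℝ} (hh : 0 < h) : 0 ≤ bump a v h := by
  unfold bump
  rcases max_cases (v + 2 * h - a) 0 with ⟨h1, h1'⟩ | ⟨h1, h1'⟩ <;>
  rcases max_cases (v + h - a) 0 with ⟨h2, h2'⟩ | ⟨h2, h2'⟩ <;>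
  rcases max_cases (v - a) 0 with ⟨h3, h3'⟩ | ⟨h3, h3'⟩ <;> rw [h1, h2, h3] <;> nlinarith

lemma bump_le {a v h : ℝ} (hh : 0 < h) : bump a v h ≤ h ^ 2 := by
  unfold bump
  rcases max_cases (v + 2 * h - a) 0 with ⟨h1, h1'⟩ | ⟨h1, h1'⟩ <;>
  rcases max_cases (v + h - a) 0 with ⟨h2, h2'⟩ | ⟨h2, h2'⟩ <;>
  rcases max_cases (v - a) 0 with ⟨h3, h3'⟩ | ⟨h3, h3'⟩ <;> rw [h1, h2, h3] <;> nlinarith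

lemma bump_eq {a v h : ℝ} (hh : 0 < h) (ha : a ≤ v) : bump a v h = h ^ 2 := by
  unfold bump
  rw [max_eq_left (by linarith), max_eq_left (by linarith), max_eq_left (by linarith)]
  ring

lemma bump_eq_zero {a v h : ℝ} (hh : 0 < h) (ha : v + 2 * h ≤ a) : bump a v h = 0 := by
  unfold bump
  rw [max_eq_right (by linarith), max_eq_right (by linarith), max_eq_right (by linarith)]
  ring

open ArithmeticFunction in
lemma psiSm_eq_sum {u : ℝ} {N : ℕ} (hN : Real.exp u ≤ N) :
    psiSm u = ∑ n ∈ Finset.Ioc 0 N, Λ n * (max (u - Real.log n) 0 ^ 2 / 2) := by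
  rw [psiSm, tsum_eq_sum]
  intro n hn
  rcases Nat.eq_zero_or_pos n with rfl | hn0
  · simp
  have h1 : N < n := by
    by_contra h
    exact hn (Finset.mem_Ioc.mpr ⟨hn0, not_lt.mp h⟩)
  have h2 : u ≤ Real.log n := by
    rw [Real.le_log_iff_exp_le (by positivity)]
    exact hN.trans (by exact_mod_cast h1.le)
  rw [max_eq_right (by linarith)]; simp

open ArithmeticFunction in
lemma psi_le_psiSm {v h : ℝ} (hh : 0 < h) :
    h ^ 2 * Chebyshev.psi (Real.exp v) ≤ psiSm (v + 2 * h) - 2 * psiSm (v + h) + psiSm v ∧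
    psiSm (v + 2 * h) - 2 * psiSm (v + h) + psiSm v ≤
      h ^ 2 * Chebyshev.psi (Real.exp (v + 2 * h)) := by
  obtain ⟨N, hN⟩ := exists_nat_ge (Real.exp (v + 2 * h))
  have e1 := psiSm_eq_sum hN
  have e2 := psiSm_eq_sum (u := v + h) ((Real.exp_le_exp.mpr (by linarith)).trans hN)
  have hN0 := (Real.exp_le_exp.mpr (show v ≤ v + 2 * h by linarith)).trans hN
  have e3 := psiSm_eq_sum (u := v) hN0
  have e : psiSm (v + 2 * h) - 2 * psiSm (v + h) + psiSm v =
      ∑ n ∈ Finset.Ioc 0 N, Λ n * bump (Real.log n) v h := by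
    rw [e1, e2, e3, Finset.mul_sum, ← Finset.sum_sub_distrib, ← Finset.sum_add_distrib]
    refine Finset.sum_congr rfl fun n _ ↦ ?_
    unfold bump; ring
  rw [e, Chebyshev.psi, Chebyshev.psi, Finset.mul_sum, Finset.mul_sum]
  have hsub : ∀ {x : ℝ}, x ≤ N → Finset.Ioc 0 ⌊x⌋₊ ⊆ Finset.Ioc 0 N := fun hx ↦
    Finset.Ioc_subset_Ioc_right (Nat.floor_le_of_le hx)
  constructor
  · refine (Finset.sum_le_sum fun n hn ↦ ?_).trans (Finset.sum_le_sum_of_subset_of_nonneg (hsub hN0)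
      fun n _ _ ↦ mul_nonneg vonMangoldt_nonneg (bump_nonneg hh))
    rw [Finset.mem_Ioc] at hn
    have : Real.log n ≤ v := by
      rw [Real.log_le_iff_le_exp (by exact_mod_cast hn.1)]
      exact (Nat.le_floor_iff (Real.exp_pos _).le).mp hn.2
    rw [bump_eq hh this, mul_comm]
  · rw [← Finset.sum_subset (hsub hN)]
    · refine Finset.sum_le_sum fun n _ ↦ ?_
      rw [mul_comm]
      exact mul_le_mul_of_nonneg_right (bump_le hh) vonMangoldt_nonneg
    · intro n hn hn'
      rw [Finset.mem_Ioc] at hn hn'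
      have h1 : ⌊Real.exp (v + 2 * h)⌋₊ < n := by
        by_contra h'; exact hn' ⟨hn.1, not_lt.mp h'⟩
      rw [bump_eq_zero hh, mul_zero]
      rw [Real.le_log_iff_exp_le (by exact_mod_cast hn.1)]
      exact (Nat.lt_of_floor_lt h1).le

lemma psi_le_add_zeroSum {u h : ℝ} (hu : 1 ≤ u) (hh : 0 < h) :
    Chebyshev.psi (Real.exp u) ≤
      Real.exp (u + 2 * h) * ((1 - Real.exp (-h)) / h) ^ 2 + zeroSum (2 / h) (u + 2 * h) := by
  have h1 := (psi_le_psiSm (v := u) hh).1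
  have h2 := (abs_le.mp (psiSm_second_difference (v := u) (by linarith) hh)).2
  have h3 := trivSum_le hu hh
  have h4 : 1 ≤ Real.log (2 * Real.pi) := by
    rw [Real.le_log_iff_exp_le (by positivity)]
    linarith [Real.exp_one_lt_d9, Real.pi_gt_three]
  have h5 : 0 < h ^ 2 := by positivity
  rw [← mul_le_mul_iff_right₀ h5]
  have : h ^ 2 * (Real.exp (u + 2 * h) * ((1 - Real.exp (-h)) / h) ^ 2 +
      zeroSum (2 / h) (u + 2 * h)) = Real.exp (u + 2 * h) * (1 - Real.exp (-h)) ^ 2 +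
      h ^ 2 * zeroSum (2 / h) (u + 2 * h) := by field_simp
  rw [this]
  nlinarith

lemma sub_zeroSum_le_psi {u h : ℝ} (hh : 0 < h) (hu : 2 * h ≤ u) :
    Real.exp u * ((1 - Real.exp (-h)) / h) ^ 2 - zeroSum (2 / h) u - 2 ≤
      Chebyshev.psi (Real.exp u) := by
  have h1 := (psi_le_psiSm (v := u - 2 * h) hh).2
  have h2 := (abs_le.mp (psiSm_second_difference (v := u - 2 * h) (by linarith) hh)).1
  rw [sub_add_cancel] at h1 h2
  have h3 := trivSum_nonneg u h
  have h4 : Real.log (2 * Real.pi) ≤ 2 := by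
    rw [Real.log_le_iff_le_exp (by positivity)]
    have : (Real.exp 2) = Real.exp 1 ^ 2 := by rw [← Real.exp_nat_mul]; norm_num
    nlinarith [Real.exp_one_gt_d9, Real.pi_lt_d2]
  have h5 : 0 < h ^ 2 := by positivity
  rw [← mul_le_mul_iff_right₀ h5]
  have : h ^ 2 * (Real.exp u * ((1 - Real.exp (-h)) / h) ^ 2 - zeroSum (2 / h) u - 2) =
      Real.exp u * (1 - Real.exp (-h)) ^ 2 - h ^ 2 * zeroSum (2 / h) u - 2 * h ^ 2 := by field_simp
  rw [this]
  nlinarith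

/-- The joint contribution of zeros `β + iγ` and `1 - β + iγ` to the real part of `ξ'/ξ` at
`σ + it`, where `η = γ - t`. -/
noncomputable def pairTerm (σ β η : ℝ) : ℝ :=
  (σ - β) / ((σ - β) ^ 2 + η ^ 2) + (σ - 1 + β) / ((σ - 1 + β) ^ 2 + η ^ 2)

lemma pairTerm_nonneg {σ β η : ℝ} (hσ : 1 ≤ σ) (h0 : 0 < β) (h1 : β < 1) :
    0 ≤ pairTerm σ β η := by
  unfold pairTerm
  have : 0 < σ - β := by linarith
  have : 0 < σ - 1 + β := by linarith
  positivity

lemma pairTerm_eq {σ β η : ℝ} (hσ : 1 ≤ σ) (h0 : 0 < β) (h1 : β < 1) :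
    pairTerm σ β η = (2 * σ - 1) * ((σ ^ 2 - σ + β * (1 - β)) + η ^ 2) /
      ((σ ^ 2 - σ + β * (1 - β)) ^ 2 +
        η ^ 2 * ((2 * σ - 1) ^ 2 - 2 * (σ ^ 2 - σ + β * (1 - β))) + (η ^ 2) ^ 2) := by
  have a1 : 0 < σ - β := by linarith
  have a2 : 0 < σ - 1 + β := by linarith
  have b1 : 0 < (σ - β) ^ 2 + η ^ 2 := by positivity
  have b2 : 0 < (σ - 1 + β) ^ 2 + η ^ 2 := by positivity
  have : (σ ^ 2 - σ + β * (1 - β)) ^ 2 +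
        η ^ 2 * ((2 * σ - 1) ^ 2 - 2 * (σ ^ 2 - σ + β * (1 - β))) + (η ^ 2) ^ 2 =
      ((σ - β) ^ 2 + η ^ 2) * ((σ - 1 + β) ^ 2 + η ^ 2) := by ring
  rw [this, pairTerm]
  field_simp
  ring

lemma stechkin {s β : ℝ} (η : ℝ) (hs : 0 ≤ s) (hs1 : s ≤ 1 / 10) (h0 : 0 < β) (h1 : β < 1) :
    0.447 * pairTerm 1.618 β η ≤ pairTerm (1 + s) β η := by
  rw [pairTerm_eq (by norm_num) h0 h1, pairTerm_eq (by linarith) h0 h1]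
  have hq : 0 < β * (1 - β) := mul_pos h0 (by linarith)
  have hq1 : β * (1 - β) ≤ 1 / 4 := by nlinarith [sq_nonneg (β - 1 / 2)]
  generalize β * (1 - β) = q at *
  have hE : 0 ≤ η ^ 2 := sq_nonneg _
  generalize η ^ 2 = E at *
  obtain ⟨P, hP⟩ : ∃ P, P = (1 + s) ^ 2 - (1 + s) + q := ⟨_, rfl⟩
  rw [← hP]
  have hP0 : s + q ≤ P := by nlinarith
  have hP2 : P ≤ 1.1 * s + q := by nlinarith
  have d1 : 0 < ((1.618:ℝ) ^ 2 - 1.618 + q) ^ 2 +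
      E * ((2 * 1.618 - 1) ^ 2 - 2 * (1.618 ^ 2 - 1.618 + q)) + E ^ 2 := by
    have : 0 ≤ ((2 * 1.618 - 1) ^ 2 - 2 * (1.618 ^ 2 - 1.618 + q)) := by norm_num; linarith
    have : 0 < (1.618:ℝ) ^ 2 - 1.618 + q := by norm_num; linarith
    positivity
  have d2 : 0 < P ^ 2 + E * ((2 * (1 + s) - 1) ^ 2 - 2 * P) + E ^ 2 := by
    have : 0 ≤ (2 * (1 + s) - 1) ^ 2 - 2 * P := by nlinarith
    have : 0 < P := by linarith
    positivity
  rw [← mul_div_assoc, div_le_div_iff₀ d1 d2]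
  have c1 : 0 ≤ E * ((1 + 2 * s) * ((0.999924 + q) ^ 2 + P * (2.999848 - 2 * q)) -
      0.999492 * (P ^ 2 + (0.999924 + q) * ((1 + 2 * s) ^ 2 - 2 * P))) := by
    refine mul_nonneg hE ?_
    nlinarith [mul_nonneg hs hq.le, mul_nonneg hs hs, mul_nonneg (mul_nonneg hs hs) hq.le,
      mul_nonneg hs (sub_nonneg.mpr hs1), mul_nonneg hq.le (sub_nonneg.mpr hq1),
      mul_nonneg hs (sub_nonneg.mpr hP0), mul_nonneg hs (sub_nonneg.mpr hP2),
      mul_nonneg hq.le (sub_nonneg.mpr hP0), mul_nonneg hq.le (sub_nonneg.mpr hP2),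
      mul_nonneg (mul_nonneg hs hq.le) (sub_nonneg.mpr hP0)]
  have c2 : 0 ≤ E ^ 2 * ((1 + 2 * s) * (2.999848 - 2 * q + P) -
      0.999492 * ((1 + 2 * s) ^ 2 - 2 * P + (0.999924 + q))) := by
    refine mul_nonneg (sq_nonneg _) ?_
    nlinarith
  have c3 : 0 ≤ E ^ 3 * ((1 + 2 * s) - 0.999492) := mul_nonneg (by positivity) (by linarith)
  have c0 : 0 ≤ P * (0.999924 + q) * ((1 + 2 * s) * (0.999924 + q) - 0.999492 * P) := by
    refine mul_nonneg (mul_nonneg (by linarith) (by linarith)) ?_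
    nlinarith
  nlinarith

lemma pairTerm_zero_ge {s β : ℝ} (hs : 0 < s) (hs1 : s ≤ 1 / 10) (h0 : 1 / 2 ≤ β) (h1 : β < 1) :
    1 / (1 + s - β) + 1 / (s + β) - 1 ≤ pairTerm (1 + s) β 0 - 0.447 * pairTerm 1.618 β 0 := by
  have e (σ : ℝ) (hσ : 1 ≤ σ) : pairTerm σ β 0 = 1 / (σ - β) + 1 / (σ - 1 + β) := by
    have a1 : σ - β ≠ 0 := by linarith
    have a2 : σ - 1 + β ≠ 0 := by linarith
    unfold pairTerm
    field_simp
    ring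
  rw [e _ (by linarith), e _ (by norm_num)]
  have h3 : 0.447 * (1 / (1.618 - β) + 1 / (1.618 - 1 + β)) ≤ 1 := by
    rw [div_add_div _ _ (by linarith) (by linarith), ← mul_div_assoc,
      div_le_iff₀ (mul_pos (by linarith) (by linarith))]
    nlinarith [mul_nonneg (sub_nonneg.mpr h0) (sub_nonneg.mpr h1.le)]
  rw [show 1 + s - 1 + β = s + β by ring]
  linarith

lemma hasSum_pairTerm {σ : ℝ} (hσ : 1 ≤ σ) (t : ℝ) :
    HasSum (fun ρ : ℂ ↦ mz ρ * (pairTerm σ ρ.re (ρ.im - t) / 2)) (logDeriv xi (σ + t * I)).re := by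
  have h := hasSum_re_logDeriv_xi (s := σ + t * I) (by simpa using hσ)
  have e : (fun ρ : ℂ ↦ 1 - conj ρ) ∘ (fun ρ : ℂ ↦ 1 - conj ρ) = id := by funext ρ; simp
  let eq : ℂ ≃ ℂ := ⟨fun ρ ↦ 1 - conj ρ, fun ρ ↦ 1 - conj ρ, congrFun e, congrFun e⟩
  have h' := (eq.hasSum_iff).mpr h
  have h2 := (h.add h').div_const 2
  rw [add_self_div_two] at h2
  refine h2.congr_fun ?_ |> id
  intro ρ
  have : mz (eq ρ) = mz ρ := by
    change mz (1 - conj ρ) = _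
    rw [mz_one_sub, mz_conj]
  simp only [Function.comp_apply, this, re_inv_sub, pairTerm]
  simp only [eq, Equiv.coe_fn_mk, add_re, ofReal_re, mul_re, I_re, mul_zero, ofReal_im, I_im,
    mul_one, sub_self, add_zero, add_im, mul_im, zero_add, sub_re, one_re, conj_re, sub_im, one_im,
    conj_im]
  ring_nf

open ArithmeticFunction in
lemma hasSum_vonMangoldt_cos {σ : ℝ} (hσ : 1 < σ) (t : ℝ) :
    HasSum (fun n : ℕ ↦ Λ n * (Real.exp (-(σ * Real.log n)) * Real.cos (t * Real.log n)))
      (-(deriv riemannZeta (σ + t * I) / riemannZeta (σ + t * I))).re := by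
  have hs : 1 < ((σ : ℂ) + t * I).re := by simpa using hσ
  have h := (LSeriesSummable_vonMangoldt hs).LSeriesHasSum
  rw [LSeries_vonMangoldt_eq_deriv_riemannZeta_div hs, neg_div] at h
  refine (reCLM.hasSum h).congr_fun ?_ |> id
  intro n
  rcases eq_or_ne n 0 with rfl | hn
  · simp
  have hn' : (n : ℂ) ≠ 0 := by exact_mod_cast hn
  simp only [reCLM_apply]
  rw [LSeries.term_of_ne_zero hn, cpow_def_of_ne_zero hn', div_eq_mul_inv, ← Complex.exp_neg,
    re_ofReal_mul, ← natCast_log]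
  rw [exp_re]
  simp only [neg_re, neg_im, add_re, add_im, ofReal_re, ofReal_im,
    mul_re, mul_im, I_re, I_im, mul_zero, mul_one, sub_self, add_zero, zero_add]
  rw [Real.cos_neg, mul_comm σ, mul_comm t]
  simp only [zero_mul, sub_zero, add_zero]

open ArithmeticFunction in
/-- Stechkin's combination of values of `-ζ'/ζ`. -/
noncomputable def stech (s t : ℝ) : ℝ :=
  ∑' n : ℕ, Λ n * ((Real.exp (-((1 + s) * Real.log n)) -
    0.447 * Real.exp (-(1.618 * Real.log n))) * Real.cos (t * Real.log n))

open ArithmeticFunction in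
lemma hasSum_stech {s : ℝ} (hs : 0 < s) (t : ℝ) :
    HasSum (fun n : ℕ ↦ Λ n * ((Real.exp (-((1 + s) * Real.log n)) -
    0.447 * Real.exp (-(1.618 * Real.log n))) * Real.cos (t * Real.log n))) (stech s t) ∧
    stech s t = (-(deriv riemannZeta ((1 + s : ℝ) + t * I) / riemannZeta ((1 + s : ℝ) + t * I))).re
      - 0.447 * (-(deriv riemannZeta ((1.618 : ℝ) + t * I) /
        riemannZeta ((1.618 : ℝ) + t * I))).re := by
  have h := (hasSum_vonMangoldt_cos (σ := 1 + s) (by linarith) t).sub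
    ((hasSum_vonMangoldt_cos (σ := 1.618) (by norm_num) t).mul_left 0.447)
  have h' : HasSum (fun n : ℕ ↦ Λ n * ((Real.exp (-((1 + s) * Real.log n)) -
    0.447 * Real.exp (-(1.618 * Real.log n))) * Real.cos (t * Real.log n))) _ :=
    h.congr_fun fun n ↦ by ring
  exact ⟨h'.summable.hasSum, h'.tsum_eq⟩

open ArithmeticFunction in
lemma stech_sum_nonneg {s : ℝ} (hs : 0 < s) (hs1 : s ≤ 1 / 10) (Γ : Finset ℝ) (a : ℝ) :
    0 ≤ a ^ 2 * stech s 0 + 4 * a * ∑ γ ∈ Γ, stech s γ +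
      2 * ∑ γ ∈ Γ, ∑ γ' ∈ Γ, (stech s (γ - γ') + stech s (γ + γ')) := by
  have h1 := (hasSum_stech hs 0).1.mul_left (a ^ 2)
  have h2 := (hasSum_sum (s := Γ) fun γ _ ↦ (hasSum_stech hs γ).1).mul_left (4 * a)
  have h3 := (hasSum_sum (s := Γ) fun γ _ ↦ hasSum_sum (s := Γ) fun γ' _ ↦
    (hasSum_stech hs (γ - γ')).1.add (hasSum_stech hs (γ + γ')).1).mul_left 2
  refine ((h1.add h2).add h3).nonneg fun n ↦ ?_
  set θ := Real.log n with hθ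
  have key : a ^ 2 * (Real.cos (0 * θ)) + 4 * a * ∑ γ ∈ Γ, Real.cos (γ * θ) +
      2 * ∑ γ ∈ Γ, ∑ γ' ∈ Γ, (Real.cos ((γ - γ') * θ) + Real.cos ((γ + γ') * θ)) =
      (a + 2 * ∑ γ ∈ Γ, Real.cos (γ * θ)) ^ 2 := by
    have : ∀ γ γ' : ℝ, Real.cos ((γ - γ') * θ) + Real.cos ((γ + γ') * θ) =
        2 * (Real.cos (γ * θ) * Real.cos (γ' * θ)) := fun γ γ' ↦ by
      rw [sub_mul, add_mul, Real.cos_sub, Real.cos_add]; ring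
    simp_rw [this, ← Finset.mul_sum, ← Finset.sum_mul]
    simp
    ring
  have hc : 0 ≤ Λ n * (Real.exp (-((1 + s) * θ)) - 0.447 * Real.exp (-(1.618 * θ))) := by
    refine mul_nonneg vonMangoldt_nonneg ?_
    have h0 : 0 ≤ θ := Real.log_natCast_nonneg n
    have : Real.exp (-(1.618 * θ)) ≤ Real.exp (-((1 + s) * θ)) :=
      Real.exp_le_exp.mpr (by nlinarith)
    have := Real.exp_pos (-(1.618 * θ))
    linarith
  have := mul_nonneg hc (sq_nonneg (a + 2 * ∑ γ ∈ Γ, Real.cos (γ * θ)))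
  rw [← key] at this
  refine this.trans_eq ?_
  simp only [mul_add, Finset.mul_sum, Finset.sum_add_distrib]
  congr 1
  · congr 1
    · ring
    · exact Finset.sum_congr rfl fun _ _ ↦ by ring
  · congr 1 <;>
    exact Finset.sum_congr rfl fun _ _ ↦ Finset.sum_congr rfl fun _ _ ↦ by ring

/-- The zeros' share of Stechkin's combination. -/
noncomputable def stechZeros (s t : ℝ) : ℝ :=
  (logDeriv xi ((1 + s : ℝ) + t * I)).re - 0.447 * (logDeriv xi ((1.618 : ℝ) + t * I)).re

lemma hasSum_stechZeros {s : ℝ} (hs : 0 < s) (t : ℝ) :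
    HasSum (fun ρ : ℂ ↦ mz ρ * ((pairTerm (1 + s) ρ.re (ρ.im - t) -
      0.447 * pairTerm 1.618 ρ.re (ρ.im - t)) / 2)) (stechZeros s t) := by
  refine ((hasSum_pairTerm (σ := 1 + s) (by linarith) t).sub
    ((hasSum_pairTerm (σ := 1.618) (by norm_num) t).mul_left 0.447)).congr_fun fun ρ ↦ ?_
  ring

lemma stechZeros_term_nonneg {s : ℝ} (hs : 0 < s) (hs1 : s ≤ 1 / 10) (t : ℝ) (ρ : ℂ) :
    0 ≤ mz ρ * ((pairTerm (1 + s) ρ.re (ρ.im - t) -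
      0.447 * pairTerm 1.618 ρ.re (ρ.im - t)) / 2) := by
  by_cases h : xi ρ = 0
  · have := xi_zero_re h
    exact mul_nonneg (mz_nonneg ρ) (by linarith [stechkin (ρ.im - t) hs.le hs1 this.1 this.2])
  · rw [mz_eq_zero h, zero_mul]

lemma stechZeros_nonneg {s : ℝ} (hs : 0 < s) (hs1 : s ≤ 1 / 10) (t : ℝ) : 0 ≤ stechZeros s t :=
  (hasSum_stechZeros hs t).nonneg (stechZeros_term_nonneg hs hs1 t)

lemma le_stechZeros {s : ℝ} (hs : 0 < s) (hs1 : s ≤ 1 / 10) {ρ : ℂ} (hρ : xi ρ = 0)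
    (hβ : 1 / 2 < ρ.re) :
    1 / (1 + s - ρ.re) + 1 / (s + ρ.re) - 1 ≤ stechZeros s ρ.im := by
  classical
  have hne : ρ ≠ 1 - conj ρ := fun h ↦ by
    have := congrArg re h
    simp at this; linarith
  have h := sum_le_hasSum {ρ, 1 - conj ρ} (fun ρ' _ ↦ stechZeros_term_nonneg hs hs1 ρ.im ρ')
    (hasSum_stechZeros hs ρ.im)
  rw [Finset.sum_pair hne] at h
  have hz := xi_zero_re hρ
  have h2 := one_le_mz hρ
  have h3 : ∀ σ, pairTerm σ (1 - conj ρ).re ((1 - conj ρ).im - ρ.im) = pairTerm σ ρ.re 0 := fun σ ↦ by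
    simp [pairTerm]; ring
  rw [mz_one_sub, mz_conj, h3, h3, sub_self] at h
  have h4 := pairTerm_zero_ge hs hs1 hβ.le hz.2
  have h5 := stechkin 0 hs.le hs1 hz.1 hz.2
  nlinarith

lemma stech_eq {s : ℝ} (hs : 0 < s) (t : ℝ) :
    stech s t = s / (s ^ 2 + t ^ 2) - 0.447 * (0.618 / (0.618 ^ 2 + t ^ 2)) +
      ((digamma (((3 + s) / 2 : ℝ) + (t / 2 : ℝ) * I)).re -
        0.447 * (digamma ((1.809 : ℝ) + (t / 2 : ℝ) * I)).re) / 2 -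
      0.2765 * Real.log Real.pi - stechZeros s t := by
  have key (σ : ℝ) (hσ : 1 < σ) :
      (-(deriv riemannZeta (σ + t * I) / riemannZeta (σ + t * I))).re =
        (σ - 1) / ((σ - 1) ^ 2 + t ^ 2) +
          (digamma (((σ + 2) / 2 : ℝ) + (t / 2 : ℝ) * I)).re / 2 - Real.log Real.pi / 2 -
            (logDeriv xi (σ + t * I)).re := by
    have h := logDeriv_xi_eq (s := σ + t * I) (by simpa using hσ)
    have e : ((σ : ℂ) + t * I) / 2 + 1 = ((σ + 2) / 2 : ℝ) + (t / 2 : ℝ) * I := by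
      push_cast; ring
    rw [h, e]
    have e2 : (((σ : ℂ) + t * I - 1)⁻¹).re = (σ - 1) / ((σ - 1) ^ 2 + t ^ 2) := by
      simp [inv_re, normSq_apply]; ring
    have e3 (z : ℂ) : (z / 2).re = z.re / 2 := by simp
    have e4 : (Real.log Real.pi / 2 : ℂ).re = Real.log Real.pi / 2 := by
      rw [e3, ofReal_re]
    simp only [add_re, sub_re, neg_re, e2, e3, ofReal_re]
    ring
  rw [(hasSum_stech hs t).2, key _ (by linarith), key _ (by norm_num), stechZeros,
    show (1 + s + 2) / 2 = (3 + s) / 2 by ring]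
  norm_num
  ring

lemma stech_zero_le {s : ℝ} (hs : 0 < s) (hs1 : s ≤ 1 / 10) : stech s 0 ≤ 1 / s - 1 := by
  have h := stech_eq hs 0
  have h0 := stechZeros_nonneg hs hs1 0
  have d (x : ℝ) (hx : 0 < x) : |psi x - (Real.log x - 1 / x / 2)| ≤ 1 / x ^ 2 / 4 := by
    have := abs_re_digamma_sub_le (z := x) (by simpa)
    rw [digamma_ofReal hx] at this
    simp only [ofReal_re, ofReal_im, ne_eq, OfNat.ofNat_ne_zero, not_false_eq_true, zero_pow,
      add_zero, Real.log_pow] at this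
    rwa [show x / x ^ 2 = 1 / x by field_simp, Nat.cast_ofNat, mul_div_cancel_left₀ _ two_ne_zero]
      at this
  have a1 := (abs_le.mp (d ((3 + s) / 2 + 1) (by linarith))).2
  have a2 := (abs_le.mp (d (1.809 + 1) (by norm_num))).1
  rw [psi_add_one (by linarith)] at a1
  rw [psi_add_one (by norm_num)] at a2
  have b1 : Real.log ((3 + s) / 2 + 1) ≤ 0.9362 := by
    rw [Real.log_le_iff_le_exp (by linarith)]
    have := Real.sum_le_exp_of_nonneg (x := 0.9362) (by norm_num) 7
    refine le_trans ?_ this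
    norm_num [Finset.sum_range_succ, Nat.factorial]
    linarith
  have b2 : 1.03 ≤ Real.log (1.809 + 1) := by
    rw [Real.le_log_iff_exp_le (by norm_num)]
    have := Real.exp_one_lt_d9
    have h3 := Real.exp_bound' (x := 0.03) (by norm_num) (by norm_num) (n := 3) (by norm_num)
    rw [show (1.03:ℝ) = 1 + 0.03 by norm_num, Real.exp_add]
    norm_num [Finset.sum_range_succ, Nat.factorial] at h3 this ⊢
    nlinarith [Real.exp_pos 1, Real.exp_pos (3 / 100)]
  have b3 : 1.14 ≤ Real.log Real.pi := by
    rw [Real.le_log_iff_exp_le Real.pi_pos]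
    have := Real.exp_one_lt_d9
    have h3 := Real.exp_bound' (x := 0.14) (by norm_num) (by norm_num) (n := 4) (by norm_num)
    have h4 := Real.pi_gt_d4
    rw [show (1.14:ℝ) = 1 + 0.14 by norm_num, Real.exp_add]
    norm_num [Finset.sum_range_succ, Nat.factorial] at h3 this h4 ⊢
    nlinarith [Real.exp_pos 1, Real.exp_pos (7 / 50)]
  have c1 : 1 / 2.55 ≤ 1 / ((3 + s) / 2 + 1) :=
    one_div_le_one_div_of_le (by positivity) (by linarith)
  have c2 : 1 / ((3 + s) / 2 + 1) ^ 2 ≤ 1 / 2.5 ^ 2 := by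
    apply one_div_le_one_div_of_le (by positivity); nlinarith
  have c3 : 1.55⁻¹ ≤ ((3 + s) / 2)⁻¹ := inv_anti₀ (by linarith) (by linarith)
  have c4 : s / (s ^ 2 + 0 ^ 2) = 1 / s := by field_simp; simp
  rw [c4, show ((0 / 2 : ℝ) : ℂ) = 0 by simp, zero_mul, add_zero, add_zero,
    digamma_ofReal (by linarith), digamma_ofReal (by norm_num)] at h
  norm_num at *
  linarith

/-- The size of the logarithmic derivative of the Gamma-factor on the horizontal line of height
`T`, in Stechkin's combination. -/
noncomputable def ell (T : ℝ) : ℝ := 0.2765 * Real.log (T / (2 * Real.pi)) + 1 / 1000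

lemma stech_le {s t T : ℝ} (hs : 0 < s) (hs1 : s ≤ 1 / 10) (hT : 200 ≤ T) (ht : |t| ≤ T) :
    stech s t ≤ s / (s ^ 2 + t ^ 2) + ell T - stechZeros s t := by
  have h := stech_eq hs t
  have a1 := (abs_le.mp (abs_re_digamma_sub_le (z := ((3 + s) / 2 : ℝ) + (t / 2 : ℝ) * I)
    (by simp; linarith))).2
  have a2 := (abs_le.mp (abs_re_digamma_sub_le (z := (1.809 : ℝ) + (t / 2 : ℝ) * I)
    (by simp; norm_num))).1
  simp only [add_re, ofReal_re, re_ofReal_mul, I_re, mul_zero, add_zero, add_im, ofReal_im,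
    im_ofReal_mul, I_im, mul_one, zero_add] at a1 a2
  set q0 := ((3 + s) / 2) ^ 2 + (t / 2) ^ 2 with hq0
  set q := (1.809 : ℝ) ^ 2 + (t / 2) ^ 2 with hq
  set Q := (1.809 : ℝ) ^ 2 + (T / 2) ^ 2 with hQ
  have p0 : 0 < q0 := by positivity
  have pq : 3.2 < q := by nlinarith [sq_nonneg (t / 2)]
  have p01 : q0 ≤ q := by rw [hq0, hq]; nlinarith
  have pQ : q ≤ Q := by
    have := sq_le_sq' (abs_le.mp ht).1 (abs_le.mp ht).2
    rw [hq, hQ]; nlinarith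
  have l0 : Real.log q0 ≤ Real.log q := Real.log_le_log p0 p01
  have l1 : 1 / q0 / 4 ≤ (3 + s) / 2 / q0 / 2 := by
    rw [div_div, div_div, div_div, div_le_div_iff₀ (by positivity) (by positivity)]
    nlinarith
  have l2 : 1 - q / Q ≤ Real.log Q - Real.log q := by
    rw [← Real.log_div (by positivity) (by positivity)]
    have := Real.one_sub_inv_le_log_of_pos (x := Q / q) (by positivity)
    rwa [inv_div] at this
  have l3 : 0.2581 * (1 / q - 1 / Q) ≤ 0.13825 * (1 - q / Q) := by
    have e : (1 - q / Q) = q * (1 / q - 1 / Q) := by field_simp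
    have : 0 ≤ 1 / q - 1 / Q := by
      rw [sub_nonneg]; exact one_div_le_one_div_of_le (by positivity) pQ
    rw [e]; nlinarith
  have l4 : Real.log Q ≤ 2 * Real.log (T / 2) + 13.1 / T ^ 2 := by
    have e : Q = (T / 2) ^ 2 * (1 + 4 * 1.809 ^ 2 / T ^ 2) := by rw [hQ]; field_simp; ring
    rw [e, Real.log_mul (by positivity) (by positivity), Real.log_pow]
    have := Real.log_le_sub_one_of_pos (x := 1 + 4 * 1.809 ^ 2 / T ^ 2) (by positivity)
    have : 4 * 1.809 ^ 2 / T ^ 2 ≤ 13.1 / T ^ 2 := by gcongr; norm_num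
    push_cast; linarith
  have l5 : 13.1 / T ^ 2 ≤ 13.1 / 200 ^ 2 := by gcongr
  have l6 : 1 / Q ≤ 1 / 10000 := by
    apply one_div_le_one_div_of_le (by norm_num); rw [hQ]; nlinarith only [hT]
  have l7 : ell T = 0.2765 * (Real.log (T / 2) - Real.log Real.pi) + 1 / 1000 := by
    rw [ell, ← div_div, Real.log_div (by positivity) (by positivity)]
  have l8 : 0 ≤ 0.618 / (0.618 ^ 2 + t ^ 2) := by positivity
  have l9 : 1.809 / q / 2 = 0.9045 * (1 / q) := by ring
  have l10 : 1 / q / 4 = 0.25 * (1 / q) := by ring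
  rw [l9, l10] at a2
  have : 0 < 1 / q := by positivity
  clear_value q0 q Q
  norm_num at l5
  linarith only [h, a1, a2, l0, l1, l3, l2, l4, l5, l6, l7, l8, this]

lemma repulsion_sum {Γ : Finset ℝ} {T b s a : ℝ} (hT : 464 ≤ T) (hb : b < 1 / 2) (hs : 0 < s)
    (hs1 : s ≤ 1 / 10) (ha : 0 ≤ a) (hΓ : ∀ γ ∈ Γ, 290 ≤ γ ∧ γ ≤ T)
    (hz : ∀ γ ∈ Γ, ∃ ρ, xi ρ = 0 ∧ ρ.im = γ ∧ 1 - b ≤ ρ.re)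
    (hsep : ∀ γ ∈ Γ, ∀ γ' ∈ Γ, γ ≠ γ' → 1 ≤ |γ - γ'|) :
    0 ≤ (a ^ 2 + 2 * Γ.card) * (1 / s - 1) +
      4 * a * Γ.card * (ell T + 0.00001 - 1 / (s + b) - 1 / (1 + s - b) + 1) +
      2 * Γ.card * (ell (2 * T) + 0.00001) +
      2 * Γ.card * (Γ.card - 1) * (ell T + s + ell (2 * T) + 0.00001) := by
  classical
  have h := stech_sum_nonneg hs hs1 Γ a
  have small (t : ℝ) (ht : 290 ≤ t) : s / (s ^ 2 + t ^ 2) ≤ 0.00001 := by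
    rw [div_le_iff₀ (by positivity)]
    nlinarith
  have h1 : ∀ γ ∈ Γ, stech s γ ≤ ell T + 0.00001 - 1 / (s + b) - 1 / (1 + s - b) + 1 := by
    intro γ hγ
    obtain ⟨ρ, hρ, rfl, hρb⟩ := hz γ hγ
    have h2 := (hΓ _ hγ).1
    have h3 := (hΓ _ hγ).2
    have h4 := stech_le hs hs1 (t := ρ.im) (T := T) (by linarith)
      (by rw [abs_of_nonneg (by linarith)]; exact h3)
    have h5 := le_stechZeros hs hs1 hρ (by linarith)
    have h6 := (xi_zero_re hρ).2
    have h7 := small _ h2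
    have h8 : 1 / (s + b) + 1 / (1 + s - b) ≤ 1 / (1 + s - ρ.re) + 1 / (s + ρ.re) := by
      have p1 : 0 < 1 + s - ρ.re := by linarith
      have p2 : 0 < s + ρ.re := by linarith
      have p3 : 0 < s + b := by linarith
      have p4 : 0 < 1 + s - b := by linarith
      rw [div_add_div _ _ p3.ne' p4.ne', div_add_div _ _ p1.ne' p2.ne',
        div_le_div_iff₀ (by positivity) (by positivity)]
      have : (1 + s - ρ.re) * (s + ρ.re) ≤ (s + b) * (1 + s - b) := by nlinarith
      nlinarith
    linarith
  have h2 : ∀ γ ∈ Γ, stech s (γ + γ) ≤ ell (2 * T) + 0.00001 := by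
    intro γ hγ
    have h2 := hΓ _ hγ
    have h4 := stech_le hs hs1 (t := γ + γ) (T := 2 * T) (by linarith)
      (by rw [abs_of_nonneg (by linarith)]; linarith)
    have := small (γ + γ) (by linarith)
    have := stechZeros_nonneg hs hs1 (γ + γ)
    linarith
  have h3 : ∀ γ ∈ Γ, ∀ γ' ∈ Γ, γ ≠ γ' →
      stech s (γ - γ') + stech s (γ + γ') ≤ ell T + s + ell (2 * T) + 0.00001 := by
    intro γ hγ γ' hγ' hne
    have a1 := hΓ _ hγ
    have a2 := hΓ _ hγ'
    have h4 := stech_le hs hs1 (t := γ + γ') (T := 2 * T) (by linarith)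
      (by rw [abs_of_nonneg (by linarith)]; linarith)
    have h5 := small (γ + γ') (by linarith)
    have h6 := stechZeros_nonneg hs hs1 (γ + γ')
    have h7 := stech_le hs hs1 (t := γ - γ') (T := T) (by linarith)
      (by rw [abs_le]; constructor <;> linarith)
    have h8 := stechZeros_nonneg hs hs1 (γ - γ')
    have h9 := hsep γ hγ γ' hγ' hne
    have h10 : s / (s ^ 2 + (γ - γ') ^ 2) ≤ s := by
      have : 1 ≤ (γ - γ') ^ 2 := by rw [← sq_abs]; nlinarith
      exact div_le_self hs.le (by nlinarith [sq_nonneg s])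
    linarith
  have s0 := stech_zero_le hs hs1
  have S1 := Finset.sum_le_sum h1
  have S2 : ∑ γ ∈ Γ, ∑ γ' ∈ Γ, (stech s (γ - γ') + stech s (γ + γ')) ≤
      ∑ γ ∈ Γ, ((1 / s - 1 + (ell (2 * T) + 0.00001)) +
        (Γ.card - 1) * (ell T + s + ell (2 * T) + 0.00001)) := by
    refine Finset.sum_le_sum fun γ hγ ↦ ?_
    rw [← Finset.add_sum_erase _ _ hγ]
    refine add_le_add ?_ ?_
    · rw [sub_self]; exact add_le_add s0 (h2 γ hγ)
    · refine (Finset.sum_le_sum (g := fun _ ↦ ell T + s + ell (2 * T) + 0.00001) fun γ' hγ' ↦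
        h3 γ hγ γ' (Finset.mem_of_mem_erase hγ') (Finset.ne_of_mem_erase hγ').symm).trans_eq ?_
      rw [Finset.sum_const, Finset.card_erase_of_mem hγ, nsmul_eq_mul,
        Nat.cast_pred (Finset.card_pos.mpr ⟨γ, hγ⟩)]
  rw [Finset.sum_const, nsmul_eq_mul] at S1 S2
  have t1 := mul_le_mul_of_nonneg_left s0 (sq_nonneg a)
  have t2 := mul_le_mul_of_nonneg_left S1 (show 0 ≤ 4 * a by linarith)
  refine h.trans ((add_le_add (add_le_add t1 t2)
    (mul_le_mul_of_nonneg_left S2 zero_le_two)).trans_eq ?_)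
  ring

lemma log_464_lower : 6.1398 ≤ Real.log 464 := by
  have h2 := Real.log_two_gt_d9
  have e : Real.log 464 = 9 * Real.log 2 - Real.log (512 / 464) := by
    rw [show (464 : ℝ) = 2 ^ 9 / (512 / 464) by norm_num, Real.log_div (by norm_num) (by norm_num),
      Real.log_pow]
    norm_num
  have h3 : Real.log (512 / 464) ≤ 0.09852 := by
    rw [Real.log_le_iff_le_exp (by norm_num)]
    refine le_trans ?_ (Real.sum_le_exp_of_nonneg (x := 0.09852) (by norm_num) 4)
    norm_num [Finset.sum_range_succ, Nat.factorial]
  norm_num at *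
  linarith

lemma log_two_pi_lower : 1.8378 ≤ Real.log (2 * Real.pi) := by
  have h2 := Real.log_two_gt_d9
  have h3 : 1.144654 ≤ Real.log Real.pi := by
    rw [Real.le_log_iff_exp_le Real.pi_pos]
    have := Real.exp_one_lt_d9
    have h3 := Real.exp_bound' (x := 0.144654) (by norm_num) (by norm_num) (n := 5) (by norm_num)
    have h4 := Real.pi_gt_d4
    rw [show (1.144654:ℝ) = 1 + 0.144654 by norm_num, Real.exp_add]
    norm_num [Finset.sum_range_succ, Nat.factorial] at h3 this h4 ⊢
    nlinarith [Real.exp_pos 1, Real.exp_pos (72327 / 500000)]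
  rw [Real.log_mul (by norm_num) Real.pi_pos.ne']
  norm_num at *
  linarith

/-- If `J` zeros with ordinates in `[290, T]`, separated by at least one, lie to the right of
`1 - b`, then `b` cannot be too small. -/
lemma repulsion_core {Γ : Finset ℝ} {T c d a x u₀ s₀ : ℝ} (hT : 464 ≤ T) (ha : 0 ≤ a)
    (hc : 0 < c) (hx : 1 ≤ x) (hu₀ : u₀ = 6.1398 - d) (hu : 0 < u₀) (hs₀ : x * c / u₀ ≤ s₀)
    (hs₁ : s₀ ≤ 1 / 10)
    (hΓ : ∀ γ ∈ Γ, 290 ≤ γ ∧ γ ≤ T)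
    (hz : ∀ γ ∈ Γ, ∃ ρ, xi ρ = 0 ∧ ρ.im = γ ∧ 1 - c / (Real.log T - d) ≤ ρ.re)
    (hsep : ∀ γ ∈ Γ, ∀ γ' ∈ Γ, γ ≠ γ' → 1 ≤ |γ - γ'|)
    (hlin : (a ^ 2 + 2 * Γ.card) / (x * c) + 4 * a * Γ.card * (0.2765 - 1 / ((1 + x) * c)) +
      2 * Γ.card * 0.2765 + 2 * Γ.card * (Γ.card - 1) * 0.553 ≤ 0)
    (hcard : 1 ≤ Γ.card)
    (hconst : ((a ^ 2 + 2 * Γ.card) / (x * c) + 4 * a * Γ.card * (0.2765 - 1 / ((1 + x) * c)) +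
      2 * Γ.card * 0.2765 + 2 * Γ.card * (Γ.card - 1) * 0.553) * u₀ - (a ^ 2 + 2 * Γ.card) +
      4 * a * Γ.card * (0.2765 * (d - 1.8378) + 0.00101 - 1 / (1 + (x - 1) * c / u₀) + 1) +
      2 * Γ.card * (0.2765 * (d - 1.8378 + 0.6932) + 0.00101) +
      2 * Γ.card * (Γ.card - 1) * (0.2765 * (2 * (d - 1.8378) + 0.6932) + 0.00201 + s₀) < 0) :
    False := by
  have hlog : 6.1398 ≤ Real.log T :=
    log_464_lower.trans (Real.log_le_log (by norm_num) hT)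
  obtain ⟨u, hudef⟩ : ∃ u, u = Real.log T - d := ⟨_, rfl⟩
  have huu : u₀ ≤ u := by linarith
  have hup : 0 < u := by linarith
  rw [← hudef] at hz
  have hxc : 0 < x * c := by positivity
  have e1 : x * (c / u) ≤ x * c / u₀ := by
    rw [← mul_div_assoc]; gcongr
  have hb : c / u ≤ 1 / 10 := by
    have : c / u ≤ x * (c / u) := le_mul_of_one_le_left (by positivity) hx
    linarith
  have h := repulsion_sum (b := c / u) (s := x * (c / u)) hT (by linarith) (by positivity)
    (by linarith) ha hΓ hz hsep
  have hl2 := log_two_pi_lower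
  have hl : ell T = 0.2765 * (u + d - Real.log (2 * Real.pi)) + 1 / 1000 := by
    rw [ell, Real.log_div (by linarith) (by positivity)]; simp [hudef]
  have hl' : ell (2 * T) ≤ 0.2765 * (u + d - 1.8378 + 0.6932) + 1 / 1000 := by
    rw [ell, Real.log_div (by linarith) (by positivity), Real.log_mul (by norm_num) (by linarith)]
    have := Real.log_two_lt_d9
    norm_num at *
    linarith
  have hl'' : ell T ≤ 0.2765 * (u + d - 1.8378) + 1 / 1000 := by rw [hl]; linarith
  have f1 : 1 / (x * (c / u)) = u / (x * c) := by field_simp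
  have f2 : 1 / (x * (c / u) + c / u) = u / ((1 + x) * c) := by field_simp; ring
  have f3 : 1 / (1 + (x - 1) * c / u₀) ≤ 1 / (1 + x * (c / u) - c / u) := by
    have : (x - 1) * c / u ≤ (x - 1) * c / u₀ := by
      have : 0 ≤ (x - 1) * c := mul_nonneg (by linarith) hc.le
      gcongr
    have p : 0 ≤ (x - 1) * c / u := div_nonneg (mul_nonneg (by linarith) hc.le) hup.le
    have e : 1 + x * (c / u) - c / u = 1 + (x - 1) * c / u := by ring
    rw [e]
    exact one_div_le_one_div_of_le (by linarith) (by linarith)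
  rw [f1, f2] at h
  have hJ : (1 : ℝ) ≤ Γ.card := by exact_mod_cast hcard
  generalize (Γ.card : ℝ) = J at *
  have g1 : 4 * a * J * (ell T + 0.00001 - u / ((1 + x) * c) - 1 / (1 + x * (c / u) - c / u) + 1) ≤
      4 * a * J * (0.2765 * (u + d - 1.8378) + 0.00101 - u / ((1 + x) * c) -
        1 / (1 + (x - 1) * c / u₀) + 1) := by
    apply mul_le_mul_of_nonneg_left _ (by positivity)
    norm_num at *
    linarith
  have g2 : 2 * J * (ell (2 * T) + 0.00001) ≤
      2 * J * (0.2765 * (u + d - 1.8378 + 0.6932) + 0.00101) := by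
    apply mul_le_mul_of_nonneg_left _ (by positivity)
    norm_num at *
    linarith
  have g3 : 2 * J * (J - 1) * (ell T + x * (c / u) + ell (2 * T) + 0.00001) ≤
      2 * J * (J - 1) * (0.2765 * (2 * u + 2 * (d - 1.8378) + 0.6932) + 0.00201 + s₀) := by
    apply mul_le_mul_of_nonneg_left _ (mul_nonneg (by positivity) (by linarith))
    norm_num at *
    linarith
  have g4 := mul_le_mul_of_nonpos_left huu hlin
  have g5 : (a ^ 2 + 2 * J) * (u / (x * c) - 1) + 4 * a * J * (0.2765 * (u + d - 1.8378) + 0.00101 -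
      u / ((1 + x) * c) - 1 / (1 + (x - 1) * c / u₀) + 1) +
      2 * J * (0.2765 * (u + d - 1.8378 + 0.6932) + 0.00101) +
      2 * J * (J - 1) * (0.2765 * (2 * u + 2 * (d - 1.8378) + 0.6932) + 0.00201 + s₀) =
      ((a ^ 2 + 2 * J) / (x * c) + 4 * a * J * (0.2765 - 1 / ((1 + x) * c)) +
      2 * J * 0.2765 + 2 * J * (J - 1) * 0.553) * u - (a ^ 2 + 2 * J) +
      4 * a * J * (0.2765 * (d - 1.8378) + 0.00101 - 1 / (1 + (x - 1) * c / u₀) + 1) +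
      2 * J * (0.2765 * (d - 1.8378 + 0.6932) + 0.00101) +
      2 * J * (J - 1) * (0.2765 * (2 * (d - 1.8378) + 0.6932) + 0.00201 + s₀) := by
    ring
  linarith only [h, g1, g2, g3, g4, g5, hconst]

/-- The constants of the repulsion estimates. -/
noncomputable def repC : ℕ → ℝ
  | 1 => 0.0639
  | 2 => 0.1769
  | 3 => 0.238
  | 4 => 0.284
  | _ => 0

/-- The constants of the repulsion estimates. -/
noncomputable def repD : ℕ → ℝ
  | 1 => 3.4
  | 2 => 2.6
  | 3 => 2.4
  | 4 => 2.2
  | _ => 0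

/-- There are fewer than `J` separated zeros of ordinate in `[290, T]` which are very close to the
line `Re s = 1`. -/
lemma repulsion {Γ : Finset ℝ} {T : ℝ} (hT : 464 ≤ T) {J : ℕ} (hJ : 1 ≤ J) (hJ4 : J ≤ 4)
    (hcard : Γ.card = J) (hΓ : ∀ γ ∈ Γ, 290 ≤ γ ∧ γ ≤ T)
    (hz : ∀ γ ∈ Γ, ∃ ρ, xi ρ = 0 ∧ ρ.im = γ ∧ 1 - repC J / (Real.log T - repD J) ≤ ρ.re)
    (hsep : ∀ γ ∈ Γ, ∀ γ' ∈ Γ, γ ≠ γ' → 1 ≤ |γ - γ'|) : False := by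
  interval_cases J
  · refine repulsion_core (c := 0.0639) (d := 3.4) (a := 1.5) (x := 4.2) (s₀ := 0.098) hT
      (by norm_num) (by norm_num) (by norm_num) rfl (by norm_num) (by norm_num) (by norm_num)
      hΓ hz hsep ?_ hcard.ge ?_ <;> rw [hcard] <;> norm_num
  · refine repulsion_core (c := 0.1769) (d := 2.6) (a := 2.3) (x := 2) (s₀ := 0.09999) hT
      (by norm_num) (by norm_num) (by norm_num) rfl (by norm_num) (by norm_num) (by norm_num)
      hΓ hz hsep ?_ (by omega) ?_ <;> rw [hcard] <;> norm_num
  · refine repulsion_core (c := 0.238) (d := 2.4) (a := 3.2) (x := 1.5) (s₀ := 0.0956) hT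
      (by norm_num) (by norm_num) (by norm_num) rfl (by norm_num) (by norm_num) (by norm_num)
      hΓ hz hsep ?_ (by omega) ?_ <;> rw [hcard] <;> norm_num
  · refine repulsion_core (c := 0.284) (d := 2.2) (a := 3.7) (x := 1.3) (s₀ := 0.094) hT
      (by norm_num) (by norm_num) (by norm_num) rfl (by norm_num) (by norm_num) (by norm_num)
      hΓ hz hsep ?_ (by omega) ?_ <;> rw [hcard] <;> norm_num

/-- If a finite set contains no `J + 1` points with separated ordinates, then it is covered by `J`
intervals of unit length. -/
lemma sum_le_of_no_separated {w : ℂ → ℝ} (hw : ∀ ρ, 0 ≤ w ρ) {n : ℝ} (J : ℕ) (A : Finset ℂ)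
    (hn : ∀ a, ∑ ρ ∈ A with a ≤ ρ.im ∧ ρ.im < a + 1, w ρ ≤ n)
    (hsep : ∀ Γ ⊆ A.image im, (∀ γ ∈ Γ, ∀ γ' ∈ Γ, γ ≠ γ' → 1 ≤ |γ - γ'|) → Γ.card ≠ J + 1) :
    ∑ ρ ∈ A, w ρ ≤ J * n := by
  classical
  have hn0 : 0 ≤ n := (Finset.sum_nonneg fun ρ _ ↦ hw ρ).trans (hn 0)
  induction J generalizing A with
  | zero =>
    rcases A.eq_empty_or_nonempty with rfl | ⟨ρ, hρ⟩
    · simp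
    · refine absurd ?_ (hsep {ρ.im} ?_ ?_)
      · simp
      · simpa using ⟨ρ, hρ, rfl⟩
      · simp +contextual
  | succ J ih =>
    rcases A.eq_empty_or_nonempty with rfl | hA
    · simp; positivity
    obtain ⟨ρ₀, hρ₀, hmin⟩ := A.exists_min_image im hA
    have h1 := ih (A.filter (ρ₀.im + 1 ≤ im ·)) (fun a ↦ by
      refine le_trans (Finset.sum_le_sum_of_subset_of_nonneg ?_ fun _ _ _ ↦ hw _) (hn a)
      exact Finset.filter_subset_filter _ (Finset.filter_subset _ _)) (fun Γ hΓ hΓs hc ↦ by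
      have hmem : ∀ γ ∈ Γ, ρ₀.im + 1 ≤ γ := fun γ hγ ↦ by
        obtain ⟨ρ, hρ, rfl⟩ := Finset.mem_image.mp (hΓ hγ)
        exact (Finset.mem_filter.mp hρ).2
      refine hsep (insert ρ₀.im Γ) ?_ ?_ ?_
      · refine Finset.insert_subset (Finset.mem_image_of_mem _ hρ₀) (hΓ.trans ?_)
        exact Finset.image_subset_image (Finset.filter_subset _ _)
      · intro γ hγ γ' hγ' hne
        rcases Finset.mem_insert.mp hγ with rfl | h <;> rcases Finset.mem_insert.mp hγ' with rfl | h'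
        · exact absurd rfl hne
        · rw [abs_sub_comm]; exact le_trans (by linarith [hmem _ h']) (le_abs_self _)
        · exact le_trans (by linarith [hmem _ h]) (le_abs_self _)
        · exact hΓs _ h _ h' hne
      · rw [Finset.card_insert_of_notMem fun h ↦ by linarith [hmem _ h], hc])
    have h2 := hn ρ₀.im
    have h3 := Finset.sum_filter_add_sum_filter_not A (ρ₀.im + 1 ≤ im ·) w
    have h4 : ∑ ρ ∈ A with ¬ ρ₀.im + 1 ≤ ρ.im, w ρ ≤
        ∑ ρ ∈ A with ρ₀.im ≤ ρ.im ∧ ρ.im < ρ₀.im + 1, w ρ := by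
      refine Finset.sum_le_sum_of_subset_of_nonneg (fun ρ hρ ↦ ?_) fun _ _ _ ↦ hw _
      rw [Finset.mem_filter] at hρ ⊢
      exact ⟨hρ.1, hmin _ hρ.1, not_le.mp hρ.2⟩
    push_cast
    linarith

lemma pairTerm_two_ge {β η : ℝ} (h0 : 0 < β) (h1 : β < 1) (hη : |η| ≤ 1 / 2) :
    1.2 ≤ pairTerm 2 β η := by
  have h2 : η ^ 2 ≤ 1 / 4 := by rw [← sq_abs]; nlinarith [abs_nonneg η]
  rw [pairTerm_eq (by norm_num) h0 h1]
  have hq : 0 < β * (1 - β) := mul_pos h0 (by linarith)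
  have hq1 : β * (1 - β) ≤ 1 / 4 := by nlinarith [sq_nonneg (β - 1 / 2)]
  have hE := sq_nonneg η
  generalize β * (1 - β) = q at *
  generalize η ^ 2 = E at *
  rw [le_div_iff₀ (by nlinarith)]
  nlinarith [mul_nonneg hE hq.le, mul_nonneg hE hE]

lemma re_logDeriv_xi_eq {σ : ℝ} (hσ : 1 < σ) (t : ℝ) :
    (logDeriv xi (σ + t * I)).re = (σ - 1) / ((σ - 1) ^ 2 + t ^ 2) +
      (digamma (((σ + 2) / 2 : ℝ) + (t / 2 : ℝ) * I)).re / 2 - Real.log Real.pi / 2 -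
        (-(deriv riemannZeta (σ + t * I) / riemannZeta (σ + t * I))).re := by
  have h := logDeriv_xi_eq (s := σ + t * I) (by simpa using hσ)
  have e : ((σ : ℂ) + t * I) / 2 + 1 = ((σ + 2) / 2 : ℝ) + (t / 2 : ℝ) * I := by
    push_cast; ring
  rw [h, e]
  have e2 : (((σ : ℂ) + t * I - 1)⁻¹).re = (σ - 1) / ((σ - 1) ^ 2 + t ^ 2) := by
    simp [inv_re, normSq_apply]; ring
  have e3 (z : ℂ) : (z / 2).re = z.re / 2 := by simp
  have e4 : (Real.log Real.pi / 2 : ℂ).re = Real.log Real.pi / 2 := by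
    rw [e3, ofReal_re]
  simp only [add_re, sub_re, neg_re, e2, e3, ofReal_re]
  ring

lemma re_logDeriv_xi_nonneg {σ : ℝ} (hσ : 1 ≤ σ) (t : ℝ) : 0 ≤ (logDeriv xi (σ + t * I)).re :=
  (hasSum_pairTerm hσ t).nonneg fun ρ ↦ by
    by_cases hρ : xi ρ = 0
    · have := xi_zero_re hρ
      exact mul_nonneg (mz_nonneg ρ) (div_nonneg (pairTerm_nonneg hσ this.1 this.2) two_pos.le)
    · rw [mz_eq_zero hρ, zero_mul]

lemma log_five_upper : Real.log 5 ≤ 1.6095 := by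
  have h2 := Real.log_two_lt_d9
  have e : Real.log 5 = 2 * Real.log 2 + Real.log (5 / 4) := by
    rw [show (5 : ℝ) = 2 ^ 2 * (5 / 4) by norm_num, Real.log_mul (by norm_num) (by norm_num),
      Real.log_pow]
    norm_num
  have h3 : Real.log (5 / 4) ≤ 0.2232 := by
    rw [Real.log_le_iff_le_exp (by norm_num)]
    refine le_trans ?_ (Real.sum_le_exp_of_nonneg (x := 0.2232) (by norm_num) 5)
    norm_num [Finset.sum_range_succ, Nat.factorial]
  norm_num at *
  linarith

lemma neg_logDeriv_zeta_two_le :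
    (-(deriv riemannZeta ((2 : ℝ) + (0 : ℝ) * I) / riemannZeta ((2 : ℝ) + (0 : ℝ) * I))).re
      ≤ 0.65 := by
  have h := re_logDeriv_xi_eq (σ := 2) (by norm_num) 0
  have h0 := re_logDeriv_xi_nonneg (σ := 2) (by norm_num) 0
  have h1 := (abs_le.mp (abs_re_digamma_sub_le (z := (5 : ℝ)) (by norm_num))).2
  rw [digamma_ofReal (by norm_num)] at h1
  have p1 := psi_add_one (x := 4) (by norm_num)
  have p2 := psi_add_one (x := 3) (by norm_num)
  have p3 := psi_add_one (x := 2) (by norm_num)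
  have e : (((2 + 2) / 2 : ℝ) : ℂ) + ((0 / 2 : ℝ) : ℂ) * I = (2 : ℝ) := by norm_num
  rw [e, digamma_ofReal (by norm_num)] at h
  have h5 := log_five_upper
  have h6 := log_two_pi_lower
  rw [Real.log_mul (by norm_num) Real.pi_pos.ne'] at h6
  have h7 := Real.log_two_lt_d9
  have e5 : Real.log (5 ^ 2) = 2 * Real.log 5 := by rw [Real.log_pow]; norm_num
  simp only [ofReal_re, ofReal_im] at h1
  rw [show (5:ℝ) ^ 2 + 0 ^ 2 = 5 ^ 2 by norm_num, e5] at h1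
  norm_num at p1 p2 p3 h1 h5 h6 h7
  rw [h] at h0
  norm_num at h0 ⊢
  linarith

open ArithmeticFunction in
lemma re_logDeriv_xi_two_le {t : ℝ} (ht : 290 ≤ t) :
    (logDeriv xi ((2 : ℝ) + t * I)).re ≤ Real.log (t / (2 * Real.pi)) / 2 + 0.651 := by
  have h := re_logDeriv_xi_eq (σ := 2) (by norm_num) t
  have z1 : -(-(deriv riemannZeta ((2 : ℝ) + t * I) / riemannZeta ((2 : ℝ) + t * I))).re ≤ 0.65 := by
    refine le_trans ?_ neg_logDeriv_zeta_two_le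
    refine hasSum_le (fun n ↦ ?_) (hasSum_vonMangoldt_cos (σ := 2) (by norm_num) t).neg
      (hasSum_vonMangoldt_cos (σ := 2) (by norm_num) 0)
    rw [zero_mul, Real.cos_zero, mul_one, ← mul_neg, ← mul_neg]
    refine mul_le_mul_of_nonneg_left ?_ vonMangoldt_nonneg
    have := Real.neg_one_le_cos (t * Real.log n)
    have := Real.exp_pos (-(2 * Real.log n))
    nlinarith
  have a1 := (abs_le.mp (abs_re_digamma_sub_le (z := ((2 + 2) / 2 : ℝ) + (t / 2 : ℝ) * I)
    (by simp))).2
  simp only [add_re, ofReal_re, re_ofReal_mul, I_re, mul_zero, add_zero, add_im, ofReal_im,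
    im_ofReal_mul, I_im, mul_one, zero_add] at a1
  have q : (((2 : ℝ) + 2) / 2) ^ 2 + (t / 2) ^ 2 = (t / 2) ^ 2 * (1 + 16 / t ^ 2) := by
    field_simp; ring
  have hl : Real.log ((((2 : ℝ) + 2) / 2) ^ 2 + (t / 2) ^ 2) ≤ 2 * Real.log (t / 2) + 16 / t ^ 2 := by
    rw [q, Real.log_mul (by positivity) (by positivity), Real.log_pow]
    have := Real.log_le_sub_one_of_pos (x := 1 + 16 / t ^ 2) (by positivity)
    push_cast; linarith
  have hq : 0 < (((2 : ℝ) + 2) / 2) ^ 2 + (t / 2) ^ 2 := by positivity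
  generalize (((2 : ℝ) + 2) / 2) ^ 2 + (t / 2) ^ 2 = Q at *
  have l5 : 16 / t ^ 2 ≤ 16 / 290 ^ 2 := by gcongr
  have l6 : ((2 : ℝ) - 1) / ((2 - 1) ^ 2 + t ^ 2) ≤ 1 / 290 ^ 2 := by
    rw [div_le_div_iff₀ (by positivity) (by positivity)]; nlinarith
  have l7 : Real.log (t / (2 * Real.pi)) = Real.log (t / 2) - Real.log Real.pi := by
    rw [← div_div, Real.log_div (by positivity) (by positivity)]
  have l8 : 1 / Q / 4 = 1 / 4 * (1 / Q) := by ring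
  have l9 : (2 + 2) / 2 / Q / 2 = 1 * (1 / Q) := by ring
  have l10 : 0 < 1 / Q := by positivity
  rw [h, l7]
  rw [l8, l9] at a1
  norm_num at l5
  linarith

lemma sum_mz_unit_le {A : Finset ℂ} {a : ℝ} (ha : 290 ≤ a) :
    ∑ ρ ∈ A with a ≤ ρ.im ∧ ρ.im < a + 1, mz ρ ≤
      (Real.log ((a + 1 / 2) / (2 * Real.pi)) + 1.302) / 1.2 := by
  have h := hasSum_pairTerm (σ := 2) (by norm_num) (a + 1 / 2)
  have h1 := re_logDeriv_xi_two_le (t := a + 1 / 2) (by linarith)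
  have h2 := sum_le_hasSum (A.filter fun ρ ↦ a ≤ ρ.im ∧ ρ.im < a + 1) (fun ρ _ ↦ by
    by_cases hρ : xi ρ = 0
    · have := xi_zero_re hρ
      exact mul_nonneg (mz_nonneg ρ)
        (div_nonneg (pairTerm_nonneg (by norm_num) this.1 this.2) two_pos.le)
    · rw [mz_eq_zero hρ, zero_mul]) h
  have h3 : ∑ ρ ∈ A with a ≤ ρ.im ∧ ρ.im < a + 1, mz ρ * 0.6 ≤
      ∑ ρ ∈ A with a ≤ ρ.im ∧ ρ.im < a + 1, mz ρ * (pairTerm 2 ρ.re (ρ.im - (a + 1 / 2)) / 2) := by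
    refine Finset.sum_le_sum fun ρ hρ ↦ ?_
    have hm := (Finset.mem_filter.mp hρ).2
    by_cases hρ : xi ρ = 0
    · have := xi_zero_re hρ
      have := pairTerm_two_ge (η := ρ.im - (a + 1 / 2)) this.1 this.2
        (by rw [abs_le]; constructor <;> linarith)
      exact mul_le_mul_of_nonneg_left (by linarith) (mz_nonneg ρ)
    · rw [mz_eq_zero hρ, zero_mul, zero_mul]
  rw [← Finset.sum_mul] at h3
  push_cast at h1 h2
  rw [le_div_iff₀ (by norm_num)]
  linarith

/-- The larger of the real parts of the zeros `ρ` and `1 - conj ρ`. -/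
noncomputable def remax (ρ : ℂ) : ℝ := max ρ.re (1 - ρ.re)

/-- The distance from the line `Re s = 1` attached to the height `T` and the index `j`. -/
noncomputable def repB (T : ℝ) (j : ℕ) : ℝ := repC j / (Real.log T - repD j)

lemma sum_mz_near_le {t : ℝ} (ht : 290 ≤ t) {A : Finset ℂ} (hA : ∀ ρ ∈ A, xi ρ = 0)
    (hAt : ∀ ρ ∈ A, t ≤ ρ.im ∧ ρ.im < 1.6 * t) {J : ℕ} (hJ : J < 4) :
    ∑ ρ ∈ A with 1 - remax ρ < repB (1.6 * t) (J + 1), mz ρ ≤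
      J * ((Real.log (1.6 * t / (2 * Real.pi)) + 1.306) / 1.2) := by
  classical
  refine sum_le_of_no_separated mz_nonneg J _ (fun a ↦ ?_) (fun Γ hΓ hs hc ↦ ?_)
  · have hL : Real.log ((1.6 * t + 1 / 2) / (2 * Real.pi)) ≤
        Real.log (1.6 * t / (2 * Real.pi)) + 0.004 := by
      have e : (1.6 * t + 1 / 2) / (2 * Real.pi) =
          1.6 * t / (2 * Real.pi) * (1 + 1 / (3.2 * t)) := by
        field_simp; ring
      rw [e, Real.log_mul (by positivity) (by positivity)]
      have := Real.log_le_sub_one_of_pos (x := 1 + 1 / (3.2 * t)) (by positivity)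
      have : 1 / (3.2 * t) ≤ 1 / (3.2 * 290) := by gcongr
      norm_num at *
      linarith
    rcases le_or_gt (1.6 * t) (max a t) with h | h
    · rw [Finset.sum_eq_zero fun ρ hρ ↦ ?_]
      · have : 0 ≤ Real.log (1.6 * t / (2 * Real.pi)) := by
          refine Real.log_nonneg ?_
          rw [le_div_iff₀ (by positivity)]
          nlinarith [Real.pi_lt_d2]
        positivity
      · simp only [Finset.mem_filter] at hρ
        have := hAt ρ hρ.1.1
        rcases le_max_iff.mp h with h | h <;> linarith
    · have h1 := sum_mz_unit_le (A := A) (a := max a t) (ht.trans (le_max_right _ _))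
      refine (Finset.sum_le_sum_of_subset_of_nonneg (fun ρ hρ ↦ ?_) fun _ _ _ ↦ mz_nonneg _).trans
        (h1.trans ?_)
      · simp only [Finset.mem_filter] at hρ ⊢
        have := hAt ρ hρ.1.1
        exact ⟨hρ.1.1, max_le hρ.2.1 this.1, by linarith [le_max_left a t]⟩
      · have h2 : Real.log ((max a t + 1 / 2) / (2 * Real.pi)) ≤
            Real.log ((1.6 * t + 1 / 2) / (2 * Real.pi)) := by
          have : 0 < max a t := lt_max_of_lt_right (by linarith)
          gcongr
        refine div_le_div_of_nonneg_right ?_ (by norm_num)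
        linarith
  · refine repulsion (Γ := Γ) (T := 1.6 * t) (by linarith) (J := J + 1) (by omega) (by omega) hc
      (fun γ hγ ↦ ?_) (fun γ hγ ↦ ?_) hs
    · obtain ⟨ρ, hρ, rfl⟩ := Finset.mem_image.mp (hΓ hγ)
      have := hAt _ (Finset.mem_of_mem_filter _ hρ)
      exact ⟨by linarith, by linarith⟩
    · obtain ⟨ρ, hρ, rfl⟩ := Finset.mem_image.mp (hΓ hγ)
      have h1 := hA _ (Finset.mem_of_mem_filter _ hρ)
      have h2 := (Finset.mem_filter.mp hρ).2
      rw [remax, repB] at h2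
      rcases max_cases ρ.re (1 - ρ.re) with ⟨h, -⟩ | ⟨h, -⟩ <;> rw [h] at h2
      · exact ⟨ρ, h1, rfl, by linarith⟩
      · refine ⟨1 - conj ρ, ?_, by simp, by simp; linarith⟩
        rw [xi_one_sub, xi_conj, h1, map_zero]

lemma exp_neg_div_le {L c u : ℝ} (hL : 0 ≤ L) (hc : 0 ≤ c) (hu : 0 < u) :
    Real.exp (-(L * (c / u))) ≤ Real.exp (u - 2 * Real.sqrt (c * L)) := by
  rw [Real.exp_le_exp]
  have h1 := Real.sq_sqrt (mul_nonneg hc hL)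
  have h2 : 2 * Real.sqrt (c * L) * u ≤ u * u + L * c := by
    nlinarith [sq_nonneg (u - Real.sqrt (c * L))]
  have h3 : L * (c / u) * u = L * c := by field_simp
  by_contra! h
  nlinarith

/-- The bound for the contribution of zeros in the `j`-th range of the repulsion estimates. -/
noncomputable def repG (L : ℝ) (j : ℕ) : ℝ :=
  1.6 * Real.exp (-(2 * Real.sqrt (repC j * L)) - repD j)

lemma repG_pos (L : ℝ) (j : ℕ) : 0 < repG L j := by unfold repG; positivity

lemma exp_repB_le {L t : ℝ} (hL : 0 ≤ L) (ht : 290 ≤ t) {j : ℕ} (hj : 1 ≤ j) (hj4 : j ≤ 4) :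
    Real.exp (-(L * repB (1.6 * t) j)) ≤ t * repG L j := by
  have hlog : 6.1398 ≤ Real.log (1.6 * t) :=
    log_464_lower.trans (Real.log_le_log (by norm_num) (by linarith))
  have hu : 0 < Real.log (1.6 * t) - repD j := by
    interval_cases j <;> norm_num [repD] at * <;> linarith
  have hc : 0 ≤ repC j := by interval_cases j <;> norm_num [repC]
  refine (exp_neg_div_le hL hc hu).trans_eq ?_
  rw [repG, sub_sub, Real.exp_sub, Real.exp_log (by linarith), Real.exp_sub, Real.exp_add,
    Real.exp_neg]
  field_simp

lemma sum_blocks_le_sq {α β : ℝ} (hα : 0 ≤ α) (hβ : 0 ≤ β) (T : ℝ) (N : ℕ) :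
    ∑ k ∈ Finset.range N, (α + β * k) * min 1 ((T / (290 * 1.6 ^ k)) ^ 2) ≤
      (T / 290) ^ 2 * (64 / 39 * α + 1600 / 1521 * β) := by
  induction N generalizing α T with
  | zero => simp; positivity
  | succ N ih =>
    rw [Finset.sum_range_succ']
    have h := ih (α := α + β) (by positivity) (T / 1.6)
    have e : ∀ k : ℕ, (α + β * ((k + 1 : ℕ) : ℝ)) * min 1 ((T / (290 * 1.6 ^ (k + 1))) ^ 2) =
        (α + β + β * k) * min 1 ((T / 1.6 / (290 * 1.6 ^ k)) ^ 2) := fun k ↦ by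
      rw [div_div, show (290 * 1.6 ^ (k + 1) : ℝ) = 1.6 * (290 * 1.6 ^ k) by ring]
      push_cast
      ring
    simp_rw [e]
    have h2 : (α + β * ((0 : ℕ) : ℝ)) * min 1 ((T / (290 * 1.6 ^ 0)) ^ 2) ≤
        α * (T / 290) ^ 2 := by
      simp only [Nat.cast_zero, mul_zero, add_zero, pow_zero, mul_one]
      exact mul_le_mul_of_nonneg_left (min_le_right _ _) hα
    refine (add_le_add h h2).trans_eq ?_
    ring

lemma sum_blocks_le {α β κ : ℝ} (hα : 0 ≤ α) (hβ : 0 ≤ β) (hκ : 0 ≤ κ) (N : ℕ) :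
    ∑ k ∈ Finset.range N, (α + β * k) * min 1 ((290 * 1.6 ^ κ / (290 * 1.6 ^ k)) ^ 2) ≤
      α * (κ + 64 / 39) + β * (κ ^ 2 / 2 + (64 / 39 - 1 / 2) * κ + (1600 / 1521 + 1 / 8)) := by
  induction N generalizing α κ with
  | zero =>
    simp only [Finset.range_zero, Finset.sum_empty]
    have : (0 : ℝ) ≤ (64 / 39 - 1 / 2) * κ := by norm_num; linarith
    positivity
  | succ N ih =>
    rw [Finset.sum_range_succ']
    have e : ∀ k : ℕ, (α + β * ((k + 1 : ℕ) : ℝ)) *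
        min 1 ((290 * 1.6 ^ κ / (290 * 1.6 ^ (k + 1))) ^ 2) =
        (α + β + β * k) * min 1 ((290 * (1.6 : ℝ) ^ (κ - 1) / (290 * 1.6 ^ k)) ^ 2) := fun k ↦ by
      rw [Real.rpow_sub_one (by norm_num)]
      push_cast
      rw [show (290 * (1.6 ^ κ / 1.6) / (290 * 1.6 ^ k) : ℝ) =
        290 * 1.6 ^ κ / (290 * 1.6 ^ (k + 1)) by rw [pow_succ]; field_simp]
      ring
    simp_rw [e]
    have h2 : (α + β * ((0 : ℕ) : ℝ)) * min 1 ((290 * (1.6 : ℝ) ^ κ / (290 * 1.6 ^ 0)) ^ 2) ≤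
        α := by
      simp only [Nat.cast_zero, mul_zero, add_zero]
      exact mul_le_of_le_one_right hα (min_le_left _ _)
    rcases le_or_gt 1 κ with h1 | h1
    · refine (add_le_add (ih (α := α + β) (by positivity) (sub_nonneg.mpr h1)) h2).trans_eq ?_
      ring
    · refine (add_le_add (sum_blocks_le_sq (α := α + β) (by positivity) hβ _ N) h2).trans ?_
      have h3 : (290 * (1.6 : ℝ) ^ (κ - 1) / 290) ^ 2 ≤ 25 / 64 * (1 + 1.56 * κ) := by
        have h4 := rpow_one_add_le_one_add_mul_self (s := 1.56) (by norm_num) hκ h1.le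
        have h5 : ((1.6 : ℝ) ^ κ) ^ 2 = (1 + 1.56) ^ κ := by
          rw [← Real.rpow_natCast, ← Real.rpow_mul (by norm_num), mul_comm,
            Real.rpow_mul (by norm_num)]
          norm_num
        rw [mul_div_cancel_left₀ _ (by norm_num), Real.rpow_sub_one (by norm_num), div_pow, h5]
        norm_num at *
        linarith
      have h6 : 0 ≤ 64 / 39 * (α + β) + 1600 / 1521 * β := by positivity
      have h7 := mul_le_mul_of_nonneg_right h3 h6
      nlinarith [mul_nonneg hβ (sq_nonneg (κ - 1 / 2))]

lemma antitoneOn_wt (T : ℝ) {r s : ℝ} (hr : 0 < r) (hs : r ≤ s) : wt T s ≤ wt T r := by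
  unfold wt
  have : (T / s) ^ 2 ≤ (T / r) ^ 2 := by
    rw [div_pow, div_pow]; gcongr
  gcongr

/-- Twice the average over `ρ` and `1 - conj ρ` of `exp (-(1 - Re ρ) L)`. -/
noncomputable def pairExp (L : ℝ) (ρ : ℂ) : ℝ :=
  Real.exp (-((1 - ρ.re) * L)) + Real.exp (-(ρ.re * L))

lemma pairExp_le {L : ℝ} (hL : 0 ≤ L) (ρ : ℂ) :
    pairExp L ρ ≤ Real.exp (-(L * (1 - remax ρ))) + Real.exp (-(L / 2)) := by
  unfold pairExp remax
  rcases max_cases ρ.re (1 - ρ.re) with ⟨h, h'⟩ | ⟨h, h'⟩ <;> rw [h]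
  · refine add_le_add (by rw [mul_comm]) (Real.exp_le_exp.mpr (by nlinarith))
  · rw [add_comm]
    refine add_le_add (by ring_nf; rfl) (Real.exp_le_exp.mpr (by nlinarith))

lemma sum_block_le {L t T : ℝ} (hL : 20 ≤ L) (ht : 290 ≤ t) {A : Finset ℂ}
    (hA : ∀ ρ ∈ A, xi ρ = 0) (hAt : ∀ ρ ∈ A, t ≤ ρ.im ∧ ρ.im < 1.6 * t) :
    ∑ ρ ∈ A, mz ρ * (wt T ρ.im * pairExp L ρ) ≤
      min 1 ((T / t) ^ 2) * ((Real.log (1.6 * t / (2 * Real.pi)) + 1.306) / 1.2) *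
        (repG L 1 + repG L 2 + repG L 3) +
      1.001 * repG L 4 * ∑ ρ ∈ A, mz ρ * min 1 ((T / ρ.im) ^ 2) := by
  classical
  have hlog : 6.1398 ≤ Real.log (1.6 * t) :=
    log_464_lower.trans (Real.log_le_log (by norm_num) (by linarith))
  have e1 := exp_repB_le (L := L) (by linarith) ht (j := 1) (by norm_num) (by norm_num)
  have e2 := exp_repB_le (L := L) (by linarith) ht (j := 2) (by norm_num) (by norm_num)
  have e3 := exp_repB_le (L := L) (by linarith) ht (j := 3) (by norm_num) (by norm_num)
  have e4 := exp_repB_le (L := L) (by linarith) ht (j := 4) (by norm_num) (by norm_num)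
  have n0 := sum_mz_near_le ht hA hAt (J := 0) (by norm_num)
  have n1 := sum_mz_near_le ht hA hAt (J := 1) (by norm_num)
  have n2 := sum_mz_near_le ht hA hAt (J := 2) (by norm_num)
  have n3 := sum_mz_near_le ht hA hAt (J := 3) (by norm_num)
  simp only [zero_add, Nat.reduceAdd, Nat.cast_zero, Nat.cast_one, Nat.cast_ofNat, zero_mul] at n0 n1 n2 n3
  have b12 : repB (1.6 * t) 1 ≤ repB (1.6 * t) 2 := by
    unfold repB repC repD
    norm_num at hlog ⊢
    rw [div_le_div_iff₀ (by linarith) (by linarith)]; linarith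
  have b23 : repB (1.6 * t) 2 ≤ repB (1.6 * t) 3 := by
    unfold repB repC repD
    norm_num at hlog ⊢
    rw [div_le_div_iff₀ (by linarith) (by linarith)]; linarith
  have b34 : repB (1.6 * t) 3 ≤ repB (1.6 * t) 4 := by
    unfold repB repC repD
    norm_num at hlog ⊢
    rw [div_le_div_iff₀ (by linarith) (by linarith)]; linarith
  have b4 : repB (1.6 * t) 4 ≤ 0.073 := by
    unfold repB repC repD
    norm_num at hlog ⊢
    rw [div_le_iff₀ (by linarith)]; linarith
  have hN : 0 ≤ (Real.log (1.6 * t / (2 * Real.pi)) + 1.306) / 1.2 := by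
    have : 0 ≤ Real.log (1.6 * t / (2 * Real.pi)) := by
      refine Real.log_nonneg ?_
      rw [le_div_iff₀ (by positivity)]
      nlinarith [Real.pi_lt_d2]
    positivity
  generalize (Real.log (1.6 * t / (2 * Real.pi)) + 1.306) / 1.2 = N at *
  have half : Real.exp (-(L / 2)) ≤ 0.001 * Real.exp (-(L * repB (1.6 * t) 4)) := by
    have h7 : Real.exp (-7) ≤ 0.001 := by
      rw [Real.exp_neg, inv_le_comm₀ (Real.exp_pos _) (by norm_num)]
      have := Real.sum_le_exp_of_nonneg (x := 7) (by norm_num) 12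
      norm_num [Finset.sum_range_succ, Nat.factorial] at this ⊢
      linarith
    calc _ ≤ Real.exp (-7 + -(L * repB (1.6 * t) 4)) := Real.exp_le_exp.mpr (by nlinarith)
      _ ≤ _ := by rw [Real.exp_add]; gcongr
  have key : ∀ ρ ∈ A, pairExp L ρ ≤ 1.001 * Real.exp (-(L * repB (1.6 * t) 4)) +
      (Real.exp (-(L * repB (1.6 * t) 3)) * (if 1 - remax ρ < repB (1.6 * t) 4 then 1 else 0) +
      (Real.exp (-(L * repB (1.6 * t) 2)) - Real.exp (-(L * repB (1.6 * t) 3))) *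
        (if 1 - remax ρ < repB (1.6 * t) 3 then 1 else 0) +
      (Real.exp (-(L * repB (1.6 * t) 1)) - Real.exp (-(L * repB (1.6 * t) 2))) *
        (if 1 - remax ρ < repB (1.6 * t) 2 then 1 else 0)) := by
    intro ρ hρ
    have h1 := pairExp_le (L := L) (by linarith) ρ
    have hmono : ∀ b, b ≤ 1 - remax ρ → Real.exp (-(L * (1 - remax ρ))) ≤ Real.exp (-(L * b)) :=
      fun b hb ↦ Real.exp_le_exp.mpr (by nlinarith)
    have hp := Real.exp_pos (-(L * repB (1.6 * t) 4))
    rcases lt_or_ge (1 - remax ρ) (repB (1.6 * t) 1) with c1 | c1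
    · exfalso
      have h2 := Finset.single_le_sum (f := mz) (fun ρ _ ↦ mz_nonneg ρ)
        (show ρ ∈ A.filter (fun ρ ↦ 1 - remax ρ < repB (1.6 * t) 1) from
          Finset.mem_filter.mpr ⟨hρ, c1⟩)
      have h3 := one_le_mz (hA ρ hρ)
      linarith
    rcases lt_or_ge (1 - remax ρ) (repB (1.6 * t) 2) with c2 | c2
    · rw [if_pos (by linarith), if_pos (by linarith), if_pos c2]
      linarith [hmono _ c1]
    rcases lt_or_ge (1 - remax ρ) (repB (1.6 * t) 3) with c3 | c3
    · rw [if_pos (by linarith), if_pos c3, if_neg (by linarith)]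
      linarith [hmono _ c2]
    rcases lt_or_ge (1 - remax ρ) (repB (1.6 * t) 4) with c4 | c4
    · rw [if_pos c4, if_neg (by linarith), if_neg (by linarith)]
      linarith [hmono _ c3]
    · rw [if_neg (by linarith), if_neg (by linarith), if_neg (by linarith)]
      linarith [hmono _ c4]
  have m12 : Real.exp (-(L * repB (1.6 * t) 2)) ≤ Real.exp (-(L * repB (1.6 * t) 1)) :=
    Real.exp_le_exp.mpr (by nlinarith)
  have m23 : Real.exp (-(L * repB (1.6 * t) 3)) ≤ Real.exp (-(L * repB (1.6 * t) 2)) :=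
    Real.exp_le_exp.mpr (by nlinarith)
  have m3 := Real.exp_pos (-(L * repB (1.6 * t) 3))
  have m4 := Real.exp_pos (-(L * repB (1.6 * t) 4))
  generalize Real.exp (-(L * repB (1.6 * t) 1)) = x1 at *
  generalize Real.exp (-(L * repB (1.6 * t) 2)) = x2 at *
  generalize Real.exp (-(L * repB (1.6 * t) 3)) = x3 at *
  generalize Real.exp (-(L * repB (1.6 * t) 4)) = x4 at *
  have term : ∀ ρ ∈ A, mz ρ * (wt T ρ.im * pairExp L ρ) ≤
      1.001 * repG L 4 * (mz ρ * min 1 ((T / ρ.im) ^ 2)) +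
      wt T t * (x3 * (if 1 - remax ρ < repB (1.6 * t) 4 then mz ρ else 0) +
        (x2 - x3) * (if 1 - remax ρ < repB (1.6 * t) 3 then mz ρ else 0) +
        (x1 - x2) * (if 1 - remax ρ < repB (1.6 * t) 2 then mz ρ else 0)) := by
    intro ρ hρ
    have hm := mz_nonneg ρ
    have ht' := (hAt ρ hρ).1
    have w0 : 0 ≤ wt T ρ.im := wt_nonneg (by linarith)
    have w1 := antitoneOn_wt T (by linarith) ht'
    have h1 := mul_le_mul_of_nonneg_left (key ρ hρ) w0
    have h2 : wt T ρ.im * x4 ≤ min 1 ((T / ρ.im) ^ 2) * repG L 4 := by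
      have : wt T ρ.im * x4 ≤ wt T ρ.im * (ρ.im * repG L 4) := by
        refine mul_le_mul_of_nonneg_left (e4.trans ?_) w0
        exact mul_le_mul_of_nonneg_right ht' (repG_pos _ _).le
      refine this.trans_eq ?_
      have : ρ.im ≠ 0 := by linarith
      rw [wt]; field_simp
    have i0 (p : Prop) [Decidable p] : (0 : ℝ) ≤ if p then 1 else 0 := by split_ifs <;> norm_num
    have i1 (p : Prop) [Decidable p] : (if p then mz ρ else 0) = mz ρ * if p then 1 else 0 := by
      split_ifs <;> simp
    rw [i1, i1, i1]
    have h3 : 0 ≤ x3 * (if 1 - remax ρ < repB (1.6 * t) 4 then 1 else 0) +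
        (x2 - x3) * (if 1 - remax ρ < repB (1.6 * t) 3 then 1 else 0) +
        (x1 - x2) * (if 1 - remax ρ < repB (1.6 * t) 2 then 1 else 0) :=
      add_nonneg (add_nonneg (mul_nonneg m3.le (i0 _)) (mul_nonneg (by linarith) (i0 _)))
        (mul_nonneg (by linarith) (i0 _))
    have h4 := mul_le_mul_of_nonneg_right w1 h3
    have h5 : wt T ρ.im * pairExp L ρ ≤ 1.001 * repG L 4 * min 1 ((T / ρ.im) ^ 2) +
        wt T t * (x3 * (if 1 - remax ρ < repB (1.6 * t) 4 then 1 else 0) +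
        (x2 - x3) * (if 1 - remax ρ < repB (1.6 * t) 3 then 1 else 0) +
        (x1 - x2) * (if 1 - remax ρ < repB (1.6 * t) 2 then 1 else 0)) := by
      linarith
    refine (mul_le_mul_of_nonneg_left h5 hm).trans_eq ?_
    ring
  refine (Finset.sum_le_sum term).trans ?_
  rw [Finset.sum_add_distrib, ← Finset.mul_sum, ← Finset.mul_sum, Finset.sum_add_distrib,
    Finset.sum_add_distrib, ← Finset.mul_sum, ← Finset.mul_sum, ← Finset.mul_sum,
    ← Finset.sum_filter, ← Finset.sum_filter, ← Finset.sum_filter, add_comm]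
  refine add_le_add ?_ le_rfl
  have h1 : x3 * (∑ ρ ∈ A with 1 - remax ρ < repB (1.6 * t) 4, mz ρ) +
      (x2 - x3) * (∑ ρ ∈ A with 1 - remax ρ < repB (1.6 * t) 3, mz ρ) +
      (x1 - x2) * (∑ ρ ∈ A with 1 - remax ρ < repB (1.6 * t) 2, mz ρ) ≤
      x3 * (3 * N) + (x2 - x3) * (2 * N) + (x1 - x2) * (1 * N) := by
    gcongr
  refine (mul_le_mul_of_nonneg_left h1 (wt_nonneg (by linarith))).trans ?_
  have h2 : x3 * (3 * N) + (x2 - x3) * (2 * N) + (x1 - x2) * (1 * N) ≤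
      t * (N * (repG L 1 + repG L 2 + repG L 3)) := by
    nlinarith
  refine (mul_le_mul_of_nonneg_left h2 (wt_nonneg (by linarith))).trans_eq ?_
  have : t ≠ 0 := by linarith
  rw [wt]; field_simp

lemma logDeriv_xi_one : logDeriv xi 1 = -logDeriv xi 0 := by
  have e : xi = fun s ↦ xi (1 - s) := funext fun s ↦ (xi_one_sub s).symm
  have h1 : deriv xi 0 = -deriv xi 1 := by
    conv_lhs => rw [e]
    rw [deriv_comp_const_sub, sub_zero]
  rw [logDeriv_apply, logDeriv_apply, h1, xi_zero, xi_one]; ring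

lemma logDeriv_xi_one_re_le : (logDeriv xi 1).re ≤ 0.0679 := by
  rw [logDeriv_xi_one, logDeriv_xi_zero]
  have h4 : Real.log (4 * Real.pi) = Real.log 2 + Real.log (2 * Real.pi) := by
    rw [← Real.log_mul (by norm_num) (by positivity)]; ring_nf
  have := log_two_pi_lower
  have := Real.log_two_gt_d9
  have := Real.eulerMascheroniConstant_lt_two_thirds
  rw [show (-((Real.log (4 * Real.pi) : ℂ) / 2 - (Real.eulerMascheroniConstant : ℂ) / 2 - 1)) =
    ((-(Real.log (4 * Real.pi) / 2 - Real.eulerMascheroniConstant / 2 - 1) : ℝ) : ℂ) by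
      push_cast; ring, ofReal_re, h4]
  norm_num at *
  linarith

lemma sum_pairTerm_le {σ : ℝ} (hσ : 1 ≤ σ) (A : Finset ℂ) :
    ∑ ρ ∈ A, mz ρ * (pairTerm σ ρ.re ρ.im / 2) ≤ (logDeriv xi σ).re := by
  have h := hasSum_pairTerm hσ 0
  simp only [sub_zero, ofReal_zero, zero_mul, add_zero] at h
  refine sum_le_hasSum A (fun ρ _ ↦ ?_) h
  by_cases hρ : xi ρ = 0
  · have := xi_zero_re hρ
    exact mul_nonneg (mz_nonneg ρ) (div_nonneg (pairTerm_nonneg hσ this.1 this.2) two_pos.le)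
  · rw [mz_eq_zero hρ, zero_mul]

lemma sum_low_le {A : Finset ℂ} (hA : ∀ ρ ∈ A, xi ρ = 0 ∧ |ρ.im| ≤ 290 ∧ ρ.re = 1 / 2) :
    ∑ ρ ∈ A, mz ρ / ‖ρ‖ ≤ 39.4 := by
  have h := sum_pairTerm_le le_rfl A
  have h1 := logDeriv_xi_one_re_le
  have h2 : ∑ ρ ∈ A, mz ρ / ‖ρ‖ ≤ ∑ ρ ∈ A, mz ρ * (pairTerm 1 ρ.re ρ.im / 2) * 580.002 := by
    refine Finset.sum_le_sum fun ρ hρ ↦ ?_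
    obtain ⟨a1, a2, a3⟩ := hA ρ hρ
    have hn : ‖ρ‖ ^ 2 = 1 / 4 + ρ.im ^ 2 := by
      rw [← normSq_eq_norm_sq, normSq_apply, a3]; ring
    have hn0 : 0 < ‖ρ‖ := by have := norm_gt_of_xi_zero a1; linarith
    have hn1 : ‖ρ‖ ≤ 290.001 := by
      have : ρ.im ^ 2 ≤ 290 ^ 2 := sq_le_sq' (by linarith [neg_abs_le ρ.im])
        (le_trans (le_abs_self _) a2)
      nlinarith
    have e : pairTerm 1 ρ.re ρ.im / 2 = 1 / (2 * ‖ρ‖ ^ 2) := by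
      rw [pairTerm, a3, hn]
      have : 0 < 1 / 4 + ρ.im ^ 2 := by positivity
      field_simp
      ring
    rw [e, div_eq_mul_inv, mul_assoc]
    refine mul_le_mul_of_nonneg_left ?_ (mz_nonneg ρ)
    rw [div_mul_eq_mul_div, le_div_iff₀ (by positivity)]
    field_simp
    linarith
  rw [← Finset.sum_mul] at h2
  push_cast at h
  nlinarith

lemma logDeriv_xi_re_le {M : ℝ} (hM : 0 < M) :
    (logDeriv xi ((M + 1 : ℝ) : ℂ)).re ≤
      1 / M + Real.log ((M + 3) / (2 * Real.pi)) / 2 := by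
  have h := re_logDeriv_xi_eq (σ := M + 1) (by linarith) 0
  simp only [ofReal_zero, zero_mul, add_zero, zero_div] at h
  rw [h, digamma_ofReal (by linarith), ofReal_re]
  have h1 := psi_le_log (x := (M + 1 + 2) / 2) (by linarith)
  have h2 : 0 ≤ (-(deriv riemannZeta ((M + 1 : ℝ) : ℂ) / riemannZeta ((M + 1 : ℝ) : ℂ))).re := by
    have := hasSum_vonMangoldt_cos (σ := M + 1) (by linarith) 0
    simp only [ofReal_zero, zero_mul, add_zero] at this
    refine this.nonneg fun n ↦ ?_
    rw [Real.cos_zero, mul_one]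
    exact mul_nonneg ArithmeticFunction.vonMangoldt_nonneg (Real.exp_pos _).le
  have e : (M + 3) / (2 * Real.pi) = ((M + 1 + 2) / 2) / Real.pi := by
    rw [div_div]; ring_nf
  rw [e, Real.log_div (by linarith) Real.pi_ne_zero]
  have e2 : (M + 1 - 1) / ((M + 1 - 1) ^ 2 + 0 ^ 2) = 1 / M := by
    rw [add_sub_cancel_right]; field_simp; ring
  rw [e2]
  linarith

lemma two_mul_div_le_pairTerm {M β γ : ℝ} (hM : 290 ≤ M) (hγ : 290 ≤ γ) (h0 : 0 < β) (h1 : β < 1) :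
    2 * M / (1.007 * (M ^ 2 + γ ^ 2)) ≤ pairTerm (M + 1) β γ := by
  have key : ∀ u, M ≤ u → u ≤ M + 1 →
      M / (1.007 * (M ^ 2 + γ ^ 2)) ≤ u / (u ^ 2 + γ ^ 2) := fun u hu hu' ↦ by
    have : 0 < u := by linarith
    rw [div_le_div_iff₀ (by positivity) (by positivity)]
    have : u ^ 2 + γ ^ 2 ≤ 1.007 * (M ^ 2 + γ ^ 2) := by nlinarith
    gcongr
  have k1 := key (M + 1 - β) (by linarith) (by linarith)
  have k2 := key (M + 1 - 1 + β) (by linarith) (by linarith)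
  unfold pairTerm
  rw [two_mul, add_div]
  linarith

lemma sum_union_conj_le {A : Finset ℂ} (hA : ∀ ρ ∈ A, 0 < ρ.im) {f : ℂ → ℝ}
    (hf : ∀ ρ, f (conj ρ) = f ρ) {B : ℝ} (h : ∀ A' : Finset ℂ, ∑ ρ ∈ A', f ρ ≤ B) :
    2 * ∑ ρ ∈ A, f ρ ≤ B := by
  classical
  have hd : Disjoint A (A.image conj) := by
    rw [Finset.disjoint_left]
    rintro ρ hρ h'
    obtain ⟨ρ', h1, rfl⟩ := Finset.mem_image.mp h'
    have := hA _ hρ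
    have := hA _ h1
    rw [conj_im] at *
    linarith
  have h1 := h (A ∪ A.image conj)
  rw [Finset.sum_union hd, Finset.sum_image ((starRingEnd ℂ).injective.injOn)] at h1
  simp only [hf] at h1
  linarith

lemma sum_min_sq_le {A : Finset ℂ} (hA : ∀ ρ ∈ A, xi ρ = 0 ∧ 290 ≤ ρ.im) {T M : ℝ}
    (hM : 290 ≤ M) (hT : T = M ∨ M = 290) :
    ∑ ρ ∈ A, mz ρ * min 1 ((T / ρ.im) ^ 2) ≤
      1.007 * (T ^ 2 / M) * (1 / M + Real.log ((M + 3) / (2 * Real.pi)) / 2) := by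
  have h := sum_union_conj_le (A := A) (fun ρ hρ ↦ by linarith [(hA ρ hρ).2])
    (f := fun ρ ↦ mz ρ * (pairTerm (M + 1) ρ.re ρ.im / 2))
    (fun ρ ↦ by simp only [mz_conj, conj_re, conj_im, pairTerm, neg_sq])
    (fun A' ↦ (sum_pairTerm_le (σ := M + 1) (by linarith) A').trans
      (logDeriv_xi_re_le (M := M) (by linarith)))
  have h2 : ∑ ρ ∈ A, mz ρ * min 1 ((T / ρ.im) ^ 2) ≤
      1.007 * (T ^ 2 / M) * (2 * ∑ ρ ∈ A, mz ρ * (pairTerm (M + 1) ρ.re ρ.im / 2)) := by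
    rw [Finset.mul_sum, Finset.mul_sum]
    refine Finset.sum_le_sum fun ρ hρ ↦ ?_
    obtain ⟨a1, a2⟩ := hA ρ hρ
    have a3 := xi_zero_re a1
    have p := two_mul_div_le_pairTerm hM a2 a3.1 a3.2
    have : min 1 ((T / ρ.im) ^ 2) ≤ 1.007 * (T ^ 2 / M) * pairTerm (M + 1) ρ.re ρ.im := by
      have hM0 : 0 < M := by linarith
      have hγ0 : 0 < ρ.im := by linarith
      refine le_trans ?_ (mul_le_mul_of_nonneg_left p (by positivity))
      have e : 1.007 * (T ^ 2 / M) * (2 * M / (1.007 * (M ^ 2 + ρ.im ^ 2))) =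
          2 * T ^ 2 / (M ^ 2 + ρ.im ^ 2) := by field_simp
      rw [e]
      have hc : (T = M ∧ ρ.im ≤ M) ∨ M ≤ ρ.im := by
        rcases hT with h | h
        · exact (le_total ρ.im M).imp_left fun c ↦ ⟨h, c⟩
        · exact .inr (h.trans_le a2)
      rcases hc with ⟨rfl, c⟩ | c
      · refine (min_le_left _ _).trans ?_
        rw [le_div_iff₀ (by positivity)]; nlinarith
      · refine (min_le_right _ _).trans ?_
        rw [div_pow, div_le_div_iff₀ (by positivity) (by positivity)]
        have : 0 ≤ T ^ 2 := by positivity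
        nlinarith [mul_le_mul_of_nonneg_left (pow_le_pow_left₀ hM0.le c 2) this]
    have := mul_le_mul_of_nonneg_left this (mz_nonneg ρ)
    refine this.trans_eq ?_
    ring
  refine h2.trans (mul_le_mul_of_nonneg_left h ?_)
  positivity

lemma log_block_le (k : ℕ) :
    (Real.log (1.6 * (290 * 1.6 ^ k) / (2 * Real.pi)) + 1.306) / 1.2 ≤ 4.68 + 0.39175 * k := by
  have h2 := Real.log_two_lt_d9
  have e : Real.log (1.6 * (290 * 1.6 ^ k) / (2 * Real.pi)) =
      9 * Real.log 2 + Real.log (29 / 32) + k * Real.log 1.6 - Real.log (2 * Real.pi) := by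
    rw [Real.log_div (by positivity) (by positivity),
      show (1.6 * (290 * 1.6 ^ k) : ℝ) = 2 ^ 9 * (29 / 32) * 1.6 ^ k by norm_num; ring,
      Real.log_mul (by positivity) (by positivity), Real.log_mul (by positivity) (by positivity),
      Real.log_pow, Real.log_pow]
    push_cast; ring
  have h3 := Real.log_le_sub_one_of_pos (x := 29 / 32) (by norm_num)
  have h4 : Real.log 1.6 ≤ 0.4701 := by
    have e4 : 3 * Real.log 1.6 = 2 * Real.log 2 + Real.log 1.024 := by
      rw [← Nat.cast_ofNat (R := ℝ) (n := 3), ← Nat.cast_ofNat (R := ℝ) (n := 2), ← Real.log_pow,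
        ← Real.log_pow, ← Real.log_mul (by norm_num) (by norm_num)]
      norm_num
    have := Real.log_le_sub_one_of_pos (x := 1.024) (by norm_num)
    norm_num at *
    linarith
  have h5 := log_two_pi_lower
  have hk : (k : ℝ) * Real.log 1.6 ≤ k * 0.4701 := by gcongr
  rw [e, div_le_iff₀ (by norm_num)]
  norm_num at *
  linarith

lemma sum_upper_le {L T S M : ℝ} (hL : 20 ≤ L)
    (hS : ∀ N : ℕ, ∑ k ∈ Finset.range N,
      (4.68 + 0.39175 * (k : ℝ)) * min 1 ((T / (290 * 1.6 ^ k)) ^ 2) ≤ S)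
    (hM : 290 ≤ M) (hT : T = M ∨ M = 290)
    {A : Finset ℂ} (hA : ∀ ρ ∈ A, xi ρ = 0 ∧ 290 ≤ ρ.im) :
    ∑ ρ ∈ A, mz ρ * (wt T ρ.im * pairExp L ρ) ≤ S * (repG L 1 + repG L 2 + repG L 3) +
      1.001 * repG L 4 *
        (1.007 * (T ^ 2 / M) * (1 / M + Real.log ((M + 3) / (2 * Real.pi)) / 2)) := by
  classical
  have hk : ∀ ρ : ℂ, ∃ k : ℕ, 290 ≤ ρ.im → 290 * 1.6 ^ k ≤ ρ.im ∧ ρ.im < 1.6 * (290 * 1.6 ^ k) := by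
    intro ρ
    by_cases h : 290 ≤ ρ.im
    · obtain ⟨k, h1, h2⟩ := exists_nat_pow_near (x := ρ.im / 290) (y := 1.6)
        (by rw [le_div_iff₀ (by norm_num)]; linarith) (by norm_num)
      refine ⟨k, fun _ ↦ ?_⟩
      rw [le_div_iff₀ (by norm_num)] at h1
      rw [div_lt_iff₀ (by norm_num), pow_succ] at h2
      constructor <;> linarith
    · exact ⟨0, fun h' ↦ absurd h' h⟩
  choose k hk using hk
  obtain ⟨N, hN⟩ : ∃ N, ∀ ρ ∈ A, k ρ ∈ Finset.range N :=
    ⟨A.sup k + 1, fun ρ hρ ↦ Finset.mem_range_succ_iff.mpr (Finset.le_sup hρ)⟩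
  have g1 := repG_pos L 1
  have g2 := repG_pos L 2
  have g3 := repG_pos L 3
  have g4 := repG_pos L 4
  rw [← Finset.sum_fiberwise_of_maps_to hN]
  have step : ∀ j ∈ Finset.range N, ∑ ρ ∈ A with k ρ = j, mz ρ * (wt T ρ.im * pairExp L ρ) ≤
      (4.68 + 0.39175 * j) * min 1 ((T / (290 * 1.6 ^ j)) ^ 2) *
        (repG L 1 + repG L 2 + repG L 3) +
      1.001 * repG L 4 * ∑ ρ ∈ A with k ρ = j, mz ρ * min 1 ((T / ρ.im) ^ 2) := by
    intro j _
    have h290 : (290 : ℝ) ≤ 290 * 1.6 ^ j :=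
      le_mul_of_one_le_right (by norm_num) (one_le_pow₀ (by norm_num))
    refine (sum_block_le hL h290 (fun ρ hρ ↦ (hA ρ (Finset.mem_filter.mp hρ).1).1)
      (fun ρ hρ ↦ ?_)).trans ?_
    · obtain ⟨h1, rfl⟩ := Finset.mem_filter.mp hρ
      exact hk ρ (hA ρ h1).2
    · refine add_le_add ?_ le_rfl
      rw [mul_comm (min _ _)]
      gcongr
      exact log_block_le j
  refine (Finset.sum_le_sum step).trans ?_
  rw [Finset.sum_add_distrib, ← Finset.sum_mul, ← Finset.mul_sum,
    Finset.sum_fiberwise_of_maps_to hN]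
  have := sum_min_sq_le hA hM hT
  gcongr
  exact hS N

lemma sum_high_le {L T B : ℝ}
    (hB : ∀ A : Finset ℂ, (∀ ρ ∈ A, xi ρ = 0 ∧ 290 ≤ ρ.im) →
      ∑ ρ ∈ A, mz ρ * (wt T ρ.im * pairExp L ρ) ≤ B)
    {A : Finset ℂ} (hA : ∀ ρ ∈ A, xi ρ = 0 ∧ 290 ≤ |ρ.im|) :
    ∑ ρ ∈ A, mz ρ * (Real.exp (ρ.re * L) * wt T ‖ρ‖) ≤ Real.exp L * B := by
  classical
  let f : ℂ → ℝ := fun ρ ↦ mz ρ * (Real.exp (ρ.re * L) * wt T |ρ.im|)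
  have hf0 : ∀ ρ, 0 ≤ f ρ := fun ρ ↦ mul_nonneg (mz_nonneg ρ)
    (mul_nonneg (Real.exp_pos _).le (wt_nonneg (abs_nonneg _)))
  have h1 : ∑ ρ ∈ A, mz ρ * (Real.exp (ρ.re * L) * wt T ‖ρ‖) ≤ ∑ ρ ∈ A, f ρ := by
    refine Finset.sum_le_sum fun ρ hρ ↦ ?_
    refine mul_le_mul_of_nonneg_left (mul_le_mul_of_nonneg_left ?_ (Real.exp_pos _).le)
      (mz_nonneg ρ)
    exact antitoneOn_wt T (by linarith [(hA ρ hρ).2]) (abs_im_le_norm ρ)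
  let up : ℂ → ℂ := fun ρ ↦ if 0 < ρ.im then ρ else conj ρ
  let r : ℂ → ℂ := fun ρ ↦ 1 - conj ρ
  have hrr : ∀ ρ, r (r ρ) = ρ := fun ρ ↦ by simp [r]
  have xi_r : ∀ ρ, xi (r ρ) = conj (xi ρ) := fun ρ ↦ by simp only [r, xi_one_sub, xi_conj]
  have mz_r : ∀ ρ, mz (r ρ) = mz ρ := fun ρ ↦ by simp only [r, mz_one_sub, mz_conj]
  have im_r : ∀ ρ, (r ρ).im = ρ.im := fun ρ ↦ by simp [r]
  have re_r : ∀ ρ, (r ρ).re = 1 - ρ.re := fun ρ ↦ by simp [r]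
  have hup : ∀ ρ ∈ A, xi (up ρ) = 0 ∧ 290 ≤ (up ρ).im := by
    intro ρ hρ
    obtain ⟨a1, a2⟩ := hA ρ hρ
    simp only [up]
    split_ifs with h
    · exact ⟨a1, by rwa [abs_of_pos h] at a2⟩
    · exact ⟨by rw [xi_conj, a1, map_zero], by rwa [abs_of_nonpos (not_lt.mp h)] at a2⟩
  let P := A.image up ∪ (A.image up).image r
  have hP : ∀ ρ ∈ P, xi ρ = 0 ∧ 290 ≤ ρ.im := by
    intro ρ hρ
    rcases Finset.mem_union.mp hρ with h | h
    · obtain ⟨x, hx, rfl⟩ := Finset.mem_image.mp h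
      exact hup x hx
    · obtain ⟨y, hy, rfl⟩ := Finset.mem_image.mp h
      obtain ⟨x, hx, rfl⟩ := Finset.mem_image.mp hy
      rw [xi_r, im_r, (hup x hx).1, map_zero]
      exact ⟨rfl, (hup x hx).2⟩
  have hPr : ∀ ρ ∈ P, r ρ ∈ P := by
    intro ρ hρ
    rcases Finset.mem_union.mp hρ with h | h
    · exact Finset.mem_union_right _ (Finset.mem_image_of_mem r h)
    · obtain ⟨y, hy, rfl⟩ := Finset.mem_image.mp h
      rw [hrr]
      exact Finset.mem_union_left _ hy
  have hsub : A ⊆ P ∪ P.image conj := by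
    intro ρ hρ
    have hu : up ρ ∈ P := Finset.mem_union_left _ (Finset.mem_image_of_mem up hρ)
    by_cases h : 0 < ρ.im
    · simp only [up, if_pos h] at hu
      exact Finset.mem_union_left _ hu
    · simp only [up, if_neg h] at hu
      refine Finset.mem_union_right _ (Finset.mem_image.mpr ⟨_, hu, by simp⟩)
  have hfc : ∀ ρ, f (conj ρ) = f ρ := fun ρ ↦ by
    simp only [f, mz_conj, conj_re, conj_im, abs_neg]
  have h2 : ∑ ρ ∈ A, f ρ ≤ 2 * ∑ ρ ∈ P, f ρ := by
    refine (Finset.sum_le_sum_of_subset_of_nonneg hsub fun ρ _ _ ↦ hf0 ρ).trans ?_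
    have := Finset.sum_union_inter (s₁ := P) (s₂ := P.image conj) (f := f)
    have h0 := Finset.sum_nonneg (s := P ∩ P.image conj) fun ρ _ ↦ hf0 ρ
    rw [Finset.sum_image (starRingEnd ℂ).injective.injOn] at this
    simp only [hfc] at this
    linarith
  have h3 : ∑ ρ ∈ P, f ρ = ∑ ρ ∈ P, f (r ρ) :=
    Finset.sum_nbij' r r hPr hPr (fun ρ _ ↦ hrr ρ) (fun ρ _ ↦ hrr ρ) (fun ρ _ ↦ by rw [hrr])
  have h4 : 2 * ∑ ρ ∈ P, f ρ = Real.exp L * ∑ ρ ∈ P, mz ρ * (wt T ρ.im * pairExp L ρ) := by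
    rw [two_mul]
    nth_rewrite 2 [h3]
    rw [← Finset.sum_add_distrib, Finset.mul_sum]
    refine Finset.sum_congr rfl fun ρ hρ ↦ ?_
    simp only [f, mz_r, im_r, re_r, pairExp]
    rw [abs_of_pos (by linarith [(hP ρ hρ).2]),
      show ρ.re * L = L + -((1 - ρ.re) * L) by ring,
      show (1 - ρ.re) * L = L + -(ρ.re * L) by ring, Real.exp_add, Real.exp_add]
    ring_nf
  rw [h4] at h2
  exact (h1.trans h2).trans (mul_le_mul_of_nonneg_left (hB P hP) (Real.exp_pos _).le)

lemma zeroSum_le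
    (hRH : ∀ ρ : ℂ, xi ρ = 0 → |ρ.im| ≤ 290 → ρ.re = 1 / 2) {L T S M : ℝ} (hL : 20 ≤ L)
    (hS : ∀ N : ℕ, ∑ k ∈ Finset.range N,
      (4.68 + 0.39175 * (k : ℝ)) * min 1 ((T / (290 * 1.6 ^ k)) ^ 2) ≤ S)
    (hM : 290 ≤ M) (hT : T = M ∨ M = 290) :
    zeroSum T L ≤ Real.exp L * (39.4 * Real.exp (-(L / 2)) +
      (S * (repG L 1 + repG L 2 + repG L 3) + 1.001 * repG L 4 *
        (1.007 * (T ^ 2 / M) * (1 / M + Real.log ((M + 3) / (2 * Real.pi)) / 2)))) := by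
  classical
  refine Summable.tsum_le_of_sum_le (summable_zeroSum T (by linarith)) fun A ↦ ?_
  rw [← Finset.sum_filter_add_sum_filter_not A (fun ρ ↦ xi ρ = 0),
    Finset.sum_eq_zero (s := A.filter fun ρ ↦ ¬ xi ρ = 0) (fun ρ hρ ↦ by
      rw [mz_eq_zero (Finset.mem_filter.mp hρ).2, zero_mul]), add_zero,
    ← Finset.sum_filter_add_sum_filter_not (A.filter fun ρ ↦ xi ρ = 0) (fun ρ ↦ |ρ.im| ≤ 290),
    mul_add]
  refine add_le_add ?_ (sum_high_le
    (fun A' hA' ↦ sum_upper_le hL hS hM hT hA') fun ρ hρ ↦ ?_)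
  · have h := sum_low_le (A := (A.filter fun ρ ↦ xi ρ = 0).filter fun ρ ↦ |ρ.im| ≤ 290)
      (fun ρ hρ ↦ by
        simp only [Finset.mem_filter] at hρ
        exact ⟨hρ.1.2, hρ.2, hRH ρ hρ.1.2 hρ.2⟩)
    rw [mul_left_comm, ← Real.exp_add, show L + -(L / 2) = 1 / 2 * L by ring]
    refine le_trans ?_ (mul_le_mul_of_nonneg_right h (Real.exp_pos _).le)
    rw [Finset.sum_mul]
    refine Finset.sum_le_sum fun ρ hρ ↦ ?_
    simp only [Finset.mem_filter] at hρ
    rw [hRH ρ hρ.1.2 hρ.2, div_eq_mul_one_div (mz ρ), mul_assoc, mul_comm (1 / ‖ρ‖)]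
    refine mul_le_mul_of_nonneg_left ?_ (mz_nonneg ρ)
    exact mul_le_mul_of_nonneg_left (wt_le_one_div (norm_nonneg ρ)) (Real.exp_pos _).le
  · simp only [Finset.mem_filter, not_le] at hρ
    exact ⟨hρ.1.2, hρ.2.le⟩

lemma hasDerivAt_max_sq (a u : ℝ) :
    HasDerivAt (fun u ↦ max (u - a) 0 ^ 2 / 2) (max (u - a) 0) u := by
  rw [hasDerivAt_iff_isLittleO]
  refine Asymptotics.IsBigO.trans_isLittleO (g := fun y ↦ (y - u) ^ 2) ?_ ?_
  · refine Asymptotics.IsBigO.of_bound 1 (Eventually.of_forall fun y ↦ ?_)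
    rw [Real.norm_eq_abs, Real.norm_eq_abs, abs_of_nonneg (sq_nonneg (y - u)), one_mul, smul_eq_mul,
      abs_le]
    rcases max_cases (u - a) 0 with ⟨h1, h1'⟩ | ⟨h1, h1'⟩ <;>
    rcases max_cases (y - a) 0 with ⟨h2, h2'⟩ | ⟨h2, h2'⟩ <;> rw [h1, h2] <;>
    constructor <;> nlinarith
  · have h := Asymptotics.isLittleO_pow_id (𝕜 := ℝ) (n := 2) (by norm_num)
    have ht : Tendsto (fun y : ℝ ↦ y - u) (𝓝 u) (𝓝 0) := by
      have : Continuous fun y : ℝ ↦ y - u := by fun_prop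
      simpa using this.tendsto u
    exact h.comp_tendsto ht

/-- The integrated form `(exp (w u) - 1) / w ^ 2` of `exp (w u) / w`. -/
noncomputable def phi1 (w : ℂ) (u : ℝ) : ℂ := (cexp (w * u) - 1) / w ^ 2

lemma hasDerivAt_phi {w : ℂ} (hw : w ≠ 0) (u : ℝ) : HasDerivAt (phi w) (phi1 w u) u := by
  have h0 : HasDerivAt (fun u : ℝ ↦ (u : ℂ)) 1 u := ofRealCLM.hasDerivAt
  have h1 : HasDerivAt (fun u : ℝ ↦ w * (u : ℂ)) w u := by simpa using h0.const_mul w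
  have h2 := ((h1.cexp.sub_const 1).sub h1).div_const (w ^ 3)
  refine h2.congr_deriv ?_
  rw [phi1]; field_simp

lemma norm_phi1_le {w : ℂ} (hw : w.re ≤ 1) {u : ℝ} (hu : 0 ≤ u) :
    ‖phi1 w u‖ ≤ 2 * Real.exp u / ‖w‖ ^ 2 := by
  rw [phi1, norm_div, norm_pow]
  gcongr
  refine (norm_sub_le _ _).trans ?_
  rw [Complex.norm_exp, norm_one, re_mul_ofReal, two_mul]
  refine add_le_add (Real.exp_le_exp.mpr (by nlinarith)) (Real.one_le_exp hu)

open ArithmeticFunction in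
/-- The integral of the Chebyshev function `psi ∘ exp`. -/
noncomputable def psiInt (u : ℝ) : ℝ := ∑' n : ℕ, Λ n * max (u - Real.log n) 0

open ArithmeticFunction in
lemma psiInt_eq_sum {u : ℝ} {N : ℕ} (hN : Real.exp u ≤ N) :
    psiInt u = ∑ n ∈ Finset.Ioc 0 N, Λ n * max (u - Real.log n) 0 := by
  rw [psiInt, tsum_eq_sum]
  intro n hn
  rcases Nat.eq_zero_or_pos n with rfl | hn0
  · simp
  have h1 : N < n := by
    by_contra h
    exact hn (Finset.mem_Ioc.mpr ⟨hn0, not_lt.mp h⟩)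
  have h2 : u ≤ Real.log n := by
    rw [Real.le_log_iff_exp_le (by positivity)]
    exact hN.trans (by exact_mod_cast h1.le)
  rw [max_eq_right (by linarith)]; simp

lemma hasDerivAt_psiSm (u : ℝ) : HasDerivAt psiSm (psiInt u) u := by
  obtain ⟨N, hN⟩ := exists_nat_ge (Real.exp (u + 1))
  rw [psiInt_eq_sum ((Real.exp_le_exp.mpr (by linarith)).trans hN)]
  have h : HasDerivAt (fun u ↦ ∑ n ∈ Finset.Ioc 0 N, ArithmeticFunction.vonMangoldt n *
      (max (u - Real.log n) 0 ^ 2 / 2))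
      (∑ n ∈ Finset.Ioc 0 N, ArithmeticFunction.vonMangoldt n * max (u - Real.log n) 0) u :=
    HasDerivAt.fun_sum fun n _ ↦ (hasDerivAt_max_sq _ u).const_mul _
  refine h.congr_of_eventuallyEq ?_
  filter_upwards [gt_mem_nhds (show u < u + 1 by linarith)] with v hv
  exact psiSm_eq_sum ((Real.exp_le_exp.mpr hv.le).trans hN)

lemma norm_mz_phi1_le {u R : ℝ} (hu : 0 ≤ u) (hR : u ≤ R) (ρ : ℂ) :
    ‖(mz ρ : ℂ) * phi1 ρ u‖ ≤ 2 * Real.exp R * (mz ρ / ‖ρ‖ ^ 2) := by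
  rcases eq_or_ne (xi ρ) 0 with h | h
  · rw [norm_mul, Complex.norm_real, Real.norm_of_nonneg (mz_nonneg _)]
    refine (mul_le_mul_of_nonneg_left (norm_phi1_le (xi_zero_re h).2.le hu)
      (mz_nonneg ρ)).trans ?_
    have := Real.exp_le_exp.mpr hR
    have := mz_nonneg ρ
    calc _ = 2 * Real.exp u * (mz ρ / ‖ρ‖ ^ 2) := by ring
      _ ≤ _ := by gcongr
  · simp [mz_eq_zero h]

lemma norm_phi1_trivial_le {u : ℝ} (hu : 0 ≤ u) (k : ℕ) :
    ‖phi1 (-(2 * (k + 1))) u‖ ≤ 1 / 4 * (1 / ((k : ℝ) + 1) ^ 2) := by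
  have hk : (-(2 * ((k : ℂ) + 1))) = ((-(2 * ((k : ℝ) + 1)) : ℝ) : ℂ) := by push_cast; ring
  rw [hk, phi1, ← ofReal_mul, ← ofReal_exp, ← ofReal_one, ← ofReal_sub, ← ofReal_pow, ← ofReal_div,
    norm_real, norm_div, norm_pow]
  have h1 : ‖Real.exp (-(2 * ((k : ℝ) + 1)) * u) - 1‖ ≤ 1 := by
    rw [Real.norm_eq_abs, abs_le]
    have := Real.exp_pos (-(2 * ((k : ℝ) + 1)) * u)
    have : Real.exp (-(2 * ((k : ℝ) + 1)) * u) ≤ 1 := Real.exp_le_one_iff.mpr (by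
      have : 0 ≤ 2 * ((k : ℝ) + 1) * u := by positivity
      linarith)
    constructor <;> linarith
  have h2 : ‖-(2 * ((k : ℝ) + 1))‖ ^ 2 = 4 * ((k : ℝ) + 1) ^ 2 := by
    rw [Real.norm_eq_abs, sq_abs]; ring
  rw [h2, div_le_iff₀ (by positivity)]
  exact h1.trans_eq (by field_simp)

lemma psiInt_eq {u : ℝ} (hu : 0 ≤ u) :
    (psiInt u : ℂ) = phi1 1 u - ∑' ρ, (mz ρ : ℂ) * phi1 ρ u - ∑' k : ℕ, phi1 (-(2 * (k + 1))) u -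
      Real.log (2 * Real.pi) * u := by
  rcases hu.eq_or_lt with rfl | hu
  · have : psiInt 0 = 0 := by
      rw [psiInt_eq_sum (N := 1) (by simp)]; simp
    simp [this, phi1]
  have hopen : IsOpen (Ioo 0 (u + 1)) := isOpen_Ioo
  have hmem : u ∈ Ioo 0 (u + 1) := ⟨hu, by linarith⟩
  have d1 : HasDerivAt (fun u ↦ ∑' ρ, (mz ρ : ℂ) * phi ρ u) (∑' ρ, (mz ρ : ℂ) * phi1 ρ u) u := by
    refine hasDerivAt_tsum_of_isPreconnected (g := fun ρ u ↦ (mz ρ : ℂ) * phi ρ u)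
      (g' := fun ρ u ↦ (mz ρ : ℂ) * phi1 ρ u) (summable_mz_div_sq.mul_left (2 * Real.exp (u + 1)))
      hopen isPreconnected_Ioo (fun ρ y hy ↦ ?_) (fun ρ y hy ↦ ?_) hmem (summable_mz_phi hu.le) hmem
    · rcases eq_or_ne (xi ρ) 0 with h | h
      · have := norm_gt_of_xi_zero h
        exact (hasDerivAt_phi (norm_pos_iff.mp (by linarith)) y).const_mul _
      · have e : (mz ρ : ℂ) = 0 := by rw [mz_eq_zero h, ofReal_zero]
        simp only [e, zero_mul]
        exact hasDerivAt_const y 0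
    · exact norm_mz_phi1_le hy.1.le hy.2.le ρ
  have d2 : HasDerivAt (fun u ↦ ∑' k : ℕ, phi (-(2 * (k + 1))) u)
      (∑' k : ℕ, phi1 (-(2 * (k + 1))) u) u := by
    refine hasDerivAt_tsum_of_isPreconnected (g := fun k : ℕ ↦ phi (-(2 * (k + 1))))
      (g' := fun k : ℕ ↦ phi1 (-(2 * (k + 1)))) (summable_one_div_succ_sq.mul_left (1/4))
      hopen isPreconnected_Ioo (fun k y hy ↦ ?_) (fun k y hy ↦ norm_phi1_trivial_le hy.1.le k)
      hmem (summable_phi_trivial hu.le) hmem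
    refine hasDerivAt_phi ?_ y
    have : ((k : ℂ) + 1) ≠ 0 := Nat.cast_add_one_ne_zero k
    simpa using this
  have d0 : HasDerivAt (fun u : ℝ ↦ (u : ℂ)) 1 u := ofRealCLM.hasDerivAt
  have d3 := (((hasDerivAt_phi one_ne_zero u).sub d1).sub d2).sub
    (((d0.fun_pow 2).div_const 2).const_mul (Real.log (2 * Real.pi) : ℂ))
  have d4 : HasDerivAt (fun u ↦ (psiSm u : ℂ)) (psiInt u) u := (hasDerivAt_psiSm u).ofReal_comp
  have d5 := d4.congr_of_eventuallyEq (EventuallyEq.symm (by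
    filter_upwards [lt_mem_nhds hu] with v hv
    exact psiSm_eq hv.le))
  rw [d5.unique d3]
  push_cast
  ring

end

section

open Complex Filter Topology MeasureTheory Set
open scoped ComplexConjugate Interval

/-- The second derivative of `(V - u) * exp (-(s * u))`. -/
noncomputable def tri2 (s : ℂ) (V u : ℝ) : ℂ :=
  (2 * s + s ^ 2 * (V - u)) * cexp (-(s * u))

/-- The functional sending `max (u - a) 0` to `max (V - a) 0 * exp (-(s * a))`. -/
noncomputable def triFun (s : ℂ) (V : ℝ) (P : ℝ → ℂ) : ℂ :=
  cexp (-(s * V)) * P V + ∫ u in (0:ℝ)..V, tri2 s V u * P u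

/-- The Laplace transform of the triangle `max (V - u) 0` on the positive half-line. -/
noncomputable def triLap (V : ℝ) (z : ℂ) : ℂ := ∫ u in (0:ℝ)..V, (V - u) * cexp (-(z * u))

lemma continuous_tri2 (s : ℂ) (V : ℝ) : Continuous (tri2 s V) := by
  unfold tri2; fun_prop

lemma integral_tri2_mul (s : ℂ) (a V : ℝ) {P P' P'' : ℝ → ℂ}
    (h : ∀ u, HasDerivAt P (P' u) u) (h' : ∀ u, HasDerivAt P' (P'' u) u) (hc : Continuous P'') :
    cexp (-(s * V)) * P V + ∫ u in a..V, tri2 s V u * P u =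
      (1 + s * (V - a)) * cexp (-(s * a)) * P a + (V - a) * cexp (-(s * a)) * P' a +
      ∫ u in a..V, (V - u) * cexp (-(s * u)) * P'' u := by
  have hP : Continuous P := continuous_iff_continuousAt.mpr fun u ↦ (h u).continuousAt
  have hP' : Continuous P' := continuous_iff_continuousAt.mpr fun u ↦ (h' u).continuousAt
  have d0 (u : ℝ) : HasDerivAt (fun u : ℝ ↦ (u : ℂ)) 1 u := ofRealCLM.hasDerivAt
  have dE (u : ℝ) : HasDerivAt (fun u : ℝ ↦ cexp (-(s * u))) (cexp (-(s * u)) * -(s * 1)) u :=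
    ((d0 u).const_mul s).neg.cexp
  have dV (u : ℝ) : HasDerivAt (fun u : ℝ ↦ (V : ℂ) - u) (-1) u := (d0 u).const_sub (V : ℂ)
  have dF : ∀ u ∈ uIcc a V, HasDerivAt
      (fun u : ℝ ↦ -((1 + s * (V - u)) * cexp (-(s * u))) * P u -
        (V - u) * cexp (-(s * u)) * P' u)
      (tri2 s V u * P u - (V - u) * cexp (-(s * u)) * P'' u) u := fun u _ ↦ by
    refine ((((((dV u).const_mul s).const_add 1).mul (dE u)).neg.mul (h u)).sub
      (((dV u).mul (dE u)).mul (h' u))).congr_deriv ?_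
    unfold tri2
    simp only [Pi.mul_apply, Pi.neg_apply]
    ring
  have i1 : IntervalIntegrable (fun u ↦ tri2 s V u * P u) volume a V :=
    ((continuous_tri2 s V).mul hP).intervalIntegrable _ _
  have i2 : IntervalIntegrable (fun u : ℝ ↦ (V - u) * cexp (-(s * u)) * P'' u) volume a V :=
    (by fun_prop : Continuous fun u : ℝ ↦ (V - u) * cexp (-(s * u)) * P'' u).intervalIntegrable _ _
  have := intervalIntegral.integral_eq_sub_of_hasDerivAt dF (i1.sub i2)
  rw [intervalIntegral.integral_sub i1 i2] at this
  rw [sub_eq_iff_eq_add.mp this]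
  ring

lemma triFun_phi1 (s : ℂ) (V : ℝ) {w : ℂ} (hw : w ≠ 0) :
    triFun s V (phi1 w) = V / w + triLap V (s - w) := by
  have d0 (u : ℝ) : HasDerivAt (fun u : ℝ ↦ (u : ℂ)) 1 u := ofRealCLM.hasDerivAt
  have dE (u : ℝ) : HasDerivAt (fun u : ℝ ↦ cexp (w * u)) (cexp (w * u) * (w * 1)) u :=
    ((d0 u).const_mul w).cexp
  have h := integral_tri2_mul s 0 V (P := phi1 w) (P' := fun u ↦ cexp (w * u) / w)
    (P'' := fun u ↦ cexp (w * u))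
    (fun u ↦ (((dE u).sub_const 1).div_const (w ^ 2)).congr_deriv (by field_simp))
    (fun u ↦ ((dE u).div_const w).congr_deriv (by field_simp)) (by fun_prop)
  rw [triFun, h, triLap]
  have e : phi1 w 0 = 0 := by simp [phi1]
  simp only [e, ofReal_zero, mul_zero, neg_zero, Complex.exp_zero, sub_zero, mul_one, zero_add]
  congr 1
  · ring
  · refine intervalIntegral.integral_congr fun u _ ↦ ?_
    rw [mul_assoc, ← Complex.exp_add]
    ring_nf

lemma triFun_id (s : ℂ) (V : ℝ) : triFun s V (fun u ↦ (u : ℂ)) = V := by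
  have d0 (u : ℝ) : HasDerivAt (fun u : ℝ ↦ (u : ℂ)) 1 u := ofRealCLM.hasDerivAt
  have h := integral_tri2_mul s 0 V d0 (fun u ↦ hasDerivAt_const u 1) continuous_const
  rw [triFun, h]
  simp

lemma triFun_max (s : ℂ) {a V : ℝ} (ha : 0 ≤ a) (hV : 0 ≤ V) :
    triFun s V (fun u ↦ ((max (u - a) 0 : ℝ) : ℂ)) =
      ((max (V - a) 0 : ℝ) : ℂ) * cexp (-(s * a)) := by
  have hc : Continuous fun u : ℝ ↦ tri2 s V u * ((max (u - a) 0 : ℝ) : ℂ) :=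
    (continuous_tri2 s V).mul (by fun_prop)
  have hz : ∀ b ≤ a, 0 ≤ b → ∫ u in (0:ℝ)..b, tri2 s V u * ((max (u - a) 0 : ℝ) : ℂ) = 0 := by
    intro b hb hb0
    rw [intervalIntegral.integral_congr (g := fun _ ↦ 0), intervalIntegral.integral_zero]
    intro u hu
    rw [uIcc_of_le hb0] at hu
    simp [max_eq_right (show u - a ≤ 0 by linarith [hu.2])]
  rcases le_total V a with h | h
  · rw [triFun, hz V h hV, max_eq_right (by linarith)]; simp
  · have d0 (u : ℝ) : HasDerivAt (fun u : ℝ ↦ (u : ℂ) - a) 1 u :=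
      (ofRealCLM.hasDerivAt (x := u)).sub_const (a : ℂ)
    have h1 := integral_tri2_mul s a V d0 (fun u ↦ hasDerivAt_const u 1) continuous_const
    rw [triFun, ← intervalIntegral.integral_add_adjacent_intervals
      (hc.intervalIntegrable 0 a) (hc.intervalIntegrable a V), hz a le_rfl ha,
      intervalIntegral.integral_congr (a := a) (b := V) (g := fun u ↦ tri2 s V u * ((u : ℂ) - a)),
      zero_add, max_eq_left (by linarith)]
    · push_cast
      rw [h1]
      simp
    · intro u hu
      rw [uIcc_of_le h] at hu
      simp only [max_eq_left (show 0 ≤ u - a by linarith [hu.1])]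
      push_cast; rfl

lemma hasSum_triFun {ι : Type*} [Countable ι] (s : ℂ) {V : ℝ} (hV : 0 ≤ V) {P : ι → ℝ → ℂ}
    {b : ι → ℝ} (hc : ∀ i, Continuous (P i)) (hb : Summable b)
    (hP : ∀ i, ∀ u ∈ Icc 0 V, ‖P i u‖ ≤ b i) :
    HasSum (fun i ↦ triFun s V (P i)) (triFun s V fun u ↦ ∑' i, P i u) := by
  have hs : ∀ u ∈ Icc 0 V, Summable fun i ↦ P i u := fun u hu ↦
    Summable.of_norm_bounded hb fun i ↦ hP i u hu
  refine ((hs V ⟨hV, le_rfl⟩).hasSum.mul_left _).add ?_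
  have hmem : ∀ u ∈ Ι 0 V, u ∈ Icc 0 V := fun u hu ↦ by
    rw [uIoc_of_le hV] at hu; exact ⟨hu.1.le, hu.2⟩
  refine intervalIntegral.hasSum_integral_of_dominated_convergence
    (fun i u ↦ ‖tri2 s V u‖ * b i)
    (fun i ↦ ((continuous_tri2 s V).mul (hc i)).aestronglyMeasurable)
    (fun i ↦ Eventually.of_forall fun u hu ↦ ?_)
    (Eventually.of_forall fun u hu ↦ hb.mul_left _) ?_
    (Eventually.of_forall fun u hu ↦ (hs u (hmem u hu)).hasSum.mul_left _)
  · rw [norm_mul]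
    exact mul_le_mul_of_nonneg_left (hP i u (hmem u hu)) (norm_nonneg _)
  · simp only [tsum_mul_left]
    exact ((continuous_tri2 s V).norm.mul continuous_const).intervalIntegrable _ _

end

section

open Complex Filter Topology MeasureTheory Set
open scoped ComplexConjugate Interval ArithmeticFunction.vonMangoldt

lemma continuous_phi1 (w : ℂ) : Continuous (phi1 w) := by
  unfold phi1; fun_prop

lemma triFun_congr (s : ℂ) {V : ℝ} (hV : 0 ≤ V) {P Q : ℝ → ℂ} (h : EqOn P Q (Icc 0 V)) :
    triFun s V P = triFun s V Q := by
  rw [triFun, triFun, h ⟨hV, le_rfl⟩]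
  congr 1
  refine intervalIntegral.integral_congr fun u hu ↦ ?_
  rw [uIcc_of_le hV] at hu
  simp only [h hu]

lemma triFun_add (s : ℂ) {V : ℝ} (hV : 0 ≤ V) {P Q : ℝ → ℂ} (hP : ContinuousOn P (Icc 0 V))
    (hQ : ContinuousOn Q (Icc 0 V)) :
    triFun s V (fun u ↦ P u + Q u) = triFun s V P + triFun s V Q := by
  rw [← uIcc_of_le hV] at hP hQ
  simp only [triFun, mul_add]
  have h := intervalIntegral.integral_add (μ := volume)
    (((continuous_tri2 s V).continuousOn.fun_mul hP).intervalIntegrable)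
    (((continuous_tri2 s V).continuousOn.fun_mul hQ).intervalIntegrable)
  rw [h]
  ring

lemma triFun_const_mul (s : ℂ) (V : ℝ) (c : ℂ) (P : ℝ → ℂ) :
    triFun s V (fun u ↦ c * P u) = c * triFun s V P := by
  simp only [triFun, mul_left_comm _ c, intervalIntegral.integral_const_mul, mul_add]

lemma triFun_sum {ι : Type*} (s : ℂ) {V : ℝ} (hV : 0 ≤ V) (F : Finset ι) (P : ι → ℝ → ℂ)
    (hP : ∀ i, Continuous (P i)) :
    triFun s V (fun u ↦ ∑ i ∈ F, P i u) = ∑ i ∈ F, triFun s V (P i) := by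
  classical
  induction F using Finset.induction_on with
  | empty => simp [triFun]
  | insert i F hi ih =>
    simp only [Finset.sum_insert hi]
    rw [triFun_add s hV (hP i).continuousOn
      (continuous_finsetSum F fun j _ ↦ hP j).continuousOn, ih]

lemma continuousOn_tsum_phi1_trivial (V : ℝ) :
    ContinuousOn (fun u ↦ ∑' k : ℕ, phi1 (-(2 * (k + 1))) u) (Icc 0 V) :=
  continuousOn_tsum (fun _ ↦ (continuous_phi1 _).continuousOn)
    (summable_one_div_succ_sq.mul_left _) fun _ _ hu ↦ norm_phi1_trivial_le hu.1 _

lemma continuousOn_tsum_mz_phi1 (V : ℝ) :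
    ContinuousOn (fun u ↦ ∑' ρ, (mz ρ : ℂ) * phi1 ρ u) (Icc 0 V) :=
  continuousOn_tsum (fun _ ↦ (continuous_const.mul (continuous_phi1 _)).continuousOn)
    (summable_mz_div_sq.mul_left _) fun _ _ hu ↦ norm_mz_phi1_le hu.1 hu.2 _

lemma hasSum_mz_triLap (s : ℂ) {V : ℝ} (hV : 0 ≤ V) :
    HasSum (fun ρ ↦ (mz ρ : ℂ) * (V / ρ + triLap V (s - ρ)))
      (triFun s V fun u ↦ ∑' ρ, (mz ρ : ℂ) * phi1 ρ u) := by
  have hf : (fun ρ ↦ (mz ρ : ℂ) * (V / ρ + triLap V (s - ρ))) =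
      fun ρ ↦ triFun s V fun u ↦ (mz ρ : ℂ) * phi1 ρ u := by
    funext ρ
    rw [triFun_const_mul]
    rcases eq_or_ne ρ 0 with rfl | h
    · simp [mz_eq_zero (ρ := 0) (by simp [xi_zero])]
    · rw [triFun_phi1 s V h]
  have hsub : Function.support (fun ρ ↦ (mz ρ : ℂ) * (V / ρ + triLap V (s - ρ))) ⊆ zeroSet :=
    support_mz _
  rw [← hasSum_subtype_iff_of_support_subset hsub, hf]
  have := hasSum_triFun (ι := zeroSet) s hV (P := fun ρ u ↦ (mz ρ : ℂ) * phi1 ρ u)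
    (fun ρ ↦ continuous_const.mul (continuous_phi1 _))
    ((summable_mz_div_sq.mul_left (2 * Real.exp V)).subtype zeroSet)
    fun ρ u hu ↦ norm_mz_phi1_le hu.1 hu.2 ρ
  have hu : (fun u ↦ ∑' ρ : zeroSet, (mz ρ : ℂ) * phi1 ρ u) =
      fun u ↦ ∑' ρ, (mz ρ : ℂ) * phi1 ρ u := by
    funext u
    exact tsum_subtype_eq_of_support_subset (support_mz fun ρ ↦ phi1 ρ u)
  rwa [hu] at this

lemma hasSum_triLap_trivial (s : ℂ) {V : ℝ} (hV : 0 ≤ V) :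
    HasSum (fun k : ℕ ↦ triLap V (s + 2 * (k + 1)) - V * (2 * ((k : ℂ) + 1))⁻¹)
      (triFun s V fun u ↦ ∑' k : ℕ, phi1 (-(2 * (k + 1))) u) := by
  refine (hasSum_triFun s hV (P := fun (k : ℕ) u ↦ phi1 (-(2 * (k + 1))) u)
    (fun k ↦ continuous_phi1 _) (summable_one_div_succ_sq.mul_left _)
    fun k u hu ↦ norm_phi1_trivial_le hu.1 k).congr_fun fun k ↦ ?_
  have h : -(2 * ((k : ℂ) + 1)) ≠ 0 := neg_ne_zero.mpr (mul_ne_zero two_ne_zero (by exact_mod_cast k.succ_ne_zero))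
  rw [triFun_phi1 s V h, sub_neg_eq_add, div_neg]
  ring

lemma triFun_mz_phi1 (s : ℂ) {V : ℝ} (hV : 0 ≤ V) {N : ℕ} (hN : Real.exp V ≤ N) :
    triFun s V (fun u ↦ ∑' ρ, (mz ρ : ℂ) * phi1 ρ u) =
      V + triLap V (s - 1) - (triFun s V fun u ↦ ∑' k : ℕ, phi1 (-(2 * (k + 1))) u) -
      Real.log (2 * Real.pi) * V -
      ∑ n ∈ Finset.Ioc 0 N, (Λ n : ℂ) * (max (V - Real.log n) 0 : ℝ) *
        cexp (-(s * Real.log n)) := by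
  have h1 : triFun s V (phi1 1) = triFun s V fun u ↦
      ((∑' ρ, (mz ρ : ℂ) * phi1 ρ u) + ∑' k : ℕ, phi1 (-(2 * (k + 1))) u) +
      ((Real.log (2 * Real.pi) : ℂ) * (u : ℂ) +
        ∑ n ∈ Finset.Ioc 0 N, (Λ n : ℂ) * (max (u - Real.log n) 0 : ℝ)) := by
    refine triFun_congr s hV fun u hu ↦ ?_
    have h := psiInt_eq hu.1
    rw [psiInt_eq_sum ((Real.exp_le_exp.mpr hu.2).trans hN)] at h
    push_cast at h ⊢
    linear_combination -h
  rw [triFun_add s hV ((continuousOn_tsum_mz_phi1 V).fun_add (continuousOn_tsum_phi1_trivial V))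
      (Q := fun u ↦ (Real.log (2 * Real.pi) : ℂ) * (u : ℂ) +
        ∑ n ∈ Finset.Ioc 0 N, (Λ n : ℂ) * (max (u - Real.log n) 0 : ℝ))
      (by fun_prop), triFun_add s hV (continuousOn_tsum_mz_phi1 V)
      (continuousOn_tsum_phi1_trivial V), triFun_add s hV (P := fun u ↦ (Real.log (2 * Real.pi) : ℂ) * (u : ℂ))
      (Q := fun u ↦ ∑ n ∈ Finset.Ioc 0 N, (Λ n : ℂ) * (max (u - Real.log n) 0 : ℝ))
      (by fun_prop) (by fun_prop),
      triFun_const_mul, triFun_id, triFun_phi1 s V one_ne_zero, triFun_sum s hV _ _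
      (fun n ↦ by fun_prop)] at h1
  have h2 : ∀ n ∈ Finset.Ioc 0 N, triFun s V (fun u ↦ (Λ n : ℂ) * (max (u - Real.log n) 0 : ℝ)) =
      (Λ n : ℂ) * (max (V - Real.log n) 0 : ℝ) * cexp (-(s * Real.log n)) := fun n hn ↦ by
    rw [triFun_const_mul, triFun_max s (Real.log_natCast_nonneg n) hV, mul_assoc]
  rw [Finset.sum_congr rfl h2, div_one] at h1
  linear_combination -h1

lemma triLap_eq (V : ℝ) {z : ℂ} (hz : z ≠ 0) :
    triLap V z = V / z - (1 - cexp (-(z * V))) / z ^ 2 := by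
  have d0 (u : ℝ) : HasDerivAt (fun u : ℝ ↦ (u : ℂ)) 1 u := ofRealCLM.hasDerivAt
  have dE (u : ℝ) : HasDerivAt (fun u : ℝ ↦ cexp (-(z * u))) (cexp (-(z * u)) * -(z * 1)) u :=
    ((d0 u).const_mul z).neg.cexp
  have dV (u : ℝ) : HasDerivAt (fun u : ℝ ↦ (V : ℂ) - u) (-1) u := (d0 u).const_sub (V : ℂ)
  have dF : ∀ u ∈ uIcc 0 V, HasDerivAt
      (fun u : ℝ ↦ cexp (-(z * u)) / z ^ 2 - (V - u) * cexp (-(z * u)) / z)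
      ((V - u) * cexp (-(z * u))) u := fun u _ ↦ by
    refine (((dE u).div_const _).sub (((dV u).mul (dE u)).div_const z)).congr_deriv ?_
    field_simp
    ring
  rw [triLap, intervalIntegral.integral_eq_sub_of_hasDerivAt dF
    ((by fun_prop : Continuous fun u : ℝ ↦ (V - u) * cexp (-(z * u))).intervalIntegrable _ _)]
  simp
  field_simp
  ring

lemma triLap_re (V : ℝ) (z : ℂ) :
    (triLap V z).re = ∫ u in (0:ℝ)..V, (V - u) * (Real.exp (-(z.re * u)) * Real.cos (z.im * u)) := by
  have h := reCLM.intervalIntegral_comp_comm (μ := volume) (a := 0) (b := V)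
    ((by fun_prop : Continuous fun u : ℝ ↦ (V - u) * cexp (-(z * u))).intervalIntegrable _ _)
  rw [triLap, ← reCLM_apply, ← h]
  refine intervalIntegral.integral_congr fun u _ ↦ ?_
  simp only [reCLM_apply]
  rw [← ofReal_sub, re_ofReal_mul, Complex.exp_re]
  simp

lemma triLap_re_nonneg {V : ℝ} (hV : 0 ≤ V) {z : ℂ} (hz : 0 ≤ z.re) : 0 ≤ (triLap V z).re := by
  rw [triLap_re]
  set x := z.re
  set y := z.im
  rcases eq_or_ne y 0 with hy | hy
  · refine intervalIntegral.integral_nonneg hV fun u hu ↦ ?_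
    simp only [hy, zero_mul, Real.cos_zero, mul_one]
    exact mul_nonneg (by linarith [hu.2]) (Real.exp_pos _).le
  have d0 (u : ℝ) : HasDerivAt (fun u : ℝ ↦ u) 1 u := hasDerivAt_id u
  have dE (u : ℝ) : HasDerivAt (fun u ↦ Real.exp (-(x * u))) (Real.exp (-(x * u)) * -(x * 1)) u :=
    ((d0 u).const_mul x).neg.exp
  have dV (u : ℝ) : HasDerivAt (fun u : ℝ ↦ V - u) (-1) u := (d0 u).const_sub V
  have dG (u : ℝ) : HasDerivAt (fun u ↦ (1 - Real.cos (y * u)) / y ^ 2) (Real.sin (y * u) / y) u :=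
    (((((d0 u).const_mul y).cos).const_sub 1).div_const _).congr_deriv (by field_simp)
  have dS (u : ℝ) : HasDerivAt (fun u ↦ Real.sin (y * u) / y) (Real.cos (y * u)) u :=
    ((((d0 u).const_mul y).sin).div_const _).congr_deriv (by field_simp)
  have dD (u : ℝ) : HasDerivAt (fun u ↦ (1 + x * (V - u)) * Real.exp (-(x * u)))
      (-((2 * x + x ^ 2 * (V - u)) * Real.exp (-(x * u)))) u :=
    ((((dV u).const_mul x).const_add 1).mul (dE u)).congr_deriv (by ring)
  have dF : ∀ u ∈ uIcc 0 V, HasDerivAt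
      (fun u ↦ (V - u) * Real.exp (-(x * u)) * (Real.sin (y * u) / y) +
        (1 + x * (V - u)) * Real.exp (-(x * u)) * ((1 - Real.cos (y * u)) / y ^ 2))
      ((V - u) * (Real.exp (-(x * u)) * Real.cos (y * u)) -
        (2 * x + x ^ 2 * (V - u)) * Real.exp (-(x * u)) * ((1 - Real.cos (y * u)) / y ^ 2)) u :=
    fun u _ ↦ ((((dV u).mul (dE u)).mul (dS u)).add ((dD u).mul (dG u))).congr_deriv (by
      simp only [Pi.mul_apply]; ring)
  have i1 : IntervalIntegrable (fun u ↦ (V - u) * (Real.exp (-(x * u)) * Real.cos (y * u)))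
      volume 0 V := (by fun_prop : Continuous _).intervalIntegrable _ _
  have i2 : IntervalIntegrable (fun u ↦ (2 * x + x ^ 2 * (V - u)) * Real.exp (-(x * u)) *
      ((1 - Real.cos (y * u)) / y ^ 2)) volume 0 V :=
    (by fun_prop : Continuous _).intervalIntegrable _ _
  have h := intervalIntegral.integral_eq_sub_of_hasDerivAt dF (i1.sub i2)
  rw [intervalIntegral.integral_sub i1 i2] at h
  have hG : ∀ u, 0 ≤ (1 - Real.cos (y * u)) / y ^ 2 := fun u ↦
    div_nonneg (by linarith [Real.cos_le_one (y * u)]) (sq_nonneg _)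
  have h2 : 0 ≤ ∫ u in (0:ℝ)..V, (2 * x + x ^ 2 * (V - u)) * Real.exp (-(x * u)) *
      ((1 - Real.cos (y * u)) / y ^ 2) := intervalIntegral.integral_nonneg hV fun u hu ↦ by
    have : 0 ≤ V - u := by linarith [hu.2]
    have := hG u
    positivity
  have h3 : 0 ≤ Real.exp (-(x * V)) * ((1 - Real.cos (y * V)) / y ^ 2) :=
    mul_nonneg (Real.exp_pos _).le (hG V)
  simp at h
  linarith

lemma exp_add_exp_one_sub_ge (x u : ℝ) :
    2 * Real.exp (-(u / 2)) ≤ Real.exp (-(x * u)) + Real.exp (-((1 - x) * u)) := by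
  have h1 : Real.exp (-(x * u)) = Real.exp (-(x * u) / 2) ^ 2 := by
    rw [← Real.exp_nat_mul]; congr 1; push_cast; ring
  have h2 : Real.exp (-((1 - x) * u)) = Real.exp (-((1 - x) * u) / 2) ^ 2 := by
    rw [← Real.exp_nat_mul]; congr 1; push_cast; ring
  have h3 : Real.exp (-(u / 2)) = Real.exp (-(x * u) / 2) * Real.exp (-((1 - x) * u) / 2) := by
    rw [← Real.exp_add]; congr 1; ring
  rw [h1, h2, h3]
  nlinarith [sq_nonneg (Real.exp (-(x * u) / 2) - Real.exp (-((1 - x) * u) / 2))]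

lemma triLap_pair_ge {x η : ℝ} (hη : |η| ≤ 1 / 10) :
    19.92 ≤ (triLap 7 (x + η * I)).re + (triLap 7 (((1 - x : ℝ) : ℂ) + η * I)).re := by
  rw [triLap_re, triLap_re, ← intervalIntegral.integral_add
    ((by fun_prop : Continuous _).intervalIntegrable _ _)
    ((by fun_prop : Continuous _).intervalIntegrable _ _)]
  simp only [add_re, ofReal_re, re_ofReal_mul, I_re, mul_zero, add_zero, add_im, ofReal_im,
    im_ofReal_mul, I_im, mul_one, zero_add]
  have d0 (u : ℝ) : HasDerivAt (fun u : ℝ ↦ u) 1 u := hasDerivAt_id u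
  have dE (u : ℝ) : HasDerivAt (fun u ↦ Real.exp (-(u / 2))) (Real.exp (-(u / 2)) * -(1 / 2)) u :=
    ((d0 u).div_const 2).neg.exp
  have dF : ∀ u ∈ uIcc (0:ℝ) 7, HasDerivAt
      (fun u ↦ (u ^ 3 * (-1 / 50) + u ^ 2 * (1 / 50) + u * (102 / 25) - 496 / 25) *
        Real.exp (-(u / 2)))
      ((7 - u) * (2 * Real.exp (-(u / 2)) * (1 - u ^ 2 / 200))) u := fun u _ ↦ by
    refine ((((((d0 u).fun_pow 3).mul_const _).fun_add (((d0 u).fun_pow 2).mul_const _)).fun_add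
      ((d0 u).mul_const _)).sub_const _).fun_mul (dE u) |>.congr_deriv ?_
    simp
    ring
  have h := intervalIntegral.integral_eq_sub_of_hasDerivAt dF
    ((by fun_prop : Continuous _).intervalIntegrable _ _)
  have hexp : (0.0282 : ℝ) ≤ Real.exp (-(7 / 2)) := by
    have h1 : Real.exp (7 / 2) ^ 2 = Real.exp 1 ^ 7 := by
      rw [← Real.exp_nat_mul, ← Real.exp_nat_mul]; norm_num
    have h2 : Real.exp 1 ^ 7 ≤ 2.7182818286 ^ 7 :=
      pow_le_pow_left₀ (Real.exp_pos 1).le Real.exp_one_lt_d9.le 7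
    have h3 : Real.exp (7 / 2) ≤ 35.4 := by
      refine abs_le_of_sq_le_sq' ?_ (by norm_num) |>.2
      rw [h1]; exact h2.trans (by norm_num)
    rw [Real.exp_neg, le_inv_comm₀ (by norm_num) (Real.exp_pos _)]
    exact h3.trans (by norm_num)
  refine le_trans ?_ (intervalIntegral.integral_mono_on (by norm_num)
    (f := fun u ↦ (7 - u) * (2 * Real.exp (-(u / 2)) * (1 - u ^ 2 / 200)))
    ((by fun_prop : Continuous _).intervalIntegrable _ _)
    ((by fun_prop : Continuous _).intervalIntegrable _ _) fun u hu ↦ ?_)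
  · rw [h]
    norm_num at hexp ⊢
    linarith
  · have h1 := exp_add_exp_one_sub_ge x u
    have hu0 := hu.1
    have hu7 := hu.2
    have hη' : (η * u) ^ 2 ≤ u ^ 2 / 100 := by
      rw [mul_pow]
      have : η ^ 2 ≤ (1 / 10) ^ 2 := by rw [← sq_abs]; exact pow_le_pow_left₀ (abs_nonneg _) hη 2
      nlinarith [sq_nonneg u]
    have h2 : 1 - u ^ 2 / 200 ≤ Real.cos (η * u) :=
      le_trans (by linarith) (Real.one_sub_sq_div_two_le_cos)
    have h3 : 0 ≤ 1 - u ^ 2 / 200 := by nlinarith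
    rw [← mul_add, ← add_mul]
    exact mul_le_mul_of_nonneg_left (mul_le_mul h1 h2 h3 (by positivity)) (by linarith)

/-- The explicit formula with a triangular weight, on the line `Re s = 1`. -/
lemma hasSum_mz_triLap_re {V : ℝ} (hV : 0 ≤ V) {N : ℕ} (hN : Real.exp V ≤ N) {t : ℝ}
    (ht : t ≠ 0) :
    HasSum (fun ρ ↦ mz ρ * (triLap V (1 + t * I - ρ)).re)
      ((triLap V (t * I)).re + V * ((digamma ((1 + t * I) / 2 + 1)).re / 2 - Real.log Real.pi / 2) +
      (∑' k : ℕ, (1 - cexp (-((1 + t * I + 2 * (k + 1)) * V))) / (1 + t * I + 2 * (k + 1)) ^ 2).re -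
      ∑ n ∈ Finset.Ioc 0 N, Λ n * max (V - Real.log n) 0 *
        (Real.cos (t * Real.log n) / n)) := by
  have h1 := hasSum_mz_triLap (1 + t * I) hV
  rw [triFun_mz_phi1 _ hV hN] at h1
  have h2 : HasSum (fun ρ ↦ mz ρ * (V * (ρ⁻¹).re)) (V * -(logDeriv xi 0).re) := by
    have hs := ((Equiv.subLeft (1 : ℂ)).hasSum_iff.mpr
      (hasSum_re_logDeriv_xi (s := 1) (by simp))).mul_left V
    rw [logDeriv_xi_one, neg_re] at hs
    refine hs.congr_fun fun ρ ↦ ?_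
    simp [mz_one_sub]
    ring
  have h3 : (triFun (1 + t * I) V fun u ↦ ∑' k : ℕ, phi1 (-(2 * (k + 1))) u) =
      -(V * (digamma ((1 + t * I) / 2 + 1) / 2 + Real.eulerMascheroniConstant / 2)) -
      ∑' k : ℕ, (1 - cexp (-((1 + t * I + 2 * (k + 1)) * V))) / (1 + t * I + 2 * (k + 1)) ^ 2 := by
    have hd := (half_digamma_eq (s := 1 + t * I) (by simp)).mul_left (V : ℂ)
    have hs := (hasSum_triLap_trivial (1 + t * I) hV).add hd
    have hf : ∀ k : ℕ, triLap V (1 + t * I + 2 * (k + 1)) - V * (2 * ((k : ℂ) + 1))⁻¹ +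
        V * ((2 * ((k : ℂ) + 1))⁻¹ - (1 + t * I + 2 * (k + 1))⁻¹) =
        -((1 - cexp (-((1 + t * I + 2 * (k + 1)) * V))) / (1 + t * I + 2 * (k + 1)) ^ 2) := by
      intro k
      have hz : 1 + t * I + 2 * ((k : ℂ) + 1) ≠ 0 := fun h ↦ by
        have := congrArg Complex.im h
        simp at this
        exact ht this
      rw [triLap_eq V hz]
      ring
    have := hs.tsum_eq
    simp only [hf, tsum_neg] at this
    linear_combination -this
  have h4 := (Complex.hasSum_re h1).sub h2
  have hsum : ∀ {f g : ℂ → ℝ} {a b : ℝ}, HasSum f a → f = g → a = b → HasSum g b := by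
    rintro f g a b h rfl rfl; exact h
  refine hsum h4 ?_ ?_
  · funext ρ
    rw [re_ofReal_mul, add_re, div_eq_mul_inv, re_ofReal_mul]
    ring
  · have h5 : Real.log (2 * Real.pi) = Real.log 2 + Real.log Real.pi :=
      Real.log_mul (by norm_num) Real.pi_ne_zero
    have h6 : Real.log (4 * Real.pi) = 2 * Real.log 2 + Real.log Real.pi := by
      rw [Real.log_mul (by norm_num) Real.pi_ne_zero, show (4:ℝ) = 2 ^ 2 by norm_num, Real.log_pow]
      push_cast; ring
    have h7 : ∀ n ∈ Finset.Ioc 0 N, Λ n * max (V - Real.log n) 0 * (Real.cos (t * Real.log n) / n) =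
        ((Λ n : ℂ) * (max (V - Real.log n) 0 : ℝ) * cexp (-((1 + t * I) * Real.log n))).re := by
      intro n hn
      have hn0 : (0:ℝ) < n := by exact_mod_cast (Finset.mem_Ioc.mp hn).1
      have e1 : (-((1 + t * I) * Real.log n)).re = -Real.log n := by
        simp only [neg_re, re_mul_ofReal]; simp
      have e2 : (-((1 + t * I) * Real.log n)).im = -(t * Real.log n) := by
        simp only [neg_im, im_mul_ofReal]; simp
      rw [← ofReal_mul, re_ofReal_mul, Complex.exp_re, e1, e2, Real.exp_neg, Real.exp_log hn0,
        Real.cos_neg]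
      ring
    have h8 : (Real.log (4 * Real.pi) / 2 - Real.eulerMascheroniConstant / 2 - 1 : ℂ) =
        ((Real.log (4 * Real.pi) / 2 - Real.eulerMascheroniConstant / 2 - 1 : ℝ) : ℂ) := by
      push_cast; ring
    have h9 : (V * (digamma ((1 + t * I) / 2 + 1) / 2 + Real.eulerMascheroniConstant / 2) : ℂ).re =
        V * ((digamma ((1 + t * I) / 2 + 1)).re / 2 + Real.eulerMascheroniConstant / 2) := by
      rw [re_ofReal_mul]; simp
    rw [Finset.sum_congr rfl h7, ← Complex.re_sum, logDeriv_xi_zero, h3, h8, ofReal_re, h6, h5,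
      add_sub_cancel_left, ← ofReal_mul]
    simp only [sub_re, add_re, neg_re, h9, ofReal_re]
    ring

lemma hasSum_telescope {t : ℝ} (ht : 0 < t) :
    HasSum (fun k : ℕ ↦ 4 / ((2 * (k : ℝ) + 2 + t) * (2 * (k + 1 : ℕ) + 2 + t))) (2 / (2 + t)) := by
  have hpos : ∀ k : ℕ, 0 < 2 * (k : ℝ) + 2 + t := fun k ↦ by positivity
  rw [hasSum_iff_tendsto_nat_of_nonneg fun k ↦ (div_pos (by norm_num)
    (mul_pos (hpos k) (hpos (k + 1)))).le]
  have h : ∀ n : ℕ, ∑ k ∈ Finset.range n,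
      4 / ((2 * (k : ℝ) + 2 + t) * (2 * (k + 1 : ℕ) + 2 + t)) =
      2 / (2 + t) - 2 / (2 * (n : ℝ) + 2 + t) := fun n ↦ by
    have := Finset.sum_range_sub' (fun k : ℕ ↦ 2 / (2 * (k : ℝ) + 2 + t)) n
    simp only [Nat.cast_zero, mul_zero, zero_add] at this
    rw [← this]
    refine Finset.sum_congr rfl fun k _ ↦ ?_
    have := hpos k
    have := hpos (k + 1)
    push_cast at this ⊢
    field_simp
    ring
  simp only [h]
  have hl : Tendsto (fun n : ℕ ↦ 2 / (2 * (n : ℝ) + 2 + t)) atTop (𝓝 0) := by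
    refine tendsto_const_nhds.div_atTop ?_
    simp only [add_assoc]
    exact tendsto_atTop_add_const_right _ _
      (tendsto_natCast_atTop_atTop.const_mul_atTop (by norm_num))
  simpa using tendsto_const_nhds.sub hl

lemma norm_tsum_trivial_le {V t : ℝ} (hV : 0 ≤ V) (ht : 0 < t) :
    ‖∑' k : ℕ, (1 - cexp (-((1 + t * I + 2 * (k + 1)) * V))) / (1 + t * I + 2 * (k + 1)) ^ 2‖ ≤
      2 / (2 + t) := by
  refine tsum_of_norm_bounded (hasSum_telescope ht) fun k ↦ ?_
  set z : ℂ := 1 + t * I + 2 * (k + 1) with hz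
  have hre : z.re = 2 * k + 3 := by simp [hz]; ring
  have him : z.im = t := by simp [hz]
  have h1 : ‖1 - cexp (-(z * V))‖ ≤ 2 := by
    refine (norm_sub_le _ _).trans ?_
    rw [norm_one, Complex.norm_exp, neg_re, re_mul_ofReal, hre]
    have : Real.exp (-((2 * k + 3) * V)) ≤ 1 := Real.exp_le_one_iff.mpr (by
      have : 0 ≤ (2 * (k : ℝ) + 3) * V := by positivity
      linarith)
    linarith
  rw [norm_div, norm_pow, ← normSq_eq_norm_sq, normSq_apply, hre, him]
  have hk : (0:ℝ) ≤ k := k.cast_nonneg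
  push_cast
  rw [div_le_div_iff₀ (by positivity) (by positivity)]
  refine (mul_le_mul_of_nonneg_right h1 (by positivity)).trans ?_
  nlinarith [sq_nonneg (2 * k + 3 - t)]

/-- A zero off the critical line near `t` makes the triangular prime sum negative. -/
lemma prime_sum_le_of_off_line {ρ : ℂ} (h0 : xi ρ = 0) (hρ : ρ.re ≠ 1 / 2) {t : ℝ} (ht : 1 ≤ t)
    (hn : |t - ρ.im| ≤ 1 / 10) :
    ∑ n ∈ Finset.Ioc 0 1097, Λ n * max (7 - Real.log n) 0 * (Real.cos (t * Real.log n) / n) ≤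
      7 / 2 * Real.log (t / (2 * Real.pi)) + 18 / t ^ 2 + 2 / t - 19.92 := by
  have ht0 : 0 < t := by linarith
  have hexp : Real.exp 7 ≤ (1097 : ℕ) := by
    rw [show (7:ℝ) = (7:ℕ) * 1 by norm_num, Real.exp_nat_mul]
    exact (pow_le_pow_left₀ (Real.exp_pos 1).le Real.exp_one_lt_d9.le 7).trans (by norm_num)
  have hs := hasSum_mz_triLap_re (V := 7) (by norm_num) hexp ht0.ne'
  set ρ' : ℂ := 1 - conj ρ with hρ'
  have hc : xi (conj ρ) = 0 := by rw [xi_conj, h0, map_zero]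
  have h0' : xi ρ' = 0 := by rw [hρ', xi_one_sub, hc]
  have hne : ρ ≠ ρ' := fun h ↦ hρ (by
    have := congrArg Complex.re h
    simp [hρ'] at this
    linarith)
  have hnn : ∀ σ, 0 ≤ mz σ * (triLap 7 (1 + t * I - σ)).re := fun σ ↦ by
    by_cases h : xi σ = 0
    · exact mul_nonneg (mz_nonneg _) (triLap_re_nonneg (by norm_num) (by
        simp; linarith [(xi_zero_re h).2]))
    · rw [mz_eq_zero h, zero_mul]
  have hle := sum_le_hasSum {ρ, ρ'} (fun σ _ ↦ hnn σ) hs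
  rw [Finset.sum_pair hne] at hle
  have e1 : 1 + t * I - ρ = ((1 - ρ.re : ℝ) : ℂ) + ((t - ρ.im : ℝ) : ℂ) * I := by
    apply Complex.ext <;> simp
  have e2 : 1 + t * I - ρ' = (ρ.re : ℂ) + ((t - ρ.im : ℝ) : ℂ) * I := by
    apply Complex.ext
    · simp [hρ']
    · simp [hρ']; ring
  have hpos : ∀ {σ : ℂ}, xi σ = 0 → (triLap 7 (1 + t * I - σ)).re ≤
      mz σ * (triLap 7 (1 + t * I - σ)).re := fun {σ} h ↦
    le_mul_of_one_le_left (triLap_re_nonneg (by norm_num) (by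
        simp; linarith [(xi_zero_re h).2])) (one_le_mz h)
  have hg := triLap_pair_ge (x := ρ.re) hn
  rw [← e1, ← e2] at hg
  have h1 := hpos h0
  have h2 := hpos h0'
  have hK : (triLap 7 (t * I)).re ≤ 2 / t ^ 2 := by
    rw [triLap_eq 7 (by simp [ht0.ne'])]
    have : (((7:ℝ):ℂ) / (t * I) - (1 - cexp (-(t * I * (7:ℝ)))) / (t * I) ^ 2) =
        ((7 / t : ℝ) : ℂ) * -I + ((1 / t ^ 2 : ℝ) : ℂ) * (1 - cexp (((-(7 * t) : ℝ) : ℂ) * I)) := by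
      rw [mul_pow, I_sq]
      have : (t : ℂ) ≠ 0 := by exact_mod_cast ht0.ne'
      push_cast
      rw [show -((t : ℂ) * I * 7) = -(7 * t) * I by ring, div_mul_eq_div_div, div_I]
      field_simp
      ring
    rw [this, add_re, re_ofReal_mul, re_ofReal_mul, sub_re, Complex.exp_ofReal_mul_I_re]
    simp only [neg_re, I_re, one_re]
    rw [neg_zero, mul_zero, zero_add, div_mul_eq_mul_div, one_mul]
    gcongr
    linarith [Real.neg_one_le_cos (-(7 * t))]
  have hψ : (digamma ((1 + t * I) / 2 + 1)).re ≤ Real.log (t / 2) + 9 / 2 / t ^ 2 := by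
    have hre : ((1 + t * I) / 2 + 1 : ℂ).re = 3 / 2 := by
      rw [show (1 + t * I) / 2 + 1 = ((3 / 2 : ℝ) : ℂ) + ((t / 2 : ℝ) : ℂ) * I by push_cast; ring]
      simp
    have him : ((1 + t * I) / 2 + 1 : ℂ).im = t / 2 := by
      rw [show (1 + t * I) / 2 + 1 = ((3 / 2 : ℝ) : ℂ) + ((t / 2 : ℝ) : ℂ) * I by push_cast; ring]
      simp
    have h := (abs_le.mp (abs_re_digamma_sub_le (z := (1 + t * I) / 2 + 1) (by rw [hre]; norm_num))).2
    rw [hre, him] at h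
    have hl : Real.log ((3 / 2) ^ 2 + (t / 2) ^ 2) ≤ 2 * Real.log (t / 2) + 9 / t ^ 2 := by
      rw [show (3 / 2 : ℝ) ^ 2 + (t / 2) ^ 2 = (t / 2) ^ 2 * (1 + 9 / t ^ 2) by field_simp; ring,
        Real.log_mul (by positivity) (by positivity), Real.log_pow]
      have := Real.log_le_sub_one_of_pos (show 0 < 1 + 9 / t ^ 2 by positivity)
      push_cast
      linarith
    have h3 : 0 ≤ 1 / ((3 / 2 : ℝ) ^ 2 + (t / 2) ^ 2) := by positivity
    have h4 : (3 / 2 : ℝ) / ((3 / 2 : ℝ) ^ 2 + (t / 2) ^ 2) =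
      3 / 2 * (1 / ((3 / 2 : ℝ) ^ 2 + (t / 2) ^ 2)) := by ring
    rw [h4] at h
    have h5 : 9 / 2 / t ^ 2 = 9 / t ^ 2 / 2 := by ring
    linarith
  have hR := (Complex.re_le_norm _).trans (norm_tsum_trivial_le (V := 7) (t := t) (by norm_num) ht0)
  have hR' : 2 / (2 + t) ≤ 2 / t := by gcongr; linarith
  have hlog : Real.log (t / (2 * Real.pi)) = Real.log (t / 2) - Real.log Real.pi := by
    rw [← Real.log_div (by positivity) (by positivity), div_div]
  have h18 : 18 / t ^ 2 = 2 / t ^ 2 + 16 / t ^ 2 := by ring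
  have h16 : 9 / 2 / t ^ 2 * (7 / 2) ≤ 16 / t ^ 2 := by
    rw [div_mul_eq_mul_div]; gcongr; norm_num
  rw [hlog, h18]
  push_cast at hle hR hK ⊢
  linarith

/-- `ℓ / 2 ^ 40` is a lower approximation to `log n`. -/
def IsLog (n ℓ : ℕ) : Prop :=
  (ℓ : ℝ) ≤ 2 ^ 40 * Real.log n ∧ 2 ^ 40 * Real.log n ≤ ℓ + 1100 - 462 / n + n

/-- The rounded increment `2 ^ 40 * (log (n + 1) - log n)`. -/
def logStep (n : ℕ) : ℕ :=
  2 ^ 41 * (45045 * (2 * n + 1) ^ 12 + 15015 * (2 * n + 1) ^ 10 + 9009 * (2 * n + 1) ^ 8 +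
    6435 * (2 * n + 1) ^ 6 + 5005 * (2 * n + 1) ^ 4 + 4095 * (2 * n + 1) ^ 2 + 3465) /
    (45045 * (2 * n + 1) ^ 13)

lemma isLog_two : IsLog 2 762123384499 := by
  have h1 := Real.log_two_gt_d9
  have h2 := Real.log_two_lt_d9
  constructor <;> norm_num at h1 h2 ⊢ <;> linarith

lemma natDiv_real (a b : ℕ) (hb : 0 < b) :
    ((a / b : ℕ) : ℝ) ≤ (a : ℝ) / b ∧ (a : ℝ) / b ≤ ((a / b : ℕ) : ℝ) + 1 :=
  ⟨Nat.cast_div_le, by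
    have h : a < b * (a / b + 1) := Nat.lt_mul_div_succ a hb
    have hb' : (0:ℝ) < b := by exact_mod_cast hb
    rw [div_le_iff₀ hb', mul_comm]
    exact_mod_cast h.le⟩

lemma isLog_succ {n ℓ : ℕ} (hn : 2 ≤ n) (h : IsLog n ℓ) : IsLog (n + 1) (ℓ + logStep n) := by
  have hn' : (2:ℝ) ≤ n := by exact_mod_cast hn
  set x : ℝ := 1 / (2 * n + 1) with hx
  have hx0 : 0 < x := by positivity
  have hx1 : x ≤ 1 / 5 := by rw [hx]; gcongr; linarith
  have hq : (1 + x) / (1 - x) = (n + 1) / n := by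
    rw [hx]; field_simp; ring
  have hlog : Real.log ((n + 1 : ℕ) : ℝ) = Real.log n + Real.log ((1 + x) / (1 - x)) := by
    rw [hq, Real.log_div (by positivity) (by positivity)]
    push_cast; ring
  have hlo := Real.sum_range_le_log_div hx0.le (by linarith) 7
  have hhi := Real.log_div_le_sum_range_add hx0.le (by linarith) 7
  have hrem : 2 ^ 41 * (x ^ (2 * 7 + 1) / (1 - x ^ 2)) ≤ 462 / n - 462 / ((n + 1 : ℕ) : ℝ) := by
    have e : x ^ (2 * 7 + 1) / (1 - x ^ 2) = x ^ 13 / (4 * n * (n + 1)) := by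
      have : 1 - x ^ 2 = 4 * n * (n + 1) * x ^ 2 := by rw [hx]; field_simp; ring
      rw [this]; field_simp
    have e2 : 462 / (n:ℝ) - 462 / ((n + 1 : ℕ) : ℝ) = 462 / (n * (n + 1)) := by
      push_cast; field_simp; ring
    rw [e, e2, ← mul_div_assoc, div_le_div_iff₀ (by positivity) (by positivity)]
    have : x ^ 13 ≤ (1 / 5) ^ 13 := by gcongr
    have h2 : 2 ^ 41 * x ^ 13 ≤ 1848 := by linarith [this, show (2:ℝ) ^ 41 * (1 / 5) ^ 13 ≤ 1848 by norm_num]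
    have h3 : (0:ℝ) < n * (n + 1) := by positivity
    nlinarith
  have hstep := natDiv_real (2 ^ 41 * (45045 * (2 * n + 1) ^ 12 + 15015 * (2 * n + 1) ^ 10 +
    9009 * (2 * n + 1) ^ 8 + 6435 * (2 * n + 1) ^ 6 + 5005 * (2 * n + 1) ^ 4 +
    4095 * (2 * n + 1) ^ 2 + 3465)) (45045 * (2 * n + 1) ^ 13) (by positivity)
  rw [← logStep] at hstep
  have hsum : ((2 ^ 41 * (45045 * (2 * n + 1) ^ 12 + 15015 * (2 * n + 1) ^ 10 +
      9009 * (2 * n + 1) ^ 8 + 6435 * (2 * n + 1) ^ 6 + 5005 * (2 * n + 1) ^ 4 +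
      4095 * (2 * n + 1) ^ 2 + 3465) : ℕ) : ℝ) / ((45045 * (2 * n + 1) ^ 13 : ℕ) : ℝ) =
      2 ^ 41 * ∑ i ∈ Finset.range 7, x ^ (2 * i + 1) / (2 * (i : ℝ) + 1) := by
    simp only [Finset.sum_range_succ, Finset.sum_range_zero]
    rw [hx]; push_cast; field_simp; ring
  rw [hsum] at hstep
  obtain ⟨h1, h2⟩ := h
  refine ⟨?_, ?_⟩
  · rw [hlog]; push_cast; linarith [hstep.1]
  · rw [hlog]; push_cast at hrem ⊢; linarith [hstep.2]

lemma IsLog.err {n ℓ : ℕ} (h : IsLog n ℓ) (hn : n ≤ 4000) :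
    |Real.log n - ℓ / 2 ^ 40| ≤ 0.000000005 := by
  obtain ⟨h1, h2⟩ := h
  have h3 : (n : ℝ) ≤ 4000 := by exact_mod_cast hn
  have h4 : 0 ≤ 462 / (n : ℝ) := by positivity
  rw [abs_le]
  constructor <;> norm_num at h1 h2 ⊢ <;> linarith

/-- Pass on `n` after evaluating it. -/
def forceNat {α : Type} (n : ℕ) (f : ℕ → α) : α :=
  Nat.rec (f 0) (fun m _ ↦ f (Nat.succ m)) n

lemma forceNat_eq {α : Type} (n : ℕ) (f : ℕ → α) : forceNat n f = f n := by
  cases n <;> rfl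

/-- Pass on `n` after evaluating it. -/
noncomputable def forceInt {α : Type} (n : ℤ) (f : ℤ → α) : α :=
  Int.rec (fun m ↦ forceNat m fun k ↦ f (Int.ofNat k))
    (fun m ↦ forceNat m fun k ↦ f (Int.negSucc k)) n

lemma forceInt_eq {α : Type} (n : ℤ) (f : ℤ → α) : forceInt n f = f n := by
  cases n <;> simp [forceInt, forceNat_eq]

/-- For `n ≤ 1368`, the exponent `m` if `n` is the `m`-th power of a prime, and `0` otherwise. -/
def primeExp (n : ℕ) : ℕ :=
  match [2, 3, 5, 7, 11, 13, 17, 19, 23, 29, 31].find? fun p ↦ p ^ 10 % n == 0 with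
  | some p => ((List.range 11).find? fun m ↦ p ^ m == n).getD 0
  | none => if Nat.gcd n 200560490130 == 1 then 1 else 0

/-- Numerator of a Taylor polynomial of `cos (a / q)`. -/
def cosNum (x y : ℤ) : ℤ :=
  3628800 * y ^ 5 - 1814400 * y ^ 4 * x + 151200 * y ^ 3 * x ^ 2 - 5040 * y ^ 2 * x ^ 3 +
    90 * y * x ^ 4 - x ^ 5

/-- Numerator of a Taylor polynomial of `sin (a / q)`. -/
def sinNum (x y : ℤ) : ℤ :=
  39916800 * y ^ 5 - 6652800 * y ^ 4 * x + 332640 * y ^ 3 * x ^ 2 - 7920 * y ^ 2 * x ^ 3 +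
    110 * y * x ^ 4 - x ^ 5

/-- Real part of `(C + iS) * ∏ j, (2 ^ 24 - 1 + B ^ (2 ^ j) * e ^ (2 ^ j))`, with
`e = (c + is) / 2 ^ 40`, in fixed point arithmetic. -/
noncomputable def lanes : ℕ → ℤ → ℤ → ℤ → ℤ → ℤ → ℤ
  | 0, _, _, _, C, _ => C
  | r + 1, B, c, s, C, S =>
    forceInt (c / 65536) fun c' ↦
    forceInt (s / 65536) fun s' ↦
    forceInt (16777215 * C + B * (c' * C - s' * S)) fun C₁ ↦
    forceInt (16777215 * S + B * (c' * S + s' * C)) fun S₁ ↦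
    forceInt ((c ^ 2 - s ^ 2) / 1099511627776) fun c'' ↦
    forceInt (2 * c * s / 1099511627776) fun s'' ↦
    forceInt (B * B) fun B' ↦
    lanes r B' c'' s'' C₁ S₁

/-- Rounded contribution of `n`, for a base point `c + is`. -/
noncomputable def laneStart (W c s : ℤ) : ℤ :=
  forceInt ((c ^ 2 - s ^ 2) / 1099511627776) fun c₁ ↦
  forceInt (2 * c * s / 1099511627776) fun s₁ ↦
  lanes 11 (2 ^ 300 + 1 : ℕ) c₁ s₁ W 0

/-- Rounded weight of `n`, with `ℓ` approximating `2 ^ 40 * log n`. -/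
def weight (n ℓ : ℕ) : ℕ :=
  forceNat (primeExp n) fun m ↦ ℓ * (7 * 2 ^ 40 - ℓ) / (2 ^ 60 * (n * m))

/-- Rounded contribution of `n`, with `ℓ` approximating `2 ^ 40 * log n`. -/
noncomputable def lane (n ℓ : ℕ) : ℤ :=
  forceNat (weight n ℓ) fun w ↦
  match w with
  | 0 => 0
  | w + 1 =>
    forceInt ((ℓ : ℤ) ^ 2) fun x ↦
    forceInt (1099511627776 * cosNum x 120892581961462917470617600 /
      (3628800 * 120892581961462917470617600 ^ 5)) fun c ↦
    forceInt (1099511627776 * (ℓ * sinNum x 120892581961462917470617600) /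
      (39916800 * 120892581961462917470617600 ^ 5 * 10995116277760)) fun s ↦
    laneStart (w + 1 : ℕ) c s

/-- `acc` plus the sum of `r` values of `f` from `n` on, with `ℓ` approximating
`2 ^ 40 * log n`. -/
noncomputable def tableSum (f : ℕ → ℕ → ℤ) : ℕ → ℕ → ℕ → ℤ → ℤ
  | 0, _, _, acc => acc
  | r + 1, n, ℓ, acc =>
    forceInt (acc + f n ℓ) fun acc' ↦
    forceNat (ℓ + logStep n) fun ℓ' ↦
    forceNat (n + 1) fun n' ↦
    tableSum f r n' ℓ' acc'

/-- Inspection of the digits of `X`. -/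
def checkLanes : ℕ → ℕ → ℕ → ℕ → Bool
  | 0, _, _, _ => true
  | r + 1, k, ℓ, X =>
    (Nat.ble k 17 || Nat.ble (2 ^ 35 + 7 * ℓ / 2 ^ 21 + 450 * 2 ^ 20 / k ^ 2 + 10 * 2 ^ 20 / k + 3)
      (X % (2 ^ 300 + 1) / 2 ^ 264 + 33465303)) &&
    forceNat (X / (2 ^ 300 + 1)) fun X₁ ↦
    forceNat (ℓ + logStep k) fun ℓ₁ ↦
    forceNat (k + 1) fun k₁ ↦
    checkLanes r k₁ ℓ₁ X₁

/-- Verification that the digits of the shifted sum are large enough. -/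
theorem checkLanes_true : checkLanes 1449 2 762123384499
    ((tableSum lane 1096 2 762123384499 0 + ((2 ^ 299 * (((2 ^ 300 + 1) ^ 2048 - 1) / 2 ^ 300) : ℕ) : ℤ)).toNat /
      (2 ^ 300 + 1) ^ 2) = true := by
  decide +kernel

/-- The total weight. -/
theorem tableSum_weight : tableSum (fun n ℓ ↦ (weight n ℓ : ℤ)) 1096 2 762123384499 0 ≤ 25800000 := by
  decide +kernel

/-- Approximation to `2 ^ 40 * log n`. -/
def logTab (n : ℕ) : ℕ := 762123384499 + ∑ i ∈ Finset.Ico 2 n, logStep i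

lemma logTab_two : logTab 2 = 762123384499 := by simp [logTab]

lemma logTab_succ {n : ℕ} (hn : 2 ≤ n) : logTab (n + 1) = logTab n + logStep n := by
  rw [logTab, Finset.sum_Ico_succ_top hn, logTab, add_assoc]

lemma isLog_logTab {n : ℕ} (hn : 2 ≤ n) : IsLog n (logTab n) := by
  induction n, hn using Nat.le_induction with
  | base => rw [logTab_two]; exact_mod_cast isLog_two
  | succ n hn ih => rw [logTab_succ hn]; exact isLog_succ hn ih

lemma tableSum_eq (f : ℕ → ℕ → ℤ) (r : ℕ) : ∀ (n : ℕ), 2 ≤ n → ∀ acc : ℤ,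
    tableSum f r n (logTab n) acc = acc + ∑ i ∈ Finset.Ico n (n + r), f i (logTab i) := by
  induction r with
  | zero => intro n hn acc; simp [tableSum]
  | succ r ih =>
    intro n hn acc
    rw [tableSum, forceInt_eq, forceNat_eq, forceNat_eq, ← logTab_succ hn, ih _ (by omega),
      Finset.sum_eq_sum_Ico_succ_bot (show n < n + (r + 1) by omega),
      show n + 1 + r = n + (r + 1) by omega, add_assoc]

/-- `C + iS` is a polynomial in `B` with coefficients close to `A * E ^ k`. -/
def Packed (B : ℤ) (n : ℕ) (A δ : ℝ) (E : ℂ) (C S : ℤ) : Prop :=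
  ∃ a b : ℕ → ℤ, C = ∑ k ∈ Finset.range n, B ^ k * a k ∧ S = ∑ k ∈ Finset.range n, B ^ k * b k ∧
    ∀ k < n, ‖((a k : ℂ) + b k * I) - A * E ^ k‖ ≤ A * δ

lemma Packed.double {B : ℤ} {n : ℕ} {A δ : ℝ} {E : ℂ} {C S : ℤ} (hP : Packed B n A δ E C S)
    (hA : 0 ≤ A) (hE : ‖E‖ = 1) {u c s : ℤ} {v ε : ℝ} (hv : 0 < v) (hε : 0 ≤ ε)
    (hu : ‖(u : ℂ) - v‖ ≤ v * ε) (hcs : ‖((c : ℂ) + s * I) - v * E ^ n‖ ≤ v * ε) :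
    Packed B (n + n) (A * v) ((1 + δ) * (1 + ε) - 1) E
      (u * C + B ^ n * (c * C - s * S)) (u * S + B ^ n * (c * S + s * C)) := by
  obtain ⟨a, b, hC, hS, hab⟩ := hP
  have key : ∀ (z w F G : ℂ), ‖F‖ = 1 → ‖G‖ = 1 → ‖z - A * F‖ ≤ A * δ → ‖w - v * G‖ ≤ v * ε →
      ‖w * z - (A * v : ℝ) * (G * F)‖ ≤ A * v * ((1 + δ) * (1 + ε) - 1) := by
    intro z w F G hF hG hz hw
    have e : w * z - (A * v : ℝ) * (G * F) =
        (w - v * G) * (z - A * F) + (w - v * G) * (A * F) + v * G * (z - A * F) := by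
      push_cast; ring
    rw [e]
    refine (norm_add₃_le).trans ?_
    simp only [norm_mul, hF, hG, Complex.norm_real, Real.norm_eq_abs, abs_of_nonneg hA,
      abs_of_pos hv, mul_one]
    have h1 : ‖w - v * G‖ * ‖z - A * F‖ ≤ v * ε * (A * δ) := by gcongr
    have h2 : ‖w - v * G‖ * A ≤ v * ε * A := by gcongr
    have h3 : v * ‖z - A * F‖ ≤ v * (A * δ) := by gcongr
    nlinarith
  refine ⟨fun k ↦ if k < n then u * a k else c * a (k - n) - s * b (k - n),
    fun k ↦ if k < n then u * b k else c * b (k - n) + s * a (k - n), ?_, ?_, ?_⟩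
  · rw [Finset.sum_range_add, hC, hS, Finset.mul_sum, Finset.mul_sum, Finset.mul_sum,
      ← Finset.sum_sub_distrib, Finset.mul_sum]
    congr 1
    · refine Finset.sum_congr rfl fun k hk ↦ ?_
      simp only [if_pos (Finset.mem_range.1 hk)]; ring
    · refine Finset.sum_congr rfl fun k hk ↦ ?_
      simp only [if_neg (show ¬ n + k < n by omega), Nat.add_sub_cancel_left, pow_add]; ring
  · rw [Finset.sum_range_add, hC, hS, Finset.mul_sum, Finset.mul_sum, Finset.mul_sum,
      ← Finset.sum_add_distrib, Finset.mul_sum]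
    congr 1
    · refine Finset.sum_congr rfl fun k hk ↦ ?_
      simp only [if_pos (Finset.mem_range.1 hk)]; ring
    · refine Finset.sum_congr rfl fun k hk ↦ ?_
      simp only [if_neg (show ¬ n + k < n by omega), Nat.add_sub_cancel_left, pow_add]; ring
  · intro k hk
    by_cases hkn : k < n
    · simp only [if_pos hkn]
      have := key (a k + b k * I) u (E ^ k) 1 (by simp [hE]) (by simp) (hab k hkn) (by simpa using hu)
      convert this using 2
      push_cast; ring
    · simp only [if_neg hkn]
      have := key (a (k - n) + b (k - n) * I) (c + s * I) (E ^ (k - n)) (E ^ n) (by simp [hE])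
        (by simp [hE]) (hab (k - n) (by omega)) hcs
      rw [← pow_add, show n + (k - n) = k by omega] at this
      convert this using 2
      push_cast
      linear_combination (-(s : ℂ) * b (k - n)) * I_sq

lemma intDiv_real (a b : ℤ) (hb : 0 < b) :
    |((a / b : ℤ) : ℝ) - (a : ℝ) / b| ≤ 1 := by
  have hb' : (0:ℝ) < b := by exact_mod_cast hb
  have h1 : a / b * b ≤ a := Int.ediv_mul_le a hb.ne'
  have h2 : a < (a / b + 1) * b := Int.lt_ediv_add_one_mul_self a hb
  have h1' : ((a / b : ℤ) : ℝ) * b ≤ a := by exact_mod_cast h1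
  have h2' : (a : ℝ) ≤ (((a / b : ℤ) : ℝ) + 1) * b := by exact_mod_cast h2.le
  rw [← le_div_iff₀ hb'] at h1'
  rw [← div_le_iff₀ hb'] at h2'
  rw [abs_le]; constructor <;> linarith

/-- `(c + is) / 2 ^ 40` is within `e` of `E`. -/
def Near (E : ℂ) (e : ℝ) (c s : ℤ) : Prop := ‖((c : ℂ) + s * I) / 2 ^ 40 - E‖ ≤ e

lemma norm_le_of_abs_le {x y r : ℝ} (hr : 0 ≤ r) (hx : |x| ≤ r) (hy : |y| ≤ r) :
    ‖(x : ℂ) + y * I‖ ≤ 1.4143 * r := by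
  rw [Complex.norm_add_mul_I, Real.sqrt_le_left (by positivity)]
  nlinarith [sq_le_sq' (abs_le.1 hx).1 (abs_le.1 hx).2, sq_le_sq' (abs_le.1 hy).1 (abs_le.1 hy).2]

lemma Near.sq {E : ℂ} {e : ℝ} {c s : ℤ} (h : Near E e c s) (hE : ‖E‖ = 1) (he : 0.00000000001 ≤ e)
    (he' : e ≤ 1 / 10) :
    Near (E ^ 2) (3 * e) ((c ^ 2 - s ^ 2) / 1099511627776) (2 * c * s / 1099511627776) := by
  have h1 := intDiv_real (c ^ 2 - s ^ 2) 1099511627776 (by norm_num)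
  have h2 := intDiv_real (2 * c * s) 1099511627776 (by norm_num)
  have h3 := norm_le_of_abs_le zero_le_one h1 h2
  rw [Near] at h ⊢
  set p := (c ^ 2 - s ^ 2) / 1099511627776
  set q := 2 * c * s / 1099511627776
  set d := ((c : ℂ) + s * I) / 2 ^ 40 - E with hd
  have e1 : ((p : ℂ) + q * I) / 2 ^ 40 - E ^ 2 =
      (((p - ((c ^ 2 - s ^ 2 : ℤ) : ℝ) / (1099511627776 : ℤ) : ℝ) : ℂ) +
        ((q - ((2 * c * s : ℤ) : ℝ) / (1099511627776 : ℤ) : ℝ) : ℂ) * I) / 2 ^ 40 +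
      (d * d + 2 * E * d) := by
    rw [hd]; push_cast
    ring_nf
    rw [I_sq]; ring
  rw [e1]
  refine (norm_add_le _ _).trans ?_
  have h4 : ‖d * d + 2 * E * d‖ ≤ e * e + 2 * e := by
    refine (norm_add_le _ _).trans ?_
    rw [norm_mul, norm_mul, norm_mul, hE]
    have : ‖(2:ℂ)‖ = 2 := by simp
    rw [this]
    nlinarith [norm_nonneg d]
  rw [norm_div]
  have h5 : ‖(2:ℂ) ^ 40‖ = 2 ^ 40 := by simp
  rw [h5]
  have h6 := div_le_div_of_nonneg_right h3 (show (0:ℝ) ≤ 2 ^ 40 by positivity)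
  have h7 : (1.4143 : ℝ) * 1 / 2 ^ 40 ≤ 0.000000000002 := by norm_num
  nlinarith

lemma Near.round {E : ℂ} {e : ℝ} {c s : ℤ} (h : Near E e c s) (he : e ≤ 0.00011) :
    ‖(((c / 65536 : ℤ) : ℂ) + (s / 65536 : ℤ) * I) - (16777216 : ℝ) * E‖ ≤ 16777216 * 0.00012 := by
  have h1 := intDiv_real c 65536 (by norm_num)
  have h2 := intDiv_real s 65536 (by norm_num)
  have h3 := norm_le_of_abs_le zero_le_one h1 h2
  rw [Near] at h
  have e1 : (((c / 65536 : ℤ) : ℂ) + (s / 65536 : ℤ) * I) - (16777216 : ℝ) * E =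
      ((((c / 65536 : ℤ) : ℝ) - (c : ℝ) / (65536 : ℤ) : ℝ) : ℂ) +
        ((((s / 65536 : ℤ) : ℝ) - (s : ℝ) / (65536 : ℤ) : ℝ) : ℂ) * I +
      16777216 * (((c : ℂ) + s * I) / 2 ^ 40 - E) := by
    push_cast; ring
  rw [e1]
  refine (norm_add_le _ _).trans ?_
  rw [norm_mul]
  have : ‖(16777216:ℂ)‖ = 16777216 := by simp
  rw [this]
  norm_num at h3 he ⊢
  linarith

lemma lanes_eq {E : ℂ} (hE : ‖E‖ = 1) {A : ℝ} (hA : 0 ≤ A) {B : ℤ} (r : ℕ) :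
    ∀ (n : ℕ) (c s C S : ℤ) (v δ e : ℝ), 0 ≤ v → 0 ≤ δ → 0.00000000001 ≤ e → 3 ^ r * e ≤ 0.00033 →
      Near (E ^ n) e c s → Packed B n (A * v) δ E C S →
      ∃ S', Packed B (n * 2 ^ r) (A * (v * 16777216 ^ r)) ((1 + δ) * (1 + 0.00012) ^ r - 1) E
        (lanes r (B ^ n) c s C S) S' := by
  induction r with
  | zero =>
    intro n c s C S v δ e hv hδ he he' hN hP
    exact ⟨S, by simpa [lanes] using hP⟩
  | succ r ih =>
    intro n c s C S v δ e hv hδ he he' hN hP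
    have h3r : (1:ℝ) ≤ 3 ^ r := one_le_pow₀ (by norm_num)
    rw [pow_succ] at he'
    have he9 : e ≤ 0.00011 := by norm_num at he he' ⊢; nlinarith
    simp only [lanes, forceInt_eq]
    have hd := hP.double (by positivity) hE (u := 16777215) (c := c / 65536) (s := s / 65536)
      (v := 16777216) (ε := 0.00012) (by norm_num) (by norm_num)
      (by norm_num) (hN.round he9)
    have hsq := hN.sq (by simp [hE]) he (by norm_num at he9 ⊢; linarith)
    rw [← pow_mul, mul_two] at hsq
    have := ih (n + n) _ _ _ _ (v * 16777216) ((1 + δ) * (1 + 0.00012) - 1) (3 * e) (by positivity)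
      (by norm_num; nlinarith) (by norm_num at he ⊢; linarith) (by linarith) hsq
      (by rw [← mul_assoc]; exact hd)
    obtain ⟨S', hS'⟩ := this
    refine ⟨S', ?_⟩
    rw [← pow_add]
    convert hS' using 1
    · ring
    · ring
    · ring

lemma primeExp_spec {n : ℕ} (hn : 2 ≤ n) (hn' : n ≤ 1097) :
    (primeExp n = 0 ∧ Λ n = 0) ∨ (0 < primeExp n ∧ Λ n = Real.log n / primeExp n) := by
  have hprime : ∀ p ∈ [2, 3, 5, 7, 11, 13, 17, 19, 23, 29, 31], p.Prime := by
    intro p hp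
    simp only [List.mem_cons, List.not_mem_nil, or_false] at hp
    rcases hp with h | h | h | h | h | h | h | h | h | h | h <;> subst h <;> norm_num
  rw [primeExp]
  cases hf : [2, 3, 5, 7, 11, 13, 17, 19, 23, 29, 31].find? fun p ↦ p ^ 10 % n == 0 with
  | some p =>
    have hp := hprime p (List.mem_of_find?_eq_some hf)
    have hd : n ∣ p ^ 10 := Nat.dvd_of_mod_eq_zero (by simpa using List.find?_some hf)
    obtain ⟨m, hm, hnm⟩ := (Nat.dvd_prime_pow hp).1 hd
    right
    dsimp only
    cases hg : (List.range 11).find? fun m ↦ p ^ m == n with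
    | none =>
      rw [List.find?_eq_none] at hg
      exact absurd (by simp [hnm]) (hg m (List.mem_range.2 (by omega)))
    | some m' =>
      have h1 : p ^ m' = n := by simpa using List.find?_some hg
      have h2 : m' ≠ 0 := by rintro rfl; simp at h1; omega
      rw [Option.getD_some]
      refine ⟨Nat.pos_of_ne_zero h2, ?_⟩
      rw [← h1, ArithmeticFunction.vonMangoldt_apply_pow h2,
        ArithmeticFunction.vonMangoldt_apply_prime hp]
      have : (m' : ℝ) ≠ 0 := by exact_mod_cast h2
      push_cast
      rw [Real.log_pow]; field_simp
  | none =>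
    rw [List.find?_eq_none] at hf
    dsimp only
    by_cases hg : Nat.gcd n 200560490130 = 1
    · right
      have hpr : n.Prime := by
        by_contra hnp
        have h1 := Nat.minFac_sq_le_self (by omega) hnp
        have h2 : n.minFac < 37 := by nlinarith
        have h3 := Nat.minFac_prime (show n ≠ 1 by omega)
        have h4 : n.minFac ∣ 200560490130 := by
          revert h3; generalize n.minFac = q at h2
          interval_cases q <;> norm_num
        have h5 := Nat.dvd_gcd (Nat.minFac_dvd n) h4
        rw [hg] at h5
        exact h3.one_lt.ne' (Nat.dvd_one.1 h5)
      simp [hg, ArithmeticFunction.vonMangoldt_apply_prime hpr]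
    · left
      refine ⟨by simp [hg], ?_⟩
      rw [ArithmeticFunction.vonMangoldt_eq_zero_iff]
      rw [isPrimePow_nat_iff]
      rintro ⟨p, k, hp, hk, rfl⟩
      have hk10 : k ≤ 10 := by
        by_contra h
        have : 2 ^ 11 ≤ p ^ k := (Nat.pow_le_pow_left hp.two_le 11).trans
          (Nat.pow_le_pow_right hp.pos (by omega))
        omega
      have hpd : p ∣ 200560490130 := by
        by_contra h
        exact hg (((Nat.Prime.coprime_iff_not_dvd hp).2 h).pow_left k)
      have hmem : p ∈ [2, 3, 5, 7, 11, 13, 17, 19, 23, 29, 31] := by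
        have h6 : (200560490130:ℕ) = 2 * 3 * 5 * 7 * 11 * 13 * 17 * 19 * 23 * 29 * 31 := by norm_num
        rw [h6] at hpd
        simp only [hp.dvd_mul] at hpd
        simp only [List.mem_cons, List.not_mem_nil, or_false]
        have e : ∀ q : ℕ, q.Prime → p ∣ q → p = q := fun q hq h ↦ (Nat.prime_dvd_prime_iff_eq hp hq).1 h
        rcases hpd with (((((((((h | h) | h) | h) | h) | h) | h) | h) | h) | h) | h <;>
          simp [e _ (by norm_num) h]
      have := hf p hmem
      simp only [beq_iff_eq] at this
      exact this (Nat.mod_eq_zero_of_dvd (pow_dvd_pow p hk10))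

lemma log_le_of_le_1097 {n : ℕ} (hn' : n ≤ 1097) : Real.log n ≤ 7.5 := by
  rcases Nat.eq_zero_or_pos n with rfl | h0
  · norm_num
  have h0' : (0:ℝ) < n := by exact_mod_cast h0
  rw [Real.log_le_iff_le_exp h0']
  have h1 : (n:ℝ) ≤ 1097 := by exact_mod_cast hn'
  have h2 : (2.7182818283:ℝ) ≤ Real.exp 1 := Real.exp_one_gt_d9.le
  have h3 : Real.exp 7 ≤ Real.exp 7.5 / 1.5 := by
    rw [show (7.5:ℝ) = 7 + 0.5 by norm_num, Real.exp_add]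
    rw [le_div_iff₀ (by norm_num)]
    have := Real.add_one_le_exp (0.5:ℝ)
    gcongr
    norm_num at this ⊢
    linarith
  have h4 : Real.exp 7 = Real.exp 1 ^ 7 := by rw [← Real.exp_nat_mul]; norm_num
  have h5 : (2.7:ℝ) ^ 7 ≤ Real.exp 1 ^ 7 := by gcongr; linarith
  norm_num at h3 h5
  rw [h4] at h3
  norm_num
  linarith

lemma weight_spec {n : ℕ} (hn : 2 ≤ n) (hn' : n ≤ 1097) :
    |(weight n (logTab n) : ℝ) / 2 ^ 20 - Λ n * max (7 - Real.log n) 0 / n| ≤ 1.1 / 2 ^ 20 := by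
  have herr := (isLog_logTab hn).err (by omega)
  have hle := (isLog_logTab hn).1
  rw [weight, forceNat_eq]
  have hl := log_le_of_le_1097 hn'
  have hl0 : 0 ≤ Real.log n := Real.log_natCast_nonneg n
  set ℓ := logTab n
  rcases primeExp_spec hn hn' with ⟨h1, h2⟩ | ⟨h1, h2⟩
  · rw [h1, h2]; simp; norm_num
  set m := primeExp n
  have hm' : (1:ℝ) ≤ m := by exact_mod_cast h1
  have hn2 : (2:ℝ) ≤ n := by exact_mod_cast hn
  have hfl := natDiv_real (ℓ * (7 * 2 ^ 40 - ℓ)) (2 ^ 60 * (n * m)) (by positivity)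
  set W := ℓ * (7 * 2 ^ 40 - ℓ) / (2 ^ 60 * (n * m))
  have hsub : (((7 * 2 ^ 40 - ℓ : ℕ)) : ℝ) = 2 ^ 40 * max (7 - (ℓ:ℝ) / 2 ^ 40) 0 := by
    rw [mul_max_of_nonneg _ _ (by positivity)]
    rcases le_total ℓ (7 * 2 ^ 40) with h | h
    · have h' : (ℓ:ℝ) ≤ 7 * 2 ^ 40 := by exact_mod_cast h
      rw [Nat.cast_sub h, max_eq_left (by
        refine mul_le_mul_of_nonneg_left ?_ (by positivity)
        rw [sub_nonneg, div_le_iff₀ (by positivity)]; exact h')]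
      push_cast; ring
    · have h' : (7:ℝ) * 2 ^ 40 ≤ ℓ := by exact_mod_cast h
      rw [Nat.sub_eq_zero_of_le h, max_eq_right (by
        refine mul_le_mul_of_nonneg_left ?_ (by positivity)
        rw [sub_nonpos, le_div_iff₀ (by positivity)]; exact h')]; simp
  set lam : ℝ := ℓ / 2 ^ 40 with hlam
  have hlam0 : 0 ≤ lam := by positivity
  have hμ : |max (7 - lam) 0 - max (7 - Real.log n) 0| ≤ 0.000000005 := by
    refine (abs_max_sub_max_le_abs _ _ _).trans ?_
    rw [show 7 - lam - (7 - Real.log n) = Real.log n - lam by ring]; exact herr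
  have hμ7 : max (7 - lam) 0 ≤ 7 := max_le (by linarith) (by norm_num)
  have hμ0 : 0 ≤ max (7 - lam) 0 := le_max_right _ _
  have hval : ((ℓ * (7 * 2 ^ 40 - ℓ) : ℕ) : ℝ) / ((2 ^ 60 * (n * m) : ℕ) : ℝ) =
      2 ^ 20 * (lam * max (7 - lam) 0 / (n * m)) := by
    rw [Nat.cast_mul, hsub, show (ℓ:ℝ) = 2 ^ 40 * lam by rw [hlam]; field_simp]
    push_cast
    field_simp
    norm_num
    ring
  rw [hval] at hfl
  have hprod : |lam * max (7 - lam) 0 - Real.log n * max (7 - Real.log n) 0| ≤ 0.0000001 := by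
    rw [show lam * max (7 - lam) 0 - Real.log n * max (7 - Real.log n) 0 =
      (lam - Real.log n) * max (7 - lam) 0 +
      Real.log n * (max (7 - lam) 0 - max (7 - Real.log n) 0) by ring]
    refine (abs_add_le _ _).trans ?_
    rw [abs_mul, abs_mul, abs_of_nonneg hμ0, abs_of_nonneg hl0, abs_sub_comm lam]
    have h3 : |Real.log n - lam| * max (7 - lam) 0 ≤ 0.000000005 * 7 := by gcongr
    have h4 : Real.log n * |max (7 - lam) 0 - max (7 - Real.log n) 0| ≤ 7.5 * 0.000000005 := by gcongr
    norm_num at h3 h4 ⊢; linarith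
  have hnm : (2:ℝ) ≤ n * m := by nlinarith
  have hdiv : |lam * max (7 - lam) 0 / (n * m) -
      Real.log n * max (7 - Real.log n) 0 / (n * m)| ≤ 0.00000005 := by
    rw [← sub_div, abs_div, abs_of_pos (show (0:ℝ) < n * m by positivity),
      div_le_iff₀ (by positivity)]
    norm_num at hprod ⊢
    linarith
  rw [h2, show Real.log n / m * max (7 - Real.log n) 0 / n =
    Real.log n * max (7 - Real.log n) 0 / (n * m) by field_simp]
  rw [abs_le] at hdiv ⊢
  obtain ⟨h5, h6⟩ := hdiv
  obtain ⟨h7, h8⟩ := hfl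
  norm_num at h5 h6 h7 h8 ⊢
  constructor <;> linarith

lemma norm_exp_sub_exp_le (a b : ℝ) : ‖cexp (a * I) - cexp (b * I)‖ ≤ |a - b| := by
  have : cexp (a * I) - cexp (b * I) = cexp (b * I) * (cexp (I * ((a - b : ℝ) : ℂ)) - 1) := by
    rw [mul_sub, ← Complex.exp_add]
    push_cast
    ring_nf
  rw [this, norm_mul, Complex.norm_exp_ofReal_mul_I, one_mul]
  exact Real.norm_exp_I_mul_ofReal_sub_one_le

lemma near_start {ℓ : ℕ} {l : ℝ} (h : |l - ℓ / 2 ^ 40| ≤ 0.000000005) (hl : l ≤ 7.5)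
    (hl' : (ℓ : ℝ) ≤ 2 ^ 40 * l) :
    Near (cexp ((l / 10 : ℝ) * I)) 0.0000000006
      (1099511627776 * cosNum ((ℓ : ℤ) ^ 2) 120892581961462917470617600 /
        (3628800 * 120892581961462917470617600 ^ 5))
      (1099511627776 * (ℓ * sinNum ((ℓ : ℤ) ^ 2) 120892581961462917470617600) /
        (39916800 * 120892581961462917470617600 ^ 5 * 10995116277760)) := by
  have h1 := intDiv_real (1099511627776 * cosNum ((ℓ : ℤ) ^ 2) 120892581961462917470617600)
    (3628800 * 120892581961462917470617600 ^ 5) (by norm_num)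
  have h2 := intDiv_real (1099511627776 * (ℓ * sinNum ((ℓ : ℤ) ^ 2) 120892581961462917470617600))
    (39916800 * 120892581961462917470617600 ^ 5 * 10995116277760) (by norm_num)
  have h3 := norm_le_of_abs_le zero_le_one h1 h2
  rw [Near]
  set c := 1099511627776 * cosNum ((ℓ : ℤ) ^ 2) 120892581961462917470617600 /
        (3628800 * 120892581961462917470617600 ^ 5)
  set s := 1099511627776 * (ℓ * sinNum ((ℓ : ℤ) ^ 2) 120892581961462917470617600) /
        (39916800 * 120892581961462917470617600 ^ 5 * 10995116277760)
  set ψ : ℝ := ℓ / 10995116277760 with hψ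
  have hψ0 : 0 ≤ ψ := by positivity
  have hψ1 : ψ ≤ 0.75 := by
    rw [hψ, div_le_iff₀ (by norm_num)]
    refine hl'.trans ((mul_le_mul_of_nonneg_left hl (by positivity)).trans ?_)
    norm_num
  have hψn : ‖(ψ : ℂ) * I‖ = ψ := by simp [abs_of_nonneg hψ0]
  have ht := Complex.exp_bound (x := (ψ : ℂ) * I) (by rw [hψn]; linarith) (n := 12) (by norm_num)
  have hb : ‖(ψ : ℂ) * I‖ ^ 12 * (((12:ℕ).succ : ℝ) * (((12:ℕ).factorial * (12:ℕ) : ℝ))⁻¹) ≤ 0.00000000008 := by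
    rw [hψn]
    have : ψ ^ 12 ≤ 0.75 ^ 12 := by gcongr
    norm_num [Nat.factorial] at this ⊢
    linarith
  have hs : ∑ m ∈ Finset.range 12, ((ψ : ℂ) * I) ^ m / (m.factorial : ℂ) =
      ((((1099511627776 * cosNum ((ℓ : ℤ) ^ 2) 120892581961462917470617600 : ℤ) : ℝ) /
        ((3628800 * 120892581961462917470617600 ^ 5 : ℤ) : ℝ) : ℝ) +
       (((1099511627776 * (ℓ * sinNum ((ℓ : ℤ) ^ 2) 120892581961462917470617600) : ℤ) : ℝ) /
        ((39916800 * 120892581961462917470617600 ^ 5 * 10995116277760 : ℤ) : ℝ) : ℝ) * I) /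
        2 ^ 40 := by
    simp only [Finset.sum_range_succ, Finset.sum_range_zero, mul_pow, Nat.factorial]
    rw [hψ, cosNum, sinNum]
    have i2 : I ^ 2 = -1 := I_sq
    have i3 : I ^ 3 = -I := by rw [pow_succ, I_sq]; ring
    have i4 : I ^ 4 = 1 := I_pow_four
    have i5 : I ^ 5 = I := by rw [pow_succ, i4]; ring
    have i6 : I ^ 6 = -1 := by rw [pow_succ, i5, ← sq, i2]
    have i7 : I ^ 7 = -I := by rw [pow_succ, i6]; ring
    have i8 : I ^ 8 = 1 := by rw [pow_succ, i7, neg_mul, ← sq, i2]; ring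
    have i9 : I ^ 9 = I := by rw [pow_succ, i8]; ring
    have i10 : I ^ 10 = -1 := by rw [pow_succ, i9, ← sq, i2]
    have i11 : I ^ 11 = -I := by rw [pow_succ, i10]; ring
    rw [i2, i3, i4, i5, i6, i7, i8, i9, i10, i11]
    push_cast
    ring
  have e1 : ((c : ℂ) + s * I) / 2 ^ 40 - cexp ((l / 10 : ℝ) * I) =
      (((c - ((1099511627776 * cosNum ((ℓ : ℤ) ^ 2) 120892581961462917470617600 : ℤ) : ℝ) /
        ((3628800 * 120892581961462917470617600 ^ 5 : ℤ) : ℝ) : ℝ) : ℂ) +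
       ((s - ((1099511627776 * (ℓ * sinNum ((ℓ : ℤ) ^ 2) 120892581961462917470617600) : ℤ) : ℝ) /
        ((39916800 * 120892581961462917470617600 ^ 5 * 10995116277760 : ℤ) : ℝ) : ℝ) : ℂ) * I) /
        2 ^ 40 -
      (cexp ((ψ : ℂ) * I) - ∑ m ∈ Finset.range 12, ((ψ : ℂ) * I) ^ m / (m.factorial : ℂ)) +
      (cexp ((ψ : ℝ) * I) - cexp ((l / 10 : ℝ) * I)) := by
    rw [hs]; push_cast; ring
  rw [e1]
  refine (norm_add_le _ _).trans ?_
  have h4 := norm_exp_sub_exp_le ψ (l / 10)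
  have h5 : |ψ - l / 10| ≤ 0.0000000005 := by
    rw [show ψ - l / 10 = -((l - ℓ / 2 ^ 40) / 10) by rw [hψ]; ring, abs_neg, abs_div]
    norm_num at h ⊢; linarith
  have h6 := norm_sub_le ((((c - ((1099511627776 * cosNum ((ℓ : ℤ) ^ 2) 120892581961462917470617600 : ℤ) : ℝ) /
        ((3628800 * 120892581961462917470617600 ^ 5 : ℤ) : ℝ) : ℝ) : ℂ) +
       ((s - ((1099511627776 * (ℓ * sinNum ((ℓ : ℤ) ^ 2) 120892581961462917470617600) : ℤ) : ℝ) /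
        ((39916800 * 120892581961462917470617600 ^ 5 * 10995116277760 : ℤ) : ℝ) : ℝ) : ℂ) * I) /
        2 ^ 40)
      (cexp ((ψ : ℂ) * I) - ∑ m ∈ Finset.range 12, ((ψ : ℂ) * I) ^ m / (m.factorial : ℂ))
  rw [norm_div] at h6
  have h7 : ‖(2:ℂ) ^ 40‖ = 2 ^ 40 := by simp
  rw [h7] at h6
  have h8 := div_le_div_of_nonneg_right h3 (show (0:ℝ) ≤ 2 ^ 40 by positivity)
  have h9 : (1.4143 : ℝ) * 1 / 2 ^ 40 ≤ 0.000000000002 := by norm_num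
  norm_num at h5 h9 hb ⊢
  norm_num at h8 ht h6 h4
  linarith

lemma lane_spec {n : ℕ} (hn : 2 ≤ n) (hn' : n ≤ 1097) :
    ∃ a : ℕ → ℤ, lane n (logTab n) = ∑ k ∈ Finset.range 2048, ((2 ^ 300 + 1 : ℕ) : ℤ) ^ k * a k ∧
      ∀ k < 2048, |(a k : ℝ) - (weight n (logTab n) : ℝ) * 2 ^ 264 * Real.cos (k / 5 * Real.log n)| ≤
        (weight n (logTab n) : ℝ) * 2 ^ 264 * 0.00133 := by
  rw [lane, forceNat_eq]
  cases hw : weight n (logTab n) with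
  | zero => exact ⟨0, by simp only [Pi.zero_apply, mul_zero, Finset.sum_const_zero], by simp⟩
  | succ w =>
    dsimp only
    rw [forceInt_eq, forceInt_eq, forceInt_eq]
    have h0 := near_start ((isLog_logTab hn).err (by omega)) (log_le_of_le_1097 hn')
      (isLog_logTab hn).1
    set E := cexp ((Real.log n / 5 : ℝ) * I) with hE
    have hE1 : ‖E‖ = 1 := Complex.norm_exp_ofReal_mul_I _
    have h1 := h0.sq (Complex.norm_exp_ofReal_mul_I _) (by norm_num) (by norm_num)
    have hEsq : cexp ((Real.log n / 10 : ℝ) * I) ^ 2 = E ^ 1 := by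
      rw [hE, ← Complex.exp_nat_mul, pow_one]; push_cast; ring_nf
    rw [hEsq] at h1
    rw [laneStart, forceInt_eq, forceInt_eq]
    have hP : Packed ((2 ^ 300 + 1 : ℕ) : ℤ) 1 (((w + 1 : ℕ) : ℝ) * 1) 0 E ((w + 1 : ℕ) : ℤ) 0 := by
      refine ⟨fun _ ↦ ((w + 1 : ℕ) : ℤ), fun _ ↦ 0, by simp, by simp, ?_⟩
      intro k hk
      obtain rfl : k = 0 := by omega
      simp
    obtain ⟨S', a, b, hC, -, hab⟩ := lanes_eq hE1 (A := ((w + 1 : ℕ) : ℝ)) (by positivity) 11 1 _ _ _ _ 1 0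
      (3 * 0.0000000006) (by norm_num) (by norm_num) (by norm_num) (by norm_num) h1 hP
    have e2 : 1 * 2 ^ 11 = 2048 := by norm_num
    rw [e2] at hC hab
    rw [pow_one] at hC
    refine ⟨a, hC, fun k hk ↦ ?_⟩
    have := (Complex.abs_re_le_norm _).trans (hab k hk)
    have hre : (E ^ k).re = Real.cos (k / 5 * Real.log n) := by
      rw [hE, ← Complex.exp_nat_mul,
        show (k : ℂ) * ((Real.log n / 5 : ℝ) * I) = ((k / 5 * Real.log n : ℝ) : ℂ) * I by
          push_cast; ring, Complex.exp_ofReal_mul_I_re]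
    rw [Complex.sub_re, Complex.re_ofReal_mul, hre] at this
    simp only [add_re, intCast_re, mul_re, I_re, mul_zero, intCast_im, I_im, mul_one, add_zero, sub_self] at this
    have e264 : (1:ℝ) * 16777216 ^ 11 = 2 ^ 264 := by
      rw [show (16777216:ℝ) = 2 ^ 24 by norm_num, ← pow_mul, one_mul]
    rw [e264] at this
    refine this.trans ?_
    gcongr
    norm_num

lemma checkLanes_spec (r m : ℕ) : ∀ (k : ℕ) (g : ℕ → ℕ), 2 ≤ k → (∀ j, g j < 2 ^ 300 + 1) →
    checkLanes r k (logTab k) (∑ j ∈ Finset.range (r + m), (2 ^ 300 + 1) ^ j * g j) = true →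
    ∀ j < r, 18 ≤ k + j →
      2 ^ 35 + 7 * logTab (k + j) / 2 ^ 21 + 450 * 2 ^ 20 / (k + j) ^ 2 + 10 * 2 ^ 20 / (k + j) + 3 ≤
        g j / 2 ^ 264 + 33465303 := by
  induction r with
  | zero => intro k g _ _ _ j hj; omega
  | succ r ih =>
    intro k g hk hg h j hj hkj
    have hX : ∑ j ∈ Finset.range (r + 1 + m), (2 ^ 300 + 1) ^ j * g j =
        g 0 + (2 ^ 300 + 1) * ∑ j ∈ Finset.range (r + m), (2 ^ 300 + 1) ^ j * g (j + 1) := by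
      generalize 2 ^ 300 + 1 = B
      rw [show r + 1 + m = (r + m) + 1 by ring, Finset.sum_range_succ', Finset.mul_sum, add_comm]
      simp only [pow_zero, one_mul, pow_succ]
      congr 1
      exact Finset.sum_congr rfl fun i _ ↦ by ring
    have hmod : (∑ j ∈ Finset.range (r + 1 + m), (2 ^ 300 + 1) ^ j * g j) % (2 ^ 300 + 1) = g 0 := by
      rw [hX, Nat.add_mul_mod_self_left, Nat.mod_eq_of_lt (hg 0)]
    have hdiv : (∑ j ∈ Finset.range (r + 1 + m), (2 ^ 300 + 1) ^ j * g j) / (2 ^ 300 + 1) =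
        ∑ j ∈ Finset.range (r + m), (2 ^ 300 + 1) ^ j * g (j + 1) := by
      rw [hX, Nat.add_mul_div_left _ _ (by positivity), Nat.div_eq_of_lt (hg 0), zero_add]
    rw [checkLanes, forceNat_eq, forceNat_eq, forceNat_eq, ← logTab_succ hk, hmod, hdiv,
      Bool.and_eq_true] at h
    cases j with
    | zero =>
      have := h.1
      rw [Bool.or_eq_true, Nat.ble_eq, Nat.ble_eq] at this
      rw [add_zero] at hkj ⊢
      rcases this with h1 | h1
      · omega
      · exact h1
    | succ j =>
      have := ih (k + 1) (fun i ↦ g (i + 1)) (by omega) (fun i ↦ hg _) h.2 j (by omega) (by omega)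
      rwa [show k + 1 + j = k + (j + 1) by ring] at this

lemma weight_sum_le : ∑ n ∈ Finset.Ico 2 1098, (weight n (logTab n) : ℝ) ≤ 25800000 := by
  have h := tableSum_weight
  rw [← logTab_two, tableSum_eq _ _ _ le_rfl, zero_add] at h
  exact_mod_cast h

/-- Coefficients of the sum over all `n`, and what they approximate. -/
lemma exists_coeffs : ∃ d : ℕ → ℤ,
    tableSum lane 1096 2 762123384499 0 =
      ∑ k ∈ Finset.range 2048, ((2 ^ 300 + 1 : ℕ) : ℤ) ^ k * d k ∧
    ∀ k < 2048, |(d k : ℝ) / 2 ^ 284 - ∑ n ∈ Finset.Ioc 0 1097,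
      Λ n * max (7 - Real.log n) 0 * (Real.cos ((k / 5 : ℝ) * Real.log n) / n)| ≤ 0.0339 ∧
      |(d k : ℝ)| ≤ 2 ^ 289 := by
  have hl : ∀ n, ∃ a : ℕ → ℤ, n ∈ Finset.Ico 2 1098 → lane n (logTab n) =
      ∑ k ∈ Finset.range 2048, ((2 ^ 300 + 1 : ℕ) : ℤ) ^ k * a k ∧
      ∀ k < 2048, |(a k : ℝ) - (weight n (logTab n) : ℝ) * 2 ^ 264 *
        Real.cos (k / 5 * Real.log n)| ≤ (weight n (logTab n) : ℝ) * 2 ^ 264 * 0.00133 := by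
    intro n
    by_cases hn : n ∈ Finset.Ico 2 1098
    · rw [Finset.mem_Ico] at hn
      obtain ⟨a, ha⟩ := lane_spec hn.1 (by omega)
      exact ⟨a, fun _ ↦ ha⟩
    · exact ⟨0, fun h ↦ absurd h hn⟩
  choose a ha using hl
  refine ⟨fun k ↦ ∑ n ∈ Finset.Ico 2 1098, a n k, ?_, fun k hk ↦ ?_⟩
  · rw [← logTab_two, tableSum_eq _ _ _ le_rfl, zero_add]
    simp only [Finset.mul_sum]
    rw [Finset.sum_comm]
    exact Finset.sum_congr rfl fun n hn ↦ (ha n hn).1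
  have hW := weight_sum_le
  have hD : ∑ n ∈ Finset.Ioc 0 1097,
      Λ n * max (7 - Real.log n) 0 * (Real.cos ((k / 5 : ℝ) * Real.log n) / n) =
      ∑ n ∈ Finset.Ico 2 1098,
      Λ n * max (7 - Real.log n) 0 / n * Real.cos ((k / 5 : ℝ) * Real.log n) := by
    rw [show Finset.Ioc 0 1097 = Finset.Ico 1 1098 from rfl,
      Finset.sum_eq_sum_Ico_succ_bot (by norm_num)]
    simp only [ArithmeticFunction.vonMangoldt_apply_one, zero_mul, zero_add]
    exact Finset.sum_congr rfl fun n _ ↦ by ring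
  have h1 : |((∑ n ∈ Finset.Ico 2 1098, a n k : ℤ) : ℝ) - ∑ n ∈ Finset.Ico 2 1098,
      (weight n (logTab n) : ℝ) * 2 ^ 264 * Real.cos (k / 5 * Real.log n)| ≤
      2 ^ 264 * (0.00133 * 25800000) := by
    push_cast
    rw [← Finset.sum_sub_distrib]
    refine (Finset.abs_sum_le_sum_abs _ _).trans ((Finset.sum_le_sum fun n hn ↦ (ha n hn).2 k hk).trans ?_)
    rw [← Finset.sum_mul, ← Finset.sum_mul, mul_comm (∑ n ∈ _, _), mul_assoc,
      mul_comm (∑ n ∈ _, _)]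
    gcongr
  have h2 : |∑ n ∈ Finset.Ico 2 1098, (weight n (logTab n) : ℝ) / 2 ^ 20 * Real.cos (k / 5 * Real.log n) -
      ∑ n ∈ Finset.Ico 2 1098, Λ n * max (7 - Real.log n) 0 / n * Real.cos ((k / 5 : ℝ) * Real.log n)| ≤
      0.00116 := by
    rw [← Finset.sum_sub_distrib]
    refine (Finset.abs_sum_le_sum_abs _ _).trans ?_
    have : ∀ n ∈ Finset.Ico 2 1098, |(weight n (logTab n) : ℝ) / 2 ^ 20 * Real.cos (k / 5 * Real.log n) -
        Λ n * max (7 - Real.log n) 0 / n * Real.cos ((k / 5 : ℝ) * Real.log n)| ≤ 1.1 / 2 ^ 20 := by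
      intro n hn
      rw [Finset.mem_Ico] at hn
      rw [← sub_mul, abs_mul]
      have := mul_le_mul (weight_spec hn.1 (by omega)) (Real.abs_cos_le_one (k / 5 * Real.log n))
        (abs_nonneg _) (by positivity)
      rwa [mul_one] at this
    refine (Finset.sum_le_sum this).trans ?_
    simp
    norm_num
  have h3 : ∑ n ∈ Finset.Ico 2 1098, (weight n (logTab n) : ℝ) * 2 ^ 264 * Real.cos (k / 5 * Real.log n) =
      2 ^ 284 * ∑ n ∈ Finset.Ico 2 1098, (weight n (logTab n) : ℝ) / 2 ^ 20 *
        Real.cos (k / 5 * Real.log n) := by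
    rw [Finset.mul_sum]
    refine Finset.sum_congr rfl fun n _ ↦ ?_
    rw [show (2:ℝ) ^ 284 = 2 ^ 264 * 2 ^ 20 from (by rw [← pow_add])]
    field_simp
  have h5 : |∑ n ∈ Finset.Ico 2 1098, (weight n (logTab n) : ℝ) * 2 ^ 264 *
      Real.cos (k / 5 * Real.log n)| ≤ 2 ^ 264 * 25800000 := by
    refine (Finset.abs_sum_le_sum_abs _ _).trans ?_
    refine le_trans (Finset.sum_le_sum (g := fun n ↦ 2 ^ 264 * (weight n (logTab n) : ℝ)) fun n _ ↦ ?_) ?_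
    · rw [abs_mul, abs_of_nonneg (show (0:ℝ) ≤ (weight n (logTab n) : ℝ) * 2 ^ 264 by positivity),
        mul_comm (2 ^ 264)]
      exact mul_le_of_le_one_right (by positivity) (Real.abs_cos_le_one _)
    · rw [← Finset.mul_sum]; gcongr
  rw [hD]
  set D := ∑ n ∈ Finset.Ico 2 1098, Λ n * max (7 - Real.log n) 0 / n *
    Real.cos ((k / 5 : ℝ) * Real.log n)
  set d : ℝ := ((∑ n ∈ Finset.Ico 2 1098, a n k : ℤ) : ℝ)
  set V := ∑ n ∈ Finset.Ico 2 1098, (weight n (logTab n) : ℝ) * 2 ^ 264 * Real.cos (k / 5 * Real.log n)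
  set U := ∑ n ∈ Finset.Ico 2 1098, (weight n (logTab n) : ℝ) / 2 ^ 20 * Real.cos (k / 5 * Real.log n)
  constructor
  · have h4 : |d / 2 ^ 284 - U| ≤ 0.00133 * 25800000 / 2 ^ 20 := by
      have e : d / 2 ^ 284 - U = (d - V) / 2 ^ 284 := by rw [h3]; field_simp
      rw [e, abs_div, abs_of_pos (show (0:ℝ) < 2 ^ 284 by positivity), div_le_iff₀ (by positivity),
        show (2:ℝ) ^ 284 = 2 ^ 264 * 2 ^ 20 from (by rw [← pow_add])]
      refine h1.trans (le_of_eq ?_)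
      field_simp
    rw [show d / 2 ^ 284 - D = (d / 2 ^ 284 - U) + (U - D) by ring]
    refine (abs_add_le _ _).trans ((add_le_add h4 h2).trans ?_)
    norm_num
  · rw [show d = (d - V) + V by ring]
    refine (abs_add_le _ _).trans ((add_le_add h1 h5).trans ?_)
    rw [← mul_add, show (2:ℝ) ^ 289 = 2 ^ 264 * 2 ^ 25 from (by rw [← pow_add])]
    gcongr
    norm_num

lemma prime_sum_ge {k : ℕ} (hk : 18 ≤ k) (hk' : k ≤ 1450) :
    3.5 * Real.log k + 450 / k ^ 2 + 10 / k - 31.949 ≤ ∑ n ∈ Finset.Ioc 0 1097,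
      Λ n * max (7 - Real.log n) 0 * (Real.cos ((k / 5 : ℝ) * Real.log n) / n) := by
  obtain ⟨d, hd, hdk⟩ := exists_coeffs
  have hck := checkLanes_true
  rw [hd] at hck
  have hoff : 2 ^ 299 * (((2 ^ 300 + 1) ^ 2048 - 1) / 2 ^ 300) =
      ∑ j ∈ Finset.range 2048, (2 ^ 300 + 1) ^ j * 2 ^ 299 := by
    have := Nat.geomSum_eq (show 2 ≤ 2 ^ 300 + 1 by
      have : 1 ≤ 2 ^ 300 := Nat.one_le_two_pow
      omega) 2048
    rw [Nat.add_sub_cancel] at this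
    rw [← this, Finset.mul_sum]
    exact Finset.sum_congr rfl fun j _ ↦ mul_comm _ _
  have hpos : ∀ j < 2048, 0 ≤ d j + 2 ^ 299 := by
    intro j hj
    have h1 := (abs_le.1 (hdk j hj).2).1
    have h2 : (0:ℝ) ≤ d j + 2 ^ 299 := by
      have : (2:ℝ) ^ 289 ≤ 2 ^ 299 := pow_le_pow_right₀ (by norm_num) (by norm_num)
      generalize (2:ℝ) ^ 289 = u at h1 this
      generalize (2:ℝ) ^ 299 = v at this ⊢
      linarith
    exact_mod_cast h2
  have hlt : ∀ j < 2048, d j + 2 ^ 299 < 2 ^ 300 + 1 := by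
    intro j hj
    have h1 := (abs_le.1 (hdk j hj).2).2
    have h2 : (d j : ℝ) + 2 ^ 299 < 2 ^ 300 + 1 := by
      have : (2:ℝ) ^ 289 ≤ 2 ^ 299 := pow_le_pow_right₀ (by norm_num) (by norm_num)
      have h3 : (2:ℝ) ^ 300 = 2 ^ 299 + 2 ^ 299 := by rw [pow_succ]; ring
      generalize (2:ℝ) ^ 289 = u at h1 this
      generalize (2:ℝ) ^ 299 = v at this h3 ⊢
      generalize (2:ℝ) ^ 300 = w at h3 ⊢
      linarith
    exact_mod_cast h2
  set g : ℕ → ℕ := fun j ↦ if j < 2048 then (d j + 2 ^ 299).toNat else 0 with hg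
  have hgd : ∀ j < 2048, (g j : ℤ) = d j + 2 ^ 299 := by
    intro j hj
    rw [hg]; simp only [if_pos hj]; exact Int.toNat_of_nonneg (hpos j hj)
  have hgB : ∀ j, g j < 2 ^ 300 + 1 := by
    intro j
    by_cases hj : j < 2048
    · have h1 := hlt j hj
      rw [← hgd j hj] at h1
      exact_mod_cast h1
    · rw [hg]; simp only [if_neg hj]; positivity
  have hX : ∑ k ∈ Finset.range 2048, ((2 ^ 300 + 1 : ℕ) : ℤ) ^ k * d k +
      ((2 ^ 299 * (((2 ^ 300 + 1) ^ 2048 - 1) / 2 ^ 300) : ℕ) : ℤ) =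
      ((∑ j ∈ Finset.range 2048, (2 ^ 300 + 1) ^ j * g j : ℕ) : ℤ) := by
    rw [hoff, Nat.cast_sum, Nat.cast_sum, ← Finset.sum_add_distrib]
    refine Finset.sum_congr rfl fun j hj ↦ ?_
    rw [Nat.cast_mul, Nat.cast_mul, hgd j (Finset.mem_range.1 hj), Nat.cast_pow, ← mul_add,
      Nat.cast_pow, Nat.cast_ofNat]
  have hX2 : (∑ j ∈ Finset.range 2048, (2 ^ 300 + 1) ^ j * g j) / (2 ^ 300 + 1) ^ 2 =
      ∑ j ∈ Finset.range (1449 + 597), (2 ^ 300 + 1) ^ j * g (j + 2) := by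
    have hlow : (2 ^ 300 + 1) * g 1 + g 0 < (2 ^ 300 + 1) ^ 2 := by
      have h0 := hgB 0
      have h1 := hgB 1
      generalize 2 ^ 300 + 1 = B at *
      nlinarith
    have hs : ∑ j ∈ Finset.range 2048, (2 ^ 300 + 1) ^ j * g j = ((2 ^ 300 + 1) * g 1 + g 0) +
        (2 ^ 300 + 1) ^ 2 * ∑ j ∈ Finset.range (1449 + 597), (2 ^ 300 + 1) ^ j * g (j + 2) := by
      generalize 2 ^ 300 + 1 = B
      rw [show 2048 = 1449 + 597 + 1 + 1 by norm_num, Finset.sum_range_succ',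
        Finset.sum_range_succ', Finset.mul_sum]
      have : ∀ i, B ^ (i + 1 + 1) * g (i + 1 + 1) = B ^ 2 * (B ^ i * g (i + 2)) := fun i ↦ by ring
      simp only [this]
      ring
    rw [hs, Nat.add_mul_div_left _ _ (by positivity), Nat.div_eq_of_lt hlow, zero_add]
  rw [hX, Int.toNat_natCast, hX2, ← logTab_two] at hck
  have hmain := checkLanes_spec 1449 597 2 (fun j ↦ g (j + 2)) le_rfl (fun j ↦ hgB _) hck (k - 2)
    (by omega) (by omega)
  rw [show 2 + (k - 2) = k by omega] at hmain
  rw [show k - 2 + 2 = k by omega] at hmain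
  have hlog := (abs_le.1 ((isLog_logTab (show 2 ≤ k by omega)).err (by omega))).2
  have hDk := (abs_le.1 (hdk k (by omega)).1).2
  have hgk : (g k : ℝ) = d k + 2 ^ 299 := by exact_mod_cast hgd k (by omega)
  have n1 := (natDiv_real (7 * logTab k) (2 ^ 21) (by norm_num)).2
  have n2 := (natDiv_real (450 * 2 ^ 20) (k ^ 2) (by positivity)).2
  have n3 := (natDiv_real (10 * 2 ^ 20) k (by omega)).2
  have n4 := (natDiv_real (g k) (2 ^ 264) (by positivity)).1
  have hmain' : ((2 ^ 35 + 7 * logTab k / 2 ^ 21 + 450 * 2 ^ 20 / k ^ 2 + 10 * 2 ^ 20 / k + 3 : ℕ) : ℝ) ≤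
      ((g k / 2 ^ 264 + 33465303 : ℕ) : ℝ) := Nat.cast_le.2 hmain
  have e4 : (g k : ℝ) / ((2 ^ 264 : ℕ) : ℝ) = 2 ^ 20 * (d k / 2 ^ 284) + 2 ^ 35 := by
    rw [hgk, Nat.cast_pow, Nat.cast_ofNat, show (2:ℝ) ^ 284 = 2 ^ 264 * 2 ^ 20 from (by rw [← pow_add]),
      show (2:ℝ) ^ 299 = 2 ^ 264 * 2 ^ 35 from (by rw [← pow_add])]
    field_simp
  rw [e4] at n4
  have hk0 : (0:ℝ) < k := by exact_mod_cast (by omega : 0 < k)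
  have e2 : ((450 * 2 ^ 20 : ℕ) : ℝ) / ((k ^ 2 : ℕ) : ℝ) = 2 ^ 20 * (450 / k ^ 2) := by
    push_cast; ring
  have e3 : ((10 * 2 ^ 20 : ℕ) : ℝ) / (k : ℝ) = 2 ^ 20 * (10 / k) := by
    push_cast; ring
  have e1 : ((7 * logTab k : ℕ) : ℝ) / ((2 ^ 21 : ℕ) : ℝ) = 2 ^ 20 * (3.5 * (logTab k / 2 ^ 40)) := by
    push_cast; ring
  rw [e1] at n1
  rw [e2] at n2
  rw [e3] at n3
  set w4 := g k / 2 ^ 264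
  set w1 := 7 * logTab k / 2 ^ 21
  set w2 := 450 * 2 ^ 20 / k ^ 2
  set w3 := 10 * 2 ^ 20 / k
  rw [Nat.cast_add, Nat.cast_add, Nat.cast_add, Nat.cast_add, Nat.cast_add] at hmain'
  set D := ∑ n ∈ Finset.Ioc 0 1097,
      Λ n * max (7 - Real.log n) 0 * (Real.cos ((k / 5 : ℝ) * Real.log n) / n)
  set y := (d k : ℝ) / 2 ^ 284
  set z2 := 450 / (k:ℝ) ^ 2
  set z3 := 10 / (k:ℝ)
  set z1 := (logTab k : ℝ) / 2 ^ 40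
  norm_num at hmain' hDk hlog n1 n2 n3 n4 ⊢
  linarith

lemma log_five_lower : 1.609 ≤ Real.log 5 := by
  have h := (isLog_logTab (show 2 ≤ 5 by norm_num)).1
  have h5 : 1769500000000 ≤ logTab 5 := by decide +kernel
  have h6 : (1769500000000:ℝ) ≤ logTab 5 := by exact_mod_cast h5
  norm_num at h ⊢
  linarith

/-- Verification of the Riemann hypothesis up to height `290`. -/
theorem re_eq_half_of_abs_im_le {ρ : ℂ} (h0 : xi ρ = 0) (hρ : |ρ.im| ≤ 290) : ρ.re = 1 / 2 := by
  have main : ∀ ρ : ℂ, xi ρ = 0 → 0 ≤ ρ.im → ρ.im ≤ 290 → ρ.re = 1 / 2 := by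
    intro ρ h0 hp hle
    by_contra hne
    have him := xi_zero_im h0
    rw [abs_of_nonneg hp] at him
    obtain ⟨k, hk1, hk2⟩ : ∃ k : ℕ, (k : ℝ) ≤ 5 * ρ.im + 1 / 2 ∧ 5 * ρ.im + 1 / 2 < k + 1 :=
      ⟨⌊5 * ρ.im + 1 / 2⌋₊, Nat.floor_le (by positivity), Nat.lt_floor_add_one _⟩
    have hk3 : 18 ≤ k := by
      have : (17:ℝ) < k := by norm_num at him; linarith
      exact_mod_cast this
    have hk4 : k ≤ 1450 := by
      have : (k:ℝ) < 1451 := by linarith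
      have : k < 1451 := by exact_mod_cast this
      omega
    have hk3' : (18:ℝ) ≤ k := by exact_mod_cast hk3
    have h1 := prime_sum_le_of_off_line h0 hne (t := k / 5) (by linarith)
      (by rw [abs_le]; constructor <;> linarith)
    have h2 := prime_sum_ge hk3 hk4
    have h3 := log_five_lower
    have h4 := log_two_pi_lower
    have e : Real.log (k / 5 / (2 * Real.pi)) = Real.log k - Real.log 5 - Real.log (2 * Real.pi) := by
      rw [Real.log_div (by positivity) (by positivity), Real.log_div (by positivity) (by positivity)]
    rw [e] at h1
    have e2 : 18 / ((k:ℝ) / 5) ^ 2 = 450 / k ^ 2 := by field_simp; norm_num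
    have e3 : 2 / ((k:ℝ) / 5) = 10 / k := by field_simp; norm_num
    rw [e2, e3] at h1
    norm_num at h1 h2 h3 h4
    linarith
  rcases le_total 0 ρ.im with h | h
  · exact main ρ h0 h (by rwa [abs_of_nonneg h] at hρ)
  · have := main (conj ρ) (by rw [xi_conj, h0, map_zero]) (by simpa using h)
      (by rw [abs_of_nonpos h] at hρ; simpa using hρ)
    simpa using this

/-- A primality test for `2 ≤ n < 12769`. -/
def primeTest (n : ℕ) : Bool :=
  cond (Nat.ble n 120)
    (Nat.beq (Nat.gcd n 210) 1 || Nat.beq n 2 || Nat.beq n 3 || Nat.beq n 5 || Nat.beq n 7)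
    (Nat.beq (Nat.gcd n 279734996817854936178276161872067809674997230) 1)

/-- Comparison of a rounded value `acc` of `2 ^ 40 * θ(n)` with `n`. -/
def thetaOK (n acc : ℕ) : Bool :=
  Nat.ble (acc + 13200 * n) (1099511627776 * n) &&
    (Nat.ble n 148 || Nat.ble (cond (Nat.ble n 1096) 869 880 * 1099511627776 * (n + 1)) (1000 * acc))

/-- Comparison of `θ(n)` with `n` for `r` consecutive values of `n`. -/
def checkTheta : ℕ → ℕ → ℕ → ℕ → Bool
  | 0, _, _, _ => true
  | r + 1, n, ℓ, acc =>
    forceNat (acc + cond (primeTest n) ℓ 0) fun acc' ↦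
    thetaOK n acc' &&
    forceNat (ℓ + logStep n) fun ℓ' ↦
    forceNat (n + 1) fun n' ↦
    checkTheta r n' ℓ' acc'

theorem checkTheta_true : checkTheta 12098 2 762123384499 0 = true := by
  decide +kernel

lemma primeTest_eq {n : ℕ} (hn : 2 ≤ n) (hn' : n < 12769) : primeTest n = true ↔ n.Prime := by
  rw [primeTest]
  rcases Nat.lt_or_ge 120 n with h | h
  · rw [show Nat.ble n 120 = false by rw [Bool.eq_false_iff, ne_eq, Nat.ble_eq]; omega, cond_false,
      Nat.beq_eq]
    constructor
    · intro hg
      by_contra hnp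
      have h1 := Nat.minFac_sq_le_self (by omega) hnp
      have h2 : n.minFac < 113 := by nlinarith
      have h3 := Nat.minFac_prime (show n ≠ 1 by omega)
      have h4 : n.minFac ∣ 279734996817854936178276161872067809674997230 := by
        revert h3; generalize n.minFac = q at h2
        interval_cases q <;> norm_num
      have h5 := Nat.dvd_gcd (Nat.minFac_dvd n) h4
      rw [hg] at h5
      exact h3.one_lt.ne' (Nat.dvd_one.1 h5)
    · intro hp
      refine (Nat.Prime.coprime_iff_not_dvd hp).2 fun hd ↦ ?_
      have h6 : 279734996817854936178276161872067809674997230 = ([2, 3, 5, 7, 11, 13, 17, 19, 23, 29, 31, 37, 41, 43, 47, 53, 59, 61, 67, 71, 73, 79, 83, 89, 97, 101, 103, 107, 109]).prod := by norm_num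
      rw [h6, hp.prime.dvd_prod_iff] at hd
      obtain ⟨q, hq, hd⟩ := hd
      have : q ≤ 120 ∧ 0 < q := by
        clear hd
        revert q
        decide
      have := Nat.le_of_dvd this.2 hd
      omega
  · rw [show Nat.ble n 120 = true by simpa using h, cond_true]
    interval_cases n <;> norm_num

/-- Approximation to `2 ^ 40 * θ(n)`. -/
def thetaTab (n : ℕ) : ℕ := ∑ i ∈ Finset.Ico 2 (n + 1), cond (primeTest i) (logTab i) 0

lemma thetaOK_of_checkTheta (r : ℕ) : ∀ n, 1 ≤ n →
    checkTheta r (n + 1) (logTab (n + 1)) (thetaTab n) = true →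
    ∀ m, n < m → m ≤ n + r → thetaOK m (thetaTab m) = true := by
  induction r with
  | zero => intro n _ _ m h1 h2; omega
  | succ r ih =>
    intro n hn h m h1 h2
    have e : thetaTab n + cond (primeTest (n + 1)) (logTab (n + 1)) 0 = thetaTab (n + 1) := by
      rw [thetaTab, thetaTab, Finset.sum_Ico_succ_top (show 2 ≤ n + 1 by omega)]
    rw [checkTheta, forceNat_eq, forceNat_eq, forceNat_eq, ← logTab_succ (by omega), e,
      Bool.and_eq_true] at h
    rcases (show m = n + 1 ∨ n + 1 < m by omega) with rfl | h3
    · exact h.1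
    · exact ih (n + 1) (by omega) h.2 m h3 (by omega)

lemma thetaOK_thetaTab {n : ℕ} (hn : 2 ≤ n) (hn' : n < 12100) : thetaOK n (thetaTab n) = true :=
  thetaOK_of_checkTheta 12098 1 le_rfl
    (by rw [show (1 + 1 : ℕ) = 2 from rfl, logTab_two]; exact checkTheta_true) n (by omega) (by omega)

lemma theta_near_thetaTab {n : ℕ} (hn' : n < 12100) :
    (thetaTab n : ℝ) ≤ 2 ^ 40 * Chebyshev.theta n ∧
      2 ^ 40 * Chebyshev.theta n ≤ thetaTab n + 13200 * n := by
  have e : 2 ^ 40 * Chebyshev.theta n =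
      ∑ i ∈ Finset.Ico 2 (n + 1), if i.Prime then 2 ^ 40 * Real.log i else 0 := by
    rw [Chebyshev.theta_eq_sum_Icc, Nat.floor_natCast, Finset.mul_sum, Finset.sum_filter]
    refine (Finset.sum_subset (fun i hi ↦ ?_) fun i hi hi' ↦ ?_).symm
    · simp at hi ⊢; omega
    · rw [if_neg]; intro hp; simp at hi hi'; have := hp.two_le; omega
  rw [e, thetaTab]
  push_cast
  have key : ∀ i ∈ Finset.Ico 2 (n + 1), ((cond (primeTest i) (logTab i) 0 : ℕ) : ℝ) ≤
      (if i.Prime then 2 ^ 40 * Real.log i else 0) ∧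
      (if i.Prime then 2 ^ 40 * Real.log i else 0) ≤
        ((cond (primeTest i) (logTab i) 0 : ℕ) : ℝ) + 13200 := by
    intro i hi
    rw [Finset.mem_Ico] at hi
    have hl := isLog_logTab hi.1
    have hi' : (i:ℝ) ≤ 12100 := by exact_mod_cast (by omega : i ≤ 12100)
    have h0 : 0 ≤ 462 / (i:ℝ) := by positivity
    by_cases hp : i.Prime
    · rw [(primeTest_eq hi.1 (by omega)).2 hp, if_pos hp, cond_true]
      exact ⟨hl.1, by linarith [hl.2]⟩
    · rw [Bool.eq_false_iff.2 (fun h ↦ hp ((primeTest_eq hi.1 (by omega)).1 h)), if_neg hp]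
      norm_num
  refine ⟨Finset.sum_le_sum fun i hi ↦ (key i hi).1, ?_⟩
  refine (Finset.sum_le_sum fun i hi ↦ (key i hi).2).trans ?_
  rw [Finset.sum_add_distrib, Finset.sum_const, Nat.card_Ico, nsmul_eq_mul]
  have : ((n + 1 - 2 : ℕ) : ℝ) ≤ n := by exact_mod_cast (by omega)
  linarith

lemma theta_le_self {x : ℝ} (hx0 : 0 ≤ x) (hx : x < 12100) : Chebyshev.theta x ≤ x := by
  rcases lt_or_ge x 2 with h | h
  · rw [Chebyshev.theta_eq_zero_of_lt_two h]; exact hx0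
  refine le_trans ?_ (Nat.floor_le hx0)
  rw [Chebyshev.theta_eq_theta_coe_floor]
  have h1 : 2 ≤ ⌊x⌋₊ := Nat.le_floor (by exact_mod_cast h)
  have h2 : ⌊x⌋₊ < 12100 := (Nat.floor_lt hx0).2 (by exact_mod_cast hx)
  have h3 := thetaOK_thetaTab h1 h2
  have h4 := (theta_near_thetaTab h2).2
  rw [thetaOK, Bool.and_eq_true, Nat.ble_eq] at h3
  have h5 : ((thetaTab ⌊x⌋₊ : ℕ) : ℝ) + 13200 * (⌊x⌋₊ : ℕ) ≤ 1099511627776 * (⌊x⌋₊ : ℕ) := by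
    exact_mod_cast h3.1
  norm_num at h4 h5 ⊢
  linarith

lemma theta_ge_of_small {x : ℝ} (hx0 : 149 ≤ x) (hx : x < 12100) :
    (if x < 1097 then 0.869 else 0.88) * x ≤ Chebyshev.theta x := by
  have hx0' : 0 ≤ x := by linarith
  rw [Chebyshev.theta_eq_theta_coe_floor]
  have h1 : 149 ≤ ⌊x⌋₊ := Nat.le_floor (by exact_mod_cast hx0)
  have h2 : ⌊x⌋₊ < 12100 := (Nat.floor_lt hx0').2 (by exact_mod_cast hx)
  have h3 := thetaOK_thetaTab (by omega) h2
  have h4 := (theta_near_thetaTab h2).1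
  have hf := (Nat.lt_floor_add_one x).le
  rw [thetaOK, Bool.and_eq_true, Bool.or_eq_true, Nat.ble_eq, Nat.ble_eq, Nat.ble_eq] at h3
  have h5 := h3.2.resolve_left (by omega)
  split_ifs with h
  · have h6 : ⌊x⌋₊ < 1097 := (Nat.floor_lt hx0').2 (by exact_mod_cast h)
    rw [show Nat.ble ⌊x⌋₊ 1096 = true by rw [Nat.ble_eq]; omega, cond_true] at h5
    have h7 : (869 * 1099511627776 * ((⌊x⌋₊ : ℕ) + 1) : ℝ) ≤ 1000 * (thetaTab ⌊x⌋₊ : ℕ) := by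
      exact_mod_cast h5
    norm_num at h4 h7 ⊢
    linarith
  · have h6 : 1097 ≤ ⌊x⌋₊ := Nat.le_floor (by push_cast; linarith)
    rw [show Nat.ble ⌊x⌋₊ 1096 = false by rw [Bool.eq_false_iff, ne_eq, Nat.ble_eq]; omega, cond_false] at h5
    have h7 : (880 * 1099511627776 * ((⌊x⌋₊ : ℕ) + 1) : ℝ) ≤ 1000 * (thetaTab ⌊x⌋₊ : ℕ) := by
      exact_mod_cast h5
    norm_num at h4 h7 ⊢
    linarith

lemma psi_le_of_small {x : ℝ} (hx0 : 0 ≤ x) (hx : x < 12100) :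
    Chebyshev.psi x ≤ x + 4 * √x := by
  rcases lt_or_ge x 2 with h2 | h2
  · rw [Chebyshev.psi_eq_zero_of_lt_two h2]; positivity
  rw [Chebyshev.psi_eq_theta_add_sum_theta h2]
  set K := ⌊Real.log x / Real.log 2⌋₊ with hK
  have h1 := theta_le_self hx0 hx
  have hroot : ∀ n : ℕ, 1 ≤ n → Chebyshev.theta (x ^ ((1:ℝ) / n)) ≤ x ^ ((1:ℝ) / n) := by
    intro n hn
    have hn' : (1:ℝ) ≤ n := by exact_mod_cast hn
    refine theta_le_self (by positivity) (lt_of_le_of_lt ?_ hx)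
    calc x ^ ((1:ℝ) / n) ≤ x ^ (1:ℝ) := by
          apply Real.rpow_le_rpow_of_exponent_le (by linarith)
          rw [div_le_one (by linarith)]; exact hn'
      _ = x := Real.rpow_one x
  rcases Nat.lt_or_ge K 2 with hK2 | hK2
  · rw [Finset.Icc_eq_empty (by omega), Finset.sum_empty]
    have : 0 ≤ √x := Real.sqrt_nonneg x
    linarith
  set u := x ^ ((1:ℝ) / 6) with hu
  have hu0 : 0 < u := by positivity
  have hu3 : √x = u ^ 3 := by
    rw [Real.sqrt_eq_rpow, hu, ← Real.rpow_natCast, ← Real.rpow_mul hx0]; norm_num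
  have hu2 : x ^ ((1:ℝ) / 3) = u ^ 2 := by
    rw [hu, ← Real.rpow_natCast, ← Real.rpow_mul hx0]; norm_num
  have hlogu : Real.log x = 6 * Real.log u := by
    rw [hu, Real.log_rpow (by linarith)]; ring
  have hsum : ∑ n ∈ Finset.Icc 2 K, Chebyshev.theta (x ^ ((1:ℝ) / n)) ≤ u ^ 3 + (K - 2) * u ^ 2 := by
    rw [← Finset.add_sum_Ioc_eq_sum_Icc hK2]
    refine add_le_add ?_ ?_
    · refine (hroot 2 (by norm_num)).trans_eq ?_
      rw [← hu3, Real.sqrt_eq_rpow]; norm_num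
    · have hc : ((K:ℝ) - 2) * u ^ 2 = ∑ n ∈ Finset.Ioc 2 K, u ^ 2 := by
        rw [Finset.sum_const, Nat.card_Ioc, nsmul_eq_mul, Nat.cast_sub hK2]; norm_num
      rw [hc]
      refine Finset.sum_le_sum fun n hn ↦ (hroot n ?_).trans ?_
      · rw [Finset.mem_Ioc] at hn; omega
      · rw [Finset.mem_Ioc] at hn
        rw [← hu2]
        have : (3:ℝ) ≤ n := by exact_mod_cast hn.1
        apply Real.rpow_le_rpow_of_exponent_le (by linarith)
        gcongr
  have hl2 := Real.log_two_gt_d9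
  have hKle : (K:ℝ) ≤ Real.log x / Real.log 2 :=
    Nat.floor_le (div_nonneg (Real.log_nonneg (by linarith)) (by linarith))
  rw [le_div_iff₀ (by linarith), hlogu] at hKle
  have hlu : Real.log u ≤ u / 3 - 1 + Real.log 3 := by
    have := Real.log_le_sub_one_of_pos (show 0 < u / 3 by positivity)
    rw [Real.log_div hu0.ne' (by norm_num)] at this
    linarith
  have hKu : (K:ℝ) - 2 ≤ 3 * u := by
    have := Real.log_three_lt_d9
    have hK0 : (0:ℝ) ≤ K := by positivity
    nlinarith
  rw [hu3]
  nlinarith [mul_le_mul_of_nonneg_right hKu (sq_nonneg u)]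

lemma log_factorial_eq (N : ℕ) : ∀ M, N ≤ M →
    Real.log (N.factorial) = ∑ d ∈ Finset.Icc 1 M, Λ d * ((N / d : ℕ) : ℝ) := by
  induction N with
  | zero => intro M _; simp
  | succ N ih =>
    intro M hM
    rw [Nat.factorial_succ, Nat.cast_mul, Real.log_mul (by positivity) (by positivity),
      ih M (by omega), ← ArithmeticFunction.vonMangoldt_sum]
    have e : ∑ i ∈ (N + 1).divisors, Λ i = ∑ d ∈ Finset.Icc 1 M, if d ∣ N + 1 then Λ d else 0 := by
      rw [← Finset.sum_filter]
      refine Finset.sum_congr ?_ fun _ _ ↦ rfl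
      ext d
      simp only [Nat.mem_divisors, Finset.mem_filter, Finset.mem_Icc]
      constructor
      · rintro ⟨h, -⟩
        exact ⟨⟨Nat.pos_of_dvd_of_pos h (by omega), (Nat.le_of_dvd (by omega) h).trans hM⟩, h⟩
      · rintro ⟨-, h⟩; exact ⟨h, by omega⟩
    rw [e, ← Finset.sum_add_distrib]
    refine Finset.sum_congr rfl fun d _ ↦ ?_
    rw [Nat.succ_div]
    split_ifs <;> push_cast <;> ring

lemma log_factorial_bounds {M : ℕ} (hM : 1 ≤ M) {y : ℝ} (h1 : M ≤ y) (h2 : y < M + 1) :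
    y * Real.log y - y - Real.log y + 1 ≤ Real.log M.factorial ∧
      Real.log M.factorial ≤ y * Real.log y - y + Real.log y + 1 := by
  have key : M * Real.log M - M + 1 ≤ Real.log M.factorial ∧
      Real.log M.factorial ≤ M * Real.log M - M + Real.log M + 1 := by
    clear h1 h2
    induction M, hM using Nat.le_induction with
    | base => norm_num
    | succ n hn ih =>
      have hn' : (1:ℝ) ≤ n := by exact_mod_cast hn
      rw [Nat.factorial_succ, Nat.cast_mul, Real.log_mul (by positivity) (by positivity)]
      push_cast
      have hq : Real.log (((n:ℝ) + 1) / n) = Real.log (n + 1) - Real.log n :=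
        Real.log_div (by positivity) (by positivity)
      have ha := Real.log_le_sub_one_of_pos (show 0 < ((n:ℝ) + 1) / n by positivity)
      have hb := Real.one_sub_inv_le_log_of_pos (show 0 < ((n:ℝ) + 1) / n by positivity)
      rw [hq] at ha hb
      have ea : ((n:ℝ) + 1) / n - 1 = 1 / n := by field_simp; ring
      have eb : 1 - (((n:ℝ) + 1) / n)⁻¹ = 1 / (n + 1) := by field_simp; ring
      rw [ea, le_div_iff₀ (by positivity)] at ha
      rw [eb, div_le_iff₀ (by positivity)] at hb
      constructor <;> nlinarith [ih.1, ih.2]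
  have hM' : (1:ℝ) ≤ M := by exact_mod_cast hM
  have hy : 1 ≤ y := hM'.trans h1
  have hly : 0 ≤ Real.log y := Real.log_nonneg hy
  have hlM : Real.log M ≤ Real.log y := Real.log_le_log (by linarith) h1
  have ha := Real.log_le_sub_one_of_pos (show 0 < y / M by positivity)
  have hb := Real.one_sub_inv_le_log_of_pos (show 0 < y / M by positivity)
  rw [Real.log_div (by positivity) (by positivity)] at ha hb
  have ea : (M:ℝ) * (y / M - 1) = y - M := by field_simp
  have eb : y * (1 - (y / M)⁻¹) = y - M := by field_simp
  have ha' := mul_le_mul_of_nonneg_left ha (show (0:ℝ) ≤ M by linarith)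
  have hb' := mul_le_mul_of_nonneg_left hb (show (0:ℝ) ≤ y by linarith)
  rw [ea] at ha'
  rw [eb] at hb'
  have hlM0 : 0 ≤ Real.log M := Real.log_nonneg hM'
  constructor <;> nlinarith [key.1, key.2]

/-- Chebyshev's combination of factorials. -/
noncomputable def chebSum (N : ℕ) : ℝ :=
  Real.log N.factorial - Real.log (N / 2).factorial - Real.log (N / 3).factorial -
    Real.log (N / 5).factorial + Real.log (N / 30).factorial

lemma psi_nat_div_eq (N k : ℕ) (hk : 1 ≤ k) :
    Chebyshev.psi ((N / k : ℕ) : ℝ) = ∑ d ∈ Finset.Icc 1 N, Λ d * if k ≤ N / d then 1 else 0 := by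
  rw [Chebyshev.psi_eq_sum_Icc, Nat.floor_natCast]
  simp only [mul_ite, mul_one, mul_zero]
  rw [← Finset.sum_filter]
  refine (Finset.sum_subset_zero_on_sdiff (fun d hd ↦ ?_) (fun d hd ↦ ?_) fun _ _ ↦ rfl).symm
  · simp only [Finset.mem_filter, Finset.mem_Icc] at hd ⊢
    refine ⟨by omega, ?_⟩
    rw [Nat.le_div_iff_mul_le (by omega)] at hd ⊢
    rw [mul_comm]; exact hd.2
  · simp only [Finset.mem_sdiff, Finset.mem_filter, Finset.mem_Icc, not_and, not_le] at hd
    rcases Nat.eq_zero_or_pos d with rfl | h0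
    · simp
    · exfalso
      have h1 : d ≤ N := hd.1.2.trans (Nat.div_le_self N k)
      have h2 := hd.2 ⟨h0, h1⟩
      rw [Nat.div_lt_iff_lt_mul h0] at h2
      have h3 := hd.1.2
      rw [Nat.le_div_iff_mul_le (by omega), mul_comm] at h3
      omega

lemma chebSum_eq (N : ℕ) : chebSum N = ∑ d ∈ Finset.Icc 1 N, Λ d *
    (((N / d : ℕ) : ℝ) - ((N / d / 2 : ℕ) : ℝ) - ((N / d / 3 : ℕ) : ℝ) - ((N / d / 5 : ℕ) : ℝ) +
      ((N / d / 30 : ℕ) : ℝ)) := by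
  rw [chebSum, log_factorial_eq N N le_rfl, log_factorial_eq _ N (Nat.div_le_self N 2),
    log_factorial_eq _ N (Nat.div_le_self N 3), log_factorial_eq _ N (Nat.div_le_self N 5),
    log_factorial_eq _ N (Nat.div_le_self N 30), ← Finset.sum_sub_distrib, ← Finset.sum_sub_distrib,
    ← Finset.sum_sub_distrib, ← Finset.sum_add_distrib]
  refine Finset.sum_congr rfl fun d _ ↦ ?_
  simp only [Nat.div_div_eq_div_mul, mul_comm d]
  ring

lemma chebSum_le_psi (N : ℕ) : chebSum N ≤ Chebyshev.psi N := by
  have h := psi_nat_div_eq N 1 le_rfl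
  rw [Nat.div_one] at h
  rw [h, chebSum_eq]
  refine Finset.sum_le_sum fun d _ ↦
    mul_le_mul_of_nonneg_left ?_ ArithmeticFunction.vonMangoldt_nonneg
  generalize N / d = m
  split_ifs with hm
  · have : m + m / 30 ≤ 1 + m / 2 + m / 3 + m / 5 := by omega
    have : (m:ℝ) + (m / 30 : ℕ) ≤ 1 + (m / 2 : ℕ) + (m / 3 : ℕ) + (m / 5 : ℕ) := by exact_mod_cast this
    linarith
  · have : m = 0 := by omega
    subst this; norm_num

lemma psi_le_chebSum (N : ℕ) : Chebyshev.psi N ≤ chebSum N + Chebyshev.psi ((N / 6 : ℕ) : ℝ) -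
    Chebyshev.psi ((N / 7 : ℕ) : ℝ) + Chebyshev.psi ((N / 10 : ℕ) : ℝ) := by
  have h := psi_nat_div_eq N 1 le_rfl
  rw [Nat.div_one] at h
  rw [h, chebSum_eq, psi_nat_div_eq N 6 (by norm_num), psi_nat_div_eq N 7 (by norm_num),
    psi_nat_div_eq N 10 (by norm_num), ← Finset.sum_add_distrib, ← Finset.sum_sub_distrib,
    ← Finset.sum_add_distrib]
  refine Finset.sum_le_sum fun d _ ↦ ?_
  rw [← mul_add, ← mul_sub, ← mul_add]
  refine mul_le_mul_of_nonneg_left ?_ ArithmeticFunction.vonMangoldt_nonneg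
  generalize N / d = m
  have h1 : m / 2 + m / 3 + m / 5 ≤ m + m / 30 := by omega
  have h1' : ((m / 2 : ℕ) : ℝ) + (m / 3 : ℕ) + (m / 5 : ℕ) ≤ m + (m / 30 : ℕ) := by exact_mod_cast h1
  split_ifs <;> first | (exfalso; omega) | linarith | skip
  all_goals
    have h2 : m / 2 + m / 3 + m / 5 + 1 ≤ m + m / 30 := by omega
    have h2' : ((m / 2 : ℕ) : ℝ) + (m / 3 : ℕ) + (m / 5 : ℕ) + 1 ≤ m + (m / 30 : ℕ) := by
      exact_mod_cast h2
    linarith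

lemma natDiv_floor {x : ℝ} (hx : 0 ≤ x) (k : ℕ) (hk : 1 ≤ k) :
    ((⌊x⌋₊ / k : ℕ) : ℝ) ≤ x / k ∧ x / k < ((⌊x⌋₊ / k : ℕ) : ℝ) + 1 := by
  rw [← Nat.floor_div_natCast]
  exact ⟨Nat.floor_le (by positivity), Nat.lt_floor_add_one _⟩

lemma chebSum_bounds {x : ℝ} (hx : 30 ≤ x) :
    0.9212 * x - 5 * Real.log x ≤ chebSum ⌊x⌋₊ ∧ chebSum ⌊x⌋₊ ≤ 0.9213 * x + 5 * Real.log x := by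
  have hN : 30 ≤ ⌊x⌋₊ := Nat.le_floor (by exact_mod_cast hx)
  have hx0 : 0 ≤ x := by linarith
  have key : ∀ k : ℕ, 1 ≤ k → k ≤ 30 →
      x / k * (Real.log x - Real.log k) - x / k - (Real.log x - Real.log k) + 1 ≤
        Real.log (⌊x⌋₊ / k).factorial ∧ Real.log (⌊x⌋₊ / k).factorial ≤
      x / k * (Real.log x - Real.log k) - x / k + (Real.log x - Real.log k) + 1 := by
    intro k hk hk'
    have hk0 : (k:ℝ) ≠ 0 := by positivity
    have := log_factorial_bounds (M := ⌊x⌋₊ / k)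
      ((Nat.one_le_div_iff (by omega)).2 (by omega)) (natDiv_floor hx0 k hk).1 (natDiv_floor hx0 k hk).2
    rwa [Real.log_div (by positivity) hk0] at this
  have k1 := key 1 le_rfl (by norm_num)
  have k2 := key 2 (by norm_num) (by norm_num)
  have k3 := key 3 (by norm_num) (by norm_num)
  have k5 := key 5 (by norm_num) (by norm_num)
  have k30 := key 30 (by norm_num) (by norm_num)
  have e30 : Real.log 30 = Real.log 2 + Real.log 3 + Real.log 5 := by
    rw [← Real.log_mul (by norm_num) (by norm_num), ← Real.log_mul (by norm_num) (by norm_num)]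
    norm_num
  push_cast at k1 k2 k3 k5 k30
  rw [e30] at k30
  rw [Nat.div_one, Real.log_one] at k1
  have h2 := Real.log_two_gt_d9
  have h3 := Real.log_three_gt_d9
  have h5 := Real.log_five_gt_d9
  have h2' := Real.log_two_lt_d9
  have h3' := Real.log_three_lt_d9
  have h5' := Real.log_five_lt_d9
  have hA : Real.log 2 / 2 + Real.log 3 / 3 + Real.log 5 / 5 -
      (Real.log 2 + Real.log 3 + Real.log 5) / 30 ≤ 0.9213 := by norm_num at *; linarith
  have hA' : 0.9212 ≤ Real.log 2 / 2 + Real.log 3 / 3 + Real.log 5 / 5 -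
      (Real.log 2 + Real.log 3 + Real.log 5) / 30 := by norm_num at *; linarith
  have hB := mul_le_mul_of_nonneg_left hA hx0
  have hB' := mul_le_mul_of_nonneg_left hA' hx0
  rw [chebSum]
  constructor
  · nlinarith [k1.1, k2.2, k3.2, k5.2, k30.1]
  · nlinarith [k1.2, k2.1, k3.1, k5.1, k30.2]

lemma le_psi {x : ℝ} (hx : 30 ≤ x) : 0.9212 * x - 5 * Real.log x ≤ Chebyshev.psi x := by
  rw [Chebyshev.psi_eq_psi_coe_floor]
  exact (chebSum_bounds hx).1.trans (chebSum_le_psi _)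

lemma psi_le {x : ℝ} (hx : 0 ≤ x) : Chebyshev.psi x ≤ 1.077 * x + 4 * √x := by
  obtain ⟨n, hn⟩ : ∃ n : ℕ, x < 12100 * 2 ^ n := by
    obtain ⟨n, hn⟩ := pow_unbounded_of_one_lt x (show (1:ℝ) < 2 by norm_num)
    exact ⟨n, by linarith [show (0:ℝ) < 2 ^ n by positivity]⟩
  induction n generalizing x with
  | zero => have := psi_le_of_small hx (by simpa using hn); linarith
  | succ n ih =>
    rcases lt_or_ge x 12100 with h | h
    · have := psi_le_of_small hx h; linarith
    rw [pow_succ] at hn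
    have hdiv : ∀ k : ℕ, 1 ≤ k → Chebyshev.psi ((⌊x⌋₊ / k : ℕ) : ℝ) = Chebyshev.psi (x / k) := by
      intro k hk
      rw [← Nat.floor_div_natCast, ← Chebyshev.psi_eq_psi_coe_floor]
    have h0 := psi_le_chebSum ⌊x⌋₊
    rw [← Chebyshev.psi_eq_psi_coe_floor, hdiv 6 (by norm_num), hdiv 7 (by norm_num),
      hdiv 10 (by norm_num)] at h0
    push_cast at h0
    have h1 := (chebSum_bounds (show 30 ≤ x by linarith)).2
    have h6 := ih (x := x / 6) (by positivity) (by linarith)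
    have h10 := ih (x := x / 10) (by positivity) (by linarith)
    have h7 := le_psi (show 30 ≤ x / 7 by linarith)
    have hl7 : Real.log (x / 7) ≤ Real.log x := Real.log_le_log (by positivity) (by linarith)
    have hs0 : (110:ℝ) ≤ √x := Real.le_sqrt_of_sq_le (by norm_num; exact h)
    set s := √x with hs
    have hxs : x = s ^ 2 := (Real.sq_sqrt hx).symm
    have r6 : √(x / 6) ≤ 0.409 * s := Real.sqrt_le_iff.2 ⟨by positivity, by rw [hxs]; nlinarith⟩
    have r10 : √(x / 10) ≤ 0.3163 * s := Real.sqrt_le_iff.2 ⟨by positivity, by rw [hxs]; nlinarith⟩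
    have hlog : Real.log x ≤ 2 * (s / 125 - 1 + 3 * 1.6095) := by
      rw [hxs, Real.log_pow]
      have := Real.log_le_sub_one_of_pos (show 0 < s / 125 by positivity)
      rw [Real.log_div (by positivity) (by norm_num), show (125:ℝ) = 5 ^ 3 by norm_num,
        Real.log_pow] at this
      have h5 := log_five_upper
      push_cast at this ⊢
      linarith
    norm_num at *
    linarith

lemma psi_sub_theta_le {x : ℝ} (hx : 12000 ≤ x) :
    Chebyshev.psi x - Chebyshev.theta x ≤ 2.3 * √x := by
  have h0 : (0:ℝ) ≤ x := by linarith
  refine (Chebyshev.psi_sub_theta_le_psi_add_psi_add_psi x).trans ?_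
  set z := x ^ ((1:ℝ) / 6) with hz
  have hz6 : z ^ 6 = x := by
    rw [hz, ← Real.rpow_natCast, ← Real.rpow_mul h0]; norm_num
  have hz0 : 0 < z := by positivity
  have hzl : 4.78 ≤ z := by
    by_contra h
    have : z ^ 6 < 4.78 ^ 6 := by gcongr; linarith
    rw [hz6] at this
    norm_num at this
    linarith
  have e2 : x ^ (2:ℝ)⁻¹ = z ^ 3 := by
    rw [hz, ← Real.rpow_natCast, ← Real.rpow_mul h0]; norm_num
  have e3 : x ^ (3:ℝ)⁻¹ = z ^ 2 := by
    rw [hz, ← Real.rpow_natCast, ← Real.rpow_mul h0]; norm_num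
  have e5 : x ^ (5:ℝ)⁻¹ ≤ z ^ 2 := by
    rw [← e3]
    exact Real.rpow_le_rpow_of_exponent_le (by linarith) (by norm_num)
  have es : √x = z ^ 3 := by rw [Real.sqrt_eq_rpow, ← e2]; norm_num
  rw [e2, e3, es]
  have h3 := psi_le (show 0 ≤ z ^ 3 by positivity)
  have h2 := psi_le (show 0 ≤ z ^ 2 by positivity)
  have h5 := Chebyshev.psi_mono e5
  rw [Real.sqrt_sq hz0.le] at h2
  have hs : √(z ^ 3) ≤ 0.4575 * z ^ 2 := by
    refine Real.sqrt_le_iff.2 ⟨by positivity, ?_⟩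
    have : z ^ 3 * 1 ≤ z ^ 3 * (0.4575 ^ 2 * z) := by gcongr; linarith
    linarith
  have hb : 1 ≤ z / 4.78 := by rw [le_div_iff₀ (by norm_num)]; linarith
  have h6 : z ^ 2 * 4.78 ≤ z ^ 2 * z := by gcongr
  have h7 : z * 4.78 ≤ z * z := by gcongr
  linarith

/-- The relative error, as a function of `X = √(log x / 6.315)`. -/
noncomputable def relErr (X : ℝ) : ℝ := √(8 / (17 * Real.pi)) * √X * Real.exp (-X)

lemma sqrt_const_ge : 0.387 ≤ √(8 / (17 * Real.pi)) := by
  apply Real.le_sqrt_of_sq_le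
  have := Real.pi_lt_d4
  rw [le_div_iff₀ (by positivity)]
  norm_num at *
  linarith

lemma sqrt_mul_exp_neg_anti {X Y : ℝ} (hX : 1 / 2 ≤ X) (hXY : X ≤ Y) :
    √Y * Real.exp (-Y) ≤ √X * Real.exp (-X) := by
  have h1 : √Y ≤ √X * Real.exp (Y - X) := by
    refine Real.sqrt_le_iff.2 ⟨by positivity, ?_⟩
    rw [mul_pow, Real.sq_sqrt (by linarith), ← Real.exp_nat_mul]
    have h2 := Real.add_one_le_exp (((2:ℕ):ℝ) * (Y - X))
    have h3 := mul_le_mul_of_nonneg_left h2 (show 0 ≤ X by linarith)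
    push_cast at h3 ⊢
    nlinarith
  calc √Y * Real.exp (-Y) ≤ √X * Real.exp (Y - X) * Real.exp (-Y) := by gcongr
    _ = √X * Real.exp (-X) := by rw [mul_assoc, ← Real.exp_add]; ring_nf

lemma relErr_ge {X Y e s : ℝ} (hX : 1 / 2 ≤ X) (hXY : X ≤ Y) (hs : 0 ≤ s) (he : 0 ≤ e)
    (h1 : s ^ 2 ≤ Y) (h2 : Real.exp (Y / 2) ≤ e⁻¹) : 0.387 * s * e ^ 2 ≤ relErr X := by
  have hc := sqrt_const_ge
  have h3 := sqrt_mul_exp_neg_anti hX hXY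
  have h4 : s ≤ √Y := Real.le_sqrt_of_sq_le h1
  have h5 : e ≤ Real.exp (-(Y / 2)) := by
    rw [Real.exp_neg]
    rcases he.eq_or_lt with h | h
    · rw [← h]; positivity
    · exact (le_inv_comm₀ h (Real.exp_pos _)).2 h2
  have h6 : Real.exp (-Y) = Real.exp (-(Y / 2)) ^ 2 := by
    rw [← Real.exp_nat_mul]; congr 1; push_cast; ring
  calc 0.387 * s * e ^ 2 = 0.387 * (s * e ^ 2) := by ring
    _ ≤ √(8 / (17 * Real.pi)) * (√Y * Real.exp (-(Y / 2)) ^ 2) := by gcongr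
    _ ≤ √(8 / (17 * Real.pi)) * (√X * Real.exp (-X)) := by rw [← h6]; gcongr
    _ = relErr X := by rw [relErr]; ring

lemma half_le_sqrt_log {x : ℝ} (hx : 149 ≤ x) : 1 / 2 ≤ √(Real.log x / 6.315) := by
  have h : 4 * Real.log 2 ≤ Real.log x := by
    rw [show 4 * Real.log 2 = Real.log (2 ^ 4) by rw [Real.log_pow]; norm_num]
    exact Real.log_le_log (by norm_num) (by norm_num; linarith)
  have := Real.log_two_gt_d9
  apply Real.le_sqrt_of_sq_le
  rw [le_div_iff₀ (by norm_num)]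
  norm_num at *
  linarith

lemma relErr_log_ge {x Y e s L : ℝ} (hx : 149 ≤ x) (hxL : x ≤ Real.exp L) (hL : L ≤ 6.315 * Y ^ 2)
    (hY : 0 ≤ Y) (hY2 : Y ≤ 2) (hs : 0 ≤ s) (he : 0 ≤ e) (h1 : s ^ 2 ≤ Y)
    (h2 : (∑ m ∈ Finset.range 7, (Y / 2) ^ m / (m.factorial : ℝ)) +
      (Y / 2) ^ 7 * (7 + 1) / ((Nat.factorial 7 : ℕ) * 7) ≤ e⁻¹) :
    0.387 * s * e ^ 2 ≤ relErr √(Real.log x / 6.315) := by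
  refine relErr_ge (half_le_sqrt_log hx) ?_ hs he h1 ?_
  · refine Real.sqrt_le_iff.2 ⟨hY, ?_⟩
    rw [div_le_iff₀ (by norm_num)]
    have := (Real.log_le_iff_le_exp (show 0 < x by linarith)).2 hxL
    linarith
  · refine le_trans ?_ h2
    have := Real.exp_bound' (x := Y / 2) (by linarith) (by linarith) (n := 7) (by norm_num)
    exact_mod_cast this

lemma abs_theta_sub_le_of_small {x : ℝ} (hx : 149 ≤ x) (hx' : x < 12100) :
    |Chebyshev.theta x - x| ≤ x * relErr √(Real.log x / 6.315) := by
  have h1 := theta_le_self (by linarith) hx'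
  have h2 := theta_ge_of_small hx hx'
  have he := Real.exp_one_gt_d9
  rw [abs_of_nonpos (by linarith)]
  split_ifs at h2 with h
  · have h3 : x ≤ Real.exp 7.001 := by
      have e : Real.exp 7.001 = Real.exp 1 ^ 7 * Real.exp 0.001 := by
        rw [← Real.exp_nat_mul, ← Real.exp_add]; norm_num
      have h4 : (2.7182818:ℝ) ^ 7 ≤ Real.exp 1 ^ 7 := by gcongr; linarith
      have h5 := Real.add_one_le_exp (0.001:ℝ)
      rw [e]
      have : (2.7182818:ℝ) ^ 7 * (0.001 + 1) ≤ Real.exp 1 ^ 7 * Real.exp 0.001 := by gcongr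
      refine le_trans ?_ this
      norm_num; linarith
    have h4 := relErr_log_ge (Y := 1.053) (e := 0.59) (s := 1.026) hx h3 (by norm_num) (by norm_num)
      (by norm_num) (by norm_num) (by norm_num) (by norm_num)
      (by norm_num [Finset.sum_range_succ, Nat.factorial])
    nlinarith
  · have h3 : x ≤ Real.exp 9.402 := by
      have e : Real.exp 9.402 = Real.exp 1 ^ 9 * Real.exp 0.402 := by
        rw [← Real.exp_nat_mul, ← Real.exp_add]; norm_num
      have h4 : (2.7182818:ℝ) ^ 9 ≤ Real.exp 1 ^ 9 := by gcongr; linarith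
      have h5 : 1.494 ≤ Real.exp (0.402:ℝ) := by
        refine le_trans ?_ (Real.sum_le_exp_of_nonneg (x := 0.402) (by norm_num) 5)
        norm_num [Finset.sum_range_succ, Nat.factorial]
      rw [e]
      have : (2.7182818:ℝ) ^ 9 * 1.494 ≤ Real.exp 1 ^ 9 * Real.exp 0.402 := by gcongr
      refine le_trans ?_ this
      norm_num; linarith
    have h4 := relErr_log_ge (Y := 1.2203) (e := 0.54) (s := 1.1) hx h3 (by norm_num) (by norm_num)
      (by norm_num) (by norm_num) (by norm_num) (by norm_num)
      (by norm_num [Finset.sum_range_succ, Nat.factorial])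
    nlinarith

lemma abs_theta_sub_le_of_sqrt {x s : ℝ} (hs : 109.9 ≤ s) (hs' : s ≤ 500) (hx : s ^ 2 ≤ x) :
    |Chebyshev.theta x - x| ≤ x * (0.077 + 4 / s) := by
  have hx0 : (12000:ℝ) ≤ x := by nlinarith
  have hu := (Chebyshev.theta_le_psi x).trans (psi_le (show 0 ≤ x by linarith))
  have hl := le_psi (show 30 ≤ x by linarith)
  have hd := psi_sub_theta_le hx0
  have hsx : s ≤ √x := Real.le_sqrt_of_sq_le hx
  have hxx : √x ^ 2 = x := Real.sq_sqrt (by linarith)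
  set q := √x with hq
  have h1 : q ≤ x / s := by rw [le_div_iff₀ (by linarith)]; nlinarith
  have h2 : 0.002 * x ≤ x / s := by rw [le_div_iff₀ (by linarith)]; nlinarith
  have hlog : Real.log x ≤ 2 * (q / 125 - 1 + 3 * 1.6095) := by
    rw [← hxx, Real.log_pow]
    have := Real.log_le_sub_one_of_pos (show 0 < q / 125 by linarith)
    rw [Real.log_div (by linarith) (by norm_num), show (125:ℝ) = 5 ^ 3 by norm_num,
      Real.log_pow] at this
    have h5 := log_five_upper
    push_cast at this ⊢
    linarith
  have e : x * (0.077 + 4 / s) = 0.077 * x + 4 * (x / s) := by ring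
  rw [e, abs_le]
  constructor <;> linarith

lemma abs_theta_sub_le_of_le_exp_20 {x : ℝ} (hx : 149 ≤ x) (hx' : x ≤ Real.exp 20) :
    |Chebyshev.theta x - x| ≤ x * relErr √(Real.log x / 6.315) := by
  rcases lt_or_ge x 12100 with h | h
  · exact abs_theta_sub_le_of_small hx h
  have hx0 : (0:ℝ) ≤ x := by linarith
  rcases le_total x (Real.exp 12) with h12 | h12
  · refine (abs_theta_sub_le_of_sqrt (s := 110) (by norm_num) (by norm_num) (by norm_num; exact h)).trans ?_
    refine mul_le_mul_of_nonneg_left ?_ hx0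
    refine le_trans ?_ (relErr_log_ge (Y := 1.3786) (e := 0.5019) (s := 1.174) hx h12 (by norm_num)
      (by norm_num) (by norm_num) (by norm_num) (by norm_num) (by norm_num)
      (by norm_num [Finset.sum_range_succ, Nat.factorial]))
    norm_num
  · refine (abs_theta_sub_le_of_sqrt (s := 403.4) (by norm_num) (by norm_num) ?_).trans ?_
    · refine le_trans ?_ h12
      have h4 : (2.7182818:ℝ) ^ 12 ≤ Real.exp 1 ^ 12 := by
        gcongr; linarith [Real.exp_one_gt_d9]
      rw [← Real.exp_nat_mul] at h4
      norm_num at h4 ⊢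
      linarith
    refine mul_le_mul_of_nonneg_left ?_ hx0
    refine le_trans ?_ (relErr_log_ge (Y := 1.7797) (e := 0.41068) (s := 1.334) hx hx' (by norm_num)
      (by norm_num) (by norm_num) (by norm_num) (by norm_num) (by norm_num)
      (by norm_num [Finset.sum_range_succ, Nat.factorial]))
    norm_num

lemma exp_neg_le_of_le_sum {y b : ℝ} (n : ℕ) (hy : 0 ≤ y) (hb : 0 < b)
    (h : b⁻¹ ≤ ∑ i ∈ Finset.range n, y ^ i / (i.factorial : ℝ)) : Real.exp (-y) ≤ b := by
  rw [Real.exp_neg]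
  exact inv_le_of_inv_le₀ hb (h.trans (Real.sum_le_exp_of_nonneg hy n))

lemma exp_le_of_sum_le {y b : ℝ} (hy : 0 ≤ y) (hy8 : y ≤ 8)
    (h : ((∑ m ∈ Finset.range 5, (y / 8) ^ m / (m.factorial : ℝ)) +
      (y / 8) ^ 5 * (5 + 1) / ((Nat.factorial 5 : ℕ) * 5)) ^ 8 ≤ b) : Real.exp y ≤ b := by
  have h1 := Real.exp_bound' (x := y / 8) (by linarith) (by linarith) (n := 5) (by norm_num)
  have h2 : Real.exp y = Real.exp (y / 8) ^ 8 := by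
    rw [← Real.exp_nat_mul]; congr 1; push_cast; ring
  rw [h2]
  refine le_trans ?_ h
  gcongr
  exact_mod_cast h1

lemma repG_le_of_sqrt {L X r d c : ℝ} {j : ℕ} (hL : 6.315 * X ^ 2 ≤ L)
    (hr2 : r ^ 2 ≤ 4 * 6.315 * repC j) (hd : repD j = d)
    (hc : Real.exp (-d) ≤ c / 1.6) : repG L j ≤ c * Real.exp (-(r * X)) := by
  have hj : 0 ≤ repC j := by nlinarith [sq_nonneg r]
  have h1 : r * X ≤ 2 * √(repC j * L) := by
    have : r * X / 2 ≤ √(repC j * L) := by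
      apply Real.le_sqrt_of_sq_le
      calc (r * X / 2) ^ 2 = r ^ 2 * X ^ 2 / 4 := by ring
        _ ≤ 4 * 6.315 * repC j * X ^ 2 / 4 := by gcongr
        _ = repC j * (6.315 * X ^ 2) := by ring
        _ ≤ repC j * L := by gcongr
    linarith
  rw [repG, hd, sub_eq_add_neg, Real.exp_add]
  calc 1.6 * (Real.exp (-(2 * √(repC j * L))) * Real.exp (-d))
      ≤ 1.6 * (Real.exp (-(r * X)) * (c / 1.6)) := by gcongr
    _ = c * Real.exp (-(r * X)) := by ring

lemma repG_bounds {L X : ℝ} (hL : 6.315 * X ^ 2 ≤ L) :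
    repG L 1 ≤ 0.0534 * Real.exp (-(1.2704 * X)) ∧ repG L 2 ≤ 0.11885 * Real.exp (-(2.1138 * X)) ∧
    repG L 3 ≤ 0.14516 * Real.exp (-(2.4519 * X)) ∧ repG L 4 ≤ 0.1773 * Real.exp (-(2.6784 * X)) := by
  refine ⟨repG_le_of_sqrt hL (by norm_num [repC]) (d := 3.4) (by simp [repD]) ?_,
    repG_le_of_sqrt hL (by norm_num [repC]) (d := 2.6) (by simp [repD]) ?_,
    repG_le_of_sqrt hL (by norm_num [repC]) (d := 2.4) (by simp [repD]) ?_,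
    repG_le_of_sqrt hL (by norm_num [repC]) (d := 2.2) (by simp [repD]) ?_⟩ <;>
  exact exp_neg_le_of_le_sum 18 (by norm_num) (by norm_num)
    (by norm_num [Finset.sum_range_succ, Nat.factorial])

lemma mul_sqrt_le_mul_exp {X Y : ℝ} (hX : 0 < X) (hY : 0 < Y) :
    Y * √Y ≤ X * √X * Real.exp (3 / 2 * ((Y - X) / X)) := by
  have h1 : Y ≤ X * Real.exp ((Y - X) / X) := by
    have := mul_le_mul_of_nonneg_left (Real.add_one_le_exp ((Y - X) / X)) hX.le
    have e : X * ((Y - X) / X + 1) = Y := by field_simp; ring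
    linarith
  have h2 : √Y ≤ √X * Real.exp ((Y - X) / X / 2) := by
    refine Real.sqrt_le_iff.2 ⟨by positivity, ?_⟩
    rw [mul_pow, Real.sq_sqrt hX.le, ← Real.exp_nat_mul]
    push_cast
    rw [mul_div_cancel₀ _ (by norm_num)]
    exact h1
  calc Y * √Y ≤ (X * Real.exp ((Y - X) / X)) * (√X * Real.exp ((Y - X) / X / 2)) := by gcongr
    _ = X * √X * (Real.exp ((Y - X) / X) * Real.exp ((Y - X) / X / 2)) := by ring
    _ = _ := by rw [← Real.exp_add]; congr 2; ring

lemma exp_le_mul_sqrt_left {a c X Y : ℝ} (hX : 0 < X) (hXY : X ≤ Y) (ha : 3 / 2 ≤ a * X) (hc : 0 ≤ c)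
    (h : Real.exp (a * Y) ≤ c * (Y * √Y)) : Real.exp (a * X) ≤ c * (X * √X) := by
  have h1 := mul_le_mul_of_nonneg_left (mul_sqrt_le_mul_exp hX (hX.trans_le hXY)) hc
  have h2 : 3 / 2 * ((Y - X) / X) ≤ a * (Y - X) := by
    rw [← mul_div_assoc, div_le_iff₀ hX]
    nlinarith
  have h3 : Real.exp (3 / 2 * ((Y - X) / X)) ≤ Real.exp (a * (Y - X)) := Real.exp_le_exp.2 h2
  have h4 : Real.exp (a * Y) ≤ c * (X * √X) * Real.exp (a * (Y - X)) := by
    refine (h.trans h1).trans ?_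
    rw [← mul_assoc]
    gcongr
  have e : Real.exp (a * Y) = Real.exp (a * X) * Real.exp (a * (Y - X)) := by
    rw [← Real.exp_add]; ring_nf
  rw [e] at h4
  exact le_of_mul_le_mul_right h4 (Real.exp_pos _)

lemma exp_le_mul_sqrt_right {a c X Y : ℝ} (hX : 0 < X) (hXY : X ≤ Y) (ha : a * Y ≤ 3 / 2) (hc : 0 ≤ c)
    (h : Real.exp (a * X) ≤ c * (X * √X)) : Real.exp (a * Y) ≤ c * (Y * √Y) := by
  have hY := hX.trans_le hXY
  have h1 := mul_le_mul_of_nonneg_left (mul_sqrt_le_mul_exp hY hX) hc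
  have h2 : 3 / 2 * ((X - Y) / Y) ≤ a * (X - Y) := by
    rw [← mul_div_assoc, div_le_iff₀ hY]
    nlinarith
  have h3 : Real.exp (3 / 2 * ((X - Y) / Y)) ≤ Real.exp (a * (X - Y)) := Real.exp_le_exp.2 h2
  have h4 : Real.exp (a * X) ≤ c * (Y * √Y) * Real.exp (a * (X - Y)) := by
    refine (h.trans h1).trans ?_
    rw [← mul_assoc]
    gcongr
  have e : Real.exp (a * X) = Real.exp (a * Y) * Real.exp (a * (X - Y)) := by
    rw [← Real.exp_add]; ring_nf
  rw [e] at h4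
  exact le_of_mul_le_mul_right h4 (Real.exp_pos _)

lemma exp_le_mul_sqrt_at {y c X s b : ℝ} (hX : 0 ≤ X) (hc : 0 ≤ c) (hsX : s ^ 2 ≤ X)
    (hb : b ≤ c * (X * s)) (h : Real.exp y ≤ b) : Real.exp y ≤ c * (X * √X) := by
  have : s ≤ √X := Real.le_sqrt_of_sq_le hsX
  refine (h.trans hb).trans ?_
  gcongr

lemma low_term_le {X L k b : ℝ} (hX : 1.7796 ≤ X) (hL : 6.315 * X ^ 2 ≤ L)
    (hk : k ≤ (3.1575 * X - 1) * X) (hb : Real.exp (-k) ≤ b) :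
    39.4 * Real.exp (-(L / 2)) ≤ 39.4 / 1.33 * b * (√X * Real.exp (-X)) := by
  have h1 : (1.33:ℝ) ≤ √X := Real.le_sqrt_of_sq_le (by norm_num; linarith)
  have h2 : Real.exp (-(L / 2)) ≤ Real.exp (-k) * Real.exp (-X) := by
    rw [← Real.exp_add, Real.exp_le_exp]
    nlinarith
  have hb0 : 0 ≤ b := (Real.exp_pos _).le.trans hb
  calc 39.4 * Real.exp (-(L / 2)) ≤ 39.4 * (b * Real.exp (-X)) := by
        gcongr; exact h2.trans (by gcongr)
    _ = 39.4 / 1.33 * b * (1.33 * Real.exp (-X)) := by ring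
    _ ≤ _ := by gcongr

lemma zeroSum_le_of_exp_le {X L c₁ c₂ c₄ : ℝ} (hX : 1.7796 ≤ X) (hL : 6.315 * X ^ 2 ≤ L)
    (hL20 : 20 ≤ L)
    (h1 : Real.exp (1.7296 * X) ≤ c₁ * (X * √X)) (h2 : Real.exp (0.8862 * X) ≤ c₂ * (X * √X))
    (h4 : Real.exp (0.3216 * X) ≤ c₄ * (X * √X))
    (hsum : 0.0085 + 0.01272 * (0.0534 * c₁ + (0.11885 + 0.14516) * c₂) + 0.158 * c₄ ≤ 0.185) :
    zeroSum (2 / (0.174 * (√X * Real.exp (-X)))) L ≤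
      Real.exp L * (0.185 * (√X * Real.exp (-X))) := by
  have hX0 : 0 < X := by linarith
  set E := √X * Real.exp (-X) with hE
  have hE0 : 0 < E := by positivity
  refine (zeroSum_le (fun ρ h0 hρ ↦ re_eq_half_of_abs_im_le h0 hρ) hL20
    (sum_blocks_le_sq (by norm_num) (by norm_num) (2 / (0.174 * E))) le_rfl (Or.inr rfl)).trans ?_
  refine mul_le_mul_of_nonneg_left ?_ (Real.exp_pos _).le
  obtain ⟨g1, g2, g3, g4⟩ := repG_bounds hL
  have hlow : 39.4 * Real.exp (-(L / 2)) ≤ 0.0085 * E := by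
    refine (low_term_le (k := 8.2) (b := 1 / 3600) hX hL (by nlinarith)
      (exp_neg_le_of_le_sum 25 (by norm_num) (by norm_num)
        (by norm_num [Finset.sum_range_succ, Nat.factorial]))).trans ?_
    gcongr; norm_num
  have hEE : E ^ 2 * Real.exp (2 * X) = X := by
    rw [hE, mul_pow, Real.sq_sqrt hX0.le, ← Real.exp_nat_mul, mul_assoc, ← Real.exp_add]
    push_cast
    rw [show 2 * -X + 2 * X = 0 by ring, Real.exp_zero, mul_one]
  have hT : (2 / (0.174 * E)) ^ 2 = (1000 / 87) ^ 2 * (Real.exp (2 * X) / X) := by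
    have h5 : Real.exp (2 * X) / X = 1 / E ^ 2 := by
      rw [div_eq_div_iff hX0.ne' (by positivity)]; linarith
    rw [h5]; field_simp; norm_num
  have conv : ∀ r a c : ℝ, a = 3 - r → Real.exp (a * X) ≤ c * (X * √X) →
      Real.exp (2 * X) / X * Real.exp (-(r * X)) ≤ c * E := by
    intro r a c ha h
    rw [div_mul_eq_mul_div, div_le_iff₀ hX0, ← Real.exp_add]
    have e : Real.exp (2 * X + -(r * X)) = Real.exp (a * X) * Real.exp (-X) := by
      rw [← Real.exp_add, ha]; ring_nf
    rw [e, hE]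
    calc Real.exp (a * X) * Real.exp (-X) ≤ c * (X * √X) * Real.exp (-X) := by gcongr
      _ = _ := by ring
  have k1 := conv 1.2704 _ _ (by norm_num) h1
  have k2 := conv 2.1138 _ _ (by norm_num) h2
  have k3 := conv 2.4519 0.5481 c₂ (by norm_num)
    ((Real.exp_le_exp.2 (by nlinarith)).trans h2)
  have k4 := conv 2.6784 _ _ (by norm_num) h4
  have hlog : Real.log ((290 + 3) / (2 * Real.pi)) ≤ 3.87 := by
    rw [Real.log_div (by norm_num) (by positivity)]
    have a1 : Real.log (290 + 3) ≤ Real.log 300 := Real.log_le_log (by norm_num) (by norm_num)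
    have a2 : Real.log 300 = 2 * Real.log 2 + Real.log 3 + 2 * Real.log 5 := by
      rw [← Nat.cast_two, ← Real.log_pow, ← Real.log_pow, ← Real.log_mul (by norm_num) (by norm_num),
        ← Real.log_mul (by norm_num) (by norm_num)]
      norm_num
    have b2 := Real.log_two_lt_d9
    have b3 := Real.log_three_lt_d9
    have b5 := log_five_upper
    have b6 := log_two_pi_lower
    norm_num at *
    linarith
  set Q := Real.exp (2 * X) / X with hQ
  have hQ0 : 0 < Q := by positivity
  have hS : (2 / (0.174 * E) / 290) ^ 2 * (64 / 39 * 4.68 + 1600 / 1521 * 0.39175) ≤ 0.01272 * Q := by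
    rw [div_pow, hT]
    have : (1000 / 87) ^ 2 * Q / 290 ^ 2 * (64 / 39 * 4.68 + 1600 / 1521 * 0.39175) =
      ((1000 / 87) ^ 2 / 290 ^ 2 * (64 / 39 * 4.68 + 1600 / 1521 * 0.39175)) * Q := by ring
    rw [this]
    gcongr
    norm_num
  have hlog0 : 0 ≤ Real.log ((290 + 3) / (2 * Real.pi)) := by
    refine Real.log_nonneg ?_
    rw [le_div_iff₀ (by positivity)]
    linarith [Real.pi_lt_four]
  have hgood : 1.001 * repG L 4 * (1.007 * ((2 / (0.174 * E)) ^ 2 / 290) *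
      (1 / 290 + Real.log ((290 + 3) / (2 * Real.pi)) / 2)) ≤ 0.158 * c₄ * E := by
    rw [hT]
    calc _ ≤ 1.001 * (0.1773 * Real.exp (-(2.6784 * X))) * (1.007 * ((1000 / 87) ^ 2 * Q / 290) *
          (1 / 290 + 3.87 / 2)) := by gcongr
      _ = (1.001 * 0.1773 * 1.007 * (1000 / 87) ^ 2 / 290 * (1 / 290 + 3.87 / 2)) *
          (Q * Real.exp (-(2.6784 * X))) := by ring
      _ ≤ 0.158 * (c₄ * E) := by gcongr; norm_num
      _ = _ := by ring
  have hbad : (2 / (0.174 * E) / 290) ^ 2 * (64 / 39 * 4.68 + 1600 / 1521 * 0.39175) *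
      (repG L 1 + repG L 2 + repG L 3) ≤
      0.01272 * (0.0534 * c₁ + (0.11885 + 0.14516) * c₂) * E := by
    have hs0 : 0 ≤ repG L 1 + repG L 2 + repG L 3 := by
      linarith [repG_pos L 1, repG_pos L 2, repG_pos L 3]
    calc _ ≤ 0.01272 * Q * (0.0534 * Real.exp (-(1.2704 * X)) + 0.11885 * Real.exp (-(2.1138 * X)) +
          0.14516 * Real.exp (-(2.4519 * X))) := by gcongr
      _ = 0.01272 * (0.0534 * (Q * Real.exp (-(1.2704 * X))) +
          0.11885 * (Q * Real.exp (-(2.1138 * X))) + 0.14516 * (Q * Real.exp (-(2.4519 * X)))) := by ring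
      _ ≤ 0.01272 * (0.0534 * (c₁ * E) + 0.11885 * (c₂ * E) + 0.14516 * (c₂ * E)) := by gcongr
      _ = _ := by ring
  have := mul_le_mul_of_nonneg_right hsum hE0.le
  linarith

lemma zeroSum_le_of_le {X L : ℝ} (hX : 1.7796 ≤ X) (hX' : X ≤ 3.92) (hL : 6.315 * X ^ 2 ≤ L)
    (hL20 : 20 ≤ L) :
    zeroSum (2 / (0.174 * (√X * Real.exp (-X)))) L ≤
      Real.exp L * (0.185 * (√X * Real.exp (-X))) := by
  have hX0 : 0 < X := by linarith
  rcases le_total X 3 with h | h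
  · refine zeroSum_le_of_exp_le (c₁ := 34.7) (c₂ := 2.77) (c₄ := 0.75) hX hL hL20
      (exp_le_mul_sqrt_left hX0 h (by linarith) (by norm_num) ?_)
      (exp_le_mul_sqrt_left hX0 h (by linarith) (by norm_num) ?_)
      (exp_le_mul_sqrt_right (by norm_num) hX (by linarith) (by norm_num) ?_) (by norm_num)
    · exact exp_le_mul_sqrt_at (s := 1.732) (by norm_num) (by norm_num) (by norm_num)
        le_rfl (exp_le_of_sum_le (by norm_num) (by norm_num)
          (by norm_num [Finset.sum_range_succ, Nat.factorial]))
    · exact exp_le_mul_sqrt_at (s := 1.732) (by norm_num) (by norm_num) (by norm_num)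
        le_rfl (exp_le_of_sum_le (by norm_num) (by norm_num)
          (by norm_num [Finset.sum_range_succ, Nat.factorial]))
    · exact exp_le_mul_sqrt_at (s := 1.334) (by norm_num) (by norm_num) (by norm_num)
        le_rfl (exp_le_of_sum_le (by norm_num) (by norm_num)
          (by norm_num [Finset.sum_range_succ, Nat.factorial]))
  · refine zeroSum_le_of_exp_le (c₁ := 114) (c₂ := 4.2) (c₄ := 0.51) hX hL hL20
      (exp_le_mul_sqrt_left hX0 hX' (by linarith) (by norm_num) ?_)
      (exp_le_mul_sqrt_left hX0 hX' (by linarith) (by norm_num) ?_)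
      (exp_le_mul_sqrt_right (by norm_num) h (by linarith) (by norm_num) ?_) (by norm_num)
    · exact exp_le_mul_sqrt_at (s := 1.9798) (by norm_num) (by norm_num) (by norm_num)
        le_rfl (exp_le_of_sum_le (by norm_num) (by norm_num)
          (by norm_num [Finset.sum_range_succ, Nat.factorial]))
    · exact exp_le_mul_sqrt_at (s := 1.9798) (by norm_num) (by norm_num) (by norm_num)
        le_rfl (exp_le_of_sum_le (by norm_num) (by norm_num)
          (by norm_num [Finset.sum_range_succ, Nat.factorial]))
    · exact exp_le_mul_sqrt_at (s := 1.732) (by norm_num) (by norm_num) (by norm_num)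
        le_rfl (exp_le_of_sum_le (by norm_num) (by norm_num)
          (by norm_num [Finset.sum_range_succ, Nat.factorial]))

lemma sum_blocks_le_of_ge {X T : ℝ} (hX : 3.92 ≤ X) (hT : T = 1000 / 87 * (Real.exp X / √X))
    (hT290 : 290 ≤ T) (N : ℕ) :
    ∑ k ∈ Finset.range N, (4.68 + 0.39175 * (k : ℝ)) * min 1 ((T / (290 * 1.6 ^ k)) ^ 2) ≤
      0.887 * (X - 3.92) ^ 2 + 10.94 * (X - 3.92) + 8.28 := by
  have hlog : 0.47 ≤ Real.log 1.6 := by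
    have e : Real.log 1.6 = 3 * Real.log 2 - Real.log 5 := by
      rw [show (1.6 : ℝ) = 2 ^ 3 / 5 by norm_num, Real.log_div (by norm_num) (by norm_num),
        Real.log_pow]
      norm_num
    have h2 := Real.log_two_gt_d9
    have h5 := Real.log_five_lt_d9
    rw [e]
    norm_num at *
    linarith
  have hs : (1.9798 : ℝ) ≤ √X := Real.le_sqrt_of_sq_le (by norm_num; linarith)
  set κ := Real.log (T / 290) / Real.log 1.6 with hκ
  have hT1 : 1 ≤ T / 290 := by rw [le_div_iff₀ (by norm_num)]; linarith
  have hκ0 : 0 ≤ κ := div_nonneg (Real.log_nonneg hT1) (by linarith)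
  have hTκ : T = 290 * 1.6 ^ κ := by
    rw [Real.rpow_def_of_pos (by norm_num), hκ, mul_div_cancel₀ _ (by linarith),
      Real.exp_log (by linarith)]
    ring
  have hTexp : T / 290 ≤ Real.exp (X - 3.908) := by
    have h1 : Real.exp 3.908 ≤ 49.95 := exp_le_of_sum_le (by norm_num) (by norm_num)
      (by norm_num [Finset.sum_range_succ, Nat.factorial])
    rw [Real.exp_sub, hT]
    calc 1000 / 87 * (Real.exp X / √X) / 290 ≤ 1000 / 87 * (Real.exp X / 1.9798) / 290 := by gcongr
      _ = Real.exp X * (1000 / 87 / 1.9798 / 290) := by ring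
      _ ≤ Real.exp X * (1 / 49.95) :=
          mul_le_mul_of_nonneg_left (by norm_num) (Real.exp_pos X).le
      _ = Real.exp X / 49.95 := by ring
      _ ≤ _ := by gcongr
  have hκ1 : κ * 0.47 ≤ X - 3.908 := by
    have h1 : κ * Real.log 1.6 = Real.log (T / 290) := by
      rw [hκ, div_mul_cancel₀ _ (by linarith)]
    have h2 : Real.log (T / 290) ≤ X - 3.908 := by
      rw [Real.log_le_iff_le_exp (by linarith)]; exact hTexp
    have h3 : κ * 0.47 ≤ κ * Real.log 1.6 := by gcongr
    linarith
  have h := sum_blocks_le (α := 4.68) (β := 0.39175) (by norm_num) (by norm_num) hκ0 N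
  rw [← hTκ] at h
  refine h.trans ?_
  have hκ2 : κ ≤ 2.1277 * (X - 3.92) + 0.0256 := by linarith
  have hY : 0 ≤ X - 3.92 := by linarith
  calc 4.68 * (κ + 64 / 39) + 0.39175 * (κ ^ 2 / 2 + (64 / 39 - 1 / 2) * κ + (1600 / 1521 + 1 / 8))
      ≤ 8.1414 + 5.1271 * κ + 0.19588 * κ ^ 2 := by nlinarith [sq_nonneg κ]
    _ ≤ 8.1414 + 5.1271 * (2.1277 * (X - 3.92) + 0.0256) +
        0.19588 * (2.1277 * (X - 3.92) + 0.0256) ^ 2 := by gcongr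
    _ ≤ _ := by nlinarith [sq_nonneg (X - 3.92)]

lemma log_div_two_pi_le {X T : ℝ} (hX : 3.92 ≤ X) (hT : T = 1000 / 87 * (Real.exp X / √X)) :
    Real.log ((T + 3) / (2 * Real.pi)) ≤ X := by
  have hX0 : 0 < X := by linarith
  have hs : (1.9798 : ℝ) ≤ √X := Real.le_sqrt_of_sq_le (by norm_num; linarith)
  have hT0 : 0 < T := by rw [hT]; positivity
  rw [Real.log_le_iff_le_exp (by positivity), div_le_iff₀ (by positivity), hT]
  have p : Real.exp X * 6.28 ≤ Real.exp X * (2 * Real.pi) := by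
    gcongr; linarith [Real.pi_gt_d2]
  have r : 1 + X + X ^ 2 / 2 ≤ Real.exp X := Real.quadratic_le_exp_of_nonneg hX0.le
  have r' : 15 / 2 ≤ Real.exp X := by nlinarith
  have q : Real.exp X / √X ≤ 0.506 * Real.exp X := by
    rw [div_le_iff₀ (by positivity)]
    calc Real.exp X ≤ 0.506 * Real.exp X * 1.9798 := by linarith [Real.exp_pos X]
      _ ≤ _ := by gcongr
  calc 1000 / 87 * (Real.exp X / √X) + 3 ≤ 1000 / 87 * (0.506 * Real.exp X) + 3 := by gcongr
    _ ≤ Real.exp X * 6.28 := by norm_num; linarith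
    _ ≤ _ := p

lemma le_two_div {X : ℝ} (hX : 3.92 ≤ X) : 290 ≤ 2 / (0.174 * (√X * Real.exp (-X))) := by
  have hX0 : 0 < X := by linarith
  have e1 : Real.exp (-3.92) ≤ 1 / 50.2 := exp_neg_le_of_le_sum 16 (by norm_num) (by norm_num)
    (by norm_num [Finset.sum_range_succ, Nat.factorial])
  have e2 : √(3.92 : ℝ) ≤ 1.98 := Real.sqrt_le_iff.2 (by norm_num)
  have e3 : √X * Real.exp (-X) ≤ 1.98 * (1 / 50.2) :=
    (sqrt_mul_exp_neg_anti (by norm_num) hX).trans (by gcongr)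
  rw [le_div_iff₀ (by positivity)]
  linarith

lemma zeroSum_le_of_ge_aux {X L a s f₁ f₂ f₃ f₄ : ℝ} (ha : 3.92 ≤ a) (hX : a ≤ X)
    (hL : 6.315 * X ^ 2 ≤ L) (hL20 : 20 ≤ L)
    (hs : 0.0534 * (0.887 * (X - 3.92) ^ 2 + 10.94 * (X - 3.92) + 8.28) ≤
      s * (√X * Real.exp (0.2704 * X)))
    (h1 : Real.exp (-(0.8434 * a)) ≤ f₁) (h2 : Real.exp (-(1.1815 * a)) ≤ f₂)
    (h3 : Real.exp (-(0.6784 * a)) ≤ f₃) (h4 : Real.exp (-(1.6784 * a)) ≤ f₄)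
    (hsum : 0.0005 + s * (1 + 0.11885 / 0.0534 * f₁ + 0.14516 / 0.0534 * f₂) +
      0.1788 * (f₄ / 1.9 + 5.7472 * f₃) ≤ 0.205) :
    zeroSum (2 / (0.174 * (√X * Real.exp (-X)))) L ≤
      Real.exp L * (0.205 * (√X * Real.exp (-X))) := by
  have hX4 : 3.92 ≤ X := ha.trans hX
  have hX0 : 0 < X := by linarith
  have hsq : (1.9798 : ℝ) ≤ √X := Real.le_sqrt_of_sq_le (by norm_num; linarith)
  have hss : √X * √X = X := Real.mul_self_sqrt hX0.le
  set E := √X * Real.exp (-X) with hE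
  have hE0 : 0 < E := by positivity
  have hTe : 2 / (0.174 * E) = 1000 / 87 * (Real.exp X / √X) := by
    rw [hE, Real.exp_neg]; field_simp; norm_num
  set T := 2 / (0.174 * E) with hTdef
  have hT290 : 290 ≤ T := le_two_div hX4
  refine (zeroSum_le (fun ρ h0 hρ ↦ re_eq_half_of_abs_im_le h0 hρ) hL20
    (sum_blocks_le_of_ge hX4 hTe hT290) hT290 (Or.inl rfl)).trans ?_
  refine mul_le_mul_of_nonneg_left ?_ (Real.exp_pos _).le
  obtain ⟨g1, g2, g3, g4⟩ := repG_bounds hL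
  set S := 0.887 * (X - 3.92) ^ 2 + 10.94 * (X - 3.92) + 8.28 with hS
  have hS0 : 0 < S := by
    have : 0 ≤ X - 3.92 := by linarith
    positivity
  have hlow : 39.4 * Real.exp (-(L / 2)) ≤ 0.0005 * E := by
    refine (low_term_le (k := 12) (b := 1 / 160000) (by linarith) hL (by nlinarith)
      (exp_neg_le_of_le_sum 35 (by norm_num) (by norm_num)
        (by norm_num [Finset.sum_range_succ, Nat.factorial]))).trans ?_
    gcongr; norm_num
  have m1 : Real.exp (-(0.8434 * X)) ≤ f₁ := (Real.exp_le_exp.2 (by linarith)).trans h1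
  have m2 : Real.exp (-(1.1815 * X)) ≤ f₂ := (Real.exp_le_exp.2 (by linarith)).trans h2
  have m3 : Real.exp (-(0.6784 * X)) ≤ f₃ := (Real.exp_le_exp.2 (by linarith)).trans h3
  have m4 : Real.exp (-(1.6784 * X)) ≤ f₄ := (Real.exp_le_exp.2 (by linarith)).trans h4
  have hf1 : 0 ≤ f₁ := (Real.exp_pos _).le.trans h1
  have hf2 : 0 ≤ f₂ := (Real.exp_pos _).le.trans h2
  have hf4 : 0 ≤ f₄ := (Real.exp_pos _).le.trans h4
  have hbad : S * (repG L 1 + repG L 2 + repG L 3) ≤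
      s * (1 + 0.11885 / 0.0534 * f₁ + 0.14516 / 0.0534 * f₂) * E := by
    have e1 : Real.exp (-(2.1138 * X)) = Real.exp (-(1.2704 * X)) * Real.exp (-(0.8434 * X)) := by
      rw [← Real.exp_add]; ring_nf
    have e2 : Real.exp (-(2.4519 * X)) = Real.exp (-(1.2704 * X)) * Real.exp (-(1.1815 * X)) := by
      rw [← Real.exp_add]; ring_nf
    have e3 : Real.exp (-X) = Real.exp (0.2704 * X) * Real.exp (-(1.2704 * X)) := by
      rw [← Real.exp_add]; ring_nf
    rw [e1] at g2
    rw [e2] at g3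
    have h := mul_le_mul_of_nonneg_right hs (Real.exp_pos (-(1.2704 * X))).le
    have h' : 0.0534 * S * Real.exp (-(1.2704 * X)) ≤ s * E := by
      rw [hE, e3]; linarith
    calc S * (repG L 1 + repG L 2 + repG L 3)
        ≤ S * (0.0534 * Real.exp (-(1.2704 * X)) + 0.11885 * (Real.exp (-(1.2704 * X)) * f₁) +
          0.14516 * (Real.exp (-(1.2704 * X)) * f₂)) := by
          gcongr
          · exact g2.trans (by gcongr)
          · exact g3.trans (by gcongr)
      _ = 0.0534 * S * Real.exp (-(1.2704 * X)) *
          (1 + 0.11885 / 0.0534 * f₁ + 0.14516 / 0.0534 * f₂) := by ring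
      _ ≤ s * E * (1 + 0.11885 / 0.0534 * f₁ + 0.14516 / 0.0534 * f₂) := by gcongr
      _ = _ := by ring
  have hlog := log_div_two_pi_le hX4 hTe
  have hgood : 1.001 * repG L 4 * (1.007 * (T ^ 2 / T) *
      (1 / T + Real.log ((T + 3) / (2 * Real.pi)) / 2)) ≤ 0.1788 * (f₄ / 1.9 + 5.7472 * f₃) * E := by
    have hT0 : 0 < T := by linarith
    have e4 : Real.exp (-(2.6784 * X)) = Real.exp (-(1.6784 * X)) * Real.exp (-X) := by
      rw [← Real.exp_add]; ring_nf
    have e5 : Real.exp (-(2.6784 * X)) * Real.exp X = Real.exp (-(0.6784 * X)) * Real.exp (-X) := by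
      rw [← Real.exp_add, ← Real.exp_add]; ring_nf
    have t1 : Real.exp (-(2.6784 * X)) ≤ f₄ / 1.9 * E := by
      rw [e4, hE]
      calc Real.exp (-(1.6784 * X)) * Real.exp (-X) ≤ f₄ / 1.9 * (1.9 * Real.exp (-X)) := by
            rw [← mul_assoc, div_mul_cancel₀ _ (by norm_num)]; gcongr
        _ ≤ _ := by gcongr; linarith
    have t2 : Real.exp (-(2.6784 * X)) * (T * X) ≤ 1000 / 87 * f₃ * E := by
      have : T * X = 1000 / 87 * Real.exp X * √X := by
        rw [hTe]; nth_rw 3 [← hss]; field_simp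
      rw [this, hE]
      calc Real.exp (-(2.6784 * X)) * (1000 / 87 * Real.exp X * √X)
          = 1000 / 87 * √X * (Real.exp (-(2.6784 * X)) * Real.exp X) := by ring
        _ = 1000 / 87 * √X * (Real.exp (-(0.6784 * X)) * Real.exp (-X)) := by rw [e5]
        _ ≤ 1000 / 87 * √X * (f₃ * Real.exp (-X)) := by gcongr
        _ = _ := by ring
    have hr := repG_pos L 4
    have hf3 : 0 ≤ f₃ := (Real.exp_pos _).le.trans h3
    calc _ = 1.001 * 1.007 * repG L 4 * (1 + T * Real.log ((T + 3) / (2 * Real.pi)) / 2) := by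
          field_simp
      _ ≤ 1.001 * 1.007 * repG L 4 * (1 + T * X / 2) := by gcongr
      _ ≤ 1.001 * 1.007 * (0.1773 * Real.exp (-(2.6784 * X))) * (1 + T * X / 2) := by gcongr
      _ = 1.001 * 1.007 * 0.1773 * (Real.exp (-(2.6784 * X)) +
          Real.exp (-(2.6784 * X)) * (T * X) / 2) := by ring
      _ ≤ 1.001 * 1.007 * 0.1773 * (f₄ / 1.9 * E + 1000 / 87 * f₃ * E / 2) := by gcongr
      _ = (1.001 * 1.007 * 0.1773) * ((f₄ / 1.9 + 500 / 87 * f₃) * E) := by ring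
      _ ≤ 0.1788 * ((f₄ / 1.9 + 5.7472 * f₃) * E) := by
          gcongr <;> norm_num
      _ = _ := by ring
  have := mul_le_mul_of_nonneg_right hsum hE0.le
  linarith

lemma le_sqrt_mul_exp {X a b c e p : ℝ} (haX : a ≤ X) (hc : c ≤ √X)
    (he : Real.exp (-(0.2704 * a)) ≤ 1 / e) (he0 : 0 < e) (hb : 0 ≤ b)
    (h : p ≤ b * (c * (e * (1 + 0.2704 * (X - a) + (0.2704 * (X - a)) ^ 2 / 2)))) :
    p ≤ b * (√X * Real.exp (0.2704 * X)) := by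
  have h1 : e ≤ Real.exp (0.2704 * a) := by
    rw [Real.exp_neg, ← one_div] at he
    exact (one_div_le_one_div (Real.exp_pos _) he0).1 he
  have h2 : Real.exp (0.2704 * X) = Real.exp (0.2704 * a) * Real.exp (0.2704 * (X - a)) := by
    rw [← Real.exp_add]; ring_nf
  have h3 := Real.quadratic_le_exp_of_nonneg (x := 0.2704 * (X - a)) (by linarith)
  rw [h2]
  refine h.trans ?_
  have : 0 ≤ X - a := by linarith
  gcongr

lemma zeroSum_le_of_ge {X L : ℝ} (hX : 3.92 ≤ X) (hL : 6.315 * X ^ 2 ≤ L) (hL20 : 20 ≤ L) :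
    zeroSum (2 / (0.174 * (√X * Real.exp (-X)))) L ≤
      Real.exp L * (0.205 * (√X * Real.exp (-X))) := by
  rcases le_total X 4.3 with h | h
  · have he : Real.exp (-(0.2704 * 3.92)) ≤ 1 / 2.88 :=
      exp_neg_le_of_le_sum 25 (by norm_num) (by norm_num)
        (by norm_num [Finset.sum_range_succ, Nat.factorial])
    refine zeroSum_le_of_ge_aux (s := 0.119) (f₁ := 0.037) (f₂ := 0.01) (f₃ := 0.0702)
      (f₄ := 0.0015) le_rfl hX hL hL20
      (le_sqrt_mul_exp (c := 1.979) (e := 2.88) hX (Real.le_sqrt_of_sq_le (by norm_num; linarith))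
        he (by norm_num) (by norm_num)
        (by nlinarith [mul_nonneg (sub_nonneg.2 hX) (sub_nonneg.2 h)]))
      ?_ ?_ ?_ ?_ (by norm_num) <;>
    exact exp_neg_le_of_le_sum 25 (by norm_num) (by norm_num)
      (by norm_num [Finset.sum_range_succ, Nat.factorial])
  rcases le_total X 5 with h' | h'
  · have he : Real.exp (-(0.2704 * 4.3)) ≤ 1 / 3.19 :=
      exp_neg_le_of_le_sum 25 (by norm_num) (by norm_num)
        (by norm_num [Finset.sum_range_succ, Nat.factorial])
    refine zeroSum_le_of_ge_aux (s := 0.1375) (f₁ := 0.0268) (f₂ := 0.0064) (f₃ := 0.0543)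
      (f₄ := 0.00075) (a := 4.3) (by norm_num) h hL hL20
      (le_sqrt_mul_exp (c := 2.0736 + 0.23 * (X - 4.3)) (e := 3.19) h
        (Real.le_sqrt_of_sq_le (by nlinarith [mul_nonneg (sub_nonneg.2 h) (sub_nonneg.2 h')]))
        he (by norm_num) (by norm_num) ?_)
      ?_ ?_ ?_ ?_ (by norm_num)
    · obtain ⟨D, rfl⟩ : ∃ D, X = D + 4.3 := ⟨X - 4.3, by ring⟩
      have h0 : 0 ≤ D := by linarith
      have h1 : D ≤ 0.7 := by linarith
      ring_nf
      nlinarith [mul_nonneg h0 (sub_nonneg.2 h1), pow_nonneg h0 3]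
    all_goals
      exact exp_neg_le_of_le_sum 25 (by norm_num) (by norm_num)
        (by norm_num [Finset.sum_range_succ, Nat.factorial])
  refine zeroSum_le_of_ge_aux (s := 0.163) (f₁ := 0.0149) (f₂ := 0.0028) (f₃ := 0.0338)
    (f₄ := 0.00024) (a := 5) (by norm_num) h' hL hL20 ?_ ?_ ?_ ?_ ?_ (by norm_num)
  · have he : Real.exp (-(0.2704 * 5)) ≤ 1 / 3.86 :=
      exp_neg_le_of_le_sum 25 (by norm_num) (by norm_num)
        (by norm_num [Finset.sum_range_succ, Nat.factorial])
    rcases le_total X 8 with h8 | h8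
    · refine le_sqrt_mul_exp (c := 2.236 + 0.197 * (X - 5)) (e := 3.86) h'
        (Real.le_sqrt_of_sq_le (by nlinarith [mul_nonneg (sub_nonneg.2 h') (sub_nonneg.2 h8)]))
        he (by norm_num) (by norm_num) ?_
      obtain ⟨D, rfl⟩ : ∃ D, X = D + 5 := ⟨X - 5, by ring⟩
      have h0 : 0 ≤ D := by linarith
      ring_nf
      nlinarith [sq_nonneg (D - 2.4), pow_nonneg h0 3]
    · refine le_sqrt_mul_exp (c := 2.828) (e := 3.86) h'
        (Real.le_sqrt_of_sq_le (by norm_num; linarith))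
        he (by norm_num) (by norm_num) ?_
      nlinarith [sq_nonneg (X - 10.82)]
  all_goals
      exact exp_neg_le_of_le_sum 25 (by norm_num) (by norm_num)
        (by norm_num [Finset.sum_range_succ, Nat.factorial])

lemma sq_exp_sub_one_div_le {h : ℝ} (h0 : 0 < h) (h1 : h ≤ 1 / 20) :
    Real.exp (2 * h) * ((1 - Real.exp (-h)) / h) ^ 2 ≤ 1 + h + 0.71 * h ^ 2 := by
  have e1 : Real.exp (2 * h) * ((1 - Real.exp (-h)) / h) ^ 2 = ((Real.exp h - 1) / h) ^ 2 := by
    have : Real.exp (2 * h) = Real.exp h ^ 2 := by rw [← Real.exp_nat_mul]; push_cast; rfl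
    rw [this, ← mul_pow, ← mul_div_assoc, mul_sub, ← Real.exp_add]
    simp
  have e2 := Real.exp_bound' h0.le (by linarith) (n := 3) (by norm_num)
  norm_num [Finset.sum_range_succ, Nat.factorial] at e2
  have e3 : (Real.exp h - 1) / h ≤ 1 + h / 2 + 2 / 9 * h ^ 2 := by
    rw [div_le_iff₀ h0]; linarith
  have e4 : 0 ≤ (Real.exp h - 1) / h := div_nonneg (by linarith [Real.add_one_le_exp h]) h0.le
  rw [e1]
  calc ((Real.exp h - 1) / h) ^ 2 ≤ (1 + h / 2 + 2 / 9 * h ^ 2) ^ 2 := by gcongr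
    _ = 1 + h + h ^ 2 * (25 / 36 + 2 / 9 * h + 4 / 81 * h ^ 2) := by ring
    _ ≤ 1 + h + h ^ 2 * 0.71 := by gcongr; nlinarith
    _ = _ := by ring

lemma exp_two_mul_le {h : ℝ} (h0 : 0 < h) (h1 : h ≤ 1 / 20) : Real.exp (2 * h) ≤ 1 + 2 * h + 3 * h ^ 2 := by
  have e2 := Real.exp_bound' (x := 2 * h) (by linarith) (by linarith) (n := 2) (by norm_num)
  norm_num [Finset.sum_range_succ, Nat.factorial] at e2
  linarith

lemma one_sub_le_sq {h : ℝ} (h0 : 0 < h) (h1 : h ≤ 1 / 20) :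
    1 - h ≤ ((1 - Real.exp (-h)) / h) ^ 2 := by
  have e2 : Real.exp (-h) ≤ 1 - h + h ^ 2 / 2 := by
    have e3 := Real.quadratic_le_exp_of_nonneg h0.le
    rw [Real.exp_neg]
    apply inv_le_of_inv_le₀ (by nlinarith)
    refine le_trans ?_ e3
    rw [inv_le_iff_one_le_mul₀ (by nlinarith)]
    nlinarith [pow_pos h0 4]
  have e3 : 1 - h / 2 ≤ (1 - Real.exp (-h)) / h := by
    rw [le_div_iff₀ h0]; linarith
  calc 1 - h ≤ (1 - h / 2) ^ 2 := by nlinarith [sq_nonneg h]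
    _ ≤ _ := by gcongr; linarith

lemma sqrt_mul_exp_neg_le {X : ℝ} (hX : 1.7796 ≤ X) : √X * Real.exp (-X) ≤ 0.2252 := by
  have e1 : Real.exp (-1.7796) ≤ 0.16878 := exp_neg_le_of_le_sum 16 (by norm_num) (by norm_num)
    (by norm_num [Finset.sum_range_succ, Nat.factorial])
  have e2 : √(1.7796 : ℝ) ≤ 1.3341 := Real.sqrt_le_iff.2 (by norm_num)
  calc _ ≤ √(1.7796 : ℝ) * Real.exp (-1.7796) := sqrt_mul_exp_neg_anti (by norm_num) hX
    _ ≤ 1.3341 * 0.16878 := by gcongr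
    _ ≤ _ := by norm_num

lemma sqrt_mul_exp_neg_le_of_ge {X : ℝ} (hX : 3.92 ≤ X) : √X * Real.exp (-X) ≤ 0.0397 := by
  have h := le_two_div hX
  have hX0 : 0 < X := by linarith
  rw [le_div_iff₀ (by positivity)] at h
  linarith

lemma exists_zeroSum_le {X : ℝ} (hX : 1.7796 ≤ X) : ∃ ρ : ℝ, 0 ≤ ρ ∧ ρ ≤ 0.205 ∧
    (∀ L, 6.315 * X ^ 2 ≤ L → 20 ≤ L → zeroSum (2 / (0.174 * (√X * Real.exp (-X)))) L ≤
      Real.exp L * (ρ * (√X * Real.exp (-X)))) ∧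
    ρ + 0.1 * (√X * Real.exp (-X)) ≤ 0.21 := by
  rcases le_total X 3.92 with h | h
  · refine ⟨0.185, by norm_num, by norm_num, fun L h1 h2 ↦ zeroSum_le_of_le hX h h1 h2, ?_⟩
    linarith [sqrt_mul_exp_neg_le hX]
  · refine ⟨0.205, by norm_num, by norm_num, fun L h1 h2 ↦ zeroSum_le_of_ge h h1 h2, ?_⟩
    linarith [sqrt_mul_exp_neg_le_of_ge h]

lemma psi_le_of_zeroSum_le {X L ρ E : ℝ} (hL : 6.315 * X ^ 2 ≤ L) (hL20 : 20 ≤ L) (hE0 : 0 < E)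
    (hE : E ≤ 0.2252) (hρ0 : 0 ≤ ρ) (hρ : ρ ≤ 0.205) (hρE : ρ + 0.1 * E ≤ 0.21)
    (hZ : ∀ L, 6.315 * X ^ 2 ≤ L → 20 ≤ L →
      zeroSum (2 / (0.174 * E)) L ≤ Real.exp L * (ρ * E)) :
    Chebyshev.psi (Real.exp L) ≤ Real.exp L * (1 + 0.387 * E) := by
  set h := 0.174 * E with hh
  have h0 : 0 < h := by positivity
  have h1 : h ≤ 1 / 20 := by linarith
  refine (psi_le_add_zeroSum (u := L) (by linarith) h0).trans ?_
  have a := hZ (L + 2 * h) (by linarith) (by linarith)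
  have b := sq_exp_sub_one_div_le h0 h1
  have c := exp_two_mul_le h0 h1
  have d : (Real.exp (2 * h)) * (ρ * E) ≤ (1 + 2 * h + 3 * h ^ 2) * (ρ * E) := by gcongr
  have e : 1 + h + 0.71 * h ^ 2 + (1 + 2 * h + 3 * h ^ 2) * (ρ * E) ≤ 1 + 0.387 * E := by
    have e1 : 0.71 * h ^ 2 ≤ 0.022 * E * E := by rw [hh]; nlinarith
    have e2 : (1 + 2 * h + 3 * h ^ 2) * ρ ≤ ρ + 0.0756 * E := by
      have : 3 * h ^ 2 ≤ 0.0206 * E := by rw [hh]; nlinarith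
      calc (1 + 2 * h + 3 * h ^ 2) * ρ ≤ (1 + 2 * h + 0.0206 * E) * ρ := by gcongr
        _ = ρ + (0.348 * E + 0.0206 * E) * ρ := by rw [hh]; ring
        _ ≤ ρ + (0.348 * E + 0.0206 * E) * 0.205 := by gcongr
        _ ≤ _ := by linarith
    have e3 := mul_le_mul_of_nonneg_right e2 hE0.le
    have e4 := mul_le_mul_of_nonneg_right hρE hE0.le
    nlinarith
  rw [Real.exp_add] at a ⊢
  calc _ ≤ Real.exp L * Real.exp (2 * h) * ((1 - Real.exp (-h)) / h) ^ 2 +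
        Real.exp L * Real.exp (2 * h) * (ρ * E) := by gcongr
    _ = Real.exp L * (Real.exp (2 * h) * ((1 - Real.exp (-h)) / h) ^ 2 +
        Real.exp (2 * h) * (ρ * E)) := by ring
    _ ≤ _ := mul_le_mul_of_nonneg_left (by linarith) (Real.exp_pos L).le

lemma abs_theta_sub_le_of_exp_20_le {x : ℝ} (hx : Real.exp 20 ≤ x) :
    |Chebyshev.theta x - x| ≤ x * relErr √(Real.log x / 6.315) := by
  have hx0 : 0 < x := (Real.exp_pos _).trans_le hx
  set L := Real.log x with hLdef
  have hxL : Real.exp L = x := Real.exp_log hx0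
  have hL20 : 20 ≤ L := (Real.le_log_iff_exp_le hx0).2 hx
  set X := √(L / 6.315) with hXdef
  have hX : 1.7796 ≤ X := by
    apply Real.le_sqrt_of_sq_le
    rw [le_div_iff₀ (by norm_num)]; norm_num; linarith
  have hL : 6.315 * X ^ 2 ≤ L := by
    rw [hXdef, Real.sq_sqrt (by positivity), mul_div_cancel₀ _ (by norm_num)]
  obtain ⟨ρ, hρ0, hρ, hZ, hρE⟩ := exists_zeroSum_le hX
  have hE := sqrt_mul_exp_neg_le hX
  have hlow : 39.4 * Real.exp (-(L / 2)) ≤ 0.0085 * (√X * Real.exp (-X)) := by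
    refine (low_term_le (k := 8.2) (b := 1 / 3600) hX hL (by nlinarith)
      (exp_neg_le_of_le_sum 25 (by norm_num) (by norm_num)
        (by norm_num [Finset.sum_range_succ, Nat.factorial]))).trans ?_
    gcongr; norm_num
  have hrel : 0.387 * (√X * Real.exp (-X)) ≤ relErr X := by
    rw [relErr, mul_assoc]
    have := sqrt_const_ge
    gcongr
  have hE0 : 0 < √X * Real.exp (-X) := by
    have : 0 < X := by linarith
    positivity
  set E := √X * Real.exp (-X) with hEdef
  have hmain : |Chebyshev.theta x - x| ≤ x * (0.387 * E) := by
    rw [abs_le]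
    constructor
    · have h0 : 0 < 0.174 * E := by positivity
      have h1 : 0.174 * E ≤ 1 / 20 := by linarith
      have a := sub_zeroSum_le_psi (u := L) h0 (by linarith)
      have b := hZ L hL hL20
      have c := one_sub_le_sq h0 h1
      have hx12 : 12000 ≤ x := by
        refine le_trans ?_ hx
        have := Real.sum_le_exp_of_nonneg (x := 20) (by norm_num) 7
        norm_num [Finset.sum_range_succ, Nat.factorial] at this
        linarith
      have d := psi_sub_theta_le hx12
      have s1 : √x = x * Real.exp (-(L / 2)) := by
        rw [← hxL, ← Real.exp_half, ← Real.exp_add]; ring_nf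
      have s2 : 2 ≤ 2 * √x := by
        have : 1 ≤ √x := Real.one_le_sqrt.2 (by linarith)
        linarith
      have s3 := mul_le_mul_of_nonneg_left hlow hx0.le
      have s4 := mul_le_mul_of_nonneg_left c hx0.le
      have s5 : x * (ρ * E) ≤ x * (0.205 * E) := by gcongr
      have s6 : 0 < x * E := by positivity
      rw [hxL] at a b
      rw [s1] at d s2
      generalize ((1 - Real.exp (-(0.174 * E))) / (0.174 * E)) ^ 2 = q at *
      linarith
    · have a := psi_le_of_zeroSum_le hL hL20 hE0 hE hρ0 hρ hρE hZ
      have b := Chebyshev.theta_le_psi x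
      rw [hxL] at a
      linarith
  exact hmain.trans (by gcongr)

lemma abs_theta_sub_le {x : ℝ} (hx : 149 ≤ x) :
    |Chebyshev.theta x - x| ≤ x * relErr √(Real.log x / 6.315) := by
  rcases le_total x (Real.exp 20) with h | h
  · exact abs_theta_sub_le_of_le_exp_20 hx h
  · exact abs_theta_sub_le_of_exp_20_le h

end

end ThetaBound

/-- For `x ≥ 149`, `|θ(x) - x| ≤ x √(8/(17π)) X^{1/2} e^{-X}` with
`X = √((log x)/6.315)`. -/
theorem theta_error_bound (x : ℝ) (hx : 149 ≤ x) :
    |chebyshevTheta x - x| ≤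
      x * (Real.sqrt (8 / (17 * Real.pi)) *
        Real.sqrt (Real.sqrt (Real.log x / 6.315)) *
        Real.exp (-Real.sqrt (Real.log x / 6.315))) := by
  have h : chebyshevTheta x = Chebyshev.theta x := by
    rw [Chebyshev.theta_eq_sum_Icc, chebyshevTheta, Finset.range_eq_Ico]
    rfl
  rw [h]
  exact ThetaBound.abs_theta_sub_le hx
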